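/- Let Ω be a bounded Lipschitz domain in ℝ^N (N ≥ 2), x₀ ∈ Ω a fixed reference point, a > 0 and V ∈ 𝒱(Ω,a). Then for every boundary point y ∈ ∂Ω the following four properties are equivalent: (i) y is finely regular for L_V = Δ − V in Ω (i.e. K̃_y^V > 0); (ii) ∫_Ω G(x₀,z) V(z) K_y^V(z) dz < ∞; (iii) K_y^V admits a superharmonic (with respect to Δ) majorant in Ω; (iv) ∫_Ω G(x₀,z) V(z) K_y(z) dz < ∞. -/

import Mathlib

open MeasureTheory Metric Set Filter Topology
open scoped ENNReal NNReal

noncomputable section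

namespace Anc

abbrev ES (N : ℕ) := EuclideanSpace ℝ (Fin N)

/-- `δ_Ω(x)`: the distance from `x` to the complement of `Ω`. -/
def dista {N : ℕ} (Ω : Set (ES N)) (x : ES N) : ℝ := infDist x Ωᶜ

/-- Pointwise Laplacian (junk values where the derivatives do not exist). -/
def lap {N : ℕ} (u : ES N → ℝ) (x : ES N) : ℝ :=
  ∑ i : Fin N,
    fderiv ℝ (fun y => fderiv ℝ u y (EuclideanSpace.single i 1)) x (EuclideanSpace.single i 1)

/-- Smooth compactly supported test functions in `Ω`. -/
def IsTestFun {N : ℕ} (Ω : Set (ES N)) (φ : ES N → ℝ) : Prop :=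
  ContDiff ℝ (⊤ : ℕ∞) φ ∧ IsCompact (tsupport φ) ∧ tsupport φ ⊆ Ω

/-- `u` is a continuous weak solution of `Δu - V·u = 0` in `Ω` (i.e. `L_V`-harmonic). -/
def LVHarmonic {N : ℕ} (Ω : Set (ES N)) (V u : ES N → ℝ) : Prop :=
  ContinuousOn u Ω ∧ LocallyIntegrableOn u Ω ∧
    LocallyIntegrableOn (fun x => V x * u x) Ω ∧
    ∀ φ, IsTestFun Ω φ → ∫ x in Ω, u x * lap φ x = ∫ x in Ω, V x * u x * φ x

/-- `s` is `L_V`-superharmonic in `Ω` (weakly, `Δs - V·s ≤ 0`, `s` l.s.c.). -/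
def LVSuperharmonic {N : ℕ} (Ω : Set (ES N)) (V s : ES N → ℝ) : Prop :=
  LowerSemicontinuousOn s Ω ∧ LocallyIntegrableOn s Ω ∧
    LocallyIntegrableOn (fun x => V x * s x) Ω ∧
    ∀ φ, IsTestFun Ω φ → (∀ x, 0 ≤ φ x) →
      ∫ x in Ω, s x * lap φ x ≤ ∫ x in Ω, V x * s x * φ x

/-- The class `𝒱(Ω,a)` of nonnegative Borel potentials with `V(x) ≤ a/δ_Ω(x)²`. -/
def VClass {N : ℕ} (Ω : Set (ES N)) (a : ℝ) (V : ES N → ℝ) : Prop :=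
  Measurable V ∧ ∀ x ∈ Ω, 0 ≤ V x ∧ V x * dista Ω x ^ 2 ≤ a

/-- Lipschitz domain: open, connected, and near every boundary point, after an
orthogonal change of coordinates, the domain is the region above the graph of a
Lipschitz function. -/
def IsLipschitzDomain {N : ℕ} (Ω : Set (ES N)) : Prop :=
  IsOpen Ω ∧ IsConnected Ω ∧
    ∀ z ∈ frontier Ω, ∃ (g : ES N ≃ₗᵢ[ℝ] ES N) (i : Fin N) (f : ES N → ℝ)
      (L : ℝ≥0) (ε : ℝ), 0 < ε ∧ LipschitzWith L f ∧
      (∀ x w : ES N, (∀ j, j ≠ i → x j = w j) → f x = f w) ∧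
      ∀ x ∈ ball z ε, (x ∈ Ω ↔ f (g x) < g x i)

/-- `Ω` has a `C^{1,α}` boundary near `y`. -/
def IsC1AlphaNear {N : ℕ} (Ω : Set (ES N)) (α : ℝ) (y : ES N) : Prop :=
  ∃ (g : ES N ≃ₗᵢ[ℝ] ES N) (i : Fin N) (f : ES N → ℝ) (C : ℝ≥0) (ε : ℝ),
    0 < ε ∧ ContDiff ℝ 1 f ∧ HolderWith C α.toNNReal (fderiv ℝ f) ∧
    (∀ x w : ES N, (∀ j, j ≠ i → x j = w j) → f x = f w) ∧
    ∀ x ∈ ball y ε, (x ∈ Ω ↔ f (g x) < g x i)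

/-- `K` is the `L_V`-Martin kernel of `Ω` with pole `y ∈ ∂Ω`, normalized at `x₀`:
the unique positive `L_V`-harmonic function vanishing on `∂Ω ∖ {y}` with `K x₀ = 1`. -/
def IsMartinKernel {N : ℕ} (Ω : Set (ES N)) (V : ES N → ℝ) (x₀ y : ES N)
    (K : ES N → ℝ) : Prop :=
  LVHarmonic Ω V K ∧ (∀ x ∈ Ω, 0 < K x) ∧ K x₀ = 1 ∧
    ∀ z ∈ frontier Ω, z ≠ y → Tendsto K (𝓝[Ω] z) (𝓝 0)

/-- `G` is the `L_V`-Green function of `Ω` with pole `y ∈ Ω`: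
positive, vanishing at the boundary, and `L_V G = -δ_y` weakly. -/
def IsGreenFunction {N : ℕ} (Ω : Set (ES N)) (V : ES N → ℝ) (y : ES N)
    (G : ES N → ℝ) : Prop :=
  ContinuousOn G (Ω \ {y}) ∧ (∀ x ∈ Ω \ {y}, 0 < G x) ∧ LocallyIntegrableOn G Ω ∧
    (∀ z ∈ frontier Ω, Tendsto G (𝓝[Ω \ {y}] z) (𝓝 0)) ∧
    ∀ φ, IsTestFun Ω φ → ∫ x in Ω, G x * (lap φ x - V x * φ x) = -φ y

/-- `y ∈ ∂Ω` is finely regular w.r.t. `V`, `Ky` being the classical Martin kernel at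
`y`: the greatest `L_V`-harmonic minorant of `Ky` is positive, equivalently `Ky`
admits a positive `L_V`-harmonic minorant. -/
def FinelyRegular {N : ℕ} (Ω : Set (ES N)) (V Ky : ES N → ℝ) : Prop :=
  ∃ h, LVHarmonic Ω V h ∧ (∀ x ∈ Ω, 0 < h x) ∧ ∀ x ∈ Ω, h x ≤ Ky x

/-- `h` is the greatest nonnegative `L_V`-harmonic minorant of `w` in `Ω`. -/
def IsGreatestLVHarmMinorant {N : ℕ} (Ω : Set (ES N)) (V w h : ES N → ℝ) : Prop :=
  LVHarmonic Ω V h ∧ (∀ x ∈ Ω, 0 ≤ h x ∧ h x ≤ w x) ∧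
    ∀ g, LVHarmonic Ω V g → (∀ x ∈ Ω, 0 ≤ g x ∧ g x ≤ w x) → ∀ x ∈ Ω, g x ≤ h x

/-- Classical superharmonicity via the sub-mean value property. -/
def IsSuperharmonicOn {N : ℕ} (W : Set (ES N)) (s : ES N → ℝ) : Prop :=
  LowerSemicontinuousOn s W ∧ LocallyIntegrableOn s W ∧
    ∀ x ∈ W, ∀ t > (0:ℝ), closedBall x t ⊆ W → ⨍ z in ball x t, s z ≤ s x

/-- The réduite of `w` over `A` in `W`: infimum of the nonnegative superharmonic
functions in `W` dominating `w` on `A`. -/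
def reduite {N : ℕ} (W : Set (ES N)) (w : ES N → ℝ) (A : Set (ES N)) (x : ES N) : ℝ :=
  sInf {v | ∃ s : ES N → ℝ, IsSuperharmonicOn W s ∧ (∀ z ∈ W, 0 ≤ s z) ∧
    (∀ z ∈ A, w z ≤ s z) ∧ v = s x}

/-- The lower semicontinuous regularization `R̂` of the réduite. -/
def reduiteReg {N : ℕ} (W : Set (ES N)) (w : ES N → ℝ) (A : Set (ES N)) (x : ES N) : ℝ :=
  liminf (reduite W w A) (𝓝[W] x)

/-- Nontangential approach region at `y` with aperture `κ`. -/
def ntRegion {N : ℕ} (Ω : Set (ES N)) (y : ES N) (κ : ℝ) : Set (ES N) :=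
  {x | x ∈ Ω ∧ dist x y ≤ κ * dista Ω x}

/-- `g` tends to `l` nontangentially at `y`. -/
def TendstoNT {N : ℕ} (Ω : Set (ES N)) (g : ES N → ℝ) (y : ES N) (l : Filter ℝ) : Prop :=
  ∀ κ > (0:ℝ), Tendsto g (𝓝[ntRegion Ω y κ] y) l

/-- Truncated cone `{y + t(ν+v) : 0 < t ≤ η, ‖v‖ ≤ η}` with vertex `y`. -/
def truncCone {N : ℕ} (y ν : ES N) (η : ℝ) : Set (ES N) :=
  {x | ∃ (t : ℝ) (v : ES N), 0 < t ∧ t ≤ η ∧ ‖v‖ ≤ η ∧ x = y + t • (ν + v)}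

/-- Last coordinate of a point of `ℝ^{n+1}`. -/
def lastC {n : ℕ} (x : ES (n + 1)) : ℝ := x (Fin.last n)

/-- First `n` coordinates of a point of `ℝ^{n+1}`. -/
def firstC {n : ℕ} (x : ES (n + 1)) : ES n :=
  (EuclideanSpace.equiv (Fin n) ℝ).symm fun i => x i.castSucc

/-- The region `U_f(r,ρ) = {(x',x_N) : |x'| < r, f(x') < x_N < ρ}`. -/
def Ucyl {n : ℕ} (f : ES n → ℝ) (r ρ : ℝ) : Set (ES (n + 1)) :=
  {x | ‖firstC x‖ < r ∧ f (firstC x) < lastC x ∧ lastC x < ρ}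

/-- The cylinder `T(t) = B_{N-1}(0,tr) × (-tρ, tρ)`. -/
def Tcyl (n : ℕ) (r ρ t : ℝ) : Set (ES (n + 1)) :=
  {x | ‖firstC x‖ < t * r ∧ |lastC x| < t * ρ}

/-- The graph part `∂_#U` of the boundary of `U_f(r,ρ)`. -/
def graphBdry {n : ℕ} (f : ES n → ℝ) (r ρ : ℝ) : Set (ES (n + 1)) :=
  frontier (Ucyl f r ρ) ∩ {x | ‖firstC x‖ < r ∧ lastC x = f (firstC x)}

/-! ### Part 1 : radial kernels and mean values -/

section Part1

variable {N : ℕ}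

/-- A smooth nonincreasing radial profile supported in `s ≤ 1`. -/
structure Prof (κ : ℝ → ℝ) : Prop where
  smooth : ContDiff ℝ (⊤ : ℕ∞) κ
  nonneg : ∀ s, 0 ≤ κ s
  zero : ∀ s, 1 ≤ s → κ s = 0
  anti : Antitone κ

/-- half of the tail integral of the profile. -/
def mpr (κ : ℝ → ℝ) (s : ℝ) : ℝ := -(∫ r in (1:ℝ)..s, κ r) / 2

lemma mpr_hasDeriv {κ : ℝ → ℝ} (h : Prof κ) (s : ℝ) : HasDerivAt (mpr κ) (-κ s / 2) s := by
  unfold mpr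
  have := (h.smooth.continuous).integral_hasStrictDerivAt 1 s
  exact (this.hasDerivAt.neg).div_const 2

lemma mpr_smooth {κ : ℝ → ℝ} (h : Prof κ) : ContDiff ℝ (⊤ : ℕ∞) (mpr κ) := by
  rw [contDiff_infty_iff_deriv]
  refine ⟨fun s => (mpr_hasDeriv h s).differentiableAt, ?_⟩
  have : deriv (mpr κ) = fun s => -κ s / 2 := by
    funext s; exact (mpr_hasDeriv h s).deriv
  rw [this]
  exact (h.smooth.neg).div_const 2

lemma mpr_zero {κ : ℝ → ℝ} (h : Prof κ) {s : ℝ} (hs : 1 ≤ s) : mpr κ s = 0 := by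
  unfold mpr
  have : ∫ r in (1:ℝ)..s, κ r = ∫ r in (1:ℝ)..s, (0:ℝ) := by
    apply intervalIntegral.integral_congr
    intro r hr
    rw [uIcc_of_le hs] at hr
    exact h.zero r hr.1
  rw [this]; simp

lemma mpr_bounds {κ : ℝ → ℝ} (h : Prof κ) {s : ℝ} (hs : 0 ≤ s) :
    0 ≤ mpr κ s ∧ mpr κ s ≤ κ s / 2 := by
  by_cases h1 : 1 ≤ s
  · rw [mpr_zero h h1, h.zero s h1]; simp
  · push Not at h1
    have e : mpr κ s = (∫ r in s..(1:ℝ), κ r) / 2 := by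
      unfold mpr; rw [intervalIntegral.integral_symm]; ring
    rw [e]
    have a : 0 ≤ ∫ r in s..(1:ℝ), κ r :=
      intervalIntegral.integral_nonneg h1.le (fun u _ => h.nonneg u)
    have b : ∫ r in s..(1:ℝ), κ r ≤ ∫ r in s..(1:ℝ), κ s := by
      apply intervalIntegral.integral_mono_on h1.le
      · exact h.smooth.continuous.intervalIntegrable _ _
      · exact continuous_const.intervalIntegrable _ _
      · intro r hr; exact h.anti hr.1
    rw [intervalIntegral.integral_const, smul_eq_mul] at b
    have := h.nonneg s
    constructor
    · linarith
    · nlinarith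

lemma fderiv_radial {h h' : ℝ → ℝ} (hh : ∀ s, HasDerivAt h (h' s) s) (c : ℝ) (x z v : ES N) :
    fderiv ℝ (fun y : ES N => h (c * ‖y - x‖ ^ 2)) z v
      = h' (c * ‖z - x‖ ^ 2) * (c * (2 * inner ℝ (z - x) v)) := by
  have h1 : HasFDerivAt (fun y : ES N => ‖y - x‖ ^ 2) (2 • (innerSL ℝ (z - x))) z := by
    simpa using (((hasFDerivAt_id z).sub_const x).norm_sq)
  have h2 := (hh (c * ‖z - x‖ ^ 2)).comp_hasFDerivAt z (h1.const_mul c)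
  have h3 := h2.fderiv
  have : (fun y : ES N => h (c * ‖y - x‖ ^ 2)) = h ∘ fun y => c * ‖y - x‖ ^ 2 := rfl
  rw [this, h3]
  simp [innerSL_apply_apply, inner_sub_left]

lemma contDiff_radial {h : ℝ → ℝ} (hh : ContDiff ℝ (⊤ : ℕ∞) h) (c : ℝ) (x : ES N) :
    ContDiff ℝ (⊤ : ℕ∞) (fun y : ES N => h (c * ‖y - x‖ ^ 2)) := by
  apply hh.comp
  exact contDiff_const.mul ((contDiff_id.sub contDiff_const).norm_sq ℝ)

lemma inner_single (w : ES N) (i : Fin N) :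
    inner ℝ w (EuclideanSpace.single i (1:ℝ)) = w i := by
  rw [EuclideanSpace.inner_single_right]; simp

lemma lap_radial {h h' h'' : ℝ → ℝ} (hh : ∀ s, HasDerivAt h (h' s) s)
    (hh' : ∀ s, HasDerivAt h' (h'' s) s) (c : ℝ) (x z : ES N) :
    lap (fun y : ES N => h (c * ‖y - x‖ ^ 2)) z
      = 4 * c ^ 2 * ‖z - x‖ ^ 2 * h'' (c * ‖z - x‖ ^ 2) + 2 * N * c * h' (c * ‖z - x‖ ^ 2) := by
  unfold lap
  have key : ∀ i : Fin N, fderiv ℝ (fun y => fderiv ℝ (fun y : ES N => h (c * ‖y - x‖ ^ 2)) y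
      (EuclideanSpace.single i 1)) z (EuclideanSpace.single i 1)
      = 4 * c ^ 2 * h'' (c * ‖z - x‖ ^ 2) * ((z - x) i) ^ 2 + 2 * c * h' (c * ‖z - x‖ ^ 2) := by
    intro i
    have e : (fun y => fderiv ℝ (fun y : ES N => h (c * ‖y - x‖ ^ 2)) y
      (EuclideanSpace.single i 1)) = fun y => h' (c * ‖y - x‖ ^ 2) * (c * (2 * (y - x) i)) := by
      funext y
      rw [fderiv_radial hh, inner_single]
    rw [e]
    have d1 : DifferentiableAt ℝ (fun y : ES N => h' (c * ‖y - x‖ ^ 2)) z := by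
      apply DifferentiableAt.comp z (hh' _).differentiableAt
      exact ((differentiableAt_id.sub_const x).norm_sq ℝ).const_mul c
    have d2 : HasFDerivAt (fun y : ES N => (c * (2 * (y - x) i)))
        (c • (2:ℝ) • (EuclideanSpace.proj i : ES N →L[ℝ] ℝ)) z := by
      have := (((EuclideanSpace.proj i : ES N →L[ℝ] ℝ).hasFDerivAt (x := z - x)).comp z
        ((hasFDerivAt_id z).sub_const x))
      have := (this.const_mul 2).const_mul c
      simpa using this
    rw [fderiv_fun_mul d1 d2.differentiableAt, d2.fderiv]
    simp only [add_apply, smul_apply, smul_eq_mul]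
    rw [fderiv_radial hh', inner_single]
    simp
    ring
  rw [Finset.sum_congr rfl (fun i _ => key i)]
  rw [Finset.sum_add_distrib, ← Finset.mul_sum]
  have : ‖z - x‖ ^ 2 = ∑ i, ((z - x) i) ^ 2 := by
    rw [EuclideanSpace.norm_sq_eq]; simp
  rw [← this]
  simp
  ring

end Part1

/-! ### Part 2 : averages -/

section Part2

variable {N : ℕ}

/-- unnormalised kernel average -/
def av (κ : ℝ → ℝ) (ρ : ℝ) (w : ES N → ℝ) (x : ES N) : ℝ :=
  (ρ ^ N)⁻¹ * ∫ z, w z * κ ((ρ ^ 2)⁻¹ * ‖z - x‖ ^ 2)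

/-- the total mass of the kernel -/
def Zc (N : ℕ) (κ : ℝ → ℝ) : ℝ := ∫ z : ES N, κ (‖z‖ ^ 2)

lemma ker_zero {κ : ℝ → ℝ} (h : Prof κ) {ρ : ℝ} (hρ : 0 < ρ) {x z : ES N}
    (hz : ρ ≤ ‖z - x‖) : κ ((ρ ^ 2)⁻¹ * ‖z - x‖ ^ 2) = 0 := by
  apply h.zero
  rw [inv_mul_eq_div, le_div_iff₀ (by positivity), one_mul]
  gcongr

lemma ker_cont {κ : ℝ → ℝ} (h : Prof κ) (ρ : ℝ) (x : ES N) :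
    Continuous fun z : ES N => κ ((ρ ^ 2)⁻¹ * ‖z - x‖ ^ 2) :=
  h.smooth.continuous.comp (by fun_prop)

lemma ker_le {κ : ℝ → ℝ} (h : Prof κ) (ρ : ℝ) (x z : ES N) :
    κ ((ρ ^ 2)⁻¹ * ‖z - x‖ ^ 2) ≤ κ 0 := h.anti (by positivity)

lemma ker_supp {κ : ℝ → ℝ} (h : Prof κ) {ρ : ℝ} (hρ : 0 < ρ) (x : ES N) :
    HasCompactSupport fun z : ES N => κ ((ρ ^ 2)⁻¹ * ‖z - x‖ ^ 2) := by
  apply HasCompactSupport.intro (isCompact_closedBall x ρ)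
  intro z hz
  apply ker_zero h hρ
  rw [mem_closedBall, dist_eq_norm] at hz
  linarith

lemma ker_integral {κ : ℝ → ℝ} {ρ : ℝ} (hρ : 0 < ρ) (x : ES N) :
    ∫ z : ES N, κ ((ρ ^ 2)⁻¹ * ‖z - x‖ ^ 2) = ρ ^ N * Zc N κ := by
  unfold Zc
  rw [integral_sub_right_eq_self (fun z : ES N => κ ((ρ ^ 2)⁻¹ * ‖z‖ ^ 2)) x]
  have := Measure.integral_comp_inv_smul_of_nonneg (μ := (volume : Measure (ES N)))
    (fun z : ES N => κ (‖z‖ ^ 2)) hρ.le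
  simp only [finrank_euclideanSpace, Fintype.card_fin, smul_eq_mul] at this
  rw [← this]
  congr 1
  funext z
  rw [norm_smul, mul_pow, norm_inv, inv_pow, Real.norm_of_nonneg hρ.le]

lemma Zc_pos {κ : ℝ → ℝ} (h : Prof κ) (h0 : 0 < κ 0) : 0 < Zc N κ := by
  have e : Zc N κ = ∫ z : ES N, κ (((1:ℝ) ^ 2)⁻¹ * ‖z - 0‖ ^ 2) := by simp [Zc]
  rw [e]
  refine Continuous.integral_pos_of_hasCompactSupport_nonneg_nonzero (x := 0)
    (ker_cont h 1 0) (ker_supp h one_pos 0) (fun z => h.nonneg _) ?_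
  simpa using h0.ne'

lemma ker_integrable {κ : ℝ → ℝ} (h : Prof κ) {ρ : ℝ} (hρ : 0 < ρ) (x : ES N) :
    Integrable fun z : ES N => κ ((ρ ^ 2)⁻¹ * ‖z - x‖ ^ 2) :=
  (ker_cont h ρ x).integrable_of_hasCompactSupport (ker_supp h hρ x)

lemma ker_mul_integrable {κ : ℝ → ℝ} (h : Prof κ) {ρ : ℝ} (hρ : 0 < ρ) {x : ES N}
    {w : ES N → ℝ} (hw : IntegrableOn w (closedBall x ρ)) :
    Integrable fun z : ES N => w z * κ ((ρ ^ 2)⁻¹ * ‖z - x‖ ^ 2) := by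
  rw [← integrableOn_iff_integrable_of_support_subset (s := closedBall x ρ)]
  · refine Integrable.mul_bdd (c := κ 0) hw (ker_cont h ρ x).aestronglyMeasurable ?_
    filter_upwards with z
    rw [Real.norm_of_nonneg (h.nonneg _)]
    exact ker_le h ρ x z
  · intro z hz
    by_contra hc
    apply hz
    rw [mem_closedBall, dist_eq_norm, not_le] at hc
    simp only
    rw [ker_zero h hρ hc.le, mul_zero]

/-- replacing `w` by an a.e.\ different function outside of the ball -/
lemma av_congr {κ : ℝ → ℝ} (h : Prof κ) {ρ : ℝ} (hρ : 0 < ρ) {x : ES N} {w w' : ES N → ℝ}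
    (hw : ∀ z ∈ ball x ρ, w z = w' z) : av κ ρ w x = av κ ρ w' x := by
  unfold av
  congr 2
  funext z
  by_cases hz : z ∈ ball x ρ
  · rw [hw z hz]
  · rw [mem_ball, dist_eq_norm, not_lt] at hz
    rw [ker_zero h hρ hz]; simp

lemma av_mono {κ : ℝ → ℝ} (h : Prof κ) {ρ : ℝ} (hρ : 0 < ρ) {x : ES N} {w w' : ES N → ℝ}
    (iw : IntegrableOn w (closedBall x ρ)) (iw' : IntegrableOn w' (closedBall x ρ))
    (hw : ∀ z ∈ ball x ρ, w z ≤ w' z) : av κ ρ w x ≤ av κ ρ w' x := by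
  unfold av
  apply mul_le_mul_of_nonneg_left _ (by positivity)
  apply integral_mono (ker_mul_integrable h hρ iw) (ker_mul_integrable h hρ iw')
  intro z
  by_cases hz : z ∈ ball x ρ
  · exact mul_le_mul_of_nonneg_right (hw z hz) (h.nonneg _)
  · rw [mem_ball, dist_eq_norm, not_lt] at hz
    simp only
    rw [ker_zero h hρ hz]; simp

lemma av_const {κ : ℝ → ℝ} {ρ : ℝ} (hρ : 0 < ρ) (x : ES N) (c : ℝ) :
    av κ ρ (fun _ => c) x = c * Zc N κ := by
  unfold av
  rw [integral_const_mul, ker_integral hρ]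
  have : ρ ^ N ≠ 0 := by positivity
  field_simp

lemma av_add {κ : ℝ → ℝ} (h : Prof κ) {ρ : ℝ} (hρ : 0 < ρ) {x : ES N} {w w' : ES N → ℝ}
    (iw : IntegrableOn w (closedBall x ρ)) (iw' : IntegrableOn w' (closedBall x ρ)) :
    av κ ρ (fun z => w z + w' z) x = av κ ρ w x + av κ ρ w' x := by
  unfold av
  rw [← mul_add, ← integral_add (ker_mul_integrable h hρ iw) (ker_mul_integrable h hρ iw')]
  congr 2
  funext z; ring

lemma av_smul {κ : ℝ → ℝ} (ρ : ℝ) (x : ES N) (c : ℝ) (w : ES N → ℝ) :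
    av κ ρ (fun z => c * w z) x = c * av κ ρ w x := by
  unfold av
  rw [mul_left_comm c, ← integral_const_mul c]
  congr 2
  funext z; ring

lemma av_nonneg {κ : ℝ → ℝ} (h : Prof κ) {ρ : ℝ} (hρ : 0 < ρ) {x : ES N} {w : ES N → ℝ}
    (hw : ∀ z ∈ ball x ρ, 0 ≤ w z) : 0 ≤ av κ ρ w x := by
  unfold av
  refine mul_nonneg (by positivity) (integral_nonneg fun z => ?_)
  by_cases hz : z ∈ ball x ρ
  · exact mul_nonneg (hw z hz) (h.nonneg _)
  · rw [mem_ball, dist_eq_norm, not_lt] at hz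
    simp only
    rw [ker_zero h hρ hz]; simp

lemma integrableOn_const_ball (x : ES N) (ρ c : ℝ) :
    IntegrableOn (fun _ : ES N => c) (closedBall x ρ) :=
  integrableOn_const (by exact (isCompact_closedBall x ρ).measure_lt_top.ne)

lemma av_le_const {κ : ℝ → ℝ} (h : Prof κ) {ρ : ℝ} (hρ : 0 < ρ) {x : ES N} {w : ES N → ℝ}
    (iw : IntegrableOn w (closedBall x ρ)) {c : ℝ}
    (hw : ∀ z ∈ ball x ρ, w z ≤ c) : av κ ρ w x ≤ c * Zc N κ := by
  rw [← av_const hρ x c]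
  exact av_mono h hρ iw (integrableOn_const_ball x ρ c) hw

lemma const_le_av {κ : ℝ → ℝ} (h : Prof κ) {ρ : ℝ} (hρ : 0 < ρ) {x : ES N} {w : ES N → ℝ}
    (iw : IntegrableOn w (closedBall x ρ)) {c : ℝ}
    (hw : ∀ z ∈ ball x ρ, c ≤ w z) : c * Zc N κ ≤ av κ ρ w x := by
  rw [← av_const hρ x c]
  exact av_mono h hρ (integrableOn_const_ball x ρ c) iw hw

lemma av_tendsto {κ : ℝ → ℝ} (h : Prof κ) {R : ℝ} (hR : 0 < R) {x : ES N} {w : ES N → ℝ}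
    (iw : IntegrableOn w (closedBall x R)) (hc : ContinuousAt w x) :
    Tendsto (fun ρ => av κ ρ w x) (𝓝[>] 0) (𝓝 (Zc N κ * w x)) := by
  have hZ : 0 ≤ Zc N κ := integral_nonneg fun z => h.nonneg _
  rw [Metric.tendsto_nhds]
  intro ε hε
  obtain ⟨δ, hδ, hd⟩ := Metric.continuousAt_iff.1 hc (ε / (Zc N κ + 1)) (by positivity)
  have : ∀ᶠ ρ in 𝓝[>] (0:ℝ), ρ < min δ R := by
    apply mem_nhdsWithin_of_mem_nhds
    exact Iio_mem_nhds (by positivity)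
  filter_upwards [this, self_mem_nhdsWithin] with ρ h1 h2
  have h2 : 0 < ρ := h2
  have h3 : ρ < δ := h1.trans_le (min_le_left _ _)
  have h4 : ρ < R := h1.trans_le (min_le_right _ _)
  have iw' := iw.mono_set (closedBall_subset_closedBall (x := x) h4.le)
  have hb : ∀ z ∈ ball x ρ, w x - ε / (Zc N κ + 1) ≤ w z ∧ w z ≤ w x + ε / (Zc N κ + 1) := by
    intro z hz
    have := hd (x := z) (lt_trans hz h3)
    rw [Real.dist_eq, abs_lt] at this
    constructor <;> linarith
  have u := av_le_const h h2 iw' (fun z hz => (hb z hz).2)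
  have l := const_le_av h h2 iw' (fun z hz => (hb z hz).1)
  rw [Real.dist_eq, abs_lt]
  have : ε / (Zc N κ + 1) * Zc N κ < ε := by
    rw [div_mul_eq_mul_div, div_lt_iff₀ (by positivity)]
    nlinarith
  constructor <;> nlinarith

end Part2

/-! ### Part 3 : differentiation in the radius, mean value inequalities -/

section Part3

variable {N : ℕ}

/-- the radial test function -/
def mu (κ : ℝ → ℝ) (ρ : ℝ) (x z : ES N) : ℝ := mpr κ ((ρ ^ 2)⁻¹ * ‖z - x‖ ^ 2)

lemma Prof.hasDeriv {κ : ℝ → ℝ} (h : Prof κ) (s : ℝ) : HasDerivAt κ (deriv κ s) s :=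
  (h.smooth.differentiable (by simp)).differentiableAt.hasDerivAt

lemma Prof.deriv_zero {κ : ℝ → ℝ} (h : Prof κ) {s : ℝ} (hs : 1 < s) : deriv κ s = 0 := by
  have : κ =ᶠ[𝓝 s] fun _ => 0 := by
    filter_upwards [Ioi_mem_nhds hs] with r hr
    exact h.zero r (le_of_lt hr)
  rw [this.deriv_eq]; simp

lemma Prof.deriv_cont {κ : ℝ → ℝ} (h : Prof κ) : Continuous (deriv κ) :=
  h.smooth.continuous_deriv (by simp)

lemma Prof.bound {κ : ℝ → ℝ} (h : Prof κ) : ∃ C, 0 ≤ C ∧ ∀ s, 0 ≤ s → |s * deriv κ s| ≤ C := by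
  obtain ⟨C, hC⟩ := (isCompact_Icc (a := (0:ℝ)) (b := 1)).exists_bound_of_continuousOn
    (f := fun s => s * deriv κ s) (by exact (continuous_id.mul h.deriv_cont).continuousOn)
  have h0 : 0 ≤ C := (norm_nonneg _).trans (hC 0 (by simp))
  refine ⟨C, h0, fun s hs => ?_⟩
  by_cases h1 : s ≤ 1
  · exact hC s ⟨hs, h1⟩
  · rw [h.deriv_zero (not_le.1 h1)]; simpa using h0

lemma lap_mu {κ : ℝ → ℝ} (h : Prof κ) (ρ : ℝ) (x z : ES N) :
    lap (mu κ ρ x) z = -(2 * ((ρ ^ 2)⁻¹) ^ 2 * ‖z - x‖ ^ 2 * deriv κ ((ρ ^ 2)⁻¹ * ‖z - x‖ ^ 2)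
      + N * (ρ ^ 2)⁻¹ * κ ((ρ ^ 2)⁻¹ * ‖z - x‖ ^ 2)) := by
  have := lap_radial (N := N) (h := mpr κ) (h' := fun s => -κ s / 2)
    (h'' := fun s => -(deriv κ s) / 2) (mpr_hasDeriv h)
    (fun s => ((h.hasDeriv s).neg).div_const 2) ((ρ ^ 2)⁻¹) x z
  have e : mu κ ρ x = fun y => mpr κ ((ρ ^ 2)⁻¹ * ‖y - x‖ ^ 2) := rfl
  rw [e, this]
  ring

lemma av_hasDeriv {κ : ℝ → ℝ} (h : Prof κ) {w : ES N → ℝ} (hw : Integrable w) (x : ES N)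
    {ρ : ℝ} (hρ : 0 < ρ) :
    HasDerivAt (fun ρ => av κ ρ w x) (ρ * (ρ ^ N)⁻¹ * ∫ z, w z * lap (mu κ ρ x) z) ρ := by
  obtain ⟨C, hC0, hC⟩ := h.bound
  have pt : ∀ A r : ℝ, r ≠ 0 → HasDerivAt (fun r : ℝ => κ ((r ^ 2)⁻¹ * A))
      (-(2 * r⁻¹ * ((r ^ 2)⁻¹ * A * deriv κ ((r ^ 2)⁻¹ * A)))) r := by
    intro A r hr
    have h1 : HasDerivAt (fun r : ℝ => (r ^ 2)⁻¹ * A) (-(2 * r) / (r ^ 2) ^ 2 * A) r := by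
      have := ((hasDerivAt_pow 2 r).fun_inv (by positivity)).mul_const A
      simpa using this
    have h2 := (h.hasDeriv ((r ^ 2)⁻¹ * A)).comp r h1
    refine h2.congr_deriv ?_
    field_simp
  have main := hasDerivAt_integral_of_dominated_loc_of_deriv_le (μ := (volume : Measure (ES N)))
    (F := fun r z => w z * κ ((r ^ 2)⁻¹ * ‖z - x‖ ^ 2))
    (F' := fun r z => w z *
      (-(2 * r⁻¹ * ((r ^ 2)⁻¹ * ‖z - x‖ ^ 2 * deriv κ ((r ^ 2)⁻¹ * ‖z - x‖ ^ 2)))))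
    (x₀ := ρ) (s := Ioi (ρ / 2)) (bound := fun z => ‖w z‖ * (2 * (ρ / 2)⁻¹ * C))
    (Ioi_mem_nhds (by linarith))
    (by
      filter_upwards with r
      exact hw.aestronglyMeasurable.mul (ker_cont h r x).aestronglyMeasurable)
    (by
      exact ker_mul_integrable h hρ hw.integrableOn)
    (by
      refine hw.aestronglyMeasurable.mul (Continuous.aestronglyMeasurable ?_)
      have := h.deriv_cont
      fun_prop)
    (by
      filter_upwards with z r hr
      have hr' : ρ / 2 < r := hr
      have hr0 : 0 < r := by linarith
      rw [norm_mul]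
      gcongr
      rw [norm_neg, norm_mul, norm_mul, Real.norm_eq_abs ((r ^ 2)⁻¹ * _ * _), Real.norm_eq_abs,
        Real.norm_eq_abs, abs_of_pos (by norm_num : (0:ℝ) < 2), abs_of_pos (inv_pos.2 hr0)]
      have := hC ((r ^ 2)⁻¹ * ‖z - x‖ ^ 2) (by positivity)
      gcongr)
    (hw.norm.mul_const _)
    (by
      filter_upwards with z r hr
      have hr' : ρ / 2 < r := hr
      exact (pt _ r (by linarith)).const_mul _)
  have hp : HasDerivAt (fun r : ℝ => (r ^ N)⁻¹) (-(N * ρ⁻¹ * (ρ ^ N)⁻¹)) ρ := by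
    have := (hasDerivAt_pow N ρ).fun_inv (by positivity)
    refine this.congr_deriv ?_
    rcases N with _ | n
    · simp
    · simp only [Nat.add_sub_cancel]
      field_simp
      ring
  have fin := hp.mul main.2
  unfold av
  refine fin.congr_deriv ?_
  have i1 : Integrable fun z => w z * κ ((ρ ^ 2)⁻¹ * ‖z - x‖ ^ 2) :=
    ker_mul_integrable h hρ hw.integrableOn
  have e : ∀ z, w z * lap (mu κ ρ x) z = (ρ⁻¹) *
      (w z * (-(2 * ρ⁻¹ * ((ρ ^ 2)⁻¹ * ‖z - x‖ ^ 2 * deriv κ ((ρ ^ 2)⁻¹ * ‖z - x‖ ^ 2)))))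
      + (-(N * (ρ ^ 2)⁻¹)) * (w z * κ ((ρ ^ 2)⁻¹ * ‖z - x‖ ^ 2)) := by
    intro z
    rw [lap_mu h]
    field_simp
    ring
  rw [integral_congr_ae (Eventually.of_forall e), integral_add (main.1.const_mul _)
    (i1.const_mul _), integral_const_mul, integral_const_mul]
  generalize (∫ a : ES N, w a * κ ((ρ ^ 2)⁻¹ * ‖a - x‖ ^ 2)) = I1
  generalize (∫ a : ES N, w a * _) = I2
  field_simp
  ring

lemma mu_nonneg {κ : ℝ → ℝ} (h : Prof κ) (ρ : ℝ) (x z : ES N) : 0 ≤ mu κ ρ x z :=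
  (mpr_bounds h (by positivity)).1

lemma mu_le {κ : ℝ → ℝ} (h : Prof κ) (ρ : ℝ) (x z : ES N) :
    mu κ ρ x z ≤ κ ((ρ ^ 2)⁻¹ * ‖z - x‖ ^ 2) / 2 :=
  (mpr_bounds h (by positivity)).2

lemma mu_zero {κ : ℝ → ℝ} (h : Prof κ) {ρ : ℝ} (hρ : 0 < ρ) {x z : ES N}
    (hz : ρ ≤ ‖z - x‖) : mu κ ρ x z = 0 := by
  apply mpr_zero h
  rw [inv_mul_eq_div, le_div_iff₀ (by positivity), one_mul]
  gcongr

lemma mu_tsupport {κ : ℝ → ℝ} (h : Prof κ) {ρ : ℝ} (hρ : 0 < ρ) (x : ES N) :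
    tsupport (mu κ ρ x) ⊆ closedBall x ρ := by
  apply closure_minimal _ isClosed_closedBall
  intro z hz
  by_contra hc
  rw [mem_closedBall, dist_eq_norm, not_le] at hc
  exact hz (mu_zero h hρ hc.le)

lemma mu_contDiff {κ : ℝ → ℝ} (h : Prof κ) (ρ : ℝ) (x : ES N) :
    ContDiff ℝ (⊤ : ℕ∞) (mu κ ρ x) := contDiff_radial (mpr_smooth h) _ x

lemma mu_test {κ : ℝ → ℝ} (h : Prof κ) {ρ : ℝ} (hρ : 0 < ρ) {x : ES N} {U : Set (ES N)}
    (hU : closedBall x ρ ⊆ U) : IsTestFun U (mu κ ρ x) :=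
  ⟨mu_contDiff h ρ x,
   (isCompact_closedBall x ρ).of_isClosed_subset (isClosed_tsupport _) (mu_tsupport h hρ x),
   (mu_tsupport h hρ x).trans hU⟩

lemma lap_mu_zero {κ : ℝ → ℝ} (h : Prof κ) {ρ : ℝ} (hρ : 0 < ρ) {x z : ES N}
    (hz : ρ < ‖z - x‖) : lap (mu κ ρ x) z = 0 := by
  rw [lap_mu h, ker_zero h hρ hz.le, h.deriv_zero]
  · simp
  · rw [inv_mul_eq_div, lt_div_iff₀ (by positivity), one_mul]
    gcongr

/-- the averages (times a Gaussian factor) of a supersolution are nonincreasing -/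
theorem av_anti {κ : ℝ → ℝ} (h : Prof κ) {w F : ES N → ℝ} {x : ES N} {U : Set (ES N)}
    {R lam : ℝ} (hU : closedBall x R ⊆ U) (hw : IntegrableOn w (closedBall x R))
    (hsup : ∀ φ, IsTestFun U φ → (∀ z, 0 ≤ φ z) → ∫ z, w z * lap φ z ≤ ∫ z, F z * φ z)
 (hF : ∀ z ∈ closedBall x R, F z ≤ lam * w z)
    (hpos : ∀ z ∈ closedBall x R, 0 ≤ lam * w z) :
    AntitoneOn (fun ρ => Real.exp (-(lam * ρ ^ 2 / 4)) * av κ ρ w x) (Ioc 0 R) := by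
  set w1 := (closedBall x R).indicator w with hw1
  have iw1 : Integrable w1 := (integrable_indicator_iff measurableSet_closedBall).2 hw
  have ew : ∀ z ∈ closedBall x R, w1 z = w z := fun z hz => indicator_of_mem hz _
  have eav : ∀ ρ ∈ Ioc 0 R, av κ ρ w x = av κ ρ w1 x := by
    intro ρ hρ
    apply av_congr h hρ.1
    intro z hz
    exact (ew z (closedBall_subset_closedBall hρ.2 (ball_subset_closedBall hz))).symm
  have hder : ∀ ρ, 0 < ρ → HasDerivAt (fun ρ => Real.exp (-(lam * ρ ^ 2 / 4)) * av κ ρ w1 x)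
      (Real.exp (-(lam * ρ ^ 2 / 4)) * (ρ * (ρ ^ N)⁻¹ * (∫ z, w1 z * lap (mu κ ρ x) z)
        - lam * ρ / 2 * av κ ρ w1 x)) ρ := by
    intro ρ hρ
    have h1 : HasDerivAt (fun ρ : ℝ => Real.exp (-(lam * ρ ^ 2 / 4)))
        (Real.exp (-(lam * ρ ^ 2 / 4)) * (-(lam * ρ / 2))) ρ := by
      have := ((((hasDerivAt_pow 2 ρ).const_mul lam).div_const 4).fun_neg).exp
      refine this.congr_deriv ?_
      simp; ring
    have := h1.mul (av_hasDeriv h iw1 x hρ)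
    refine this.congr_deriv ?_
    ring
  have anti1 : AntitoneOn (fun ρ => Real.exp (-(lam * ρ ^ 2 / 4)) * av κ ρ w1 x) (Ioc 0 R) := by
    apply antitoneOn_of_deriv_nonpos (convex_Ioc 0 R)
    · intro ρ hρ
      exact (hder ρ hρ.1).continuousAt.continuousWithinAt
    · intro ρ hρ
      rw [interior_Ioc] at hρ
      exact (hder ρ hρ.1).differentiableAt.differentiableWithinAt
    · intro ρ hρ
      rw [interior_Ioc] at hρ
      rw [(hder ρ hρ.1).deriv]
      have hρ0 := hρ.1
      have hsub : closedBall x ρ ⊆ closedBall x R := closedBall_subset_closedBall hρ.2.le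
      have e1 : ∫ z, w1 z * lap (mu κ ρ x) z = ∫ z, w z * lap (mu κ ρ x) z := by
        congr 1; funext z
        by_cases hz : z ∈ closedBall x R
        · rw [ew z hz]
        · rw [lap_mu_zero h hρ0]
          · simp
          · rw [mem_closedBall, dist_eq_norm, not_le] at hz
            linarith [hρ.2]
      have h2 := hsup _ (mu_test h hρ0 (hsub.trans hU)) (mu_nonneg h ρ x)
      have nn : ∀ z, 0 ≤ (lam / 2) * (w1 z * κ ((ρ ^ 2)⁻¹ * ‖z - x‖ ^ 2)) := by
        intro z
        by_cases hz : z ∈ closedBall x R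
        · rw [ew z hz]
          have := mul_nonneg (hpos z hz) (h.nonneg ((ρ ^ 2)⁻¹ * ‖z - x‖ ^ 2))
          linarith
        · rw [hw1, indicator_of_notMem hz]; simp
      have h3 : ∫ z, F z * mu κ ρ x z ≤ ∫ z, (lam / 2) * (w1 z * κ ((ρ ^ 2)⁻¹ * ‖z - x‖ ^ 2)) := by
        by_cases hi : Integrable fun z => F z * mu κ ρ x z
        · apply integral_mono hi
          · exact (ker_mul_integrable h hρ0 iw1.integrableOn).const_mul _
          · intro z
            by_cases hz : z ∈ closedBall x R
            · simp only
              rw [ew z hz]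
              have a1 := mul_le_mul_of_nonneg_right (hF z hz) (mu_nonneg h ρ x z)
              have a2 := mul_le_mul_of_nonneg_left (mu_le h ρ x z) (hpos z hz)
              linarith
            · have : mu κ ρ x z = 0 := by
                apply mu_zero h hρ0
                rw [mem_closedBall, dist_eq_norm, not_le] at hz
                linarith [hρ.2]
              simp only [this, mul_zero]
              exact nn z
        · rw [integral_undef hi]
          exact integral_nonneg nn
      rw [integral_const_mul] at h3
      have h4 : ρ * (ρ ^ N)⁻¹ * (∫ z, w1 z * lap (mu κ ρ x) z)
        - lam * ρ / 2 * av κ ρ w1 x ≤ 0 := by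
        rw [e1]
        unfold av
        have p : 0 ≤ ρ * (ρ ^ N)⁻¹ := by positivity
        have := mul_le_mul_of_nonneg_left (h2.trans h3) p
        linarith
      exact mul_nonpos_of_nonneg_of_nonpos (Real.exp_nonneg _) h4
  intro r hr s hs hrs
  simp only
  rw [eav r hr, eav s hs]
  exact anti1 hr hs hrs

theorem mean_le {κ : ℝ → ℝ} (h : Prof κ) {w F : ES N → ℝ} {x : ES N} {U : Set (ES N)}
    {R lam : ℝ} (hR : 0 < R) (hU : closedBall x R ⊆ U) (hw : IntegrableOn w (closedBall x R))
    (hc : ContinuousAt w x)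
    (hsup : ∀ φ, IsTestFun U φ → (∀ z, 0 ≤ φ z) → ∫ z, w z * lap φ z ≤ ∫ z, F z * φ z)
 (hF : ∀ z ∈ closedBall x R, F z ≤ lam * w z)
    (hpos : ∀ z ∈ closedBall x R, 0 ≤ lam * w z) :
    av κ R w x ≤ Real.exp (lam * R ^ 2 / 4) * (Zc N κ * w x) := by
  have A := av_anti h hU hw hsup hF hpos
  have T1 := av_tendsto h hR hw hc
  have T2 : Tendsto (fun ρ : ℝ => Real.exp (-(lam * ρ ^ 2 / 4))) (𝓝[>] 0) (𝓝 1) := by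
    have : Continuous fun ρ : ℝ => Real.exp (-(lam * ρ ^ 2 / 4)) := by fun_prop
    have := this.tendsto 0
    simp at this
    exact this.mono_left nhdsWithin_le_nhds
  have T := T2.mul T1
  rw [one_mul] at T
  have : Real.exp (-(lam * R ^ 2 / 4)) * av κ R w x ≤ Zc N κ * w x := by
    apply ge_of_tendsto T
    have : Ioc (0:ℝ) R ∈ 𝓝[>] (0:ℝ) := Ioc_mem_nhdsGT hR
    filter_upwards [this] with ρ hρ
    exact A hρ ⟨hR, le_rfl⟩ hρ.2
  rw [Real.exp_neg, inv_mul_le_iff₀ (Real.exp_pos _)] at this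
  exact this

end Part3

/-! ### Part 4 : Harnack inequalities -/

section Part4

variable {N : ℕ}

/-- the standard profile -/
def kap (s : ℝ) : ℝ := expNegInvGlue (1 - s)

lemma kap_prof : Prof kap where
  smooth := expNegInvGlue.contDiff.comp (contDiff_const.sub contDiff_id)
  nonneg s := expNegInvGlue.nonneg _
  zero s hs := expNegInvGlue.zero_of_nonpos (by linarith)
  anti a b hab := expNegInvGlue.monotone (by linarith)

lemma kap_pos {s : ℝ} (hs : s < 1) : 0 < kap s := expNegInvGlue.pos_of_pos (by linarith)

/-- the mass of the standard kernel -/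
def Zk (N : ℕ) : ℝ := Zc N kap

lemma Zk_pos : 0 < Zk N := Zc_pos kap_prof (kap_pos one_pos)

/-- volume of the unit ball -/
def vb (N : ℕ) : ℝ := (volume : Measure (ES N)).real (ball 0 1)

lemma vb_pos : 0 < vb N :=
  ENNReal.toReal_pos (measure_ball_pos _ _ one_pos).ne' measure_ball_lt_top.ne

lemma vol_ball (x : ES N) {r : ℝ} (hr : 0 < r) :
    (volume : Measure (ES N)).real (ball x r) = r ^ N * vb N := by
  unfold vb Measure.real
  rw [Measure.addHaar_ball_of_pos _ _ hr]
  simp [ENNReal.toReal_mul, ENNReal.toReal_ofReal, hr.le]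

lemma kap_ker_lower {R : ℝ} (hR : 0 < R) {x z : ES N} (hz : dist z x ≤ R / 2) :
    kap (1 / 4) ≤ kap ((R ^ 2)⁻¹ * ‖z - x‖ ^ 2) := by
  apply kap_prof.anti
  rw [dist_eq_norm] at hz
  rw [inv_mul_eq_div, div_le_iff₀ (by positivity)]
  nlinarith [norm_nonneg (z - x)]

/-- lower bound for averages from a bound on a small ball -/
lemma av_lower {R r m : ℝ} {x p : ES N} {w : ES N → ℝ} (hR : 0 < R) (hr : 0 < r)
    (hw : IntegrableOn w (closedBall x R)) (h0 : ∀ z ∈ ball x R, 0 ≤ w z)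
    (hsub : ball p r ⊆ closedBall x (R / 2)) (hm : ∀ z ∈ ball p r, m ≤ w z) (hm0 : 0 ≤ m) :
    m * (kap (1 / 4) * vb N * (r / R) ^ N) ≤ av kap R w x := by
  have h1 : ∫ z, (ball p r).indicator (fun _ => m * kap (1 / 4)) z
      ≤ ∫ z, w z * kap ((R ^ 2)⁻¹ * ‖z - x‖ ^ 2) := by
    apply integral_mono
    · rw [integrable_indicator_iff measurableSet_ball]
      exact integrableOn_const measure_ball_lt_top.ne
    · exact ker_mul_integrable kap_prof hR hw
    · intro z
      by_cases hz : z ∈ ball p r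
      · simp only [indicator_of_mem hz]
        exact mul_le_mul (hm z hz) (kap_ker_lower hR (hsub hz)) (kap_prof.nonneg _)
          (hm0.trans (hm z hz))
      · simp only [indicator_of_notMem hz]
        by_cases hz2 : z ∈ ball x R
        · exact mul_nonneg (h0 z hz2) (kap_prof.nonneg _)
        · rw [mem_ball, dist_eq_norm, not_lt] at hz2
          rw [ker_zero kap_prof hR hz2]; simp
  rw [integral_indicator measurableSet_ball, setIntegral_const, vol_ball p hr, smul_eq_mul] at h1
  unfold av
  have h2 := mul_le_mul_of_nonneg_left h1 (by positivity : 0 ≤ (R ^ N)⁻¹)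
  refine le_trans (le_of_eq ?_) h2
  rw [div_pow]
  field_simp

/-- comparison of averages -/
lemma av_le_av {R r : ℝ} {x x' : ES N} {w : ES N → ℝ} (hR : 0 < R) (hr : 0 < r)
    (hw : IntegrableOn w (closedBall x R)) (h0 : ∀ z ∈ ball x R, 0 ≤ w z)
    (hsub : ball x' r ⊆ closedBall x (R / 2)) :
    av kap r w x' ≤ (R / r) ^ N * (kap 0 / kap (1 / 4)) * av kap R w x := by
  have k4 : 0 < kap (1 / 4) := kap_pos (by norm_num)
  have h1 : ∫ z, w z * kap ((r ^ 2)⁻¹ * ‖z - x'‖ ^ 2)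
      ≤ ∫ z, (kap 0 / kap (1 / 4)) * (w z * kap ((R ^ 2)⁻¹ * ‖z - x‖ ^ 2)) := by
    apply integral_mono_of_nonneg
    · filter_upwards with z
      by_cases hz : z ∈ ball x' r
      · have : z ∈ ball x R := by
          have := hsub hz
          rw [mem_closedBall] at this
          rw [mem_ball]; linarith
        exact mul_nonneg (h0 z this) (kap_prof.nonneg _)
      · rw [mem_ball, dist_eq_norm, not_lt] at hz
        simp only [Pi.zero_apply]
        rw [ker_zero kap_prof hr hz]; simp
    · exact (ker_mul_integrable kap_prof hR hw).const_mul _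
    · filter_upwards with z
      by_cases hz : z ∈ ball x' r
      · have hz2 := hsub hz
        have : z ∈ ball x R := by
          rw [mem_closedBall] at hz2
          rw [mem_ball]; linarith
        have w0 := h0 z this
        have a1 := ker_le kap_prof r x' z
        have a2 := kap_ker_lower hR hz2
        have : kap 0 ≤ kap 0 / kap (1 / 4) * kap ((R ^ 2)⁻¹ * ‖z - x‖ ^ 2) := by
          rw [div_mul_eq_mul_div, le_div_iff₀ k4]
          exact mul_le_mul_of_nonneg_left a2 (kap_prof.nonneg 0)
        calc w z * kap ((r ^ 2)⁻¹ * ‖z - x'‖ ^ 2) ≤ w z *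
              (kap 0 / kap (1 / 4) * kap ((R ^ 2)⁻¹ * ‖z - x‖ ^ 2)) :=
              mul_le_mul_of_nonneg_left (a1.trans this) w0
          _ = _ := by ring
      · rw [mem_ball, dist_eq_norm, not_lt] at hz
        rw [ker_zero kap_prof hr hz, mul_zero]
        apply mul_nonneg (by have := kap_prof.nonneg 0; positivity)
        by_cases hz2 : z ∈ ball x R
        · exact mul_nonneg (h0 z hz2) (kap_prof.nonneg _)
        · rw [mem_ball, dist_eq_norm, not_lt] at hz2
          rw [ker_zero kap_prof hR hz2]; simp
  rw [integral_const_mul] at h1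
  unfold av
  have h2 := mul_le_mul_of_nonneg_left h1 (by positivity : 0 ≤ (r ^ N)⁻¹)
  refine h2.trans (le_of_eq ?_)
  rw [div_pow]
  field_simp

/-- continuous weak supersolutions of `Δw - V w ≤ 0`. -/
def Sup (U : Set (ES N)) (V w : ES N → ℝ) : Prop :=
  ContinuousOn w U ∧ ∀ φ, IsTestFun U φ → (∀ z, 0 ≤ φ z) →
    ∫ z, w z * lap φ z ≤ ∫ z, V z * w z * φ z

lemma IsTestFun.mono {U U' : Set (ES N)} {φ : ES N → ℝ} (h : IsTestFun U φ) (hU : U ⊆ U') :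
    IsTestFun U' φ := ⟨h.1, h.2.1, h.2.2.trans hU⟩

lemma Sup.mono {U U' : Set (ES N)} {V w : ES N → ℝ} (h : Sup U' V w) (hU : U ⊆ U') :
    Sup U V w := ⟨h.1.mono hU, fun φ hφ h0 => h.2 φ (hφ.mono hU) h0⟩

lemma Sup.integrableOn {U : Set (ES N)} {V w : ES N → ℝ} (h : Sup U V w) {x : ES N} {R : ℝ}
    (hU : closedBall x R ⊆ U) : IntegrableOn w (closedBall x R) :=
  (h.1.mono hU).integrableOn_compact (isCompact_closedBall x R)

lemma cont_at {U : Set (ES N)} {w : ES N → ℝ} (h : ContinuousOn w U) {x : ES N}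
    {R : ℝ} (hR : 0 < R) (hU : closedBall x R ⊆ U) : ContinuousAt w x :=
  h.continuousAt (mem_of_superset (closedBall_mem_nhds x hR) hU)

lemma Sup.mean {U : Set (ES N)} {V w : ES N → ℝ} (h : Sup U V w) {x : ES N} {R L : ℝ}
    (hR : 0 < R) (hL : 0 ≤ L) (hU : closedBall x R ⊆ U)
    (hV : ∀ z ∈ closedBall x R, V z * R ^ 2 ≤ L) (hw : ∀ z ∈ closedBall x R, 0 ≤ w z) :
    av kap R w x ≤ Real.exp (L / 4) * (Zk N * w x) := by
  have := mean_le (lam := L / R ^ 2) kap_prof hR hU (h.integrableOn hU) (cont_at h.1 hR hU) h.2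
    (fun z hz => by
      apply mul_le_mul_of_nonneg_right _ (hw z hz)
      rw [le_div_iff₀ (by positivity)]
      exact hV z hz)
    (fun z hz => mul_nonneg (by positivity) (hw z hz))
  have e : L / R ^ 2 * R ^ 2 = L := by field_simp
  rw [e] at this
  exact this

/-- `u ≥ 0` with `Δu ≥ 0` : sub-mean value property -/
lemma Sup.submean {κ : ℝ → ℝ} (hκ : Prof κ) {U : Set (ES N)} {V u : ES N → ℝ}
    (h : Sup U V (fun z => - u z)) {x : ES N} {R : ℝ}
    (hR : 0 < R) (hU : closedBall x R ⊆ U)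
    (hV : ∀ z ∈ closedBall x R, 0 ≤ V z) (hw : ∀ z ∈ closedBall x R, 0 ≤ u z) :
    Zc N κ * u x ≤ av κ R u x := by
  have := mean_le (lam := 0) hκ hR hU (h.integrableOn hU) (cont_at h.1 hR hU) h.2
    (fun z hz => by
      have := mul_nonneg (hV z hz) (hw z hz)
      simp; linarith)
    (fun z hz => by simp)
  have e : av κ R (fun z => - u z) x = - av κ R u x := by
    have := av_smul (κ := κ) R x (-1) u
    simpa using this
  rw [e] at this
  simp at this
  linarith

/-- weak Harnack inequality -/
lemma Sup.weakHarnack {U : Set (ES N)} {V w : ES N → ℝ} (h : Sup U V w) {x p : ES N}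
    {R r L m : ℝ}
    (hR : 0 < R) (hr : 0 < r) (hL : 0 ≤ L) (hU : closedBall x R ⊆ U)
    (hV : ∀ z ∈ closedBall x R, V z * R ^ 2 ≤ L) (hw : ∀ z ∈ closedBall x R, 0 ≤ w z)
    (hsub : ball p r ⊆ closedBall x (R / 2)) (hm : ∀ z ∈ ball p r, m ≤ w z) (hm0 : 0 ≤ m) :
    m * (kap (1 / 4) * vb N * (r / R) ^ N) / (Real.exp (L / 4) * Zk N) ≤ w x := by
  have h1 := h.mean hR hL hU hV hw
  have h2 := av_lower hR hr (h.integrableOn hU) (fun z hz => hw z (ball_subset_closedBall hz))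
    hsub hm hm0
  rw [div_le_iff₀ (by have := Zk_pos (N := N); positivity)]
  linarith

/-- the constant in the Harnack inequality -/
def cH (N : ℕ) (L : ℝ) : ℝ := 4 ^ N * (kap 0 / kap (1 / 4)) * Real.exp (L / 4)

lemma cH_pos (L : ℝ) : 0 < cH N L := by
  have h4 : 0 < kap (1 / 4) := kap_pos (by norm_num)
  have h0 : 0 < kap 0 := kap_pos (by norm_num)
  unfold cH; positivity

lemma one_le_cH {L : ℝ} (hL : 0 ≤ L) : 1 ≤ cH N L := by
  have h4 : 0 < kap (1 / 4) := kap_pos (by norm_num)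
  have h0 : kap (1 / 4) ≤ kap 0 := kap_prof.anti (by norm_num)
  have a : 1 ≤ kap 0 / kap (1 / 4) := by rw [le_div_iff₀ h4]; linarith
  have b : 1 ≤ Real.exp (L / 4) := Real.one_le_exp (by positivity)
  have c : (1:ℝ) ≤ 4 ^ N := one_le_pow₀ (by norm_num)
  unfold cH
  nlinarith [mul_le_mul c a zero_le_one (by positivity)]

/-- a nonnegative solution : both `u` and `-u` are supersolutions, and `V ≥ 0`. -/
structure Sol (U : Set (ES N)) (V u : ES N → ℝ) : Prop where
  sup : Sup U V u
  sub : Sup U V (fun z => - u z)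
  pos : ∀ z ∈ U, 0 < u z
  Vnn : ∀ z ∈ U, 0 ≤ V z

lemma Sol.mono {U U' : Set (ES N)} {V w : ES N → ℝ} (h : Sol U' V w) (hU : U ⊆ U') :
    Sol U V w := ⟨h.sup.mono hU, h.sub.mono hU, fun z hz => h.pos z (hU hz),
      fun z hz => h.Vnn z (hU hz)⟩

lemma Sol.harnack {U : Set (ES N)} {V u : ES N → ℝ} (h : Sol U V u) {x x' : ES N}
    {R L : ℝ} (hR : 0 < R) (hL : 0 ≤ L) (hU : closedBall x R ⊆ U)
    (hV : ∀ z ∈ closedBall x R, V z * R ^ 2 ≤ L) (hx : dist x' x ≤ R / 4) :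
    u x' ≤ cH N L * u x := by
  have s1 : closedBall x' (R / 4) ⊆ closedBall x (R / 2) := by
    apply closedBall_subset_closedBall'; linarith
  have s2 : closedBall x (R / 2) ⊆ closedBall x R := closedBall_subset_closedBall (by linarith)
  have h1 := h.sub.submean kap_prof (x := x') (R := R / 4) (by positivity)
    ((s1.trans s2).trans hU) (fun z hz => h.Vnn z (hU (s2 (s1 hz))))
    (fun z hz => (h.pos z (hU (s2 (s1 hz)))).le)
  have h2 := av_le_av hR (by positivity : 0 < R / 4) (h.sup.integrableOn hU)
    (fun z hz => (h.pos z (hU (ball_subset_closedBall hz))).le)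
    (ball_subset_closedBall.trans s1)
  have h3 := h.sup.mean hR hL hU hV (fun z hz => (h.pos z (hU hz)).le)
  have e : R / (R / 4) = 4 := by field_simp
  rw [e] at h2
  have hZ := Zk_pos (N := N)
  have h4 : 0 < kap (1 / 4) := kap_pos (by norm_num)
  have h0 : 0 < kap 0 := kap_pos (by norm_num)
  have h5 := mul_le_mul_of_nonneg_left h3 (by positivity : 0 ≤ 4 ^ N * (kap 0 / kap (1 / 4)))
  have h6 : Zk N * u x' ≤ Zk N * (cH N L * u x) := by
    refine (h1.trans (h2.trans h5)).trans (le_of_eq ?_)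
    unfold cH; ring
  exact le_of_mul_le_mul_left h6 hZ

/-- Harnack chains along segments -/
lemma Sol.chain {U : Set (ES N)} {V u : ES N → ℝ} (h : Sol U V u) {R L : ℝ} (hR : 0 < R)
    (hL : 0 ≤ L) (n : ℕ) : ∀ p p' : ES N, dist p p' ≤ n * (R / 4) →
    (∀ q ∈ segment ℝ p p', closedBall q R ⊆ U ∧ ∀ z ∈ closedBall q R, V z * R ^ 2 ≤ L) →
    u p' ≤ cH N L ^ n * u p := by
  induction n with
  | zero =>
    intro p p' hd _
    have : p = p' := by
      rw [← dist_le_zero]; simpa using hd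
    simp [this]
  | succ n ih =>
    intro p p' hd hq
    set q := AffineMap.lineMap p p' ((n:ℝ) / (n + 1)) with hqdef
    have ht : (n:ℝ) / (n + 1) ∈ Icc (0:ℝ) 1 :=
      ⟨by positivity, by rw [div_le_one (by positivity)]; linarith⟩
    have hqs : q ∈ segment ℝ p p' := by
      rw [segment_eq_image_lineMap]; exact ⟨_, ht, rfl⟩
    have d1 : dist p q = (n:ℝ) / (n + 1) * dist p p' := by
      rw [hqdef, dist_left_lineMap, Real.norm_of_nonneg ht.1]
    have d2 : dist q p' = (1 / ((n:ℝ) + 1)) * dist p p' := by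
      rw [hqdef, dist_lineMap_right, Real.norm_of_nonneg (by linarith [ht.2])]
      congr 1; field_simp; ring
    push_cast at hd
    have hn : (0:ℝ) < n + 1 := by positivity
    have e1 : dist p q ≤ n * (R / 4) := by
      rw [d1, div_mul_eq_mul_div, div_le_iff₀ hn]
      nlinarith [(Nat.cast_nonneg n : (0:ℝ) ≤ n)]
    have e2 : dist q p' ≤ R / 4 := by
      rw [d2, div_mul_eq_mul_div, div_le_iff₀ hn]
      nlinarith
    have i1 := ih p q e1 (fun z hz => hq z (by
      exact (convex_segment p p').segment_subset (left_mem_segment ℝ p p') hqs hz))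
    have i2 := h.harnack hR hL (hq q hqs).1 (hq q hqs).2 (by rwa [dist_comm] at e2)
    calc u p' ≤ cH N L * u q := i2
      _ ≤ cH N L * (cH N L ^ n * u p) := mul_le_mul_of_nonneg_left i1 (cH_pos L).le
      _ = _ := by ring

end Part4

/-! ### Part 5 : calculus of the Laplacian, sub-mean value implies subharmonic -/

section Part5

variable {N : ℕ}

lemma lap_congr_nhds {φ ψ : ES N → ℝ} {z : ES N} (h : φ =ᶠ[𝓝 z] ψ) : lap φ z = lap ψ z := by
  unfold lap
  refine Finset.sum_congr rfl fun i _ => ?_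
  have : (fun y => fderiv ℝ φ y (EuclideanSpace.single i 1)) =ᶠ[𝓝 z]
      fun y => fderiv ℝ ψ y (EuclideanSpace.single i 1) := by
    filter_upwards [h.fderiv (𝕜 := ℝ)] with y hy
    rw [hy]
  rw [this.fderiv_eq]

lemma lap_zero_fun (z : ES N) : lap (fun _ : ES N => (0:ℝ)) z = 0 := by
  simp [lap]

lemma lap_const (c : ℝ) (z : ES N) : lap (fun _ : ES N => c) z = 0 := by
  simp [lap]

lemma lap_off {φ : ES N → ℝ} {z : ES N} (h : z ∉ tsupport φ) : lap φ z = 0 := by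
  rw [lap_congr_nhds (notMem_tsupport_iff_eventuallyEq.1 h)]
  exact lap_zero_fun z

/-- directional derivative -/
def dd (i : Fin N) (φ : ES N → ℝ) (z : ES N) : ℝ := fderiv ℝ φ z (EuclideanSpace.single i 1)

lemma lap_eq (φ : ES N → ℝ) (z : ES N) : lap φ z = ∑ i, dd i (dd i φ) z := rfl

lemma dd_contDiff {φ : ES N → ℝ} (h : ContDiff ℝ (⊤ : ℕ∞) φ) (i : Fin N) :
    ContDiff ℝ (⊤ : ℕ∞) (dd i φ) := by
  unfold dd
  exact (h.fderiv_right (m := (⊤ : ℕ∞)) (by simp)).clm_apply contDiff_const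

lemma lap_contDiff {φ : ES N → ℝ} (h : ContDiff ℝ (⊤ : ℕ∞) φ) :
    ContDiff ℝ (⊤ : ℕ∞) (lap φ) := by
  have : lap φ = fun z => ∑ i, dd i (dd i φ) z := by funext z; rfl
  rw [this]
  exact ContDiff.sum fun i _ => dd_contDiff (dd_contDiff h i) i

lemma smooth_diff {φ : ES N → ℝ} (h : ContDiff ℝ (⊤ : ℕ∞) φ) : Differentiable ℝ φ :=
  h.differentiable (by simp)

lemma dd_supp {φ : ES N → ℝ} (h : HasCompactSupport φ) (i : Fin N) :
    HasCompactSupport (dd i φ) := by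
  apply HasCompactSupport.intro h
  intro z hz
  unfold dd
  rw [(notMem_tsupport_iff_eventuallyEq.1 hz).fderiv_eq]
  simp

lemma lap_supp {φ : ES N → ℝ} (h : HasCompactSupport φ) : HasCompactSupport (lap φ) :=
  HasCompactSupport.intro h fun _ hz => lap_off hz

lemma dd_parts {f g : ES N → ℝ} (hf : ContDiff ℝ (⊤ : ℕ∞) f) (hg : ContDiff ℝ (⊤ : ℕ∞) g)
    (hs : HasCompactSupport g) (i : Fin N) : ∫ z, f z * dd i g z = - ∫ z, dd i f z * g z := by
  have c1 := dd_contDiff hf i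
  have c2 := dd_contDiff hg i
  apply integral_mul_fderiv_eq_neg_fderiv_mul_of_integrable
  · exact (c1.continuous.mul hg.continuous).integrable_of_hasCompactSupport hs.mul_left
  · exact (hf.continuous.mul c2.continuous).integrable_of_hasCompactSupport (dd_supp hs i).mul_left
  · exact (hf.continuous.mul hg.continuous).integrable_of_hasCompactSupport hs.mul_left
  · exact fun z _ => (smooth_diff hf) z
  · exact fun z _ => (smooth_diff hg) z

lemma lap_symm {f g : ES N → ℝ} (hf : ContDiff ℝ (⊤ : ℕ∞) f) (hg : ContDiff ℝ (⊤ : ℕ∞) g)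
    (hs : HasCompactSupport g) : ∫ z, f z * lap g z = ∫ z, lap f z * g z := by
  have e1 : ∀ z, f z * lap g z = ∑ i, f z * dd i (dd i g) z := by
    intro z; rw [lap_eq, Finset.mul_sum]
  have e2 : ∀ z, lap f z * g z = ∑ i, dd i (dd i f) z * g z := by
    intro z; rw [lap_eq, Finset.sum_mul]
  simp_rw [e1, e2]
  rw [integral_finsetSum, integral_finsetSum]
  · refine Finset.sum_congr rfl fun i _ => ?_
    have c1 := dd_contDiff hf i
    have c2 := dd_contDiff hg i
    rw [dd_parts hf c2 (dd_supp hs i), dd_parts c1 hg hs]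
    simp
  · intro i _
    have c1 := dd_contDiff (dd_contDiff hf i) i
    exact (c1.continuous.mul hg.continuous).integrable_of_hasCompactSupport hs.mul_left
  · intro i _
    have c2 := dd_contDiff (dd_contDiff hg i) i
    exact (hf.continuous.mul c2.continuous).integrable_of_hasCompactSupport
      (dd_supp (dd_supp hs i) i).mul_left

lemma dd_smul {f : ES N → ℝ} (hf : Differentiable ℝ f) (c : ℝ) (i : Fin N)
    (z : ES N) : dd i (fun z => c * f z) z = c * dd i f z := by
  unfold dd
  rw [fderiv_const_mul (hf z)]; simp

lemma lap_smul {f : ES N → ℝ} (hf : ContDiff ℝ (⊤ : ℕ∞) f) (c : ℝ)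
    (z : ES N) : lap (fun z => c * f z) z = c * lap f z := by
  rw [lap_eq, lap_eq, Finset.mul_sum]
  refine Finset.sum_congr rfl fun i _ => ?_
  have : dd i (fun z => c * f z) = fun z => c * dd i f z := by
    funext z; exact dd_smul (smooth_diff hf) c i z
  rw [this, dd_smul (smooth_diff (dd_contDiff hf i))]

lemma mpr_prof {κ : ℝ → ℝ} (h : Prof κ) : Prof (mpr κ) where
  smooth := mpr_smooth h
  anti := by
    apply antitone_of_deriv_nonpos
    · exact fun s => (mpr_hasDeriv h s).differentiableAt
    · intro s
      rw [(mpr_hasDeriv h s).deriv]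
      linarith [h.nonneg s]
  nonneg s := by
    have anti : Antitone (mpr κ) := by
      apply antitone_of_deriv_nonpos
      · exact fun s => (mpr_hasDeriv h s).differentiableAt
      · intro s
        rw [(mpr_hasDeriv h s).deriv]
        linarith [h.nonneg s]
    rcases le_total s 1 with hs | hs
    · rw [← mpr_zero h le_rfl]; exact anti hs
    · rw [mpr_zero h hs]
  zero s hs := mpr_zero h hs

lemma mpr_kap_pos : 0 < mpr kap 0 := by
  have : mpr kap 0 = (∫ r in (0:ℝ)..1, kap r) / 2 := by
    unfold mpr; rw [intervalIntegral.integral_symm]; ring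
  rw [this]
  have : 0 < ∫ r in (0:ℝ)..1, kap r := by
    apply intervalIntegral.intervalIntegral_pos_of_pos_on
    · exact kap_prof.smooth.continuous.intervalIntegrable _ _
    · intro r hr; exact kap_pos hr.2
    · norm_num
  linarith

/-- second order expansion of averages of smooth functions (upper bound). -/
lemma av_expand {η : ES N → ℝ} (hη : ContDiff ℝ (⊤ : ℕ∞) η) (hs : HasCompactSupport η)
    {ε : ℝ} (hε : 0 < ε) : ∃ ρ₀ > 0, ∀ ρ, 0 < ρ → ρ < ρ₀ → ∀ z,
      av kap ρ η z - Zk N * η z ≤ ρ ^ 2 / 2 * (Zc N (mpr kap) * (lap η z + ε)) := by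
  have cl : Continuous (lap η) := (lap_contDiff hη).continuous
  have uc : UniformContinuous (lap η) := (lap_supp hs).uniformContinuous_of_continuous cl
  obtain ⟨δ, hδ, hd⟩ := Metric.uniformContinuous_iff.1 uc ε hε
  have iη : Integrable η := hη.continuous.integrable_of_hasCompactSupport hs
  have il : Integrable (lap η) := cl.integrable_of_hasCompactSupport (lap_supp hs)
  refine ⟨δ, hδ, fun ρ hρ hρδ z => ?_⟩
  have hder : ∀ r, 0 < r → HasDerivAt (fun r => av kap r η z - r ^ 2 / 2 *
      (Zc N (mpr kap) * (lap η z + ε)))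
      (r * av (mpr kap) r (lap η) z - r * (Zc N (mpr kap) * (lap η z + ε))) r := by
    intro r hr
    have h1 := av_hasDeriv kap_prof iη z hr
    have e : ∫ y, η y * lap (mu kap r z) y = ∫ y, lap η y * mu kap r z y := by
      rw [lap_symm hη (mu_contDiff kap_prof r z)]
      exact (isCompact_closedBall z r).of_isClosed_subset (isClosed_tsupport _)
        (mu_tsupport kap_prof hr z)
    have h2 : HasDerivAt (fun r : ℝ => r ^ 2 / 2 * (Zc N (mpr kap) * (lap η z + ε)))
        (r * (Zc N (mpr kap) * (lap η z + ε))) r := by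
      have := ((hasDerivAt_pow 2 r).div_const 2).mul_const (Zc N (mpr kap) * (lap η z + ε))
      refine this.congr_deriv ?_
      simp
    refine (h1.sub h2).congr_deriv ?_
    rw [e]
    unfold av mu
    ring
  have anti : AntitoneOn (fun r => av kap r η z - r ^ 2 / 2 *
      (Zc N (mpr kap) * (lap η z + ε))) (Ioc 0 ρ) := by
    apply antitoneOn_of_deriv_nonpos (convex_Ioc 0 ρ)
    · intro r hr
      exact (hder r hr.1).continuousAt.continuousWithinAt
    · intro r hr
      rw [interior_Ioc] at hr
      exact (hder r hr.1).differentiableAt.differentiableWithinAt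
    · intro r hr
      rw [interior_Ioc] at hr
      rw [(hder r hr.1).deriv]
      have : av (mpr kap) r (lap η) z ≤ (lap η z + ε) * Zc N (mpr kap) := by
        apply av_le_const (mpr_prof kap_prof) hr.1 il.integrableOn
        intro y hy
        have := hd (lt_trans hy (hr.2.trans hρδ))
        rw [Real.dist_eq, abs_lt] at this
        linarith
      nlinarith [hr.1]
  have T1 := av_tendsto kap_prof hρ (x := z) (iη.integrableOn) hη.continuous.continuousAt
  have T2 : Tendsto (fun r : ℝ => r ^ 2 / 2 * (Zc N (mpr kap) * (lap η z + ε))) (𝓝[>] 0)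
      (𝓝 0) := by
    have : Continuous (fun r : ℝ => r ^ 2 / 2 * (Zc N (mpr kap) * (lap η z + ε))) := by fun_prop
    have := this.tendsto 0
    simp only [ne_eq, OfNat.ofNat_ne_zero, not_false_eq_true, zero_pow, zero_div, zero_mul] at this
    exact this.mono_left nhdsWithin_le_nhds
  have T := T1.sub T2
  rw [sub_zero] at T
  have : av kap ρ η z - ρ ^ 2 / 2 * (Zc N (mpr kap) * (lap η z + ε)) ≤ Zk N * η z := by
    apply ge_of_tendsto T
    filter_upwards [Ioc_mem_nhdsGT hρ] with r hr
    exact anti hr ⟨hρ, le_rfl⟩ hr.2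
  linarith

lemma av_swap {η f : ES N → ℝ} (hη : Integrable η) (hf : Integrable f) (ρ : ℝ) :
    ∫ x, η x * av kap ρ f x = ∫ z, f z * av kap ρ η z := by
  unfold av
  have e1 : ∀ x, η x * ((ρ ^ N)⁻¹ * ∫ z, f z * kap ((ρ ^ 2)⁻¹ * ‖z - x‖ ^ 2))
      = (ρ ^ N)⁻¹ * ∫ z, η x * f z * kap ((ρ ^ 2)⁻¹ * ‖z - x‖ ^ 2) := by
    intro x
    rw [mul_left_comm, ← integral_const_mul (η x)]
    congr 2; funext z; ring
  have e2 : ∀ x, f x * ((ρ ^ N)⁻¹ * ∫ z, η z * kap ((ρ ^ 2)⁻¹ * ‖z - x‖ ^ 2))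
      = (ρ ^ N)⁻¹ * ∫ z, η z * f x * kap ((ρ ^ 2)⁻¹ * ‖x - z‖ ^ 2) := by
    intro x
    rw [mul_left_comm, ← integral_const_mul (f x)]
    congr 2; funext z; rw [norm_sub_rev]; ring
  simp_rw [e1, e2]
  rw [integral_const_mul, integral_const_mul]
  congr 1
  apply integral_integral_swap
  refine Integrable.mul_bdd (c := kap 0) (hη.mul_prod hf) ?_ ?_
  · apply Continuous.aestronglyMeasurable
    have := kap_prof.smooth.continuous
    fun_prop
  · filter_upwards with p
    rw [Real.norm_of_nonneg (kap_prof.nonneg _)]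
    exact ker_le kap_prof ρ _ _

theorem subharm_of_submean {f : ES N → ℝ} {U : Set (ES N)} (hU : IsOpen U)
    (hf : LocallyIntegrableOn f U)
    (hsm : ∀ C ⊆ U, IsCompact C → ∃ ρ₀ > 0, ∀ ρ, 0 < ρ → ρ < ρ₀ → ∀ x ∈ C,
      Zk N * f x ≤ av kap ρ f x) {η : ES N → ℝ} (hη : IsTestFun U η) (h0 : ∀ z, 0 ≤ η z) :
    0 ≤ ∫ z, f z * lap η z := by
  obtain ⟨hs, hc', hsub⟩ := hη
  have hc : HasCompactSupport η := hc'
  obtain ⟨δ, hδ, hδU⟩ := hc'.exists_cthickening_subset_open hU hsub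
  set C2 := cthickening δ (tsupport η)
  have hC2 : IsCompact C2 := hc'.cthickening
  set f1 := C2.indicator f with hf1
  have if1 : Integrable f1 := (integrable_indicator_iff hC2.measurableSet).2
    (hf.integrableOn_compact_subset hδU hC2)
  have ef : ∀ z ∈ C2, f1 z = f z := fun z hz => indicator_of_mem hz _
  have hsC : tsupport η ⊆ C2 := self_subset_cthickening _
  obtain ⟨ρ₁, hρ₁, hm⟩ := hsm _ hsub hc'
  have iη : Integrable η := hs.continuous.integrable_of_hasCompactSupport hc
  have il : Integrable (lap η) :=
    (lap_contDiff hs).continuous.integrable_of_hasCompactSupport (lap_supp hc)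
  have e0 : ∫ z, f z * lap η z = ∫ z, f1 z * lap η z := by
    congr 1; funext z
    by_cases hz : z ∈ tsupport η
    · rw [ef z (hsC hz)]
    · rw [lap_off hz]; simp
  rw [e0]
  have Zm : 0 < Zc N (mpr kap) := Zc_pos (mpr_prof kap_prof) mpr_kap_pos
  have bdd : ∀ {g : ES N → ℝ}, Continuous g → HasCompactSupport g →
      Integrable fun z => f1 z * g z := by
    intro g hg hgs
    obtain ⟨B, hB⟩ := hgs.exists_bound_of_continuous hg
    exact if1.mul_bdd (c := B) hg.aestronglyMeasurable (Eventually.of_forall hB)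
  have key : ∀ ε > 0, 0 ≤ (∫ z, f1 z * lap η z) + ε * ∫ z, |f1 z| := by
    intro ε hε
    obtain ⟨ρ₂, hρ₂, h2⟩ := av_expand hs hc hε
    obtain ⟨ρ₃, hρ₃, h3⟩ := av_expand (η := fun z => -1 * η z) (contDiff_const.mul hs)
      (hc.mul_left) hε
    obtain ⟨ρ, hρ, hρm⟩ := exists_between (lt_min (lt_min hρ₁ hρ₂) (lt_min hρ₃ hδ))
    rw [lt_min_iff, lt_min_iff, lt_min_iff] at hρm
    obtain ⟨⟨q1, q2⟩, q3, q4⟩ := hρm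
    have a2 := h2 ρ hρ q2
    have a3 := h3 ρ hρ q3
    have a4 : ∀ z, |av kap ρ η z - Zk N * η z - ρ ^ 2 / 2 * (Zc N (mpr kap) * lap η z)|
        ≤ ρ ^ 2 / 2 * (Zc N (mpr kap) * ε) := by
      intro z
      have b2 := a2 z
      have b3 := a3 z
      rw [av_smul, lap_smul hs] at b3
      rw [abs_le]
      constructor <;> linarith
    have avη : Integrable fun z => f1 z * av kap ρ η z := by
      obtain ⟨B, hB⟩ := hc.exists_bound_of_continuous hs.continuous
      have B0 : 0 ≤ B := (norm_nonneg _).trans (hB 0)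
      have : ∀ z, f1 z * av kap ρ η z = f1 z * (av kap ρ η z - Zk N * η z - ρ ^ 2 / 2 *
         (Zc N (mpr kap) * lap η z)) + (Zk N * (f1 z * η z) + (ρ ^ 2 / 2 * Zc N (mpr kap)) *
         (f1 z * lap η z)) := by intro z; ring
      simp_rw [this]
      refine Integrable.add ?_ (((bdd hs.continuous hc).const_mul _).add
        ((bdd (lap_contDiff hs).continuous (lap_supp hc)).const_mul _))
      refine if1.mul_bdd (c := ρ ^ 2 / 2 * (Zc N (mpr kap) * ε)) ?_ (Eventually.of_forall a4)
      have cav : Continuous (av kap ρ η) := by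
        unfold av
        refine continuous_const.mul ?_
        apply continuous_of_dominated (bound := fun z => ‖η z‖ * kap 0)
        · intro x
          exact (hs.continuous.mul (ker_cont kap_prof ρ x)).aestronglyMeasurable
        · intro x
          filter_upwards with z
          rw [norm_mul, Real.norm_of_nonneg (kap_prof.nonneg _)]
          exact mul_le_mul_of_nonneg_left (ker_le kap_prof ρ x z) (norm_nonneg _)
        · exact iη.norm.mul_const _
        · filter_upwards with z
          have := kap_prof.smooth.continuous
          fun_prop
      have := (lap_contDiff hs).continuous
      have := hs.continuous
      exact Continuous.aestronglyMeasurable (by fun_prop)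
    have c1 : 0 ≤ ∫ x, η x * (av kap ρ f1 x - Zk N * f1 x) := by
      apply integral_nonneg
      intro x
      by_cases hx : x ∈ tsupport η
      · apply mul_nonneg (h0 x)
        have := hm ρ hρ q1 x hx
        rw [ef x (hsC hx)]
        rw [av_congr kap_prof hρ (w := f1) (w' := f)]
        · linarith
        · intro z hz
          apply ef
          apply closedBall_subset_cthickening hx δ
          exact closedBall_subset_closedBall q4.le (ball_subset_closedBall hz)
      · simp [image_eq_zero_of_notMem_tsupport hx]
    have c2 : ∫ x, η x * (av kap ρ f1 x - Zk N * f1 x)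
        = ∫ z, f1 z * (av kap ρ η z - Zk N * η z) := by
      have i1 := bdd hs.continuous hc
      have d1 : ∫ x, η x * (av kap ρ f1 x - Zk N * f1 x) = (∫ x, η x * av kap ρ f1 x) -
          Zk N * ∫ z, f1 z * η z := by
        rw [← integral_const_mul, ← integral_sub]
        · congr 1; funext x; ring
        · have B : ∀ x, ‖av kap ρ f1 x‖ ≤ (ρ ^ N)⁻¹ * (∫ z, ‖f1 z‖ * kap 0) := by
            intro x
            unfold av
            rw [norm_mul, Real.norm_of_nonneg (by positivity : 0 ≤ (ρ ^ N)⁻¹)]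
            gcongr
            refine (norm_integral_le_integral_norm _).trans ?_
            apply integral_mono (ker_mul_integrable kap_prof hρ if1.integrableOn).norm
              (if1.norm.mul_const _)
            intro z
            simp only
            rw [norm_mul, Real.norm_of_nonneg (kap_prof.nonneg _)]
            exact mul_le_mul_of_nonneg_left (ker_le kap_prof ρ x z) (norm_nonneg _)
          refine iη.mul_bdd (c := _) ?_ (Eventually.of_forall B)
          have cav : Continuous (av kap ρ f1) := by
            unfold av
            refine continuous_const.mul ?_
            apply continuous_of_dominated (bound := fun z => ‖f1 z‖ * kap 0)
            · intro x
              exact if1.aestronglyMeasurable.mul (ker_cont kap_prof ρ x).aestronglyMeasurable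
            · intro x
              filter_upwards with z
              rw [norm_mul, Real.norm_of_nonneg (kap_prof.nonneg _)]
              exact mul_le_mul_of_nonneg_left (ker_le kap_prof ρ x z) (norm_nonneg _)
            · exact if1.norm.mul_const _
            · filter_upwards with z
              have := kap_prof.smooth.continuous
              fun_prop
          exact cav.aestronglyMeasurable
        · exact i1.const_mul _
      rw [d1, av_swap iη if1, ← integral_const_mul, ← integral_sub avη (i1.const_mul _)]
      congr 1; funext x; ring
    rw [c2] at c1
    have c3 : ∫ z, f1 z * (av kap ρ η z - Zk N * η z) ≤
        ∫ z, (ρ ^ 2 / 2 * Zc N (mpr kap)) * (f1 z * lap η z + ε * |f1 z|) := by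
      have i1 := bdd hs.continuous hc
      apply integral_mono
      · have := avη.sub (i1.const_mul (Zk N))
        refine this.congr (Eventually.of_forall fun z => ?_)
        simp only [Pi.sub_apply]; ring
      · exact ((bdd (lap_contDiff hs).continuous (lap_supp hc)).add
          (if1.abs.const_mul _)).const_mul _
      · intro z
        have b := a4 z
        have : f1 z * (av kap ρ η z - Zk N * η z - ρ ^ 2 / 2 * (Zc N (mpr kap) * lap η z))
          ≤ |f1 z| * (ρ ^ 2 / 2 * (Zc N (mpr kap) * ε)) := by
          refine (le_abs_self _).trans ?_
          rw [abs_mul]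
          gcongr
        simp only
        linarith
    rw [integral_const_mul, integral_add (bdd (lap_contDiff hs).continuous (lap_supp hc))
      (if1.abs.const_mul _), integral_const_mul] at c3
    have := c1.trans c3
    exact nonneg_of_mul_nonneg_right this (by positivity)
  by_contra hneg
  push Not at hneg
  have I0 : 0 ≤ ∫ z, |f1 z| := integral_nonneg fun z => abs_nonneg _
  have := key (-(∫ z, f1 z * lap η z) / (2 * ((∫ z, |f1 z|) + 1))) (by
    apply div_pos <;> linarith)
  set A := ∫ z, f1 z * lap η z
  set B := ∫ z, |f1 z|
  have h5 : -A / (2 * (B + 1)) * B ≤ -A / 2 := by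
    rw [div_mul_eq_mul_div, div_le_div_iff₀ (by positivity) (by positivity)]
    nlinarith
  linarith

end Part5

/-! ### Part 6 : combinations of supersolutions, extension by zero, maximum principle -/

section Part6

variable {N : ℕ}

/-- admissible potentials: measurable, nonnegative, locally bounded -/
structure Vok (U : Set (ES N)) (V : ES N → ℝ) : Prop where
  meas : Measurable V
  nn : ∀ z ∈ U, 0 ≤ V z
  bdd : ∀ C ⊆ U, IsCompact C → ∃ B, ∀ z ∈ C, V z ≤ B

lemma Vok.mono {U U' : Set (ES N)} {V : ES N → ℝ} (h : Vok U' V) (hU : U ⊆ U') : Vok U V :=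
  ⟨h.meas, fun z hz => h.nn z (hU hz), fun C hC => h.bdd C (hC.trans hU)⟩

lemma Vok_zero (U : Set (ES N)) : Vok U (fun _ => 0) :=
  ⟨measurable_const, fun _ _ => le_rfl, fun _ _ _ => ⟨0, fun _ _ => le_rfl⟩⟩

lemma IsTestFun.hcs {U : Set (ES N)} {φ : ES N → ℝ} (h : IsTestFun U φ) : HasCompactSupport φ :=
  h.2.1

/-- integrability of products supported in a compact set -/
lemma int_of_supp {C : Set (ES N)} (hC : IsCompact C) {w g : ES N → ℝ} (hw : IntegrableOn w C)
    (hg : Continuous g) (hs : ∀ z ∉ C, g z = 0) : Integrable fun z => w z * g z := by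
  obtain ⟨B, hB⟩ := (hC.image hg).isBounded.exists_norm_le
  have h1 : Integrable (fun z => C.indicator w z * g z) := by
    refine Integrable.mul_bdd (c := max B 0) ((integrable_indicator_iff hC.measurableSet).2 hw)
      hg.aestronglyMeasurable (Eventually.of_forall fun z => ?_)
    by_cases hz : z ∈ C
    · exact (hB _ ⟨z, hz, rfl⟩).trans (le_max_left _ _)
    · rw [hs z hz]; simp
  refine h1.congr (Eventually.of_forall fun z => ?_)
  by_cases hz : z ∈ C
  · simp [indicator_of_mem hz]
  · simp [hs z hz]

lemma test_int_lap {U : Set (ES N)} {φ w : ES N → ℝ} (h : IsTestFun U φ)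
    (hw : LocallyIntegrableOn w U) : Integrable fun z => w z * lap φ z :=
  int_of_supp h.2.1 (hw.integrableOn_compact_subset h.2.2 h.2.1) (lap_contDiff h.1).continuous
    (fun z hz => lap_off hz)

lemma Vok.intOn {U : Set (ES N)} {V w : ES N → ℝ} (hV : Vok U V) {C : Set (ES N)}
    (hC : IsCompact C) (hCU : C ⊆ U) (hw : IntegrableOn w C) :
    IntegrableOn (fun z => V z * w z) C := by
  obtain ⟨B, hB⟩ := hV.bdd C hCU hC
  refine Integrable.bdd_mul (c := B) hw hV.meas.aestronglyMeasurable ?_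
  rw [ae_restrict_iff' hC.measurableSet]
  refine Eventually.of_forall fun z hz => ?_
  rw [Real.norm_of_nonneg (hV.nn z (hCU hz))]
  exact hB z hz

lemma test_intV {U : Set (ES N)} {V φ w : ES N → ℝ} (hV : Vok U V) (h : IsTestFun U φ)
    (hw : LocallyIntegrableOn w U) : Integrable fun z => V z * w z * φ z :=
  int_of_supp h.2.1 (hV.intOn h.2.1 h.2.2 (hw.integrableOn_compact_subset h.2.2 h.2.1))
    h.1.continuous (fun z hz => image_eq_zero_of_notMem_tsupport hz)

lemma contLI {U : Set (ES N)} (hU : IsOpen U) {w : ES N → ℝ} (hw : ContinuousOn w U) :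
    LocallyIntegrableOn w U := hw.locallyIntegrableOn hU.measurableSet

lemma test_lap_integral {U : Set (ES N)} {φ : ES N → ℝ} (h : IsTestFun U φ) :
    ∫ z, lap φ z = 0 := by
  have h1 : ContDiff ℝ (⊤ : ℕ∞) (fun _ : ES N => (1:ℝ)) := contDiff_const
  have h2 := lap_symm h1 h.1 h.hcs
  have h3 : ∀ z, lap (fun _ : ES N => (1:ℝ)) z = 0 := fun z => lap_const 1 z
  simp only [h3, one_mul, zero_mul, integral_zero] at h2
  exact h2.symm ▸ rfl

lemma int_comb {f g h : ES N → ℝ} (hf : Integrable f) (hg : Integrable g) (hh : Integrable h)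
    (a b c : ℝ) : Integrable (fun z => a * f z - b * g z + c * h z) ∧
    ∫ z, (a * f z - b * g z + c * h z) = a * (∫ z, f z) - b * (∫ z, g z) + c * ∫ z, h z := by
  have i1 : Integrable (fun z => a * f z - b * g z) := (hf.const_mul a).sub (hg.const_mul b)
  refine ⟨i1.add (hh.const_mul c), ?_⟩
  rw [integral_add i1 (hh.const_mul c), integral_sub (hf.const_mul a) (hg.const_mul b),
    integral_const_mul, integral_const_mul, integral_const_mul]

lemma contOn_of_neg {u : ES N → ℝ} {U : Set (ES N)} (h : ContinuousOn (fun z => - u z) U) :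
    ContinuousOn u U := by
  have h2 : ContinuousOn (fun z => - (- u z)) U := ContinuousOn.neg h
  simpa only [neg_neg] using h2

/-- linear combinations of sub- and supersolutions -/
lemma Sup.combo {U : Set (ES N)} (hU : IsOpen U) {V1 V2 u v : ES N → ℝ}
    (hV1 : Vok U V1) (hV2 : Vok U V2) (h12 : ∀ z ∈ U, V2 z ≤ V1 z)
    (hu : Sup U V1 (fun z => - u z)) (hu0 : ∀ z ∈ U, 0 ≤ u z) (hv : Sup U V2 v)
    {C c b : ℝ} (hC : 0 ≤ C) (hc : 0 ≤ c) (hb : 0 ≤ b) :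
    Sup U V2 (fun z => C * v z - c * u z + b) := by
  have cu : ContinuousOn u U := contOn_of_neg hu.1
  refine ⟨((continuousOn_const.mul hv.1).sub (continuousOn_const.mul cu)).add continuousOn_const,
    fun φ hφ h0 => ?_⟩
  have lv := contLI hU hv.1
  have lu := contLI hU cu
  have l1 : LocallyIntegrableOn (fun _ : ES N => (1:ℝ)) U := contLI hU continuousOn_const
  have I1 := hv.2 φ hφ h0
  have I2 := hu.2 φ hφ h0
  simp only [neg_mul, mul_neg, integral_neg, neg_le_neg_iff] at I2
  have iL1 := test_int_lap hφ lv
  have iL2 := test_int_lap hφ lu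
  have iL3 := test_int_lap hφ l1
  have iV1 := test_intV hV2 hφ lv
  have iV2 := test_intV hV2 hφ lu
  have iV3 := test_intV hV2 hφ l1
  have iV4 := test_intV hV1 hφ lu
  have e1 : ∫ z, (C * v z - c * u z + b) * lap φ z
      = C * (∫ z, v z * lap φ z) - c * (∫ z, u z * lap φ z) := by
    have : ∀ z, (C * v z - c * u z + b) * lap φ z =
      (C * (v z * lap φ z) - c * (u z * lap φ z)) + b * (1 * lap φ z) := fun z => by ring
    simp_rw [this]
    rw [(int_comb iL1 iL2 iL3 C c b).2]
    simp [test_lap_integral hφ]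
  have e2 : ∫ z, V2 z * (C * v z - c * u z + b) * φ z
      = C * (∫ z, V2 z * v z * φ z) - c * (∫ z, V2 z * u z * φ z)
        + b * ∫ z, V2 z * 1 * φ z := by
    have : ∀ z, V2 z * (C * v z - c * u z + b) * φ z =
      (C * (V2 z * v z * φ z) - c * (V2 z * u z * φ z)) + b * (V2 z * 1 * φ z) :=
      fun z => by ring
    simp_rw [this]
    rw [(int_comb iV1 iV2 iV3 C c b).2]
  have out : ∀ z, z ∉ U → φ z = 0 := fun z hz =>
    image_eq_zero_of_notMem_tsupport (fun h => hz (hφ.2.2 h))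
  have m1 : ∫ z, V2 z * u z * φ z ≤ ∫ z, V1 z * u z * φ z := by
    apply integral_mono iV2 iV4
    intro z
    by_cases hz : z ∈ U
    · have := h12 z hz
      have := hu0 z hz
      have := h0 z
      simp only
      gcongr
    · simp [out z hz]
  have m2 : 0 ≤ ∫ z, V2 z * 1 * φ z := by
    apply integral_nonneg
    intro z
    by_cases hz : z ∈ U
    · have := hV2.nn z hz
      have := h0 z
      simp only [Pi.zero_apply]; positivity
    · simp [out z hz]
  rw [e1, e2]
  have := mul_le_mul_of_nonneg_left I1 hC
  have := mul_le_mul_of_nonneg_left (m1.trans I2) hc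
  have := mul_nonneg hb m2
  linarith

lemma Sup.add_const {U : Set (ES N)} (hU : IsOpen U) {V w : ES N → ℝ}
    (hV : Vok U V) (hw : Sup U V w) {b : ℝ} (hb : 0 ≤ b) : Sup U V (fun z => w z + b) := by
  have h0 : Sup U V (fun z : ES N => - (fun _ => (0:ℝ)) z) :=
    ⟨by simpa using continuousOn_const, fun φ _ _ => by simp⟩
  have := Sup.combo hU hV hV (fun _ _ => le_rfl) h0 (fun _ _ => le_rfl) hw
    (C := 1) (c := 0) (b := b) zero_le_one le_rfl hb
  simpa using this

/-- weak limit: uniform limits -/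
lemma Sup.of_approx {B : Set (ES N)} {g : ES N → ℝ} (hBo : IsOpen B)
    (hg : ContinuousOn g B)
    (h : ∀ ε > 0, ∃ g' : ES N → ℝ, LocallyIntegrableOn g' B ∧ (∀ z ∈ B, |g z - g' z| ≤ ε) ∧
      ∀ φ, IsTestFun B φ → (∀ z, 0 ≤ φ z) → 0 ≤ ∫ z, g' z * lap φ z) :
    Sup B (fun _ => 0) (fun z => - g z) := by
  refine ⟨hg.neg, fun φ hφ h0 => ?_⟩
  simp only [zero_mul, integral_zero, neg_mul, integral_neg]
  have il : Integrable (lap φ) :=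
    (lap_contDiff hφ.1).continuous.integrable_of_hasCompactSupport (lap_supp hφ.hcs)
  have ig := test_int_lap hφ (contLI hBo hg)
  set I := ∫ z, |lap φ z| with hI
  have I0 : 0 ≤ I := integral_nonneg fun z => abs_nonneg _
  have key : ∀ ε > 0, - (ε * I) ≤ ∫ z, g z * lap φ z := by
    intro ε hε
    obtain ⟨g', l', hc, hs⟩ := h ε hε
    have ig' := test_int_lap hφ l'
    have h1 := hs φ hφ h0
    have h2 : ∫ z, (g' z * lap φ z - ε * |lap φ z|) ≤ ∫ z, g z * lap φ z := by
      apply integral_mono (ig'.sub (il.abs.const_mul _)) ig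
      intro z
      by_cases hz : z ∈ tsupport φ
      · have a1 := hc z (hφ.2.2 hz)
        have a2 : |(g z - g' z) * lap φ z| ≤ ε * |lap φ z| := by
          rw [abs_mul]; gcongr
        have a3 := neg_abs_le ((g z - g' z) * lap φ z)
        simp only [Pi.sub_apply]
        linarith
      · simp [lap_off hz]
    rw [integral_sub ig' (il.abs.const_mul _), integral_const_mul] at h2
    linarith
  by_contra hneg
  push Not at hneg
  have := key ((∫ z, -(g z * lap φ z)) / (2 * (I + 1))) (by
    rw [integral_neg]; apply div_pos <;> linarith)
  rw [integral_neg] at this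
  set A := ∫ z, g z * lap φ z
  have h5 : -A / (2 * (I + 1)) * I ≤ -A / 2 := by
    rw [div_mul_eq_mul_div, div_le_div_iff₀ (by positivity) (by positivity)]
    nlinarith
  linarith

/-- Extension by zero of the negative part of a supersolution. -/
theorem ext_sub {Ω B : Set (ES N)} (hΩ : IsOpen Ω) (hB : IsOpen B) {V w : ES N → ℝ}
    (hV : ∀ z ∈ Ω ∩ B, 0 ≤ V z) (h : Sup (Ω ∩ B) V w)
    (hb : ∀ z ∈ frontier Ω ∩ B, ∀ ε > 0, ∀ᶠ x in 𝓝[Ω] z, -ε < w x) :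
    Sup B (fun _ => 0) (fun z => - Ω.indicator (fun z => max (- w z) 0) z) := by
  have hUo : IsOpen (Ω ∩ B) := hΩ.inter hB
  -- general continuity
  have cont : ∀ ε ≥ 0, ContinuousOn (Ω.indicator (fun z => max (-(w z + ε)) 0)) B := by
    intro ε hε x hx
    apply ContinuousAt.continuousWithinAt
    by_cases hxΩ : x ∈ Ω
    · have : ContinuousAt (fun z => max (-(w z + ε)) 0) x := by
        have : ContinuousAt w x := h.1.continuousAt (hUo.mem_nhds ⟨hxΩ, hx⟩)
        fun_prop
      refine this.congr ?_
      filter_upwards [hΩ.mem_nhds hxΩ] with z hz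
      rw [indicator_of_mem hz]
    · by_cases hxc : x ∈ closure Ω
      · have hxf : x ∈ frontier Ω := ⟨hxc, by rwa [hΩ.interior_eq]⟩
        rw [Metric.continuousAt_iff']
        intro η hη
        have := hb x ⟨hxf, hx⟩ η hη
        rw [eventually_nhdsWithin_iff] at this
        filter_upwards [this] with z hz
        rw [indicator_of_notMem hxΩ]
        by_cases hzΩ : z ∈ Ω
        · rw [indicator_of_mem hzΩ, Real.dist_eq, sub_zero, abs_of_nonneg (le_max_right _ _)]
          have := hz hzΩ
          exact max_lt (by linarith) hη
        · rw [indicator_of_notMem hzΩ]; simpa using hη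
      · have : ContinuousAt (fun _ : ES N => (0:ℝ)) x := continuousAt_const
        refine this.congr ?_
        filter_upwards [isClosed_closure.isOpen_compl.mem_nhds hxc] with z hz
        rw [indicator_of_notMem (fun hz' => hz (subset_closure hz'))]
  have c0 : ContinuousOn (Ω.indicator (fun z => max (- w z) 0)) B := by
    have := cont 0 le_rfl
    simpa using this
  refine Sup.of_approx hB c0 fun ε hε => ?_
  refine ⟨Ω.indicator (fun z => max (-(w z + ε)) 0), contLI hB (cont ε hε.le), ?_, ?_⟩
  · intro z _
    by_cases hzΩ : z ∈ Ω
    · rw [indicator_of_mem hzΩ, indicator_of_mem hzΩ]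
      refine (abs_max_sub_max_le_abs _ _ _).trans ?_
      rw [show -w z - -(w z + ε) = ε by ring, abs_of_pos hε]
    · rw [indicator_of_notMem hzΩ, indicator_of_notMem hzΩ]; simpa using hε.le
  intro φ hφ h0
  apply subharm_of_submean hB (contLI hB (cont ε hε.le)) _ hφ h0
  intro C hCB hC
  set g := Ω.indicator (fun z => max (-(w z + ε)) 0) with hg
  -- the compact set where w ≤ -ε
  set g0 := Ω.indicator (fun z => max (- w z) 0) with hg0
  set C' := {x ∈ C | ε ≤ g0 x} with hC'
  have hC'c : IsCompact C' := by
    apply hC.of_isClosed_subset _ (fun x hx => hx.1)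
    have := (c0.mono hCB).preimage_isClosed_of_isClosed hC.isClosed (isClosed_Ici (a := ε))
    exact this
  have hC'U : C' ⊆ Ω ∩ B := by
    intro x hx
    refine ⟨?_, hCB hx.1⟩
    by_contra hxΩ
    have := hx.2
    rw [hg0, indicator_of_notMem hxΩ] at this
    linarith
  obtain ⟨δ, hδ, hδU⟩ := hC'c.exists_cthickening_subset_open hUo hC'U
  have uc : UniformContinuousOn w (cthickening δ C') :=
    hC'c.cthickening.uniformContinuousOn_of_continuous (h.1.mono hδU)
  rw [Metric.uniformContinuousOn_iff] at uc
  obtain ⟨δ', hδ', huc⟩ := uc ε hε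
  refine ⟨min δ δ', lt_min hδ hδ', fun ρ hρ hρm x hx => ?_⟩
  obtain ⟨q1, q2⟩ := lt_min_iff.1 hρm
  have gnn : ∀ z, 0 ≤ g z := fun z => indicator_nonneg (fun _ _ => le_max_right _ _) z
  by_cases hxC : x ∈ C'
  · have sub1 : closedBall x ρ ⊆ cthickening δ C' :=
      (closedBall_subset_closedBall q1.le).trans (closedBall_subset_cthickening hxC δ)
    have sub2 : closedBall x ρ ⊆ Ω ∩ B := sub1.trans hδU
    have hxΩ : x ∈ Ω := (hC'U hxC).1
    have wx : w x ≤ - ε := by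
      have := hxC.2
      rw [hg0, indicator_of_mem hxΩ] at this
      rcases le_max_iff.1 this with h | h <;> linarith
    have wneg : ∀ z ∈ closedBall x ρ, w z ≤ 0 := by
      intro z hz
      have := huc z (sub1 hz) x (sub1 (mem_closedBall_self hρ.le))
        (lt_of_le_of_lt (mem_closedBall.1 hz) q2)
      rw [Real.dist_eq, abs_lt] at this
      linarith
    have h1 := Sup.submean kap_prof (u := fun z => - w z) (V := V) (U := Ω ∩ B)
      (by simpa using h) hρ sub2 (fun z hz => hV z (sub2 hz)) (fun z hz => by
        have := wneg z hz; simp; linarith)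
    have iw := h.integrableOn sub2
    have gx : g x = - (w x) - ε := by
      rw [hg, indicator_of_mem hxΩ, max_eq_left (by linarith)]; ring
    have h2 : av kap ρ (fun z => - w z) x ≤ av kap ρ (fun z => g z + ε) x := by
      apply av_mono kap_prof hρ iw.neg
      · apply Integrable.add
        · exact ((cont ε hε.le).mono (fun z hz => (sub2 hz).2)).integrableOn_compact
            (isCompact_closedBall _ _)
        · exact integrableOn_const (isCompact_closedBall x ρ).measure_lt_top.ne
      · intro z hz
        have hzΩ := (sub2 (ball_subset_closedBall hz)).1
        simp only [hg, indicator_of_mem hzΩ, Pi.neg_apply]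
        linarith [le_max_left (-(w z + ε)) 0]
    have h3 : av kap ρ (fun z => g z + ε) x = av kap ρ g x + ε * Zk N := by
      rw [av_add kap_prof hρ, av_const hρ, Zk]
      · exact ((cont ε hε.le).mono (fun z hz => (sub2 hz).2)).integrableOn_compact
            (isCompact_closedBall _ _)
      · exact integrableOn_const (isCompact_closedBall x ρ).measure_lt_top.ne
    rw [gx]
    rw [h3] at h2
    have h1' : Zk N * (- w x) ≤ av kap ρ (fun z => - w z) x := h1
    linarith
  · have : g x = 0 := by
      by_cases hxΩ : x ∈ Ω
      · have h1 : ¬ ε ≤ g0 x := fun h => hxC ⟨hx, h⟩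
        rw [hg0, indicator_of_mem hxΩ] at h1
        push Not at h1
        have := (max_lt_iff.1 h1).1
        rw [hg, indicator_of_mem hxΩ]
        exact max_eq_right (by linarith)
      · rw [hg, indicator_of_notMem hxΩ]
    rw [this, mul_zero]
    exact av_nonneg kap_prof hρ (fun z _ => gnn z)

/-- maximum principle -/
theorem max_princ (hN : 2 ≤ N) {D : Set (ES N)} (hD : IsOpen D) (hbd : Bornology.IsBounded D)
    {V w : ES N → ℝ} (hV : ∀ z ∈ D, 0 ≤ V z) (h : Sup D V w)
    (hb : ∀ z ∈ frontier D, ∀ ε > 0, ∀ᶠ x in 𝓝[D] z, -ε < w x) : ∀ x ∈ D, 0 ≤ w x := by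
  have h1 := ext_sub (Ω := D) (B := univ) hD isOpen_univ (V := V) (w := w)
    (by simpa using hV) (by simpa using h) (fun z hz => hb z hz.1)
  set g := D.indicator (fun z => max (- w z) 0) with hg
  have gnn : ∀ z, 0 ≤ g z := fun z => indicator_nonneg (fun _ _ => le_max_right _ _) z
  have gc : Continuous g := by
    exact continuousOn_univ.1 (contOn_of_neg h1.1)
  have gs : HasCompactSupport g := by
    apply HasCompactSupport.of_support_subset_isCompact hbd.isCompact_closure
    intro z hz
    by_contra hz'
    exact hz (indicator_of_notMem (fun h => hz' (subset_closure h)) _)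
  have gi : Integrable g := gc.integrable_of_hasCompactSupport gs
  intro x hx
  by_contra hneg
  push Not at hneg
  have gx : 0 < g x := by
    rw [hg, indicator_of_mem hx]; exact lt_max_of_lt_left (by linarith)
  have key : ∀ R : ℝ, 1 ≤ R → Zk N * g x * R ≤ (∫ z, g z) * kap 0 := by
    intro R hR
    have R0 : 0 < R := by linarith
    have a1 : Zk N * g x ≤ av kap R g x := Sup.submean kap_prof h1 R0 (subset_univ _)
      (fun _ _ => le_rfl) (fun z _ => gnn z)
    have a2 : av kap R g x ≤ R⁻¹ * ((∫ z, g z) * kap 0) := by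
      unfold av
      have b1 : ∫ z, g z * kap ((R ^ 2)⁻¹ * ‖z - x‖ ^ 2) ≤ (∫ z, g z) * kap 0 := by
        rw [← integral_mul_const]
        apply integral_mono (ker_mul_integrable kap_prof R0 gi.integrableOn) (gi.mul_const _)
        intro z
        exact mul_le_mul_of_nonneg_left (ker_le kap_prof R x z) (gnn z)
      have b0 : 0 ≤ ∫ z, g z * kap ((R ^ 2)⁻¹ * ‖z - x‖ ^ 2) :=
        integral_nonneg fun z => mul_nonneg (gnn z) (kap_prof.nonneg _)
      apply mul_le_mul _ b1 b0 (by positivity)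
      apply inv_anti₀ R0
      calc R = R ^ 1 := (pow_one R).symm
        _ ≤ R ^ N := pow_le_pow_right₀ hR (by omega)
    have a3 := a1.trans a2
    rw [inv_mul_eq_div, le_div_iff₀ R0] at a3
    exact a3
  have hZ := Zk_pos (N := N)
  have p : 0 < Zk N * g x := by positivity
  have := key (((∫ z, g z) * kap 0) / (Zk N * g x) + 1) (by
    have : 0 ≤ (∫ z, g z) * kap 0 := mul_nonneg (integral_nonneg gnn) (kap_prof.nonneg _)
    have := div_nonneg this p.le
    linarith)
  rw [mul_add, mul_div_cancel₀ _ p.ne'] at this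
  linarith

end Part6

/-! ### Part 7 : local graphs, Harnack chains, strips -/

section Part7

variable {N : ℕ}

/-- local graph data near the boundary point `z`; `d` is the vertical height. -/
structure LG (Ω : Set (ES N)) (e : ES N) (d : ES N → ℝ) (M : ℝ) (z : ES N) (R : ℝ) : Prop where
  e1 : ‖e‖ = 1
  M1 : 1 ≤ M
  lip : ∀ x y, |d x - d y| ≤ M * dist x y
  shift : ∀ x t, d (x + t • e) = d x + t
  dz : d z = 0
  Rpos : 0 < R
  mem : ∀ x ∈ ball z R, (x ∈ Ω ↔ 0 < d x)

/-- bound on the potential in terms of the height -/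
def VB (V d : ES N → ℝ) (A : ℝ) (z : ES N) (R : ℝ) : Prop :=
  ∀ x ∈ ball z R, 0 < d x → 0 ≤ V x ∧ V x * d x ^ 2 ≤ A

lemma VB.mono {V d : ES N → ℝ} {A : ℝ} {z z' : ES N} {R R' : ℝ} (h : VB V d A z R)
    (hs : ball z' R' ⊆ ball z R) : VB V d A z' R' := fun x hx => h x (hs hx)

lemma LG.recenter {Ω : Set (ES N)} {e : ES N} {d : ES N → ℝ} {M : ℝ} {z z' : ES N} {R R' : ℝ}
    (h : LG Ω e d M z R) (hz : d z' = 0) (hR : 0 < R') (hs : ball z' R' ⊆ ball z R) :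
    LG Ω e d M z' R' :=
  ⟨h.e1, h.M1, h.lip, h.shift, hz, hR, fun x hx => h.mem x (hs hx)⟩

lemma LG.cont {Ω : Set (ES N)} {e : ES N} {d : ES N → ℝ} {M : ℝ} {z : ES N} {R : ℝ}
    (h : LG Ω e d M z R) : Continuous d := by
  have : LipschitzWith (Real.toNNReal M) d := LipschitzWith.of_dist_le_mul fun x y => by
    rw [Real.dist_eq, Real.coe_toNNReal _ (by linarith [h.M1])]; exact h.lip x y
  exact this.continuous

lemma LG.le {Ω : Set (ES N)} {e : ES N} {d : ES N → ℝ} {M : ℝ} {z : ES N} {R : ℝ}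
    (h : LG Ω e d M z R) (x y : ES N) : d x - M * dist x y ≤ d y := by
  have := (abs_le.1 (h.lip x y)).2
  linarith

lemma LG.le_dist {Ω : Set (ES N)} {e : ES N} {d : ES N → ℝ} {M : ℝ} {z : ES N} {R : ℝ}
    (h : LG Ω e d M z R) (x : ES N) : d x ≤ M * dist x z := by
  have := h.le x z
  rw [h.dz] at this
  linarith

lemma LG.dist_shift {Ω : Set (ES N)} {e : ES N} {d : ES N → ℝ} {M : ℝ} {z : ES N} {R : ℝ}
    (h : LG Ω e d M z R) (x : ES N) (t : ℝ) : dist (x + t • e) x = |t| := by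
  rw [dist_eq_norm, add_sub_cancel_left, norm_smul, h.e1, mul_one, Real.norm_eq_abs]

/-- Harnack balls -/
lemma LG.hball {Ω : Set (ES N)} {e : ES N} {d : ES N → ℝ} {M : ℝ} {z : ES N} {R A : ℝ}
    {V : ES N → ℝ} (h : LG Ω e d M z R) (hV : VB V d A z R) {q : ES N} {η : ℝ}
    (hη : 0 < η) (hq : η ≤ d q) (hb : closedBall q (η / (2 * M)) ⊆ ball z R) :
    closedBall q (η / (2 * M)) ⊆ Ω ∩ ball z R ∧
      (∀ p ∈ closedBall q (η / (2 * M)), η / 2 ≤ d p) ∧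
      ∀ p ∈ closedBall q (η / (2 * M)), V p * (η / (2 * M)) ^ 2 ≤ A := by
  have M0 : 0 < M := by linarith [h.M1]
  have h1 : ∀ p ∈ closedBall q (η / (2 * M)), η / 2 ≤ d p := by
    intro p hp
    have := h.le q p
    rw [mem_closedBall, dist_comm, le_div_iff₀ (by positivity)] at hp
    nlinarith
  refine ⟨fun p hp => ⟨(h.mem p (hb hp)).2 (by linarith [h1 p hp]), hb hp⟩, h1, fun p hp => ?_⟩
  have h2 := h1 p hp
  obtain ⟨v0, v1⟩ := hV p (hb hp) (by linarith)
  refine le_trans (mul_le_mul_of_nonneg_left ?_ v0) v1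
  apply pow_le_pow_left₀ (by positivity)
  refine le_trans ?_ h2
  apply div_le_div_of_nonneg_left hη.le (by norm_num)
  linarith [h.M1]

/-- vertical chains -/
lemma LG.vert {Ω : Set (ES N)} {e : ES N} {d : ES N → ℝ} {M : ℝ} {z : ES N} {R A : ℝ}
    {V u : ES N → ℝ} (h : LG Ω e d M z R) (hA : 0 ≤ A) (hV : VB V d A z R)
    (hu : Sol (Ω ∩ ball z R) V u) {p : ES N} {η T : ℝ} (hη : 0 < η) (hp : η ≤ d p)
    (hT : 0 ≤ T) (hR : dist p z + T + η / (2 * M) < R) (n : ℕ)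
    (hn : T ≤ n * (η / (8 * M))) :
    u p ≤ cH N A ^ n * u (p + T • e) ∧ u (p + T • e) ≤ cH N A ^ n * u p := by
  have M0 : 0 < M := by linarith [h.M1]
  have key : ∀ q ∈ segment ℝ p (p + T • e), closedBall q (η / (2 * M)) ⊆ Ω ∩ ball z R ∧
      ∀ p ∈ closedBall q (η / (2 * M)), V p * (η / (2 * M)) ^ 2 ≤ A := by
    intro q hq
    rw [segment_eq_image'] at hq
    obtain ⟨θ, hθ, rfl⟩ := hq
    simp only [add_sub_cancel_left, smul_smul]
    have hθT : θ * T ≤ T := by nlinarith [hθ.2]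
    have hθ0 : 0 ≤ θ * T := mul_nonneg hθ.1 hT
    have := h.hball hV (q := p + (θ * T) • e) hη (by rw [h.shift]; linarith) (by
      intro x hx
      rw [mem_closedBall] at hx
      rw [mem_ball]
      have d1 := h.dist_shift p (θ * T)
      rw [abs_of_nonneg hθ0] at d1
      linarith [dist_triangle x (p + (θ * T) • e) z, dist_triangle (p + (θ * T) • e) p z])
    exact ⟨this.1, this.2.2⟩
  have hd : dist p (p + T • e) ≤ n * (η / (2 * M) / 4) := by
    rw [dist_comm, h.dist_shift, abs_of_nonneg hT]
    convert hn using 2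
    field_simp; norm_num
  constructor
  · refine hu.chain (R := η / (2 * M)) (by positivity) hA n _ _ (by rwa [dist_comm]) ?_
    rwa [segment_symm]
  · exact hu.chain (R := η / (2 * M)) (by positivity) hA n _ _ hd key

/-- constant for nontangential Harnack -/
def cNT (N : ℕ) (A M c : ℝ) : ℝ := cH N A ^ (3 * ⌈64 * M ^ 2 / c⌉₊)

lemma one_le_cNT {A M c : ℝ} (hA : 0 ≤ A) : 1 ≤ cNT N A M c := one_le_pow₀ (one_le_cH hA)

/-- nontangential Harnack inequality -/
lemma LG.nt {Ω : Set (ES N)} {e : ES N} {d : ES N → ℝ} {M : ℝ} {z : ES N} {R A : ℝ}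
    {V u : ES N → ℝ} (h : LG Ω e d M z R) (hA : 0 ≤ A) (hV : VB V d A z R)
    (hu : Sol (Ω ∩ ball z R) V u) {s c : ℝ} (hs : 0 < s) (hc : 0 < c) (hR : 16 * M * s ≤ R)
    {p p' : ES N} (hp : p ∈ ball z (4 * s)) (hp' : p' ∈ ball z (4 * s))
    (hd : c * s ≤ d p) (hd' : c * s ≤ d p') : u p' ≤ cNT N A M c * u p := by
  have M1 := h.M1
  have M0 : 0 < M := by linarith
  rw [mem_ball] at hp hp'
  set n := ⌈64 * M ^ 2 / c⌉₊ with hn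
  have hn1 : 64 * M ^ 2 / c ≤ n := Nat.le_ceil _
  have η0 : 0 < c * s := by positivity
  have hT : 8 * M * s ≤ n * (c * s / (8 * M)) := by
    rw [div_le_iff₀ hc] at hn1
    rw [← mul_div_assoc, le_div_iff₀ (by positivity)]
    nlinarith
  have ηs : c * s / (2 * M) < 2 * s := by
    rw [div_lt_iff₀ (by positivity)]
    have := h.le_dist p
    nlinarith
  have sMs : s ≤ M * s := by nlinarith
  have v1 := (h.vert hA hV hu η0 hd (T := 8 * M * s) (by positivity) (by linarith) n hT).2
  have v2 := (h.vert hA hV hu η0 hd' (T := 8 * M * s) (by positivity) (by linarith) n hT).1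
  have mid : u (p' + (8 * M * s) • e) ≤ cH N A ^ n * u (p + (8 * M * s) • e) := by
    refine hu.chain (R := c * s / (2 * M)) (by positivity) hA n _ _ ?_ ?_
    · rw [dist_add_right]
      have := dist_triangle_right p p' z
      have e : c * s / (2 * M) / 4 = c * s / (8 * M) := by field_simp; norm_num
      rw [e]; linarith
    · intro q hq
      rw [segment_eq_image'] at hq
      obtain ⟨θ, hθ, rfl⟩ := hq
      simp only [add_sub_add_right_eq_sub]
      have eq1 : p + (8 * M * s) • e + θ • (p' - p) = (p + θ • (p' - p)) + (8 * M * s) • e := by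
        abel
      rw [eq1]
      set q := p + θ • (p' - p) with hqd
      have hqb : q ∈ ball z (4 * s) := by
        have : q ∈ segment ℝ p p' := by rw [segment_eq_image']; exact ⟨θ, hθ, rfl⟩
        exact (convex_ball z (4 * s)).segment_subset (mem_ball.2 hp) (mem_ball.2 hp') this
      rw [mem_ball] at hqb
      have hpq : dist p q < 8 * s := by
        linarith [dist_triangle_right p q z]
      have dq : c * s ≤ d (q + (8 * M * s) • e) := by
        rw [h.shift]
        have := h.le p q
        nlinarith
      have := h.hball hV η0 dq (by
        intro x hx
        rw [mem_closedBall] at hx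
        rw [mem_ball]
        have d1 := h.dist_shift q (8 * M * s)
        rw [abs_of_nonneg (by positivity)] at d1
        linarith [dist_triangle x (q + (8 * M * s) • e) z,
          dist_triangle (q + (8 * M * s) • e) q z])
      exact ⟨this.1, this.2.2⟩
  have cc : 0 < cH N A ^ n := pow_pos (cH_pos A) n
  calc u p' ≤ cH N A ^ n * u (p' + (8 * M * s) • e) := v2
    _ ≤ cH N A ^ n * (cH N A ^ n * (cH N A ^ n * u p)) := by gcongr; exact mid.trans (by gcongr)
    _ = cNT N A M c * u p := by
      unfold cNT; rw [← hn, pow_mul']; ring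

/-- splitting of averages -/
lemma av_split {ρ c1 c2 θ : ℝ} (hρ : 0 < ρ) {x : ES N} {g : ES N → ℝ} {S : Set (ES N)}
    (hS : MeasurableSet S) (hg : IntegrableOn g (closedBall x ρ)) (h1 : 0 ≤ c1)
    (hle : ∀ z ∈ ball x ρ, g z ≤ S.indicator (fun _ => c1) z + c2)
    (hv : (volume : Measure (ES N)).real (S ∩ ball x ρ) ≤ θ * ρ ^ N) :
    av kap ρ g x ≤ c1 * (kap 0 * θ) + c2 * Zk N := by
  have iS : IntegrableOn (S.indicator (fun _ => c1)) (closedBall x ρ) :=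
    (integrableOn_const (isCompact_closedBall x ρ).measure_lt_top.ne).indicator hS
  have ic : IntegrableOn (fun _ : ES N => c2) (closedBall x ρ) :=
    integrableOn_const (isCompact_closedBall x ρ).measure_lt_top.ne
  have a1 := av_mono kap_prof hρ hg (iS.add ic) hle
  have a2 : av kap ρ (S.indicator (fun _ => c1) + fun _ => c2) x = _ :=
    av_add kap_prof hρ iS ic
  rw [a2, av_const hρ] at a1
  have a3 : av kap ρ (S.indicator (fun _ => c1)) x ≤ c1 * (kap 0 * θ) := by
    unfold av
    have b1 : ∫ z, S.indicator (fun _ => c1) z * kap ((ρ ^ 2)⁻¹ * ‖z - x‖ ^ 2) ≤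
        ∫ z, (S ∩ ball x ρ).indicator (fun _ => c1 * kap 0) z := by
      apply integral_mono (ker_mul_integrable kap_prof hρ iS)
      · rw [integrable_indicator_iff (hS.inter measurableSet_ball)]
        exact integrableOn_const (ne_top_of_le_ne_top measure_ball_lt_top.ne
          (measure_mono inter_subset_right))
      · intro z
        by_cases hz : z ∈ ball x ρ
        · by_cases hzS : z ∈ S
          · simp only
            rw [indicator_of_mem hzS, indicator_of_mem (show z ∈ S ∩ ball x ρ from ⟨hzS, hz⟩)]
            exact mul_le_mul_of_nonneg_left (ker_le kap_prof ρ x z) h1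
          · simp only
            rw [indicator_of_notMem hzS, indicator_of_notMem (fun h : z ∈ S ∩ ball x ρ => hzS h.1), zero_mul]
        · simp only
          rw [indicator_of_notMem (fun h : z ∈ S ∩ ball x ρ => hz h.2)]
          rw [mem_ball, dist_eq_norm, not_lt] at hz
          rw [ker_zero kap_prof hρ hz, mul_zero]
    rw [integral_indicator (hS.inter measurableSet_ball), setIntegral_const, smul_eq_mul] at b1
    have k0 := kap_prof.nonneg 0
    calc (ρ ^ N)⁻¹ * _ ≤ (ρ ^ N)⁻¹ * (θ * ρ ^ N * (c1 * kap 0)) := by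
          gcongr
          exact b1.trans (by gcongr)
      _ = _ := by field_simp
  unfold Zk
  linarith

/-- the strip has small measure -/
lemma LG.strip {Ω : Set (ES N)} {e : ES N} {d : ES N → ℝ} {M : ℝ} {z : ES N} {R : ℝ}
    (h : LG Ω e d M z R) {x : ES N} {ρ η : ℝ} (hρ : 0 < ρ) (hη : 0 < η) {n : ℕ} (hn : 0 < n)
    (hnη : n * η ≤ ρ) :
    (volume : Measure (ES N)).real ({p | 0 < d p ∧ d p < η} ∩ ball x ρ) ≤
      (2 ^ N * vb N / n) * ρ ^ N := by
  set S := {p | 0 < d p ∧ d p < η} ∩ ball x ρ with hS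
  have mS : MeasurableSet S := by
    apply MeasurableSet.inter _ measurableSet_ball
    exact ((isOpen_lt continuous_const h.cont).inter (isOpen_lt h.cont continuous_const)).measurableSet
  let T : ℕ → Set (ES N) := fun k => (fun p => p - ((k : ℝ) * η) • e) ⁻¹' S
  have vT : ∀ k, volume (T k) = volume S := fun k =>
    by simp only [T, sub_eq_add_neg]; exact measure_preimage_add_right volume _ S
  have mT : ∀ k, MeasurableSet (T k) := fun k => mS.preimage (measurable_id.sub_const _)
  have hdT : ∀ k, ∀ p ∈ T k, k * η < d p ∧ d p < (k + 1) * η := by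
    intro k p hp
    have h1 : 0 < d (p - ((k : ℝ) * η) • e) ∧ d (p - ((k : ℝ) * η) • e) < η := hp.1
    have h2 := h.shift (p - ((k : ℝ) * η) • e) (k * η)
    rw [sub_add_cancel] at h2
    constructor <;> linarith [h1.1, h1.2]
  have disj : Pairwise (Function.onFun Disjoint T) := by
    intro i j hij
    rw [Function.onFun, Set.disjoint_left]
    intro p hi hj
    have a := hdT i p hi
    have b := hdT j p hj
    rcases lt_or_gt_of_ne hij with h | h
    · have : (i:ℝ) + 1 ≤ j := by exact_mod_cast h
      nlinarith
    · have : (j:ℝ) + 1 ≤ i := by exact_mod_cast h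
      nlinarith
  have sub : (⋃ k ∈ Finset.range n, T k) ⊆ ball x (2 * ρ) := by
    intro p hp
    simp only [mem_iUnion, Finset.mem_range] at hp
    obtain ⟨k, hk, hp⟩ := hp
    have h1 : p - ((k : ℝ) * η) • e ∈ ball x ρ := hp.2
    rw [mem_ball, dist_eq_norm] at h1 ⊢
    have h2 : ‖((k : ℝ) * η) • e‖ ≤ ρ := by
      rw [norm_smul, h.e1, mul_one, Real.norm_of_nonneg (by positivity)]
      have : (k:ℝ) ≤ n := by exact_mod_cast hk.le
      nlinarith
    calc ‖p - x‖ = ‖(p - ((k : ℝ) * η) • e - x) + ((k : ℝ) * η) • e‖ := by congr 1; abel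
      _ ≤ _ := norm_add_le _ _
      _ < 2 * ρ := by linarith
  have m1 : (n : ℝ≥0∞) * volume S ≤ volume (ball x (2 * ρ)) := by
    calc (n : ℝ≥0∞) * volume S = ∑ k ∈ Finset.range n, volume (T k) := by
          simp [vT]
      _ = volume (⋃ k ∈ Finset.range n, T k) :=
          (measure_biUnion_finset (fun i _ j _ hij => disj hij) (fun k _ => mT k)).symm
      _ ≤ _ := measure_mono sub
  have m2 := ENNReal.toReal_mono measure_ball_lt_top.ne m1
  rw [ENNReal.toReal_mul, ENNReal.toReal_natCast] at m2
  have m3 := vol_ball x (r := 2 * ρ) (by positivity)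
  unfold Measure.real at m3 ⊢
  rw [m3] at m2
  have n0 : (0:ℝ) < n := by exact_mod_cast hn
  rw [div_mul_eq_mul_div, le_div_iff₀ n0]
  calc _ = (n:ℝ) * (volume S).toReal := by ring
    _ ≤ _ := m2
    _ = _ := by rw [mul_pow]; ring

/-- positive solution vanishing on the boundary near `z` -/
structure PS (Ω : Set (ES N)) (V u : ES N → ℝ) (z : ES N) (R : ℝ) : Prop where
  sol : Sol (Ω ∩ ball z R) V u
  van : ∀ p ∈ frontier Ω ∩ ball z R, Tendsto u (𝓝[Ω] p) (𝓝 0)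

/-- extension by zero is subharmonic -/
lemma PS.ext {Ω : Set (ES N)} {V u : ES N → ℝ} {z : ES N} {R : ℝ} (h : PS Ω V u z R)
    (hΩ : IsOpen Ω) : Sup (ball z R) (fun _ => 0) (fun x => - Ω.indicator u x) := by
  have := ext_sub (w := fun x => - u x) hΩ isOpen_ball h.sol.Vnn h.sol.sub (by
    intro p hp ε hε
    have := (h.van p hp).eventually_lt_const hε
    filter_upwards [this] with x hx
    linarith)
  simp only [neg_neg] at this
  refine ⟨this.1.congr fun x hx => ?_, fun φ hφ h0 => ?_⟩
  · congr 1
    by_cases hxΩ : x ∈ Ω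
    · rw [indicator_of_mem hxΩ, indicator_of_mem hxΩ, max_eq_left (h.sol.pos x ⟨hxΩ, hx⟩).le]
    · rw [indicator_of_notMem hxΩ, indicator_of_notMem hxΩ]
  · refine le_trans (le_of_eq ?_) ((this.2 φ hφ h0).trans (by simp))
    congr 1; funext x
    by_cases hx : x ∈ tsupport φ
    · congr 1
      simp only
      congr 1
      by_cases hxΩ : x ∈ Ω
      · rw [indicator_of_mem hxΩ, indicator_of_mem hxΩ,
          max_eq_left (h.sol.pos x ⟨hxΩ, hφ.2.2 hx⟩).le]
      · rw [indicator_of_notMem hxΩ, indicator_of_notMem hxΩ]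
    · rw [lap_off hx]; simp

end Part7

/-! ### Part 8 : Carleson estimate -/

section Part8

variable {N : ℕ}

/-- dyadic vertical chains -/
lemma LG.dyadic {Ω : Set (ES N)} {e : ES N} {d : ES N → ℝ} {M : ℝ} {z : ES N} {R A : ℝ}
    {V u : ES N → ℝ} (h : LG Ω e d M z R) (hA : 0 ≤ A) (hV : VB V d A z R)
    (hu : Sol (Ω ∩ ball z R) V u) {x : ES N} (hx : 0 < d x) (k : ℕ)
    (hR : dist x z + 2 ^ (k + 1) * d x < R) :
    u x ≤ (cH N A ^ ⌈8 * M⌉₊) ^ k * u (x + ((2 ^ k - 1) * d x) • e) := by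
  have M1 := h.M1
  have M0 : 0 < M := by linarith
  induction k with
  | zero => simp
  | succ k ih =>
    have p2 : (1:ℝ) ≤ 2 ^ k := one_le_pow₀ (by norm_num)
    have e1 : (2:ℝ) ^ (k + 1) = 2 * 2 ^ k := by ring
    have e2 : (2:ℝ) ^ (k + 1 + 1) = 4 * 2 ^ k := by ring
    rw [e2] at hR
    have i1 := ih (by rw [e1]; nlinarith)
    set p := x + ((2 ^ k - 1) * d x) • e with hp
    have dp : d p = 2 ^ k * d x := by rw [hp, h.shift]; ring
    have P : 0 < 2 ^ k * d x := by positivity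
    have hdist : dist p x = (2 ^ k - 1) * d x := by
      rw [hp, h.dist_shift, abs_of_nonneg]; nlinarith
    have hM2 : 2 ^ k * d x / (2 * M) ≤ 2 ^ k * d x := by
      rw [div_le_iff₀ (by positivity)]; nlinarith
    have := (h.vert hA hV hu P dp.ge P.le (by
      have := dist_triangle p x z
      nlinarith) ⌈8 * M⌉₊ (by
        have := Nat.le_ceil (8 * M)
        calc 2 ^ k * d x = (8 * M) * (2 ^ k * d x / (8 * M)) := by field_simp
          _ ≤ _ := by gcongr)).1
    have e3 : p + (2 ^ k * d x) • e = x + ((2 ^ (k + 1) - 1) * d x) • e := by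
      rw [hp, add_assoc, ← add_smul]; congr 2; ring
    rw [e3] at this
    have cc : 0 < (cH N A ^ ⌈8 * M⌉₊) ^ k := pow_pos (pow_pos (cH_pos A) _) k
    calc u x ≤ (cH N A ^ ⌈8 * M⌉₊) ^ k * u p := i1
      _ ≤ (cH N A ^ ⌈8 * M⌉₊) ^ k * (cH N A ^ ⌈8 * M⌉₊ * _) := by gcongr
      _ = _ := by rw [← mul_assoc, ← pow_succ]

/-- polynomial growth -/
lemma growth (N : ℕ) {A M : ℝ} (hA : 0 ≤ A) (hM : 1 ≤ M) : ∃ γ : ℕ, ∃ C ≥ (1:ℝ),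
    ∀ (Ω : Set (ES N)) (e : ES N) (d : ES N → ℝ) (z : ES N) (R : ℝ) (V u : ES N → ℝ) (s : ℝ),
    LG Ω e d M z R → VB V d A z R → Sol (Ω ∩ ball z R) V u → 0 < s → 16 * M * s ≤ R →
    ∀ x ∈ Ω ∩ ball z (2 * s), u x * d x ^ γ ≤ C * s ^ γ * u (z + s • e) := by
  obtain ⟨γ, hγ⟩ := pow_unbounded_of_one_lt (cH N A ^ ⌈8 * M⌉₊) (one_lt_two (α := ℝ))
  have M0 : 0 < M := by linarith
  refine ⟨γ, (2 * M) ^ γ * cNT N A M 1, ?_, ?_⟩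
  · exact one_le_mul_of_one_le_of_one_le (one_le_pow₀ (by linarith)) (one_le_cNT hA)
  intro Ω e d z R V u s h hV hu hs hR x hx
  have hxb := mem_ball.1 hx.2
  have sMs : s ≤ M * s := by nlinarith
  have dx : 0 < d x := (h.mem x (mem_ball.2 (by linarith))).1 hx.1
  have Ab : z + s • e ∈ ball z (4 * s) := by
    rw [mem_ball, h.dist_shift, abs_of_pos hs]; linarith
  have Ad : 1 * s ≤ d (z + s • e) := by rw [h.shift, h.dz]; linarith
  have Apos : 0 < u (z + s • e) := by
    have b : z + s • e ∈ ball z R := by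
      rw [mem_ball] at Ab ⊢; linarith
    exact hu.pos _ ⟨(h.mem _ b).2 (by linarith), b⟩
  rcases le_or_gt s (d x) with hsd | hsd
  · have h1 := h.nt hA hV hu hs one_pos hR Ab (mem_ball.2 (by linarith)) Ad (by linarith)
    have h2 : d x ≤ 2 * M * s := by
      have := h.le_dist x; nlinarith
    calc u x * d x ^ γ ≤ (cNT N A M 1 * u (z + s • e)) * (2 * M * s) ^ γ := by
          have := one_le_cNT (N := N) (M := M) (c := 1) hA
          gcongr
      _ = _ := by rw [mul_pow]; ring
  · obtain ⟨n, hn1, hn2⟩ := exists_nat_pow_near (x := s / d x) (y := 2)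
      (by rw [le_div_iff₀ dx]; linarith) one_lt_two
    rw [le_div_iff₀ dx] at hn1
    rw [div_lt_iff₀ dx] at hn2
    have e1 : (2:ℝ) ^ (n + 1) = 2 * 2 ^ n := by ring
    have h1 := h.dyadic hA hV hu dx (n + 1) (by
      rw [pow_succ, e1]; nlinarith)
    set x' := x + ((2 ^ (n + 1) - 1) * d x) • e with hx'
    have p2 : (1:ℝ) ≤ 2 ^ (n + 1) := one_le_pow₀ (by norm_num)
    have dx' : dist x' x = (2 ^ (n + 1) - 1) * d x := by
      rw [hx', h.dist_shift, abs_of_nonneg]; nlinarith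
    have h2 := h.nt hA hV hu hs one_pos hR Ab (p' := x') (by
        rw [mem_ball]
        have := dist_triangle x' x z
        rw [e1] at dx'
        nlinarith) Ad (by rw [hx', h.shift]; nlinarith)
    have h3 : (cH N A ^ ⌈8 * M⌉₊) ^ (n + 1) * d x ^ γ ≤ (2 * s) ^ γ := by
      calc (cH N A ^ ⌈8 * M⌉₊) ^ (n + 1) * d x ^ γ ≤ (2 ^ γ) ^ (n + 1) * d x ^ γ := by
            have := cH_pos (N := N) A
            gcongr
        _ = (2 ^ (n + 1) * d x) ^ γ := by rw [mul_pow, ← pow_mul, ← pow_mul]; ring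
        _ ≤ (2 * s) ^ γ := by
            apply pow_le_pow_left₀ (by positivity)
            rw [e1]; linarith
    have cn := one_le_cNT (N := N) (M := M) (c := 1) hA
    have ch := cH_pos (N := N) A
    calc u x * d x ^ γ ≤ ((cH N A ^ ⌈8 * M⌉₊) ^ (n + 1) * (cNT N A M 1 * u (z + s • e))) * d x ^ γ := by
          gcongr
          exact h1.trans (by gcongr)
      _ = ((cH N A ^ ⌈8 * M⌉₊) ^ (n + 1) * d x ^ γ) * (cNT N A M 1 * u (z + s • e)) := by ring
      _ ≤ (2 * s) ^ γ * (cNT N A M 1 * u (z + s • e)) := by gcongr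
      _ ≤ (2 * M * s) ^ γ * (cNT N A M 1 * u (z + s • e)) := by
          gcongr; linarith
      _ = _ := by rw [mul_pow]; ring

/-- Carleson estimate -/
theorem carleson (N : ℕ) {A M : ℝ} (hA : 0 ≤ A) (hM : 1 ≤ M) : ∃ C ≥ (1:ℝ),
    ∀ (Ω : Set (ES N)) (e : ES N) (d : ES N → ℝ) (z : ES N) (R : ℝ) (V u : ES N → ℝ) (s : ℝ),
    IsOpen Ω → LG Ω e d M z R → VB V d A z R → PS Ω V u z R → 0 < s → 16 * M * s ≤ R →
    ∀ x ∈ Ω ∩ ball z s, u x ≤ C * u (z + s • e) := by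
  obtain ⟨γ, C0, hC0, hgr⟩ := growth N hA hM
  have M0 : 0 < M := by linarith
  have Zp := Zk_pos (N := N)
  have vp := vb_pos (N := N)
  have k0 : 0 < kap 0 := kap_pos (by norm_num)
  obtain ⟨n, hn⟩ := exists_nat_gt (2 * (kap 0 * (2 ^ N * vb N)) * 2 ^ γ / Zk N)
  have n0 : (0:ℝ) < n := lt_of_le_of_lt (by positivity) hn
  have n0' : 0 < n := by exact_mod_cast n0
  refine ⟨2 * C0 * (2 * n) ^ γ, ?_, ?_⟩
  · have : (1:ℝ) ≤ (2 * n) ^ γ := one_le_pow₀ (by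
      have : (1:ℝ) ≤ n := by exact_mod_cast n0'
      linarith)
    nlinarith
  intro Ω e d z R V u s hΩ h hV hu hs hR x hx
  set g := Ω.indicator u with hg
  have hext := hu.ext hΩ
  have sMs : s ≤ M * s := by nlinarith
  have b2 : closedBall z (2 * s) ⊆ ball z R := closedBall_subset_ball (by linarith)
  have gc : ContinuousOn g (closedBall z (2 * s)) := (contOn_of_neg hext.1).mono b2
  have gnn : ∀ p ∈ ball z R, 0 ≤ g p := by
    intro p hp
    by_cases hpΩ : p ∈ Ω
    · rw [hg, indicator_of_mem hpΩ]; exact (hu.sol.pos p ⟨hpΩ, hp⟩).le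
    · rw [hg, indicator_of_notMem hpΩ]
  -- maximum of g * D^γ
  set F : ES N → ℝ := fun p => g p * (2 * s - dist p z) ^ γ with hF
  have Fc : ContinuousOn F (closedBall z (2 * s)) := gc.mul (by fun_prop)
  obtain ⟨p, hp, hmax⟩ := (isCompact_closedBall z (2 * s)).exists_isMaxOn
    ⟨z, mem_closedBall_self (by linarith)⟩ Fc
  have Apos : 0 < u (z + s • e) := by
    have b : z + s • e ∈ ball z R := by
      rw [mem_ball, h.dist_shift, abs_of_pos hs]; linarith
    exact hu.sol.pos _ ⟨(h.mem _ b).2 (by rw [h.shift, h.dz]; linarith), b⟩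
  have hxb := mem_ball.1 hx.2
  have gx : g x = u x := by rw [hg, indicator_of_mem hx.1]
  have ux : 0 < u x := hu.sol.pos x ⟨hx.1, mem_ball.2 (by linarith)⟩
  have hFx : F x ≤ F p := hmax (mem_closedBall.2 (by linarith))
  have hFx2 : u x * s ^ γ ≤ F x := by
    simp only [hF]
    rw [gx]
    gcongr
    linarith
  suffices hs2 : F p ≤ 2 * C0 * (2 * n) ^ γ * u (z + s • e) * s ^ γ by
    have : u x * s ^ γ ≤ (2 * C0 * (2 * n) ^ γ * u (z + s • e)) * s ^ γ :=
      hFx2.trans (hFx.trans hs2)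
    exact le_of_mul_le_mul_right this (by positivity)
  set D := 2 * s - dist p z with hD
  have D0 : 0 ≤ D := by rw [hD]; linarith [mem_closedBall.1 hp]
  rcases D0.eq_or_lt with hD0 | Dpos
  · rcases Nat.eq_zero_or_pos γ with hγ | hγ
    · -- γ = 0
      have hFp : F p = g p := by simp [hF, hγ]
      rw [hFp]
      by_cases hpΩ : p ∈ Ω
      · -- use continuity : closure argument through the growth bound
        have hcl : p ∈ closure (ball z (2 * s) ∩ Ω) := by
          have : p ∈ closure (ball z (2 * s)) := by
            rw [closure_ball z (by positivity)]; exact hp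
          rw [inter_comm]
          exact hΩ.inter_closure ⟨hpΩ, this⟩
        have hbd : ∀ q ∈ ball z (2 * s) ∩ Ω, g q ≤ C0 * u (z + s • e) := by
          intro q hq
          have := hgr Ω e d z R V u s h hV hu.sol hs hR q ⟨hq.2, hq.1⟩
          rw [hγ] at this
          rw [hg, indicator_of_mem hq.2]
          simpa using this
        have cp : ContinuousWithinAt g (ball z (2 * s) ∩ Ω) p :=
          (gc p hp).mono (fun q hq => ball_subset_closedBall hq.1)
        have := ContinuousWithinAt.closure_le hcl cp continuousWithinAt_const hbd
        rw [hγ]; simp only [pow_zero, mul_one]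
        nlinarith
      · rw [hg, indicator_of_notMem hpΩ]; positivity
    · have : F p = 0 := by
        simp only [hF]
        rw [← hD, ← hD0, zero_pow hγ.ne', mul_zero]
      rw [this]; positivity
  · set ρ := D / 2 with hρ
    have ρ0 : 0 < ρ := by positivity
    have sub : closedBall p ρ ⊆ ball z (2 * s) := by
      intro q hq
      rw [mem_closedBall] at hq
      rw [mem_ball]
      linarith [dist_triangle q p z]
    have subR : closedBall p ρ ⊆ ball z R := (sub.trans ball_subset_closedBall).trans b2
    have up : ∀ q ∈ ball p ρ, g q ≤ 2 ^ γ * g p := by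
      intro q hq
      have hq2 := sub (ball_subset_closedBall hq)
      have h1 : F q ≤ F p := hmax (ball_subset_closedBall hq2)
      have h2 : D / 2 ≤ 2 * s - dist q z := by
        rw [mem_ball] at hq
        linarith [dist_triangle q p z]
      have g0 := gnn q (subR (ball_subset_closedBall hq))
      have h3 : g q * (D / 2) ^ γ ≤ g p * D ^ γ := by
        refine le_trans ?_ h1
        simp only [hF]
        gcongr
      rw [div_pow, ← mul_div_assoc, div_le_iff₀ (by positivity)] at h3
      have : g q * D ^ γ ≤ (2 ^ γ * g p) * D ^ γ := by linarith
      exact le_of_mul_le_mul_right this (by positivity)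
    set η := ρ / n with hη
    have η0 : 0 < η := by positivity
    set S := {q | 0 < d q ∧ d q < η} with hS
    have mS : MeasurableSet S :=
      ((isOpen_lt continuous_const h.cont).inter (isOpen_lt h.cont continuous_const)).measurableSet
    set c2 := C0 * (s / η) ^ γ * u (z + s • e) with hc2
    have c20 : 0 ≤ c2 := by positivity
    have gp := gnn p (subR (mem_closedBall_self ρ0.le))
    have hle : ∀ q ∈ ball p ρ, g q ≤ S.indicator (fun _ => 2 ^ γ * g p) q + c2 := by
      intro q hq
      have hqR := subR (ball_subset_closedBall hq)
      by_cases hqS : q ∈ S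
      · rw [indicator_of_mem hqS]
        linarith [up q hq]
      · rw [indicator_of_notMem hqS, zero_add]
        by_cases hqΩ : q ∈ Ω
        · have dq := (h.mem q hqR).1 hqΩ
          have dq2 : η ≤ d q := by
            by_contra hlt
            exact hqS ⟨dq, not_le.1 hlt⟩
          have h1 := hgr Ω e d z R V u s h hV hu.sol hs hR q
            ⟨hqΩ, sub (ball_subset_closedBall hq)⟩
          rw [hg, indicator_of_mem hqΩ, hc2, div_pow]
          have uq : 0 < u q := hu.sol.pos q ⟨hqΩ, hqR⟩
          have h2 : u q * η ^ γ ≤ C0 * s ^ γ * u (z + s • e) := by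
            refine le_trans ?_ h1
            gcongr
          rw [← le_div_iff₀ (by positivity)] at h2
          refine h2.trans (le_of_eq ?_)
          ring
        · rw [hg, indicator_of_notMem hqΩ]; exact c20
    have gi : IntegrableOn g (closedBall p ρ) :=
      (gc.mono (sub.trans ball_subset_closedBall)).integrableOn_compact (isCompact_closedBall _ _)
    have sm : Zk N * g p ≤ av kap ρ g p :=
      Sup.submean kap_prof hext ρ0 subR (fun _ _ => le_rfl) (fun q hq => gnn q (subR hq))
    have sp := av_split ρ0 mS gi (by positivity) hle
      (h.strip ρ0 η0 n0' (by rw [hη]; field_simp; exact le_rfl))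
    have half : 2 ^ γ * g p * (kap 0 * (2 ^ N * vb N / n)) ≤ Zk N * g p / 2 := by
      rw [div_lt_iff₀ Zp] at hn
      have : 2 ^ γ * (kap 0 * (2 ^ N * vb N / n)) ≤ Zk N / 2 := by
        rw [← mul_div_assoc, ← mul_div_assoc, div_le_div_iff₀ n0 (by norm_num)]
        linarith
      calc _ = (2 ^ γ * (kap 0 * (2 ^ N * vb N / n))) * g p := by ring
        _ ≤ Zk N / 2 * g p := by gcongr
        _ = _ := by ring
    have fin : g p ≤ 2 * c2 := by
      have : Zk N * g p ≤ Zk N * (2 * c2) := by nlinarith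
      exact le_of_mul_le_mul_left this Zp
    have e1 : (s / η) ^ γ * D ^ γ = (2 * n) ^ γ * s ^ γ := by
      rw [← mul_pow, ← mul_pow]
      congr 1
      rw [hη, hρ]; field_simp
    calc F p = g p * D ^ γ := rfl
      _ ≤ 2 * c2 * D ^ γ := by gcongr
      _ = 2 * C0 * u (z + s • e) * ((s / η) ^ γ * D ^ γ) := by rw [hc2]; ring
      _ = _ := by rw [e1]; ring

end Part8

/-! ### Part 9 : boundary Harnack principle -/

section Part9

variable {N : ℕ}

def cA (N : ℕ) (A M : ℝ) : ℝ :=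
  (kap (1 / 4) * vb N * (1 / (8 * M)) ^ N) / (Real.exp (A / 4) * Zk N)

lemma cA_pos {A M : ℝ} (hM : 1 ≤ M) : 0 < cA N A M := by
  have := Zk_pos (N := N)
  have := vb_pos (N := N)
  have := kap_pos (show (1/4:ℝ) < 1 by norm_num)
  unfold cA; positivity

lemma LG.stepA1 {Ω : Set (ES N)} {e : ES N} {d : ES N → ℝ} {M : ℝ} {z : ES N} {R A : ℝ}
    {V w : ES N → ℝ} (h : LG Ω e d M z R) (hA : 0 ≤ A) (hV : VB V d A z R)
    (hw : Sup (Ω ∩ ball z R) V w) {σ η m : ℝ} (hσ : σ ≤ R) (hη : 0 < η) (hm : 0 ≤ m)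
    (h0 : ∀ x ∈ Ω ∩ ball z σ, 0 ≤ w x) (h1 : ∀ x ∈ ball z σ, η ≤ d x → m ≤ w x) :
    ∀ x ∈ ball z (σ - η / (4 * M)), (1 - 1 / (32 * M)) * η ≤ d x → cA N A M * m ≤ w x := by
  intro x hx hdx
  have M1 := h.M1
  have M0 : 0 < M := by linarith
  set R' := η / (4 * M) with hR'
  have R0 : 0 < R' := by positivity
  have MR : M * R' = η / 4 := by rw [hR']; field_simp
  have hτ : (1 - 1 / (32 * M)) * η = η - R' / 8 := by rw [hR']; field_simp; ring
  have R4 : R' ≤ η / 4 := by nlinarith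
  rw [hτ] at hdx
  have hin : closedBall x R' ⊆ ball z σ := by
    intro p hp
    rw [mem_closedBall] at hp
    rw [mem_ball] at hx ⊢
    linarith [dist_triangle p x z]
  have hd : ∀ p ∈ closedBall x R', R' ≤ d p := by
    intro p hp
    rw [mem_closedBall, dist_comm] at hp
    have := h.le x p
    nlinarith
  have hU : closedBall x R' ⊆ Ω ∩ ball z R := fun p hp =>
    ⟨(h.mem p (ball_subset_ball hσ (hin hp))).2 (by linarith [hd p hp]),
      ball_subset_ball hσ (hin hp)⟩
  have key := hw.weakHarnack (x := x) (p := x + (R' / 4) • e) (R := R') (r := R' / (8 * M))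
    (L := A) (m := m) R0 (by positivity) hA hU ?_ (fun p hp => h0 p ⟨(hU hp).1, hin hp⟩) ?_ ?_ hm
  · have e1 : R' / (8 * M) / R' = 1 / (8 * M) := by field_simp
    rw [e1] at key
    refine le_trans (le_of_eq ?_) key
    unfold cA; ring
  · intro p hp
    have h2 := hd p hp
    obtain ⟨v0, v1⟩ := hV p (hU hp).2 (by linarith)
    refine le_trans (mul_le_mul_of_nonneg_left ?_ v0) v1
    gcongr
  · intro p hp
    rw [mem_ball] at hp
    have h2 := h.dist_shift x (R' / 4)
    rw [abs_of_pos (by positivity)] at h2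
    have h3 : R' / (8 * M) ≤ R' / 8 := by
      apply div_le_div_of_nonneg_left R0.le (by norm_num); linarith
    rw [mem_closedBall]
    linarith [dist_triangle p (x + (R' / 4) • e) x]
  · intro p hp
    rw [mem_ball] at hp
    have h2 := h.dist_shift x (R' / 4)
    rw [abs_of_pos (by positivity)] at h2
    have h3 : R' / (8 * M) ≤ R' / 8 := by
      apply div_le_div_of_nonneg_left R0.le (by norm_num); linarith
    refine h1 p (hin ?_) ?_
    · rw [mem_closedBall]
      linarith [dist_triangle p (x + (R' / 4) • e) x]
    · have h4 := h.le (x + (R' / 4) • e) p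
      rw [h.shift, dist_comm] at h4
      have h5 : M * (R' / (8 * M)) = R' / 8 := by field_simp
      nlinarith

lemma LG.stepA {Ω : Set (ES N)} {e : ES N} {d : ES N → ℝ} {M : ℝ} {z : ES N} {R A : ℝ}
    {V w : ES N → ℝ} (h : LG Ω e d M z R) (hA : 0 ≤ A) (hV : VB V d A z R)
    (hw : Sup (Ω ∩ ball z R) V w) {σ η m : ℝ} (hσ : σ ≤ R) (hη : 0 < η) (hm : 0 ≤ m)
    (h0 : ∀ x ∈ Ω ∩ ball z σ, 0 ≤ w x) (h1 : ∀ x ∈ ball z σ, η ≤ d x → m ≤ w x) (j : ℕ) :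
    ∀ x ∈ ball z (σ - j * (η / (4 * M))), (1 - 1 / (32 * M)) ^ j * η ≤ d x →
      cA N A M ^ j * m ≤ w x := by
  have M1 := h.M1
  have M0 : 0 < M := by linarith
  have t1 : 1 / (32 * M) ≤ 1 / 2 := by
    apply one_div_le_one_div_of_le (by norm_num); linarith
  have t0 : 0 < 1 / (32 * M) := by positivity
  induction j with
  | zero => simpa using h1
  | succ j ih =>
    intro x hx hdx
    have hp : (1 - 1 / (32 * M)) ^ j ≤ 1 := pow_le_one₀ (by linarith) (by linarith)
    have hp0 : 0 < (1 - 1 / (32 * M)) ^ j := pow_pos (by linarith) _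
    have E : 0 < η / (4 * M) := by positivity
    have := h.stepA1 hA hV hw (σ := σ - j * (η / (4 * M))) (η := (1 - 1 / (32 * M)) ^ j * η)
      (m := cA N A M ^ j * m) (by nlinarith [Nat.cast_nonneg (α := ℝ) j]) (by positivity)
      (mul_nonneg (pow_nonneg (cA_pos M1).le _) hm)
      (fun x hx => h0 x ⟨hx.1, ball_subset_ball (by nlinarith [Nat.cast_nonneg (α := ℝ) j]) hx.2⟩)
      ih x (ball_subset_ball ?_ hx) ?_
    · rw [pow_succ]; linarith
    · push_cast
      have : (1 - 1 / (32 * M)) ^ j * η / (4 * M) ≤ η / (4 * M) := by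
        rw [mul_div_assoc]; nlinarith
      linarith
    · rw [pow_succ] at hdx; linarith

lemma LG.stepB1 {Ω : Set (ES N)} {e : ES N} {d : ES N → ℝ} {M : ℝ} {z : ES N} {R : ℝ}
    {g : ES N → ℝ} (h : LG Ω e d M z R)
    (hg : Sup (ball z R) (fun _ => 0) (fun x => - g x)) {n : ℕ} (hn : 0 < n)
    (hn2 : kap 0 * (2 ^ N * vb N / n) ≤ Zk N / 2) {σ η β : ℝ} (hσ : σ ≤ R) (hη : 0 < η)
    (hβ : 0 ≤ β) (g0 : ∀ x, 0 ≤ g x) (h1 : ∀ x ∈ ball z σ, g x ≤ β)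
    (h2 : ∀ x ∈ ball z σ, g x ≠ 0 → 0 < d x ∧ d x < η) :
    ∀ x ∈ ball z (σ - n * η), g x ≤ β / 2 := by
  intro x hx
  have n0 : (0:ℝ) < n := by exact_mod_cast hn
  set ρ := n * η with hρ
  have ρ0 : 0 < ρ := by positivity
  have hin : closedBall x ρ ⊆ ball z σ := by
    intro p hp
    rw [mem_closedBall] at hp
    rw [mem_ball] at hx ⊢
    linarith [dist_triangle p x z]
  have hinR := hin.trans (ball_subset_ball hσ)
  have sm : Zk N * g x ≤ av kap ρ g x :=
    Sup.submean kap_prof hg ρ0 hinR (fun _ _ => le_rfl) (fun q _ => g0 q)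
  have mS : MeasurableSet {p | 0 < d p ∧ d p < η} :=
    ((isOpen_lt continuous_const h.cont).inter (isOpen_lt h.cont continuous_const)).measurableSet
  have sp := av_split (c1 := β) (c2 := 0) ρ0 mS
    (((contOn_of_neg hg.1).mono hinR).integrableOn_compact (isCompact_closedBall _ _)) hβ ?_
    (h.strip (x := x) ρ0 hη hn le_rfl)
  · have := Zk_pos (N := N)
    have h3 : β * (kap 0 * (2 ^ N * vb N / n)) ≤ β * (Zk N / 2) := by gcongr
    have : Zk N * g x ≤ Zk N * (β / 2) := by linarith
    exact le_of_mul_le_mul_left this (Zk_pos (N := N))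
  · intro q hq
    have hq' := hin (ball_subset_closedBall hq)
    by_cases hqS : q ∈ {p | 0 < d p ∧ d p < η}
    · rw [indicator_of_mem hqS, add_zero]; exact h1 q hq'
    · rw [indicator_of_notMem hqS, add_zero]
      by_contra hne
      exact hqS (h2 q hq' (by intro h0; rw [h0] at hne; exact hne le_rfl))

lemma LG.stepB {Ω : Set (ES N)} {e : ES N} {d : ES N → ℝ} {M : ℝ} {z : ES N} {R : ℝ}
    {g : ES N → ℝ} (h : LG Ω e d M z R)
    (hg : Sup (ball z R) (fun _ => 0) (fun x => - g x)) {n : ℕ} (hn : 0 < n)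
    (hn2 : kap 0 * (2 ^ N * vb N / n) ≤ Zk N / 2) {σ η β : ℝ} (hσ : σ ≤ R) (hη : 0 < η)
    (hβ : 0 ≤ β) (g0 : ∀ x, 0 ≤ g x) (h1 : ∀ x ∈ ball z σ, g x ≤ β)
    (h2 : ∀ x ∈ ball z σ, g x ≠ 0 → 0 < d x ∧ d x < η) (j : ℕ) :
    ∀ x ∈ ball z (σ - j * (n * η)), g x ≤ β / 2 ^ j := by
  induction j with
  | zero => simpa using h1
  | succ j ih =>
    have n0 : (0:ℝ) < n := by exact_mod_cast hn
    have hs : σ - j * (n * η) ≤ σ := by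
      have : (0:ℝ) ≤ j * (n * η) := by positivity
      linarith
    intro x hx
    have := h.stepB1 hg hn hn2 (hs.trans hσ) hη (show 0 ≤ β / 2 ^ j by positivity) g0 ih
      (fun x hx => h2 x (ball_subset_ball hs hx)) x (ball_subset_ball (by push_cast; linarith) hx)
    rw [pow_succ, ← div_div]; exact this

/-- the one-scale improvement -/
lemma bhp_step (N : ℕ) {A M : ℝ} (hA : 0 ≤ A) (hM : 1 ≤ M) : ∃ a M1 δ : ℝ, 0 < a ∧ 0 < M1 ∧
    0 < δ ∧ δ ≤ 1 / 2 ∧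
    ∀ (Ω : Set (ES N)) (e : ES N) (d : ES N → ℝ) (z : ES N) (R : ℝ) (V w : ES N → ℝ) (s b : ℝ),
    IsOpen Ω → LG Ω e d M z R → VB V d A z R → Vok (Ω ∩ ball z R) V → Sup (Ω ∩ ball z R) V w →
    (∀ p ∈ frontier Ω ∩ ball z R, ∀ ε > 0, ∀ᶠ x in 𝓝[Ω] p, -ε < w x) →
    0 < s → s ≤ R → 0 < b → (∀ x ∈ Ω ∩ ball z s, - b ≤ w x) →
    (∀ x ∈ ball z s, δ * s ≤ d x → M1 * b ≤ w x) →
    (∀ x ∈ Ω ∩ ball z (s / 2), - (a * b) ≤ w x) ∧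
    (∀ x ∈ ball z (s / 2), δ * (s / 2) ≤ d x → M1 * (a * b) ≤ w x) := by
  have M0 : 0 < M := by linarith
  have t0 : 0 < 1 / (32 * M) := by positivity
  have t1 : 1 / (32 * M) ≤ 1 / 2 := by
    apply one_div_le_one_div_of_le (by norm_num); linarith
  obtain ⟨J, hJ⟩ := exists_pow_lt_of_lt_one (show (0:ℝ) < 1 / 2 by norm_num)
    (show 1 - 1 / (32 * M) < 1 by linarith)
  have cp : 0 < cA N A M := cA_pos hM
  set c := cA N A M with hc
  have Zp := Zk_pos (N := N)
  have vp := vb_pos (N := N)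
  have kp := kap_pos (show (0:ℝ) < 1 by norm_num)
  obtain ⟨n, hn⟩ := exists_nat_gt (2 * (kap 0 * (2 ^ N * vb N)) / Zk N)
  have n0 : (0:ℝ) < n := lt_of_le_of_lt (by positivity) hn
  have hn2 : kap 0 * (2 ^ N * vb N / n) ≤ Zk N / 2 := by
    rw [div_lt_iff₀ Zp] at hn
    rw [← mul_div_assoc, div_le_div_iff₀ n0 (by norm_num)]
    linarith
  have ap : 0 < c ^ J / 2 := by positivity
  obtain ⟨j, hj⟩ := exists_pow_lt_of_lt_one ap (show (1 / 2 : ℝ) < 1 by norm_num)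
  refine ⟨c ^ J / 2, 2 / c ^ J, 1 / (2 * (J + j * n + 1)), ap, by positivity, by positivity, ?_, ?_⟩
  · have h0 : (0:ℝ) ≤ J + j * n := by positivity
    apply one_div_le_one_div_of_le (by norm_num)
    linarith
  set δ : ℝ := 1 / (2 * (J + j * n + 1)) with hδ
  have δ0 : 0 < δ := by positivity
  have δ1 : (J + j * n + 1) * δ = 1 / 2 := by rw [hδ]; field_simp
  intro Ω e d z R V w s b hΩ h hV hVok hw hbd hs hsR hb hl hu
  have q0 : (0:ℝ) ≤ J * δ := by positivity
  have q1 : (0:ℝ) ≤ j * n * δ := by positivity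
  have q2 : J * δ ≤ 1 / 2 := by linarith
  have q3 : j * n * δ ≤ 1 / 2 := by linarith
  constructor
  · set g := Ω.indicator (fun z => max (- w z) 0) with hg
    have hext := ext_sub hΩ isOpen_ball (fun p hp => hVok.nn p hp) hw hbd
    have g0 : ∀ x, 0 ≤ g x := fun x => indicator_nonneg (fun _ _ => le_max_right _ _) x
    have := h.stepB (g := g) hext (n := n) (by exact_mod_cast n0) hn2 (σ := s) (η := δ * s)
      (β := b) hsR (by positivity) hb.le g0 ?_ ?_ j
    · intro x hx
      have h3 := this x (ball_subset_ball ?_ hx.2)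
      · rw [hg, indicator_of_mem hx.1] at h3
        have h4 : - w x ≤ b / 2 ^ j := (le_max_left _ _).trans h3
        have h5 : b / 2 ^ j ≤ c ^ J / 2 * b := by
          rw [div_eq_mul_inv, mul_comm]
          have : ((2:ℝ) ^ j)⁻¹ = (1 / 2) ^ j := by rw [one_div, inv_pow]
          rw [this]; gcongr
        linarith
      · nlinarith
    · intro x hx
      by_cases hxΩ : x ∈ Ω
      · rw [hg, indicator_of_mem hxΩ]
        exact max_le (by linarith [hl x ⟨hxΩ, hx⟩]) hb.le
      · rw [hg, indicator_of_notMem hxΩ]; exact hb.le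
    · intro x hx hne
      have hxΩ : x ∈ Ω := by
        by_contra hxΩ
        exact hne (by rw [hg, indicator_of_notMem hxΩ])
      refine ⟨(h.mem x (ball_subset_ball hsR hx)).1 hxΩ, ?_⟩
      by_contra hlt
      have h3 := hu x hx (not_lt.1 hlt)
      apply hne
      rw [hg, indicator_of_mem hxΩ]
      apply max_eq_right
      have : 0 < 2 / c ^ J * b := by positivity
      linarith
  · intro x hx hdx
    have hW := hw.add_const (hΩ.inter isOpen_ball) hVok hb.le
    have := h.stepA hA hV hW (σ := s) (η := δ * s) (m := 2 / c ^ J * b) hsR (by positivity)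
      (by positivity) (fun p hp => by linarith [hl p hp])
      (fun p hp hd => by linarith [hu p hp hd]) J x (ball_subset_ball ?_ hx) ?_
    · rw [← hc] at this
      have e1 : c ^ J * (2 / c ^ J * b) = 2 * b := by field_simp
      have e2 : 2 / c ^ J * (c ^ J / 2 * b) = b := by field_simp
      rw [e1] at this
      rw [e2]; linarith
    · have : δ * s / (4 * M) ≤ δ * s := by
        apply div_le_self (by positivity); linarith
      have h4 : J * (δ * s / (4 * M)) ≤ J * (δ * s) := by gcongr
      nlinarith
    · have : (1 - 1 / (32 * M)) ^ J * (δ * s) ≤ 1 / 2 * (δ * s) := by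
        gcongr
      linarith

theorem bhp (N : ℕ) {A M : ℝ} (hA : 0 ≤ A) (hM : 1 ≤ M) : ∃ C ≥ (1:ℝ),
    ∀ (Ω : Set (ES N)) (e : ES N) (d : ES N → ℝ) (z : ES N) (R : ℝ) (V1 V2 u v : ES N → ℝ) (s : ℝ),
    IsOpen Ω → LG Ω e d M z R → VB V1 d A z R → VB V2 d A z R →
    Vok (Ω ∩ ball z R) V1 → Vok (Ω ∩ ball z R) V2 → (∀ x ∈ Ω ∩ ball z R, V2 x ≤ V1 x) →
    PS Ω V1 u z R → PS Ω V2 v z R → 0 < s → 16 * M * s ≤ R →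
    ∀ t, 0 < t → t ≤ s →
      u (z + t • e) * v (z + s • e) ≤ C * u (z + s • e) * v (z + t • e) := by
  obtain ⟨Cc, hCc, hcar⟩ := carleson N hA hM
  obtain ⟨a, M1, δ, a0, M10, δ0, δ1, hst⟩ := bhp_step N hA hM
  set C1 := (M1 + 1) * cNT N A M δ with hC1
  have n1 : 1 ≤ cNT N A M δ := one_le_cNT hA
  have C11 : 1 ≤ C1 := by nlinarith
  refine ⟨Cc * C1, by nlinarith, ?_⟩
  intro Ω e d z R V1 V2 u v s hΩ h hV1 hV2 ho1 ho2 h12 hu hv hs hR t ht hts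
  have hsR : s < R := by nlinarith
  have ins : ∀ t, 0 < t → t ≤ s → z + t • e ∈ Ω ∩ ball z R := by
    intro t ht hts
    have hb : z + t • e ∈ ball z R := by
      rw [mem_ball, h.dist_shift, abs_of_pos ht]; linarith
    exact ⟨(h.mem _ hb).2 (by rw [h.shift, h.dz]; linarith), hb⟩
  have uA := hu.sol.pos _ (ins s hs le_rfl)
  have vA := hv.sol.pos _ (ins s hs le_rfl)
  have ut := hu.sol.pos _ (ins t ht hts)
  have vt := hv.sol.pos _ (ins t ht hts)
  rcases hts.eq_or_lt with rfl | hlt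
  · have : 1 ≤ Cc * C1 := by nlinarith
    have h3 := mul_pos uA vA
    nlinarith
  set uA' := u (z + s • e) with huA
  set vA' := v (z + s • e) with hvA
  set w : ES N → ℝ := fun x => (C1 / vA') * v x - (1 / (Cc * uA')) * u x + 0 with hw
  have Ccp : 0 < Cc := by linarith
  have hwS : Sup (Ω ∩ ball z R) V2 w :=
    Sup.combo (hΩ.inter isOpen_ball) ho1 ho2 h12 hu.sol.sub (fun p hp => (hu.sol.pos p hp).le)
      hv.sol.sup (by positivity) (by positivity) le_rfl
  have hwb : ∀ p ∈ frontier Ω ∩ ball z R, ∀ ε > 0, ∀ᶠ x in 𝓝[Ω] p, -ε < w x := by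
    intro p hp ε hε
    have T : Tendsto w (𝓝[Ω] p) (𝓝 0) := by
      have := (((hv.van p hp).const_mul (C1 / vA')).sub
        ((hu.van p hp).const_mul (1 / (Cc * uA')))).add_const 0
      simpa [hw] using this
    exact T.eventually (lt_mem_nhds (by linarith))
  have main : ∀ k : ℕ, (∀ x ∈ Ω ∩ ball z (s / 2 ^ k), - (a ^ k) ≤ w x) ∧
      (∀ x ∈ ball z (s / 2 ^ k), δ * (s / 2 ^ k) ≤ d x → M1 * (a ^ k) ≤ w x) := by
    intro k
    induction k with
    | zero =>
      simp only [pow_zero, div_one, mul_one]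
      have L : ∀ x ∈ Ω ∩ ball z s, 1 / (Cc * uA') * u x ≤ 1 := by
        intro x hx
        have := hcar Ω e d z R V1 u s hΩ h hV1 hu hs hR x hx
        rw [one_div, inv_mul_le_iff₀ (by positivity), mul_one]
        exact this
      constructor
      · intro x hx
        have h3 := L x hx
        have h4 : 0 ≤ C1 / vA' * v x := by
          have := hv.sol.pos x ⟨hx.1, ball_subset_ball hsR.le hx.2⟩
          positivity
        simp only [hw]; linarith
      · intro x hx hdx
        have hxΩ : x ∈ Ω := (h.mem x (ball_subset_ball hsR.le hx)).2 (by
          have := mul_pos δ0 hs; linarith)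
        have h3 := L x ⟨hxΩ, hx⟩
        have h4 := h.nt hA hV2 hv.sol hs δ0 hR (p := x) (p' := z + s • e)
          (ball_subset_ball (by linarith) hx)
          (by rw [mem_ball, h.dist_shift, abs_of_pos hs]; linarith) hdx
          (by rw [h.shift, h.dz]; nlinarith)
        have h5 : M1 + 1 ≤ C1 / vA' * v x := by
          rw [div_mul_eq_mul_div, le_div_iff₀ vA, hC1, mul_assoc]
          gcongr
        simp only [hw]; linarith
    | succ k ih =>
      have := hst Ω e d z R V2 w (s / 2 ^ k) (a ^ k) hΩ h hV2 ho2 hwS hwb (by positivity)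
        ((div_le_self hs.le (one_le_pow₀ (by norm_num))).trans hsR.le) (by positivity) ih.1 ih.2
      rw [show s / 2 ^ (k + 1) = s / 2 ^ k / 2 by rw [pow_succ, div_div],
        show a ^ (k + 1) = a * a ^ k by ring]
      exact this
  -- choose the scale
  have hex : ∃ k : ℕ, s / 2 ^ k ≤ t := by
    obtain ⟨k, hk⟩ := exists_pow_lt_of_lt_one (show 0 < t / s by positivity)
      (show (1 / 2 : ℝ) < 1 by norm_num)
    refine ⟨k, ?_⟩
    rw [lt_div_iff₀ hs, one_div, inv_pow] at hk
    rw [div_eq_mul_inv]; linarith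
  classical
  set k := Nat.find hex with hk
  have k1 : s / 2 ^ k ≤ t := Nat.find_spec hex
  have kne : k ≠ 0 := by
    intro h0
    rw [h0] at k1
    simp at k1; linarith
  obtain ⟨k', hk'⟩ := Nat.exists_eq_succ_of_ne_zero kne
  have k2 : t < s / 2 ^ k' := not_le.1 (Nat.find_min hex (show k' < Nat.find hex by omega))
  rw [hk', Nat.succ_eq_add_one, pow_succ, ← div_div] at k1
  have fin := (main k').2 (z + t • e) (by rw [mem_ball, h.dist_shift, abs_of_pos ht]; exact k2)
    (by
      rw [h.shift, h.dz]
      have : 0 < s / 2 ^ k' := by positivity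
      nlinarith)
  have pos : 0 < M1 * a ^ k' := by positivity
  have fin2 : 1 / (Cc * uA') * u (z + t • e) ≤ C1 / vA' * v (z + t • e) := by
    simp only [hw] at fin; linarith
  rw [one_div, inv_mul_le_iff₀ (by positivity), div_mul_eq_mul_div, mul_div_assoc',
    le_div_iff₀ vA] at fin2
  linarith

end Part9

/-! ### Part 10 : bridge to the frozen definitions, shells -/

section Part10

variable {N : ℕ}

lemma VClass.vok {Ω : Set (ES N)} (hΩ : IsOpen Ω) (hne : (Ωᶜ).Nonempty) {a : ℝ} {V : ES N → ℝ}
    (h : VClass Ω a V) : Vok Ω V := by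
  refine ⟨h.1, fun z hz => (h.2 z hz).1, fun C hC hc => ?_⟩
  rcases C.eq_empty_or_nonempty with rfl | hCn
  · exact ⟨0, by simp⟩
  obtain ⟨p, hp, hmin⟩ := hc.exists_isMinOn hCn (continuous_infDist_pt Ωᶜ).continuousOn
  have dp : 0 < infDist p Ωᶜ :=
    (hΩ.isClosed_compl.notMem_iff_infDist_pos hne).1 (by simpa using hC hp)
  refine ⟨a / infDist p Ωᶜ ^ 2, fun z hz => ?_⟩
  have h1 : infDist p Ωᶜ ≤ infDist z Ωᶜ := hmin hz
  obtain ⟨v0, v1⟩ := h.2 z (hC hz)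
  rw [le_div_iff₀ (by positivity)]
  refine le_trans (mul_le_mul_of_nonneg_left ?_ v0) v1
  unfold dista
  gcongr

lemma IsTestFun.off {Ω : Set (ES N)} {φ : ES N → ℝ} (h : IsTestFun Ω φ) {z : ES N} (hz : z ∉ Ω) :
    φ z = 0 := image_eq_zero_of_notMem_tsupport fun hz' => hz (h.2.2 hz')

lemma IsTestFun.lap_off {Ω : Set (ES N)} {φ : ES N → ℝ} (h : IsTestFun Ω φ) {z : ES N}
    (hz : z ∉ Ω) : lap φ z = 0 := Anc.lap_off fun hz' => hz (h.2.2 hz')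

lemma LVHarmonic.eq {Ω : Set (ES N)} {V u φ : ES N → ℝ} (h : LVHarmonic Ω V u)
    (hφ : IsTestFun Ω φ) : ∫ z, u z * lap φ z = ∫ z, V z * u z * φ z := by
  have := h.2.2.2 φ hφ
  rwa [setIntegral_eq_integral_of_forall_compl_eq_zero,
    setIntegral_eq_integral_of_forall_compl_eq_zero] at this
  · intro z hz; rw [hφ.off hz, mul_zero]
  · intro z hz; rw [hφ.lap_off hz, mul_zero]

lemma LVHarmonic.sol {Ω : Set (ES N)} {V u : ES N → ℝ} (h : LVHarmonic Ω V u)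
    (hV : ∀ z ∈ Ω, 0 ≤ V z) (hu : ∀ z ∈ Ω, 0 < u z) : Sol Ω V u := by
  refine ⟨⟨h.1, fun φ hφ _ => (h.eq hφ).le⟩, ⟨h.1.neg, fun φ hφ _ => ?_⟩, hu, hV⟩
  have := h.eq hφ
  simp only [neg_mul, mul_neg, integral_neg]
  linarith

lemma green_eq {Ω : Set (ES N)} {x₀ : ES N} {G φ : ES N → ℝ}
    (h : IsGreenFunction Ω (fun _ => 0) x₀ G)
    (hφ : IsTestFun Ω φ) : ∫ z, G z * lap φ z = - φ x₀ := by
  have := h.2.2.2.2 φ hφ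
  simp only [zero_mul, sub_zero] at this
  rwa [setIntegral_eq_integral_of_forall_compl_eq_zero] at this
  intro z hz; rw [hφ.lap_off hz, mul_zero]

lemma green_sol {Ω : Set (ES N)} {x₀ : ES N} {G : ES N → ℝ}
    (h : IsGreenFunction Ω (fun _ => 0) x₀ G) : Sol (Ω \ {x₀}) (fun _ => 0) G := by
  have key : ∀ φ, IsTestFun (Ω \ {x₀}) φ → ∫ z, G z * lap φ z = 0 := by
    intro φ hφ
    rw [green_eq h (hφ.mono diff_subset), hφ.off (by simp), neg_zero]
  refine ⟨⟨h.1, fun φ hφ _ => ?_⟩, ⟨h.1.neg, fun φ hφ _ => ?_⟩, h.2.1, fun _ _ => le_rfl⟩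
  · simp [key φ hφ]
  · simp only [neg_mul, integral_neg, key φ hφ]; simp

/-- local graph at a boundary point -/
lemma exists_LG {Ω : Set (ES N)} (hΩ : IsLipschitzDomain Ω) {z : ES N} (hz : z ∈ frontier Ω) :
    ∃ (e : ES N) (d : ES N → ℝ) (M R : ℝ), LG Ω e d M z R := by
  obtain ⟨g, i, f, L, ε, hε, hL, hf, hmem⟩ := hΩ.2.2 z hz
  set e : ES N := g.symm (EuclideanSpace.single i 1) with he
  set d : ES N → ℝ := fun x => g x i - f (g x) with hd
  have lip : ∀ x y, |d x - d y| ≤ (1 + L) * dist x y := by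
    intro x y
    have h1 : |g x i - g y i| ≤ dist x y := by
      have := EuclideanSpace.dist_eq (g x) (g y)
      have h2 := PiLp.norm_apply_le (g x - g y) i
      rw [← dist_eq_norm, g.isometry.dist_eq] at h2
      simpa using h2
    have h2 : |f (g x) - f (g y)| ≤ L * dist x y := by
      have := hL.dist_le_mul (g x) (g y)
      rwa [g.isometry.dist_eq, Real.dist_eq] at this
    calc |d x - d y| = |(g x i - g y i) - (f (g x) - f (g y))| := by congr 1; simp only [hd]; ring
      _ ≤ |g x i - g y i| + |f (g x) - f (g y)| := abs_sub _ _
      _ ≤ _ := by linarith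
  have shift : ∀ x t, d (x + t • e) = d x + t := by
    intro x t
    have e1 : g (x + t • e) = g x + t • EuclideanSpace.single i 1 := by simp [he]
    have e2 : f (g (x + t • e)) = f (g x) := by
      apply hf
      intro j hj
      rw [e1]; simp [hj]
    simp only [hd]
    rw [e2, e1]; simp; ring
  have e1 : ‖e‖ = 1 := by rw [he, LinearIsometryEquiv.norm_map]; simp
  have cont : Continuous d := by
    have : LipschitzWith (Real.toNNReal (1 + L)) d := LipschitzWith.of_dist_le_mul fun x y => by
      rw [Real.dist_eq, Real.coe_toNNReal _ (by positivity)]; exact lip x y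
    exact this.continuous
  have mem : ∀ x ∈ ball z ε, (x ∈ Ω ↔ 0 < d x) := by
    intro x hx
    rw [hmem x hx]; simp [hd]
  have dz : d z = 0 := by
    have hzb : z ∈ ball z ε := mem_ball_self hε
    have h1 : z ∉ Ω := fun h => hz.2 (by rwa [hΩ.1.interior_eq])
    rw [mem z hzb, not_lt] at h1
    by_contra hne
    have hlt : d z < 0 := lt_of_le_of_ne h1 hne
    have : ∀ᶠ p in 𝓝 z, p ∈ ball z ε ∧ d p < 0 :=
      (eventually_mem_set.2 (isOpen_ball.mem_nhds hzb)).and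
        (cont.continuousAt.eventually_lt continuousAt_const hlt)
    obtain ⟨p, hp, hpΩ⟩ := mem_closure_iff_nhds.1 hz.1 _ this
    have := (mem p hp.1).1 hpΩ
    linarith [hp.2]
  exact ⟨e, d, 1 + L, ε, e1, by simp, lip, shift, dz, hε, mem⟩

lemma LG.vb {Ω : Set (ES N)} {e : ES N} {d : ES N → ℝ} {M : ℝ} {z : ES N} {R a : ℝ}
    {V : ES N → ℝ} (h : LG Ω e d M z R) (hΩ : IsOpen Ω) (hz : z ∈ _root_.frontier Ω)
    (hV : VClass Ω a V) : VB V d (a * M ^ 2) z (R / 2) := by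
  intro x hx hdx
  have hxR : x ∈ ball z R := ball_subset_ball (by linarith [h.Rpos]) hx
  have hxΩ := (h.mem x hxR).2 hdx
  obtain ⟨v0, v1⟩ := hV.2 x hxΩ
  refine ⟨v0, ?_⟩
  have M0 : 0 < M := by linarith [h.M1]
  have hzc : z ∈ Ωᶜ := fun h => hz.2 (by rwa [hΩ.interior_eq])
  have key : d x ≤ M * dista Ω x := by
    unfold dista
    rw [mul_comm, ← div_le_iff₀ M0, le_infDist ⟨z, hzc⟩]
    intro w hw
    rw [div_le_iff₀ M0, mul_comm]
    by_cases hwR : w ∈ ball z R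
    · have h1 : d w ≤ 0 := by
        by_contra hlt
        exact hw ((h.mem w hwR).2 (not_le.1 hlt))
      have := h.le x w
      linarith
    · have h1 := h.le_dist x
      rw [mem_ball, not_lt] at hwR
      rw [mem_ball] at hx
      have h2 : dist x z ≤ dist x w := by
        have := dist_triangle w x z
        rw [dist_comm w x] at this
        linarith
      exact h1.trans (by gcongr)
  have D0 : 0 ≤ dista Ω x := infDist_nonneg
  calc V x * d x ^ 2 ≤ V x * (M * dista Ω x) ^ 2 := by gcongr
    _ = V x * dista Ω x ^ 2 * M ^ 2 := by ring
    _ ≤ a * M ^ 2 := by gcongr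

lemma VB_zero {d : ES N → ℝ} {A : ℝ} (hA : 0 ≤ A) {z : ES N} {R : ℝ} :
    VB (fun _ => 0) d A z R := fun x _ _ => ⟨le_rfl, by simpa using hA⟩

/-- positive solution near `y` vanishing on the boundary except perhaps at `y` -/
structure PM (Ω : Set (ES N)) (V u : ES N → ℝ) (y : ES N) (R : ℝ) : Prop where
  sol : Sol (Ω ∩ ball y R) V u
  van : ∀ p ∈ frontier Ω ∩ ball y R, p ≠ y → Tendsto u (𝓝[Ω] p) (𝓝 0)

lemma PM.ps {Ω : Set (ES N)} {V u : ES N → ℝ} {y z : ES N} {R r : ℝ} (h : PM Ω V u y R)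
    (hs : ball z r ⊆ ball y R) (hy : y ∉ ball z r) : PS Ω V u z r :=
  ⟨h.sol.mono (inter_subset_inter_right _ hs),
    fun p hp => h.van p ⟨hp.1, hs hp.2⟩ fun hpy => hy (hpy ▸ hp.2)⟩

lemma LG.foot {Ω : Set (ES N)} {e : ES N} {d : ES N → ℝ} {M : ℝ} {y : ES N} {R : ℝ}
    (h : LG Ω e d M y R) {r : ℝ} (hr : 0 < r) (hR : 16 * M * r ≤ R)
    {x : ES N} (hx1 : r ≤ dist x y) (hx2 : dist x y ≤ 2 * r) (hd0 : 0 < d x)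
    (hd : d x < r / (64 * M)) :
    LG Ω e d M (x - d x • e) (r / 4) ∧ ball (x - d x • e) (r / 4) ⊆ ball y R ∧
      y ∉ ball (x - d x • e) (r / 4) ∧ 16 * M * (r / (64 * M)) ≤ r / 4 ∧
      (x - d x • e) + d x • e = x ∧ dist ((x - d x • e) + (r / (64 * M)) • e) y < 4 * r ∧
      (1 / (64 * M)) * r ≤ d ((x - d x • e) + (r / (64 * M)) • e) := by
  have M1 := h.M1
  have M0 : 0 < M := by linarith
  set z := x - d x • e with hz
  have ezx : z + d x • e = x := by rw [hz]; simp
  have dz0 : d z = 0 := by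
    have := h.shift z (d x)
    rw [ezx] at this; linarith
  have hs64 : r / (64 * M) ≤ r / 64 := by
    apply div_le_div_of_nonneg_left hr.le (by norm_num); linarith
  have dzx : dist x z = d x := by
    have := h.dist_shift z (d x)
    rwa [ezx, abs_of_pos hd0] at this
  have hsub : ball z (r / 4) ⊆ ball y R := by
    intro p hp
    rw [mem_ball] at hp ⊢
    have := dist_triangle p z y
    have := dist_triangle z x y
    rw [dist_comm z x] at this
    nlinarith
  refine ⟨h.recenter dz0 (by linarith) hsub, hsub, ?_, ?_, ezx, ?_, ?_⟩
  · intro hy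
    rw [mem_ball, dist_comm] at hy
    have := dist_triangle x z y
    linarith
  · rw [le_div_iff₀ (by norm_num)]; apply le_of_eq; field_simp; norm_num
  · have h1 := h.dist_shift z (r / (64 * M))
    rw [abs_of_pos (by positivity)] at h1
    have := dist_triangle (z + (r / (64 * M)) • e) z y
    have := dist_triangle z x y
    rw [dist_comm z x] at this
    linarith
  · rw [h.shift, dz0]; apply le_of_eq; ring

lemma LG.Ar {Ω : Set (ES N)} {e : ES N} {d : ES N → ℝ} {M : ℝ} {y : ES N} {R : ℝ}
    (h : LG Ω e d M y R) {r : ℝ} (hr : 0 < r) (hR : r < R) : y + r • e ∈ Ω ∩ ball y R := by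
  have hb : y + r • e ∈ ball y R := by
    rw [mem_ball, h.dist_shift, abs_of_pos hr]; exact hR
  exact ⟨(h.mem _ hb).2 (by rw [h.shift, h.dz]; linarith), hb⟩

/-- Carleson on shells -/
theorem shell_car (N : ℕ) {A M : ℝ} (hA : 0 ≤ A) (hM : 1 ≤ M) : ∃ C ≥ (1:ℝ),
    ∀ (Ω : Set (ES N)) (e : ES N) (d : ES N → ℝ) (y : ES N) (R : ℝ) (V u : ES N → ℝ) (r : ℝ),
    IsOpen Ω → LG Ω e d M y R → VB V d A y R → PM Ω V u y R → 0 < r → 16 * M * r ≤ R →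
    ∀ x ∈ Ω, r ≤ dist x y → dist x y ≤ 2 * r → u x ≤ C * u (y + r • e) := by
  obtain ⟨Cc, hCc, hcar⟩ := carleson N hA hM
  have n1 : 1 ≤ cNT N A M (1 / (64 * M)) := one_le_cNT hA
  refine ⟨Cc * cNT N A M (1 / (64 * M)), by nlinarith, ?_⟩
  intro Ω e d y R V u r hΩ h hV hu hr hR x hx h1 h2
  have M0 : 0 < M := by linarith
  have c0 : 0 < 1 / (64 * M) := by positivity
  have hrR : r < R := by nlinarith
  have hxb : x ∈ ball y R := by rw [mem_ball]; nlinarith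
  have dx := (h.mem x hxb).1 hx
  have hu0 := hu.sol.pos _ (h.Ar hr hrR)
  have hAr : y + r • e ∈ ball y (4 * r) := by
    rw [mem_ball, h.dist_shift, abs_of_pos hr]; linarith
  have hdA : 1 / (64 * M) * r ≤ d (y + r • e) := by
    rw [h.shift, h.dz, zero_add]
    have : 1 / (64 * M) ≤ 1 := by rw [div_le_one (by positivity)]; linarith
    nlinarith
  by_cases hd : d x < r / (64 * M)
  · obtain ⟨f1, f2, f3, f4, f5, f6, f7⟩ := h.foot hr hR h1 h2 dx hd
    have k1 := hcar Ω e d _ (r / 4) V u (r / (64 * M)) hΩ f1 (hV.mono f2) (hu.ps f2 f3)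
      (by positivity) f4 x ⟨hx, ?_⟩
    · have k2 := h.nt hA hV hu.sol hr c0 hR hAr (mem_ball.2 f6) hdA f7
      calc u x ≤ Cc * _ := k1
        _ ≤ Cc * (cNT N A M (1 / (64 * M)) * u (y + r • e)) := by gcongr
        _ = _ := by ring
    · have := h.dist_shift (x - d x • e) (d x)
      rw [f5, abs_of_pos dx] at this
      rw [mem_ball, this]; exact hd
  · have k2 := h.nt hA hV hu.sol hr c0 hR hAr (p' := x) (by rw [mem_ball]; linarith) hdA
      (by rw [not_lt] at hd; refine le_trans (le_of_eq ?_) hd; ring)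
    refine k2.trans ?_
    have : 0 < cNT N A M (1 / (64 * M)) * u (y + r • e) := by positivity
    nlinarith

/-- boundary Harnack on shells -/
theorem shell_bhp (N : ℕ) {A M : ℝ} (hA : 0 ≤ A) (hM : 1 ≤ M) : ∃ C ≥ (1:ℝ),
    ∀ (Ω : Set (ES N)) (e : ES N) (d : ES N → ℝ) (y : ES N) (R : ℝ) (V1 V2 u v : ES N → ℝ) (r : ℝ),
    IsOpen Ω → LG Ω e d M y R → VB V1 d A y R → VB V2 d A y R →
    Vok (Ω ∩ ball y R) V1 → Vok (Ω ∩ ball y R) V2 → (∀ x ∈ Ω ∩ ball y R, V2 x ≤ V1 x) →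
    PM Ω V1 u y R → PM Ω V2 v y R → 0 < r → 16 * M * r ≤ R →
    ∀ x ∈ Ω, r ≤ dist x y → dist x y ≤ 2 * r →
      u x * v (y + r • e) ≤ C * u (y + r • e) * v x := by
  obtain ⟨Cb, hCb, hbhp⟩ := bhp N hA hM
  set cn := cNT N A M (1 / (64 * M)) with hcn
  have n1 : 1 ≤ cn := one_le_cNT hA
  have n2 : 1 ≤ cn ^ 2 := one_le_pow₀ n1
  refine ⟨Cb * cn ^ 2, by nlinarith, ?_⟩
  intro Ω e d y R V1 V2 u v r hΩ h hV1 hV2 ho1 ho2 h12 hu hv hr hR x hx h1 h2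
  have M0 : 0 < M := by linarith
  have c0 : 0 < 1 / (64 * M) := by positivity
  have hrR : r < R := by nlinarith
  have hxb : x ∈ ball y R := by rw [mem_ball]; nlinarith
  have dx := (h.mem x hxb).1 hx
  have hu0 := hu.sol.pos _ (h.Ar hr hrR)
  have hv0 := hv.sol.pos _ (h.Ar hr hrR)
  have hux := hu.sol.pos x ⟨hx, hxb⟩
  have hvx := hv.sol.pos x ⟨hx, hxb⟩
  have hAr : y + r • e ∈ ball y (4 * r) := by
    rw [mem_ball, h.dist_shift, abs_of_pos hr]; linarith
  have hdA : 1 / (64 * M) * r ≤ d (y + r • e) := by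
    rw [h.shift, h.dz, zero_add]
    have : 1 / (64 * M) ≤ 1 := by rw [div_le_one (by positivity)]; linarith
    nlinarith
  by_cases hd : d x < r / (64 * M)
  · obtain ⟨f1, f2, f3, f4, f5, f6, f7⟩ := h.foot hr hR h1 h2 dx hd
    have sI : Ω ∩ ball (x - d x • e) (r / 4) ⊆ Ω ∩ ball y R := inter_subset_inter_right _ f2
    have k1 := hbhp Ω e d _ (r / 4) V1 V2 u v (r / (64 * M)) hΩ f1 (hV1.mono f2) (hV2.mono f2)
      (ho1.mono sI) (ho2.mono sI) (fun p hp => h12 p (sI hp)) (hu.ps f2 f3) (hv.ps f2 f3)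
      (by positivity) f4 (d x) dx hd.le
    rw [f5] at k1
    have k2 := h.nt hA hV1 hu.sol hr c0 hR hAr (mem_ball.2 f6) hdA f7
    have k3 := h.nt hA hV2 hv.sol hr c0 hR (mem_ball.2 f6) hAr f7 hdA
    set p := x - d x • e + (r / (64 * M)) • e
    calc u x * v (y + r • e) ≤ u x * (cn * v p) := by gcongr
      _ = cn * (u x * v p) := by ring
      _ ≤ cn * (Cb * u p * v x) := by gcongr
      _ ≤ cn * (Cb * (cn * u (y + r • e)) * v x) := by gcongr
      _ = _ := by ring
  · have hd' : 1 / (64 * M) * r ≤ d x := by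
      rw [not_lt] at hd; refine le_trans (le_of_eq ?_) hd; ring
    have hxb4 : x ∈ ball y (4 * r) := by rw [mem_ball]; linarith
    have k2 := h.nt hA hV1 hu.sol hr c0 hR hAr hxb4 hdA hd'
    have k3 := h.nt hA hV2 hv.sol hr c0 hR hxb4 hAr hd' hdA
    calc u x * v (y + r • e) ≤ (cn * u (y + r • e)) * (cn * v x) := by gcongr
      _ = 1 * (cn ^ 2 * u (y + r • e) * v x) := by ring
      _ ≤ Cb * (cn ^ 2 * u (y + r • e) * v x) := by gcongr
      _ = _ := by ring

end Part10

section Part11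
variable {N : ℕ}

open scoped Convolution

lemma conv_dd {f g : ES N → ℝ} (hf : LocallyIntegrable f) (hg : ContDiff ℝ (⊤ : ℕ∞) g)
    (hs : HasCompactSupport g) (i : Fin N) :
    dd i (f ⋆[ContinuousLinearMap.mul ℝ ℝ, volume] g)
      = (f ⋆[ContinuousLinearMap.mul ℝ ℝ, volume] (dd i g)) := by
  funext x
  have h1 := hs.hasFDerivAt_convolution_right (ContinuousLinearMap.mul ℝ ℝ) hf
    (hg.of_le (by exact_mod_cast le_top)) x
  unfold dd
  rw [h1.fderiv]
  rw [convolution_precompR_apply _ hf (hs.fderiv (𝕜 := ℝ)) (hg.continuous_fderiv (by simp))]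

lemma conv_lap {f g : ES N → ℝ} (hf : LocallyIntegrable f) (hg : ContDiff ℝ (⊤ : ℕ∞) g)
    (hs : HasCompactSupport g) (x : ES N) :
    lap (f ⋆[ContinuousLinearMap.mul ℝ ℝ, volume] g) x = ∫ z, f z * lap g (x - z) := by
  rw [lap_eq]
  have : ∀ i, dd i (dd i (f ⋆[ContinuousLinearMap.mul ℝ ℝ, volume] g)) x
      = ∫ z, f z * dd i (dd i g) (x - z) := by
    intro i
    rw [conv_dd hf hg hs, conv_dd hf (dd_contDiff hg i) (dd_supp hs i)]
    rfl
  simp_rw [this]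
  rw [← integral_finset_sum]
  · refine integral_congr_ae (Eventually.of_forall fun z => ?_)
    simp only [lap_eq, Finset.mul_sum]
  · intro i _
    have := (dd_supp (dd_supp hs i) i).convolutionExists_right (ContinuousLinearMap.mul ℝ ℝ) hf
      (dd_contDiff (dd_contDiff hg i) i).continuous x
    exact this

lemma av_conv (t : ℝ) (w : ES N → ℝ) : av kap t w = fun x => (t ^ N)⁻¹ *
    (w ⋆[ContinuousLinearMap.mul ℝ ℝ, volume] (fun z => kap ((t ^ 2)⁻¹ * ‖z - 0‖ ^ 2))) x := by
  funext x
  unfold av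
  rw [convolution_def]
  congr 1
  refine integral_congr_ae (Eventually.of_forall fun z => ?_)
  simp [norm_sub_rev]

lemma av_contDiff {w : ES N → ℝ} (hw : LocallyIntegrable w) {t : ℝ} (ht : 0 < t) :
    ContDiff ℝ (⊤ : ℕ∞) (av kap t w) := by
  rw [av_conv]
  exact contDiff_const.mul ((ker_supp kap_prof ht 0).contDiff_convolution_right _ hw
    (contDiff_radial kap_prof.smooth _ 0))

lemma lap_ker {t : ℝ} (x z : ES N) :
    lap (fun z => kap ((t ^ 2)⁻¹ * ‖z - 0‖ ^ 2)) (x - z)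
      = lap (fun z => kap ((t ^ 2)⁻¹ * ‖z - x‖ ^ 2)) z := by
  have h2 : ∀ s, HasDerivAt (deriv kap) (deriv (deriv kap) s) s := fun s =>
    ((((contDiff_infty_iff_deriv.1 kap_prof.smooth).2).differentiable
      (by simp)).differentiableAt).hasDerivAt
  rw [lap_radial kap_prof.hasDeriv h2, lap_radial kap_prof.hasDeriv h2, sub_zero,
    norm_sub_rev]

lemma lap_av {w : ES N → ℝ} (hw : LocallyIntegrable w) {t : ℝ} (ht : 0 < t) (x : ES N) :
    lap (av kap t w) x
      = (t ^ N)⁻¹ * ∫ z, w z * lap (fun z => kap ((t ^ 2)⁻¹ * ‖z - x‖ ^ 2)) z := by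
  have hs := ker_supp (N := N) kap_prof ht 0
  have hg := contDiff_radial (N := N) kap_prof.smooth ((t ^ 2)⁻¹) 0
  rw [av_conv, lap_smul (hs.contDiff_convolution_right _ hw hg), conv_lap hw hg hs]
  simp_rw [lap_ker]

lemma ker_test {t : ℝ} (ht : 0 < t) {x : ES N} {U : Set (ES N)} (hU : closedBall x t ⊆ U) :
    IsTestFun U (fun z => kap ((t ^ 2)⁻¹ * ‖z - x‖ ^ 2)) := by
  have hs : tsupport (fun z : ES N => kap ((t ^ 2)⁻¹ * ‖z - x‖ ^ 2)) ⊆ closedBall x t := by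
    refine closure_minimal ?_ isClosed_closedBall
    intro z hz
    by_contra hz'
    refine hz (ker_zero kap_prof ht ?_)
    rw [mem_closedBall, dist_eq_norm] at hz'
    linarith
  exact ⟨contDiff_radial kap_prof.smooth _ x,
    (isCompact_closedBall x t).of_isClosed_subset (isClosed_tsupport _) hs, hs.trans hU⟩

/-- Locally replace a function by a globally integrable one. -/
lemma av_ind {w : ES N → ℝ} {S : Set (ES N)} {t : ℝ} (ht : 0 < t) {x : ES N}
    (hx : closedBall x t ⊆ S) : av kap t (S.indicator w) x = av kap t w x := by
  refine av_congr kap_prof ht fun z hz => ?_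
  rw [indicator_of_mem (hx (ball_subset_closedBall hz))]

lemma int_ind {w φ : ES N → ℝ} {S : Set (ES N)} (hφ : IsTestFun S φ) :
    ∫ z, S.indicator w z * lap φ z = ∫ z, w z * lap φ z := by
  refine integral_congr_ae (Eventually.of_forall fun z => ?_)
  by_cases hz : z ∈ S
  · simp only [indicator_of_mem hz]
  · simp only [hφ.lap_off hz, mul_zero]

lemma mean_eq {U : Set (ES N)} {u : ES N → ℝ} (h1 : Sup U (fun _ => 0) u)
    (h2 : Sup U (fun _ => 0) (fun z => - u z)) {x : ES N} {t : ℝ} (ht : 0 < t)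
    (hU : closedBall x t ⊆ U) {κ : ℝ → ℝ} (hκ : Prof κ) : av κ t u x = Zc N κ * u x := by
  have a1 := mean_le hκ (lam := 0) ht hU (h1.integrableOn hU) (cont_at h1.1 ht hU)
    (F := fun _ => 0) (fun φ hφ h0 => by simpa using h1.2 φ hφ h0) (by simp) (by simp)
  have a2 := mean_le hκ (lam := 0) ht hU (h2.integrableOn hU) (cont_at h2.1 ht hU)
    (F := fun _ => 0) (fun φ hφ h0 => by simpa using h2.2 φ hφ h0) (by simp) (by simp)
  have e : (fun z => - u z) = fun z => (-1) * u z := by funext z; ring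
  rw [e, av_smul] at a2
  simp only [zero_mul, zero_div, Real.exp_zero, one_mul] at a1 a2
  linarith

lemma harm_smooth {U : Set (ES N)} (hU : IsOpen U) {u : ES N → ℝ} (h1 : Sup U (fun _ => 0) u)
    (h2 : Sup U (fun _ => 0) (fun z => - u z)) {x : ES N} (hx : x ∈ U) :
    ContDiffAt ℝ (⊤ : ℕ∞) u x ∧ lap u x = 0 := by
  obtain ⟨r, hr, hrU⟩ := Metric.nhds_basis_closedBall.mem_iff.1 (hU.mem_nhds hx)
  set t := r / 2 with htd
  have ht : 0 < t := by positivity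
  set w := (closedBall x r).indicator u
  have hw : LocallyIntegrable w := by
    refine Integrable.locallyIntegrable ?_
    exact (integrable_indicator_iff measurableSet_closedBall).2 (h1.integrableOn hrU)
  have hsub : ∀ x' ∈ ball x t, closedBall x' t ⊆ closedBall x r := by
    intro x' hx'
    refine closedBall_subset_closedBall' ?_
    rw [mem_ball] at hx'; linarith
  have hev : u =ᶠ[𝓝 x] fun x' => (Zk N)⁻¹ * av kap t w x' := by
    filter_upwards [ball_mem_nhds x ht] with x' hx'
    rw [av_ind ht (hsub x' hx'), mean_eq h1 h2 ht ((hsub x' hx').trans hrU) kap_prof]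
    have := Zk_pos (N := N)
    unfold Zk at *
    field_simp
  have hsm := av_contDiff hw ht
  refine ⟨((contDiff_const.mul hsm).contDiffAt).congr_of_eventuallyEq hev, ?_⟩
  rw [lap_congr_nhds hev, lap_smul hsm, lap_av hw ht]
  have hT := ker_test ht (hsub x (mem_ball_self ht))
  rw [int_ind hT]
  have a1 := h1.2 _ (hT.mono hrU) (fun z => kap_prof.nonneg _)
  have a2 := h2.2 _ (hT.mono hrU) (fun z => kap_prof.nonneg _)
  simp only [zero_mul, integral_zero, neg_mul, integral_neg] at a1 a2
  have : ∫ z, u z * lap (fun z => kap ((t ^ 2)⁻¹ * ‖z - x‖ ^ 2)) z = 0 := by linarith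
  rw [this]; simp

/-- A regularised Green function. -/
structure GR (Ω : Set (ES N)) (x₀ : ES N) (t : ℝ) (m J : ES N → ℝ) : Prop where
  tpos : 0 < t
  ball : closedBall x₀ t ⊆ Ω
  mc : Continuous m
  m0 : ∀ x, 0 ≤ m x
  mz : ∀ x ∉ closedBall x₀ t, m x = 0
  mi : 0 < m x₀
  sm : ∀ x ∈ Ω, ContDiffAt ℝ (⊤ : ℕ∞) J x
  lp : ∀ x ∈ Ω, lap J x = - m x
  pos : ∀ x ∈ Ω, 0 < J x
  van : ∀ p ∈ frontier Ω, Tendsto J (𝓝[Ω] p) (𝓝 0)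

lemma exists_GR {Ω : Set (ES N)} (hN : 2 ≤ N) (hΩ : IsOpen Ω) {x₀ : ES N} {G : ES N → ℝ}
    (hG : IsGreenFunction Ω (fun _ => 0) x₀ G) {t : ℝ} (ht : 0 < t)
    (hb : closedBall x₀ (4 * t) ⊆ Ω) : ∃ m J : ES N → ℝ, GR Ω x₀ t m J ∧
      ∀ x ∈ Ω, x ∉ closedBall x₀ t → J x = G x := by
  classical
  have hZ := Zk_pos (N := N)
  have hGi : IntegrableOn G (closedBall x₀ (4 * t)) :=
    hG.2.2.1.integrableOn_compact_subset hb (isCompact_closedBall _ _)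
  set w := (closedBall x₀ (4 * t)).indicator G
  have hw : LocallyIntegrable w := by
    refine Integrable.locallyIntegrable ?_
    exact (integrable_indicator_iff measurableSet_closedBall).2 hGi
  have hwi : ∀ S : Set (ES N), IntegrableOn w S := fun S =>
    ((integrable_indicator_iff measurableSet_closedBall).2 hGi).integrableOn
  have hsol := green_sol hG
  have hUo : IsOpen (Ω \ {x₀}) := hΩ.sdiff isClosed_singleton
  set J : ES N → ℝ := fun x => if dist x x₀ < 2 * t then (Zk N)⁻¹ * av kap t w x else G x
  set m : ES N → ℝ := fun x => (Zk N)⁻¹ * ((t ^ N)⁻¹ * kap ((t ^ 2)⁻¹ * ‖x - x₀‖ ^ 2))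
  have hsub : ∀ x, dist x x₀ < 2 * t → closedBall x t ⊆ closedBall x₀ (4 * t) := by
    intro x hx
    exact closedBall_subset_closedBall' (by linarith)
  have hJG : ∀ x ∈ Ω, x ∉ closedBall x₀ t → J x = G x := by
    intro x hx hxt
    rw [mem_closedBall, not_le] at hxt
    by_cases h : dist x x₀ < 2 * t
    · simp only [J, if_pos h]
      rw [av_ind ht (hsub x h), mean_eq hsol.sup hsol.sub ht ?_ kap_prof]
      · unfold Zk at *; field_simp
      · intro z hz
        refine ⟨hb (hsub x h hz), ?_⟩
        rintro rfl
        rw [mem_closedBall, dist_comm] at hz; linarith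
    · simp only [J, if_neg h]
  have hev1 : ∀ x, dist x x₀ < 2 * t → J =ᶠ[𝓝 x] fun x => (Zk N)⁻¹ * av kap t w x := by
    intro x hx
    filter_upwards [isOpen_ball.mem_nhds (mem_ball.2 hx)] with z hz
    simp only [J, if_pos (mem_ball.1 hz)]
  have hev2 : ∀ x ∈ Ω, x ∉ closedBall x₀ t → J =ᶠ[𝓝 x] G := by
    intro x hx hxt
    filter_upwards [hΩ.mem_nhds hx, isClosed_closedBall.isOpen_compl.mem_nhds hxt] with z h1 h2
    exact hJG z h1 h2
  have hne : ∀ x, x ∉ closedBall x₀ t → x ≠ x₀ := by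
    rintro x hx rfl; exact hx (mem_closedBall_self ht.le)
  have hm : ∀ x ∉ closedBall x₀ t, m x = 0 := by
    intro x hx
    simp only [m]
    rw [ker_zero kap_prof ht]; · simp
    rw [mem_closedBall, dist_eq_norm] at hx; linarith
  have hsm := av_contDiff hw ht
  have key : ∀ x ∈ Ω, x ∉ closedBall x₀ t ∨ dist x x₀ < 2 * t := by
    intro x _
    by_cases h : dist x x₀ < 2 * t
    · exact Or.inr h
    · left; rw [mem_closedBall]; intro h'; linarith
  refine ⟨m, J, ⟨ht, (closedBall_subset_closedBall (by linarith)).trans hb, ?_, ?_, hm, ?_, ?_,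
    ?_, ?_, ?_⟩, hJG⟩
  · exact continuous_const.mul (continuous_const.mul (ker_cont kap_prof t x₀))
  · intro x
    have := kap_prof.nonneg ((t ^ 2)⁻¹ * ‖x - x₀‖ ^ 2)
    simp only [m]; positivity
  · have : 0 < kap 0 := kap_pos one_pos
    simp only [m, sub_self, norm_zero]; norm_num; positivity
  · intro x hx
    rcases key x hx with h | h
    · exact (harm_smooth hUo hsol.sup hsol.sub ⟨hx, hne x h⟩).1.congr_of_eventuallyEq
        (hev2 x hx h)
    · exact ((contDiff_const.mul hsm).contDiffAt).congr_of_eventuallyEq (hev1 x h)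
  · intro x hx
    rcases key x hx with h | h
    · rw [lap_congr_nhds (hev2 x hx h), hm x h,
        (harm_smooth hUo hsol.sup hsol.sub ⟨hx, hne x h⟩).2, neg_zero]
    · have hT := ker_test ht (hsub x h)
      rw [lap_congr_nhds (hev1 x h), lap_smul hsm, lap_av hw ht, int_ind hT,
        green_eq hG (hT.mono hb)]
      simp only [m, norm_sub_rev x x₀]; ring
  · intro x hx
    rcases key x hx with h | h
    · rw [hJG x hx h]; exact hG.2.1 x ⟨hx, hne x h⟩
    · simp only [J, if_pos h]
      refine mul_pos (inv_pos.2 hZ) ?_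
      -- a small ball avoiding the pole
      have : ∃ p ∈ ball x (t / 4), p ≠ x₀ := by
        by_contra hcon
        push Not at hcon
        have hx0 := hcon x (mem_ball_self (by positivity))
        have hN0 : 0 < N := by omega
        have := hcon (x + (t / 8) • EuclideanSpace.single (⟨0, hN0⟩ : Fin N) (1:ℝ)) (by
          rw [mem_ball, dist_eq_norm, add_sub_cancel_left, norm_smul]
          simp [abs_of_pos ht]; linarith)
        rw [hx0] at this
        simp [ht.ne'] at this
      obtain ⟨p, hp, hpx⟩ := this
      set r := min (t / 4) (dist p x₀ / 2) with hr
      have hdp : 0 < dist p x₀ := dist_pos.2 hpx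
      have hr0 : 0 < r := lt_min (by positivity) (by positivity)
      rw [mem_ball] at hp
      have hpb : closedBall p r ⊆ closedBall x (t / 2) :=
        closedBall_subset_closedBall' (by have := min_le_left (t / 4) (dist p x₀ / 2); linarith)
      have hpU : closedBall p r ⊆ Ω \ {x₀} := by
        intro z hz
        refine ⟨hb (hsub x h (closedBall_subset_closedBall (by linarith) (hpb hz))), ?_⟩
        rintro rfl
        rw [mem_closedBall, dist_comm] at hz
        have := min_le_right (t / 4) (dist p z / 2); linarith
      obtain ⟨q, hq, hqm⟩ := (isCompact_closedBall p r).exists_isMinOn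
        ⟨p, mem_closedBall_self hr0.le⟩ (hG.1.mono hpU)
      have hGq := hG.2.1 q (hpU hq)
      have hw0 : ∀ z ∈ ball x t, z ≠ x₀ → w z = G z ∧ 0 < G z := by
        intro z hz hzx
        have hz' := hsub x h (ball_subset_closedBall hz)
        exact ⟨indicator_of_mem hz' _, hG.2.1 z ⟨hb hz', hzx⟩⟩
      -- replace the value at the pole by zero
      set w' : ES N → ℝ := fun z => if z = x₀ then 0 else w z
      have hae : w' =ᵐ[volume] w := by
        haveI : Nontrivial (ES N) := ⟨⟨p, x₀, hpx⟩⟩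
        have : ∀ᵐ z : ES N, z ≠ x₀ := by
          rw [ae_iff]; simp
        filter_upwards [this] with z hz
        simp only [w', if_neg hz]
      have hav : av kap t w x = av kap t w' x := by
        unfold av
        congr 1
        refine integral_congr_ae ?_
        filter_upwards [hae] with z hz
        rw [hz]
      rw [hav]
      refine lt_of_lt_of_le ?_ (av_lower (m := G q) (p := p) ht hr0
        ((hwi _).congr (ae_restrict_of_ae hae.symm)) ?_ ((ball_subset_closedBall).trans hpb) ?_
        hGq.le)
      · have := vb_pos (N := N)
        have : 0 < kap (1 / 4) := kap_pos (by norm_num)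
        positivity
      · intro z hz
        simp only [w']
        split_ifs with h'
        · exact le_rfl
        · rw [(hw0 z hz h').1]; exact (hw0 z hz h').2.le
      · intro z hz
        have hz' := ball_subset_closedBall hz
        have hzx : z ≠ x₀ := (hpU hz').2
        have hzb : z ∈ ball x t := by
          have := hpb hz'; rw [mem_closedBall] at this; rw [mem_ball]; linarith
        simp only [w', if_neg hzx]
        rw [(hw0 z hzb hzx).1]
        exact hqm hz'
  · intro p hp
    have hpΩ : p ∉ Ω := by
      intro h
      exact (hΩ.frontier_eq ▸ hp : p ∈ closure Ω \ Ω).2 h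
    have hpb : p ∉ closedBall x₀ t := fun h =>
      hpΩ (hb (closedBall_subset_closedBall (by linarith) h))
    have h1 := hG.2.2.2.1 p hp
    have e1 : 𝓝[Ω \ {x₀}] p = 𝓝[Ω] p := by
      have hx : {x₀}ᶜ ∈ 𝓝 p := isOpen_compl_singleton.mem_nhds (hne p hpb)
      rw [diff_eq, nhdsWithin_inter', ← nhdsWithin_inter', nhdsWithin_inter_of_mem']
      exact mem_nhdsWithin_of_mem_nhds hx
    rw [e1] at h1
    refine h1.congr' ?_
    filter_upwards [self_mem_nhdsWithin,
      mem_nhdsWithin_of_mem_nhds (isClosed_closedBall.isOpen_compl.mem_nhds hpb)] with z a b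
    exact (hJG z a b).symm

end Part11

section Part12
variable {N : ℕ}

open scoped Manifold ContDiff in
lemma exists_cut {C U : Set (ES N)} (hC : IsClosed C) (hU : IsOpen U) (h : C ⊆ U) :
    ∃ χ : ES N → ℝ, ContDiff ℝ (⊤ : ℕ∞) χ ∧ (∀ x, 0 ≤ χ x ∧ χ x ≤ 1) ∧
      (∀ x ∈ C, χ =ᶠ[𝓝 x] fun _ => 1) ∧ ∀ x ∉ U, χ =ᶠ[𝓝 x] fun _ => 0 := by
  obtain ⟨f, h0, h1, h2⟩ := exists_contMDiffMap_zero_one_nhds_of_isClosed (n := (⊤ : ℕ∞))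
    𝓘(ℝ, ES N) hU.isClosed_compl hC (by
      rw [Set.disjoint_left]; intro x hx hx'; exact hx (h hx'))
  refine ⟨f, f.contMDiff.contDiff, fun x => h2 x, fun x hx => ?_, fun x hx => ?_⟩
  · exact (eventually_nhdsSet_iff_forall.1 h1) x hx
  · exact (eventually_nhdsSet_iff_forall.1 h0) x hx

lemma glob_smooth {u : ES N → ℝ} (h : ∀ x, ContDiffAt ℝ (⊤ : ℕ∞) u x) :
    ContDiff ℝ (⊤ : ℕ∞) u := contDiff_iff_contDiffAt.2 h

lemma weak_smooth {Ω : Set (ES N)} (hΩ : IsOpen Ω) {u φ : ES N → ℝ}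
    (hu : ∀ x ∈ Ω, ContDiffAt ℝ (⊤ : ℕ∞) u x) (hφ : IsTestFun Ω φ) :
    ∫ z, u z * lap φ z = ∫ z, lap u z * φ z := by
  obtain ⟨χ, c1, -, c3, c4⟩ := exists_cut (isClosed_tsupport φ) hΩ hφ.2.2
  have hg : ContDiff ℝ (⊤ : ℕ∞) (fun z => χ z * u z) := by
    refine glob_smooth fun x => ?_
    by_cases hx : x ∈ Ω
    · exact c1.contDiffAt.mul (hu x hx)
    · refine (contDiffAt_const (c := (0:ℝ))).congr_of_eventuallyEq ?_
      filter_upwards [c4 x hx] with z hz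
      rw [hz, zero_mul]
  have h := lap_symm hg hφ.1 hφ.hcs
  have e : ∀ x ∈ tsupport φ, (fun z => χ z * u z) =ᶠ[𝓝 x] u := by
    intro x hx
    filter_upwards [c3 x hx] with z hz
    rw [hz, one_mul]
  calc ∫ z, u z * lap φ z = ∫ z, χ z * u z * lap φ z := by
        refine integral_congr_ae (Eventually.of_forall fun z => ?_)
        by_cases hz : z ∈ tsupport φ
        · have := (e z hz).self_of_nhds
          simp only at this ⊢; rw [this]
        · simp only [lap_off hz, mul_zero]
    _ = ∫ z, lap (fun z => χ z * u z) z * φ z := h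
    _ = _ := by
        refine integral_congr_ae (Eventually.of_forall fun z => ?_)
        by_cases hz : z ∈ tsupport φ
        · simp only; rw [lap_congr_nhds (e z hz)]
        · simp only [image_eq_zero_of_notMem_tsupport hz, mul_zero]

lemma mp_out (hN : 2 ≤ N) {Ω F : Set (ES N)} (hΩ : IsOpen Ω) (hbd : Bornology.IsBounded Ω)
    (hF : IsClosed F) {V w : ES N → ℝ} (hV : ∀ z ∈ Ω, 0 ≤ V z) (h : Sup (Ω \ F) V w)
    (hc : ContinuousOn w Ω)
    (hb1 : ∀ p ∈ frontier Ω, p ∉ interior F → ∀ ε > 0, ∀ᶠ x in 𝓝[Ω] p, -ε < w x)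
    (hb2 : ∀ p ∈ Ω, p ∈ F → p ∉ interior F → 0 ≤ w p) : ∀ x ∈ Ω, x ∉ F → 0 ≤ w x := by
  intro x hx hxF
  have hD : IsOpen (Ω \ F) := hΩ.sdiff hF
  refine max_princ hN hD (hbd.subset diff_subset) (fun z hz => hV z hz.1) h ?_ x ⟨hx, hxF⟩
  intro p hp ε hε
  rw [hD.frontier_eq] at hp
  have hpF : p ∉ interior F := by
    have : p ∈ closure Fᶜ := closure_mono (fun z hz => hz.2) hp.1
    rwa [closure_compl] at this
  by_cases hpΩ : p ∈ Ω
  · have hpF' : p ∈ F := by by_contra h'; exact hp.2 ⟨hpΩ, h'⟩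
    have h0 := hb2 p hpΩ hpF' hpF
    have := (hc.continuousAt (hΩ.mem_nhds hpΩ)).tendsto.eventually (lt_mem_nhds (show -ε < w p by linarith))
    exact this.filter_mono nhdsWithin_le_nhds
  · have hpf : p ∈ frontier Ω := by
      rw [hΩ.frontier_eq]; exact ⟨closure_mono diff_subset hp.1, hpΩ⟩
    exact (hb1 p hpf hpF ε hε).filter_mono (nhdsWithin_mono _ diff_subset)

structure Glo (Ω : Set (ES N)) (y : ES N) (d : ES N → ℝ) (A R : ℝ) (V u : ES N → ℝ) : Prop where
  sol : Sol Ω V u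
  van : ∀ p ∈ frontier Ω, p ≠ y → Tendsto u (𝓝[Ω] p) (𝓝 0)
  vok : Vok Ω V
  vb : VB V d A y R

structure Ctx (Ω : Set (ES N)) (x₀ y e : ES N) (d : ES N → ℝ) (M R t A : ℝ) (m J K : ES N → ℝ) :
    Prop where
  hN : 2 ≤ N
  op : IsOpen Ω
  bd : Bornology.IsBounded Ω
  lg : LG Ω e d M y R
  hA : 0 ≤ A
  hy : y ∈ frontier Ω
  gr : GR Ω x₀ t m J
  far : ∀ x ∈ ball y R, x ∉ closedBall x₀ t
  kg : Glo Ω y d A R (fun _ => 0) K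

variable {Ω : Set (ES N)} {x₀ y e : ES N} {d : ES N → ℝ} {M R t A : ℝ} {m J K : ES N → ℝ}

lemma Glo.pm {V u : ES N → ℝ} (h : Glo Ω y d A R V u) : PM Ω V u y R :=
  ⟨h.sol.mono inter_subset_left, fun p hp => h.van p hp.1⟩

lemma GR.cont (h : GR Ω x₀ t m J) : ContinuousOn J Ω := fun x hx =>
  (h.sm x hx).continuousAt.continuousWithinAt

lemma GR.weak (h : GR Ω x₀ t m J) (hΩ : IsOpen Ω) {φ : ES N → ℝ} (hφ : IsTestFun Ω φ) :
    ∫ z, J z * lap φ z = - ∫ z, m z * φ z := by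
  rw [weak_smooth hΩ h.sm hφ, ← integral_neg]
  refine integral_congr_ae (Eventually.of_forall fun z => ?_)
  by_cases hz : z ∈ Ω
  · simp only [h.lp z hz, neg_mul]
  · simp only [hφ.off hz, mul_zero, neg_zero]

lemma GR.sup (h : GR Ω x₀ t m J) (hΩ : IsOpen Ω) : Sup Ω (fun _ => 0) J := by
  refine ⟨h.cont, fun φ hφ h0 => ?_⟩
  rw [h.weak hΩ hφ]
  have : 0 ≤ ∫ z, m z * φ z := integral_nonneg fun z => mul_nonneg (h.m0 z) (h0 z)
  simp; exact this

lemma GR.sol (h : GR Ω x₀ t m J) (hΩ : IsOpen Ω) {U : Set (ES N)} (hU : U ⊆ Ω)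
    (hUt : ∀ x ∈ U, x ∉ closedBall x₀ t) : Sol U (fun _ => 0) J := by
  refine ⟨(h.sup hΩ).mono hU, ⟨(h.cont.mono hU).neg, fun φ hφ h0 => ?_⟩,
    fun z hz => h.pos z (hU hz), fun _ _ => le_rfl⟩
  have h1 := h.weak hΩ (hφ.mono hU)
  have h2 : ∫ z, m z * φ z = 0 := by
    rw [← integral_zero (ES N) ℝ]
    refine integral_congr_ae (Eventually.of_forall fun z => ?_)
    by_cases hz : z ∈ U
    · simp only [h.mz z (hUt z hz), zero_mul]
    · simp only [hφ.off hz, mul_zero]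
  simp only [neg_mul, integral_neg, h1, h2, zero_mul, integral_zero]; simp

lemma Ctx.jpm (c : Ctx Ω x₀ y e d M R t A m J K) : PM Ω (fun _ => 0) J y R :=
  ⟨c.gr.sol c.op inter_subset_left fun x hx => c.far x hx.2, fun p hp _ => c.gr.van p hp.1⟩

lemma Ctx.vb0 (c : Ctx Ω x₀ y e d M R t A m J K) : VB (fun _ => 0) d A y R := VB_zero c.hA

lemma Ctx.Ar (c : Ctx Ω x₀ y e d M R t A m J K) {r : ℝ} (hr : 0 < r) (hR : 16 * M * r ≤ R) :
    y + r • e ∈ Ω := by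
  have := c.lg.M1
  exact (c.lg.Ar hr (by nlinarith)).1

lemma Ctx.Ad (c : Ctx Ω x₀ y e d M R t A m J K) {r : ℝ} (hr : 0 < r) :
    dist (y + r • e) y = r := by rw [c.lg.dist_shift, abs_of_pos hr]

lemma lin_bd {u v : ES N → ℝ} {p : ES N} (hu : Tendsto u (𝓝[Ω] p) (𝓝 0)) (C : ℝ)
    (hv : ∀ x ∈ Ω, 0 ≤ v x) {ε : ℝ} (hε : 0 < ε) :
    ∀ᶠ x in 𝓝[Ω] p, -ε < v x - C * u x := by
  have h1 : Tendsto (fun x => C * u x) (𝓝[Ω] p) (𝓝 0) := by simpa using hu.const_mul C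
  filter_upwards [h1.eventually (gt_mem_nhds hε), self_mem_nhdsWithin] with x h2 h3
  have := hv x h3
  linarith

/-- Global comparison away from the pole. -/
lemma Ctx.cmp (c : Ctx Ω x₀ y e d M R t A m J K) : ∃ C ≥ (1:ℝ), ∀ V1 V2 u v : ES N → ℝ,
    Glo Ω y d A R V1 u → Glo Ω y d A R V2 v → (∀ z ∈ Ω, V2 z ≤ V1 z) → ∀ r, 0 < r →
    16 * M * r ≤ R → ∀ x ∈ Ω, r ≤ dist x y →
      u x * v (y + r • e) ≤ C * u (y + r • e) * v x := by
  obtain ⟨C, hC, h⟩ := shell_bhp N c.hA c.lg.M1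
  refine ⟨C, hC, fun V1 V2 u v hu hv h12 r hr hR x hx hxr => ?_⟩
  have sI : Ω ∩ ball y R ⊆ Ω := inter_subset_left
  have hs := h Ω e d y R V1 V2 u v r c.op c.lg hu.vb hv.vb (hu.vok.mono sI) (hv.vok.mono sI)
    (fun z hz => h12 z hz.1) hu.pm hv.pm hr hR
  by_cases hx2 : dist x y ≤ 2 * r
  · exact hs x hx hxr hx2
  have hAr := c.Ar hr hR
  have uA := hu.sol.pos _ hAr
  have vA := hv.sol.pos _ hAr
  have hw : Sup Ω V2 (fun z => (C * u (y + r • e)) * v z - v (y + r • e) * u z + 0) :=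
    Sup.combo c.op hu.vok hv.vok h12 hu.sol.sub (fun z hz => (hu.sol.pos z hz).le) hv.sol.sup
      (by positivity) vA.le le_rfl
  have := mp_out c.hN c.op c.bd (F := closedBall y r) isClosed_closedBall hv.vok.nn
    (hw.mono diff_subset) hw.1 ?_ ?_ x hx (by rw [mem_closedBall]; linarith)
  · linarith
  · intro p hp hpi ε hε
    have hpy : p ≠ y := by
      rintro rfl
      exact hpi (mem_interior_iff_mem_nhds.2 (closedBall_mem_nhds _ hr))
    have := lin_bd (Ω := Ω) (v := fun z => (C * u (y + r • e)) * v z)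
      (hu.van p hp hpy) (v (y + r • e))
      (fun z hz => by have := hv.sol.pos z hz; positivity) hε
    simpa using this
  · intro p hp hpF hpi
    have hpr : r ≤ dist p y := by
      by_contra hlt
      exact hpi (mem_interior_iff_mem_nhds.2
        (mem_of_superset (isOpen_ball.mem_nhds (mem_ball.2 (not_le.1 hlt))) ball_subset_closedBall))
    rw [mem_closedBall] at hpF
    have := hs p hp hpr (by linarith)
    linarith

lemma Ctx.car (c : Ctx Ω x₀ y e d M R t A m J K) : ∃ C ≥ (1:ℝ), ∀ V u : ES N → ℝ,
    Glo Ω y d A R V u → ∀ r, 0 < r →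
    16 * M * r ≤ R → ∀ x ∈ Ω, r ≤ dist x y → u x ≤ C * u (y + r • e) := by
  obtain ⟨C, hC, h⟩ := shell_car N c.hA c.lg.M1
  refine ⟨C, hC, fun V u hu r hr hR x hx hxr => ?_⟩
  have hs := h Ω e d y R V u r c.op c.lg hu.vb hu.pm hr hR
  by_cases hx2 : dist x y ≤ 2 * r
  · exact hs x hx hxr hx2
  have hAr := c.Ar hr hR
  have uA := hu.sol.pos _ hAr
  have hw : Sup Ω V (fun z => 0 * u z - 1 * u z + C * u (y + r • e)) :=
    Sup.combo c.op hu.vok hu.vok (fun _ _ => le_rfl) hu.sol.sub (fun z hz => (hu.sol.pos z hz).le)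
      hu.sol.sup le_rfl zero_le_one (by positivity)
  have := mp_out c.hN c.op c.bd (F := closedBall y r) isClosed_closedBall hu.vok.nn
    (hw.mono diff_subset) hw.1 ?_ ?_ x hx (by rw [mem_closedBall]; linarith)
  · linarith
  · intro p hp hpi ε hε
    have hpy : p ≠ y := by
      rintro rfl
      exact hpi (mem_interior_iff_mem_nhds.2 (closedBall_mem_nhds _ hr))
    have := lin_bd (Ω := Ω) (v := fun z => C * u (y + r • e))
      (hu.van p hp hpy) 1 (fun z hz => by positivity) hε
    filter_upwards [this] with z hz
    linarith
  · intro p hp hpF hpi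
    have hpr : r ≤ dist p y := by
      by_contra hlt
      exact hpi (mem_interior_iff_mem_nhds.2
        (mem_of_superset (isOpen_ball.mem_nhds (mem_ball.2 (not_le.1 hlt))) ball_subset_closedBall))
    rw [mem_closedBall] at hpF
    have := hs p hp hpr (by linarith)
    linarith

lemma Ctx.jout (c : Ctx Ω x₀ y e d M R t A m J K) : ∃ C ≥ (1:ℝ), ∀ r, 0 < r →
    16 * M * r ≤ R → ∀ x ∈ Ω, r ≤ dist x y →
      K x * J (y + r • e) ≤ C * K (y + r • e) * J x := by
  obtain ⟨C, hC, h⟩ := shell_bhp N c.hA c.lg.M1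
  refine ⟨C, hC, fun r hr hR x hx hxr => ?_⟩
  have sI : Ω ∩ ball y R ⊆ Ω := inter_subset_left
  have hs := h Ω e d y R _ _ K J r c.op c.lg c.vb0 c.vb0 (Vok_zero _) (Vok_zero _)
    (fun z hz => le_rfl) c.kg.pm c.jpm hr hR
  by_cases hx2 : dist x y ≤ 2 * r
  · exact hs x hx hxr hx2
  have hAr := c.Ar hr hR
  have uA := c.kg.sol.pos _ hAr
  have vA := c.gr.pos _ hAr
  have hw : Sup Ω (fun _ => 0) (fun z => (C * K (y + r • e)) * J z - J (y + r • e) * K z + 0) :=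
    Sup.combo c.op (Vok_zero _) (Vok_zero _) (fun _ _ => le_rfl) c.kg.sol.sub
      (fun z hz => (c.kg.sol.pos z hz).le) (c.gr.sup c.op)
      (by positivity) vA.le le_rfl
  have := mp_out c.hN c.op c.bd (F := closedBall y r) isClosed_closedBall (fun _ _ => le_rfl)
    (hw.mono diff_subset) hw.1 ?_ ?_ x hx (by rw [mem_closedBall]; linarith)
  · linarith
  · intro p hp hpi ε hε
    have hpy : p ≠ y := by
      rintro rfl
      exact hpi (mem_interior_iff_mem_nhds.2 (closedBall_mem_nhds _ hr))
    have := lin_bd (Ω := Ω) (v := fun z => (C * K (y + r • e)) * J z)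
      (c.kg.van p hp hpy) (J (y + r • e))
      (fun z hz => by have := c.gr.pos z hz; positivity) hε
    simpa using this
  · intro p hp hpF hpi
    have hpr : r ≤ dist p y := by
      by_contra hlt
      exact hpi (mem_interior_iff_mem_nhds.2
        (mem_of_superset (isOpen_ball.mem_nhds (mem_ball.2 (not_le.1 hlt))) ball_subset_closedBall))
    rw [mem_closedBall] at hpF
    have := hs p hp hpr (by linarith)
    linarith

lemma Ctx.jin (c : Ctx Ω x₀ y e d M R t A m J K) : ∃ C ≥ (1:ℝ), ∀ r, 0 < r →
    16 * M * r ≤ R → ∀ x ∈ Ω, dist x y ≤ r →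
      J x * K (y + r • e) ≤ C * J (y + r • e) * K x := by
  obtain ⟨C, hC, h⟩ := shell_bhp N c.hA c.lg.M1
  refine ⟨C, hC, fun r hr hR x hx hxr => ?_⟩
  have hM := c.lg.M1
  have hs := h Ω e d y R _ _ J K r c.op c.lg c.vb0 c.vb0 (Vok_zero _) (Vok_zero _)
    (fun z hz => le_rfl) c.jpm c.kg.pm hr hR
  by_cases hx2 : r ≤ dist x y
  · exact hs x hx hx2 (by linarith)
  have hAr := c.Ar hr hR
  have uA := c.kg.sol.pos _ hAr
  have vA := c.gr.pos _ hAr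
  have hRr : r < R := by nlinarith
  have hUo : IsOpen (Ω ∩ ball y R) := c.op.inter isOpen_ball
  have hw : Sup (Ω ∩ ball y R) (fun _ => 0)
      (fun z => (C * J (y + r • e)) * K z - K (y + r • e) * J z + 0) :=
    Sup.combo hUo (Vok_zero _) (Vok_zero _) (fun _ _ => le_rfl) c.jpm.sol.sub
      (fun z hz => (c.jpm.sol.pos z hz).le) c.kg.pm.sol.sup
      (by positivity) uA.le le_rfl
  have hcont : ContinuousOn (fun z => (C * J (y + r • e)) * K z - K (y + r • e) * J z + 0) Ω :=
    ((continuousOn_const.mul c.kg.sol.sup.1).sub (continuousOn_const.mul c.gr.cont)).add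
      continuousOn_const
  have := mp_out c.hN c.op c.bd (F := (ball y r)ᶜ) isOpen_ball.isClosed_compl
    (fun _ _ => le_rfl) (hw.mono ?_) hcont ?_ ?_ x hx (by simpa using hx2)
  · linarith
  · intro z hz
    refine ⟨hz.1, ball_subset_ball hRr.le ?_⟩
    simpa using hz.2
  · intro p hp hpi ε hε
    have := lin_bd (Ω := Ω) (v := fun z => (C * J (y + r • e)) * K z)
      (c.gr.van p hp) (K (y + r • e))
      (fun z hz => by have := c.kg.sol.pos z hz; positivity) hε
    simpa using this
  · intro p hp hpF hpi
    have hpr : dist p y ≤ r := by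
      by_contra hlt
      refine hpi (mem_interior_iff_mem_nhds.2 (mem_of_superset
        (isClosed_closedBall.isOpen_compl.mem_nhds (x := p) (s := (closedBall y r)ᶜ) ?_) ?_))
      · simpa using hlt
      · exact compl_subset_compl.2 ball_subset_closedBall
    have hpr' : r ≤ dist p y := by simpa using hpF
    have := hs p hp hpr' (by linarith)
    linarith

/-- Decay of the Green function at the boundary. -/
lemma Ctx.jdec (c : Ctx Ω x₀ y e d M R t A m J K) {ε : ℝ} (hε : 0 < ε) : ∃ k : ℕ, ∀ s, 0 < s →
    16 * M * s ≤ R → J (y + (s / 16 ^ (k + 1)) • e) ≤ ε * J (y + s • e) := by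
  obtain ⟨C, hC, hcar⟩ := carleson N c.hA c.lg.M1
  have hM := c.lg.M1
  have hv := vb_pos (N := N)
  have hk4 : 0 < kap (1 / 4) := kap_pos (by norm_num)
  have hZ := Zk_pos (N := N)
  set θ : ℝ := (kap (1 / 4) * vb N * ((1 / (16 * M)) / (1 / 2)) ^ N) / (Real.exp (0 / 4) * Zk N)
    with hθ
  have hθ0 : 0 < θ := by positivity
  have hps : PS Ω (fun _ => 0) J y R :=
    ⟨c.jpm.sol, fun p hp => c.gr.van p hp.1⟩
  have hext := hps.ext c.op
  have hg0 : ∀ x, 0 ≤ Ω.indicator J x := fun x =>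
    indicator_nonneg (fun z hz => (c.gr.pos z hz).le) x
  -- one step
  have step : ∀ ρ mm : ℝ, 0 < ρ → ρ ≤ R → 0 < mm → (∀ x ∈ ball y ρ, Ω.indicator J x ≤ mm) →
      ∀ x ∈ ball y (ρ / 16), Ω.indicator J x ≤ (1 - θ) * mm := by
    intro ρ mm hρ hρR hmm hle x hx
    rw [mem_ball] at hx
    have hw : Sup (ball y R) (fun _ => 0) (fun z => - Ω.indicator J z + mm) :=
      Sup.add_const isOpen_ball (Vok_zero _) hext hmm.le
    have hcl : closedBall x (ρ / 2) ⊆ ball y ρ := closedBall_subset_ball' (by linarith)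
    have := hw.weakHarnack (x := x) (R := ρ / 2) (p := y - (ρ / 8) • e) (r := ρ / (16 * M)) (L := 0)
      (m := mm)
      (by positivity) (by positivity) le_rfl (hcl.trans (ball_subset_ball hρR)) (by simp)
      (fun z hz => by have := hle z (hcl hz); linarith) ?_ ?_ hmm.le
    · have e1 : ρ / (16 * M) / (ρ / 2) = (1 / (16 * M)) / (1 / 2) := by field_simp
      rw [e1] at this
      have e2 : mm * (kap (1 / 4) * vb N * (1 / (16 * M) / (1 / 2)) ^ N) / (Real.exp (0 / 4) * Zk N)
        = θ * mm := by rw [hθ]; ring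
      rw [e2] at this
      linarith
    · -- geometry: small exterior ball inside
      have h16 : ρ / (16 * M) ≤ ρ / 16 := by
        rw [div_le_div_iff₀ (by positivity) (by positivity)]; nlinarith
      have hde : dist (y - (ρ / 8) • e) y = ρ / 8 := by
        rw [sub_eq_add_neg, ← neg_smul, c.lg.dist_shift, abs_neg, abs_of_pos (by positivity)]
      refine ball_subset_closedBall.trans (closedBall_subset_closedBall' ?_)
      have := dist_triangle (y - (ρ / 8) • e) y x
      rw [dist_comm y x] at this
      linarith
    · intro z hz
      rw [mem_ball] at hz
      have hdz : d z < 0 := by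
        have h1 := c.lg.lip z (y - (ρ / 8) • e)
        have h2 : d (y - (ρ / 8) • e) = - (ρ / 8) := by
          rw [sub_eq_add_neg, ← neg_smul, c.lg.shift, c.lg.dz]; ring
        have h3 := (abs_le.1 h1).2
        rw [h2] at h3
        have h4 : M * dist z (y - (ρ / 8) • e) < M * (ρ / (16 * M)) := by gcongr
        have h5 : M * (ρ / (16 * M)) = ρ / 16 := by field_simp
        linarith
      have hzb : z ∈ ball y R := by
        have hde : dist (y - (ρ / 8) • e) y = ρ / 8 := by
          rw [sub_eq_add_neg, ← neg_smul, c.lg.dist_shift, abs_neg, abs_of_pos (by positivity)]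
        have h16 : ρ / (16 * M) ≤ ρ / 16 := by
          rw [div_le_div_iff₀ (by positivity) (by positivity)]; nlinarith
        have := dist_triangle z (y - (ρ / 8) • e) y
        rw [mem_ball]; linarith
      have : z ∉ Ω := fun h => by
        have := (c.lg.mem z hzb).1 h; linarith
      rw [indicator_of_notMem this]; simp
  -- we may assume θ < 1
  have hθ1 : θ < 1 ∨ 1 ≤ θ := lt_or_ge _ _
  set q := max (1 - θ) (1 / 2) with hq
  have hq0 : 0 < q := lt_of_lt_of_le (by norm_num) (le_max_right _ _)
  have hq1 : q < 1 := max_lt (by linarith) (by norm_num)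
  have iter : ∀ (k : ℕ) (s : ℝ), 0 < s → 16 * M * s ≤ R →
      ∀ x ∈ ball y (s / 16 ^ k), Ω.indicator J x ≤ q ^ k * (C * J (y + s • e)) := by
    intro k
    induction k with
    | zero =>
      intro s hs hR x hx
      have hJ := c.gr.pos _ (c.Ar hs hR)
      simp only [pow_zero, div_one, one_mul] at hx ⊢
      by_cases hxΩ : x ∈ Ω
      · rw [indicator_of_mem hxΩ]
        exact hcar Ω e d y R _ J s c.op c.lg c.vb0 hps hs hR x ⟨hxΩ, hx⟩
      · rw [indicator_of_notMem hxΩ]; positivity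
    | succ k ih =>
      intro s hs hR x hx
      have hJ := c.gr.pos _ (c.Ar hs hR)
      have h1 := step (s / 16 ^ k) (q ^ k * (C * J (y + s • e))) (by positivity) ?_ (by positivity)
        (ih s hs hR) x (by rwa [div_div, ← pow_succ])
      · refine h1.trans ?_
        rw [pow_succ]
        have : (1 - θ) * (q ^ k * (C * J (y + s • e))) ≤ q * (q ^ k * (C * J (y + s • e))) := by
          gcongr; exact le_max_left _ _
        linarith
      · have : s / 16 ^ k ≤ s := div_le_self hs.le (one_le_pow₀ (by norm_num))
        nlinarith
  obtain ⟨k, hk⟩ := exists_pow_lt_of_lt_one (show 0 < ε / C by positivity) hq1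
  refine ⟨k, fun s hs hR => ?_⟩
  have hJ := c.gr.pos _ (c.Ar hs hR)
  have hs' : 0 < s / 16 ^ (k + 1) := by positivity
  have hle : s / 16 ^ (k + 1) ≤ s := div_le_self hs.le (one_le_pow₀ (by norm_num))
  have hA' : y + (s / 16 ^ (k + 1)) • e ∈ Ω := c.Ar hs' (by nlinarith)
  have := iter k s hs hR (y + (s / 16 ^ (k + 1)) • e) (by
    rw [mem_ball, c.Ad hs', pow_succ]
    rw [div_lt_div_iff₀ (by positivity) (by positivity)]
    have : (0:ℝ) < s * 16 ^ k := by positivity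
    nlinarith)
  rw [indicator_of_mem hA'] at this
  calc _ ≤ _ := this
    _ ≤ ε / C * (C * J (y + s • e)) := by gcongr
    _ = _ := by field_simp

end Part12

/-! ### Part 13 : truncated Green functions -/

section Part13
variable {N : ℕ}

def st1 (s : ℝ) : ℝ := Real.smoothTransition (1 - s)

lemma st1_prof : Prof st1 where
  smooth := Real.smoothTransition.contDiff.comp (contDiff_const.sub contDiff_id)
  nonneg s := Real.smoothTransition.nonneg _
  zero s hs := Real.smoothTransition.zero_of_nonpos (by linarith)
  anti a b hab := Real.smoothTransition.monotone (by linarith)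

lemma st1_le (s : ℝ) : st1 s ≤ 1 := Real.smoothTransition.le_one _

lemma st1_one {s : ℝ} (hs : s ≤ 0) : st1 s = 1 :=
  Real.smoothTransition.one_of_one_le (by linarith)

/-- smooth truncation -/
def gp (ε s : ℝ) : ℝ := st1 (2 - s / ε)
def gg (ε s : ℝ) : ℝ := 2 * ε * mpr st1 (2 - s / ε)

lemma gp_smooth (ε : ℝ) : ContDiff ℝ (⊤ : ℕ∞) (gp ε) :=
  st1_prof.smooth.comp (contDiff_const.sub (contDiff_id.div_const ε))

lemma gg_smooth (ε : ℝ) : ContDiff ℝ (⊤ : ℕ∞) (gg ε) :=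
  contDiff_const.mul ((mpr_smooth st1_prof).comp (contDiff_const.sub (contDiff_id.div_const ε)))

lemma gg_deriv {ε : ℝ} (hε : 0 < ε) (s : ℝ) : HasDerivAt (gg ε) (gp ε s) s := by
  have h1 : HasDerivAt (fun s : ℝ => 2 - s / ε) (-(1 / ε)) s :=
    ((hasDerivAt_id s).div_const ε).const_sub 2
  have h2 := ((mpr_hasDeriv st1_prof (2 - s / ε)).comp s h1).const_mul (2 * ε)
  refine h2.congr_deriv ?_
  unfold gp; field_simp

lemma gp_nonneg (ε s : ℝ) : 0 ≤ gp ε s := st1_prof.nonneg _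
lemma gp_le (ε s : ℝ) : gp ε s ≤ 1 := st1_le _

lemma gp_mono {ε : ℝ} (hε : 0 < ε) : Monotone (gp ε) := fun a b h => by
  apply st1_prof.anti
  gcongr

lemma gp_zero {ε s : ℝ} (hε : 0 < ε) (h : s ≤ ε) : gp ε s = 0 := by
  apply st1_prof.zero
  have : s / ε ≤ 1 := by rw [div_le_one hε]; exact h
  linarith

lemma gp_one {ε s : ℝ} (hε : 0 < ε) (h : 2 * ε ≤ s) : gp ε s = 1 := by
  apply st1_one
  have : 2 ≤ s / ε := by rw [le_div_iff₀ hε]; exact h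
  linarith

lemma gp_deriv {ε : ℝ} (s : ℝ) : HasDerivAt (gp ε) (deriv (gp ε) s) s :=
  ((gp_smooth ε).differentiable (by simp) s).hasDerivAt

lemma gp_deriv_nonneg {ε : ℝ} (hε : 0 < ε) (s : ℝ) : 0 ≤ deriv (gp ε) s :=
  (gp_mono hε).deriv_nonneg

lemma gp_deriv_zero {ε s : ℝ} (hε : 0 < ε) (h : s < ε ∨ 2 * ε < s) : deriv (gp ε) s = 0 := by
  rcases h with h | h
  · have : gp ε =ᶠ[𝓝 s] fun _ => 0 := by
      filter_upwards [Iio_mem_nhds h] with z hz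
      exact gp_zero hε (le_of_lt hz)
    rw [this.deriv_eq]; simp
  · have : gp ε =ᶠ[𝓝 s] fun _ => 1 := by
      filter_upwards [Ioi_mem_nhds h] with z hz
      exact gp_one hε (le_of_lt hz)
    rw [this.deriv_eq]; simp

lemma gg_zero {ε s : ℝ} (hε : 0 < ε) (h : s ≤ ε) : gg ε s = 0 := by
  unfold gg
  rw [mpr_zero st1_prof, mul_zero]
  have : s / ε ≤ 1 := by rw [div_le_one hε]; exact h
  linarith

lemma gg_mono {ε : ℝ} (hε : 0 < ε) : Monotone (gg ε) :=
  monotone_of_deriv_nonneg (fun s => (gg_deriv hε s).differentiableAt)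
    (fun s => by rw [(gg_deriv hε s).deriv]; exact gp_nonneg _ _)

lemma gg_nonneg {ε : ℝ} (hε : 0 < ε) (s : ℝ) : 0 ≤ gg ε s := by
  rcases le_total s ε with h | h
  · rw [gg_zero hε h]
  · rw [← gg_zero hε le_rfl]; exact gg_mono hε h

lemma gg_lip {ε : ℝ} (hε : 0 < ε) {a b : ℝ} (h : a ≤ b) : gg ε b - gg ε a ≤ b - a := by
  have : Monotone (fun s => s - gg ε s) :=
    monotone_of_deriv_nonneg (fun s => differentiableAt_id.sub (gg_deriv hε s).differentiableAt)
    (fun s => by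
      have hd : HasDerivAt (fun s => s - gg ε s) (1 - gp ε s) s :=
        (hasDerivAt_id s).sub (gg_deriv hε s)
      rw [hd.deriv]; have := gp_le ε s; linarith)
  have := this h
  simp only at this
  linarith

lemma gg_le {ε s : ℝ} (hε : 0 < ε) (hs : 0 ≤ s) : gg ε s ≤ s := by
  have := gg_lip hε hs
  rw [gg_zero hε hε.le] at this
  linarith

lemma gg_ge {ε : ℝ} (hε : 0 < ε) (s : ℝ) : s - 2 * ε ≤ gg ε s := by
  rcases le_total s (2 * ε) with h | h
  · have := gg_nonneg hε s; linarith
  · have : MonotoneOn (fun s => gg ε s - s) (Ici (2 * ε)) :=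
      monotoneOn_of_deriv_nonneg (convex_Ici _)
      ((gg_smooth ε).continuous.sub continuous_id).continuousOn
      (fun s _ => ((gg_deriv hε s).differentiableAt.sub differentiableAt_id).differentiableWithinAt)
      (fun s hs => by
        have hd : HasDerivAt (fun s => gg ε s - s) (gp ε s - 1) s :=
          (gg_deriv hε s).sub (hasDerivAt_id s)
        rw [hd.deriv]
        rw [interior_Ici] at hs
        rw [gp_one hε (le_of_lt hs)]; simp)
    have h1 := this (mem_Ici.2 le_rfl) (mem_Ici.2 h) h
    have h2 := gg_nonneg hε (2 * ε)
    simp only at h1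
    linarith

/-! chain rules -/

lemma dd_comp {w : ES N → ℝ} {g g' : ℝ → ℝ} {x : ES N} (hw : DifferentiableAt ℝ w x)
    (hg : ∀ s, HasDerivAt g (g' s) s) (i : Fin N) :
    dd i (fun z => g (w z)) x = g' (w x) * dd i w x := by
  have := ((hg (w x)).comp_hasFDerivAt x hw.hasFDerivAt).fderiv
  unfold dd
  have e : (fun z => g (w z)) = g ∘ w := rfl
  rw [e, this]; simp

lemma dd_mul {f g : ES N → ℝ} {x : ES N} (hf : DifferentiableAt ℝ f x)
    (hg : DifferentiableAt ℝ g x) (i : Fin N) :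
    dd i (fun z => f z * g z) x = f x * dd i g x + dd i f x * g x := by
  unfold dd
  have := (hf.hasFDerivAt.mul hg.hasFDerivAt).fderiv
  have e : (fun z => f z * g z) = f * g := rfl
  rw [e, this]; simp [mul_comm]

lemma smoothAt_nhds {w : ES N → ℝ} {x : ES N} (hw : ContDiffAt ℝ (⊤ : ℕ∞) w x) :
    ∀ᶠ z in 𝓝 x, DifferentiableAt ℝ w z := by
  have h2 : ContDiffAt ℝ 1 w x := hw.of_le (by exact_mod_cast le_top)
  filter_upwards [h2.eventually (by simp)] with z hz
  exact hz.differentiableAt (by simp)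

lemma dd_smoothAt {w : ES N → ℝ} {x : ES N} (hw : ContDiffAt ℝ (⊤ : ℕ∞) w x) (i : Fin N) :
    ContDiffAt ℝ (⊤ : ℕ∞) (dd i w) x := by
  have : ContDiffAt ℝ (⊤ : ℕ∞) (fderiv ℝ w) x := hw.fderiv_right (by simp)
  exact this.clm_apply contDiffAt_const

lemma dd_congr {f g : ES N → ℝ} {x : ES N} (h : f =ᶠ[𝓝 x] g) (i : Fin N) :
    dd i f x = dd i g x := by
  unfold dd; rw [h.fderiv_eq]

lemma lap_comp {w : ES N → ℝ} {g g' g'' : ℝ → ℝ} {x : ES N} (hw : ContDiffAt ℝ (⊤ : ℕ∞) w x)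
    (hg : ∀ s, HasDerivAt g (g' s) s) (hg' : ∀ s, HasDerivAt g' (g'' s) s) :
    lap (fun z => g (w z)) x = g' (w x) * lap w x + g'' (w x) * ∑ i, (dd i w x) ^ 2 := by
  rw [lap_eq, lap_eq, Finset.mul_sum, Finset.mul_sum, ← Finset.sum_add_distrib]
  refine Finset.sum_congr rfl fun i _ => ?_
  have e : dd i (fun z => g (w z)) =ᶠ[𝓝 x] fun z => g' (w z) * dd i w z := by
    filter_upwards [smoothAt_nhds hw] with z hz
    exact dd_comp hz hg i
  have hwx := (smoothAt_nhds hw).self_of_nhds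
  rw [dd_congr e, dd_mul (f := fun z => g' (w z)) ((hg' (w x)).differentiableAt.comp x hwx)
    (smoothAt_nhds (dd_smoothAt hw i)).self_of_nhds, dd_comp hwx hg']
  ring

lemma dd_lin {f g : ES N → ℝ} {x : ES N} (hf : DifferentiableAt ℝ f x)
    (hg : DifferentiableAt ℝ g x) (β : ℝ) (i : Fin N) :
    dd i (fun z => f z - β * g z) x = dd i f x - β * dd i g x := by
  unfold dd
  have := (hf.hasFDerivAt.sub (hg.hasFDerivAt.const_mul β)).fderiv
  have e : (fun z => f z - β * g z) = f - fun z => β * g z := rfl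
  rw [e, this]; simp

lemma lap_lin {f g : ES N → ℝ} {x : ES N} (hf : ContDiffAt ℝ (⊤ : ℕ∞) f x)
    (hg : ContDiffAt ℝ (⊤ : ℕ∞) g x) (β : ℝ) :
    lap (fun z => f z - β * g z) x = lap f x - β * lap g x := by
  rw [lap_eq, lap_eq, lap_eq, Finset.mul_sum, ← Finset.sum_sub_distrib]
  refine Finset.sum_congr rfl fun i _ => ?_
  have e : dd i (fun z => f z - β * g z) =ᶠ[𝓝 x] fun z => dd i f z - β * dd i g z := by
    filter_upwards [smoothAt_nhds hf, smoothAt_nhds hg] with z h1 h2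
    exact dd_lin h1 h2 β i
  rw [dd_congr e, dd_lin (smoothAt_nhds (dd_smoothAt hf i)).self_of_nhds
    (smoothAt_nhds (dd_smoothAt hg i)).self_of_nhds]

variable {Ω : Set (ES N)} {x₀ y e : ES N} {d : ES N → ℝ} {M R t A : ℝ} {m J K : ES N → ℝ}

lemma GR.compact (h : GR Ω x₀ t m J) (hbd : Bornology.IsBounded Ω) {ε : ℝ} (hε : 0 < ε) :
    IsCompact {z | z ∈ Ω ∧ ε ≤ J z} := by
  refine Metric.isCompact_of_isClosed_isBounded ?_ (hbd.subset fun z hz => hz.1)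
  refine isClosed_of_closure_subset fun z hz => ?_
  have hzc : z ∈ closure Ω := closure_mono (fun z hz => hz.1) hz
  have hfr : ∃ᶠ x in 𝓝 z, x ∈ Ω ∧ ε ≤ J x := mem_closure_iff_frequently.1 hz
  have key : ∀ l, Tendsto J (𝓝[Ω] z) (𝓝 l) → ε ≤ l := by
    intro l hl
    by_contra hlt
    push Not at hlt
    have h1 := hl.eventually (Iio_mem_nhds hlt)
    rw [eventually_nhdsWithin_iff] at h1
    obtain ⟨x, hx, hx'⟩ := (hfr.and_eventually h1).exists
    exact absurd (hx' hx.1) (not_lt.2 hx.2)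
  by_cases hzΩ : z ∈ Ω
  · exact ⟨hzΩ, key _ (h.cont z hzΩ)⟩
  · exfalso
    have : ε ≤ 0 := key 0 (h.van z ⟨hzc, fun hh => hzΩ (interior_subset hh)⟩)
    linarith

/-- truncated test function -/
def phi (Ω : Set (ES N)) (J K : ES N → ℝ) (ε β : ℝ) : ES N → ℝ :=
  Ω.indicator fun z => gg ε (J z - β * K z)

lemma Ctx.ksm (c : Ctx Ω x₀ y e d M R t A m J K) {x : ES N} (hx : x ∈ Ω) :
    ContDiffAt ℝ (⊤ : ℕ∞) K x ∧ lap K x = 0 :=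
  harm_smooth c.op c.kg.sol.sup c.kg.sol.sub hx

lemma phi_nonneg {ε : ℝ} (hε : 0 < ε) (β : ℝ) (x : ES N) : 0 ≤ phi Ω J K ε β x :=
  indicator_nonneg (fun _ _ => gg_nonneg hε _) x

lemma Ctx.phi_le (c : Ctx Ω x₀ y e d M R t A m J K) {ε β : ℝ} (hε : 0 < ε) (hβ : 0 ≤ β)
    {x : ES N} (hx : x ∈ Ω) : phi Ω J K ε β x ≤ J x := by
  unfold phi; rw [indicator_of_mem hx]
  have h1 : J x - β * K x ≤ J x := by
    have := c.kg.sol.pos x hx; nlinarith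
  exact (gg_mono hε h1).trans (gg_le hε (c.gr.pos x hx).le)

lemma Ctx.phi_ge {ε β : ℝ} (hε : 0 < ε)
    {x : ES N} (hx : x ∈ Ω) : J x - β * K x - 2 * ε ≤ phi Ω J K ε β x := by
  unfold phi; rw [indicator_of_mem hx]
  exact gg_ge hε _

lemma Ctx.phi_zero {ε β : ℝ} (hε : 0 < ε)
    {x : ES N} (hx : x ∈ Ω → J x ≤ β * K x) : phi Ω J K ε β x = 0 := by
  unfold phi
  by_cases h : x ∈ Ω
  · rw [indicator_of_mem h]; exact gg_zero hε (by have := hx h; linarith)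
  · rw [indicator_of_notMem h]

lemma Ctx.phi_test (c : Ctx Ω x₀ y e d M R t A m J K) {ε β : ℝ} (hε : 0 < ε) (hβ : 0 ≤ β) :
    IsTestFun Ω (phi Ω J K ε β) := by
  have hC := c.gr.compact c.bd hε
  have hs : tsupport (phi Ω J K ε β) ⊆ {z | z ∈ Ω ∧ ε ≤ J z} := by
    refine closure_minimal (fun z hz => ?_) hC.isClosed
    have hzΩ : z ∈ Ω := by
      by_contra h; exact hz (indicator_of_notMem h _)
    refine ⟨hzΩ, ?_⟩
    by_contra h
    push Not at h
    refine hz ?_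
    unfold phi; rw [indicator_of_mem hzΩ]
    refine gg_zero hε ?_
    have := c.kg.sol.pos z hzΩ
    nlinarith
  refine ⟨glob_smooth fun x => ?_, hC.of_isClosed_subset (isClosed_tsupport _) hs,
    hs.trans fun z hz => hz.1⟩
  by_cases hx : x ∈ Ω
  · have h1 : ContDiffAt ℝ (⊤ : ℕ∞) (fun z => gg ε (J z - β * K z)) x :=
      (gg_smooth ε).contDiffAt.comp x
        ((c.gr.sm x hx).sub (contDiffAt_const.mul (c.ksm hx).1))
    refine h1.congr_of_eventuallyEq ?_
    filter_upwards [c.op.mem_nhds hx] with z hz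
    exact indicator_of_mem hz _
  · have hx' : x ∉ tsupport (phi Ω J K ε β) := fun h => hx (hs h).1
    exact (contDiffAt_const (c := (0:ℝ))).congr_of_eventuallyEq
      (notMem_tsupport_iff_eventuallyEq.1 hx')

lemma Ctx.phi_lap (c : Ctx Ω x₀ y e d M R t A m J K) {ε β : ℝ} (hε : 0 < ε) {x : ES N}
    (hx : x ∈ Ω) : lap (phi Ω J K ε β) x = - gp ε (J x - β * K x) * m x +
      deriv (gp ε) (J x - β * K x) * ∑ i, (dd i (fun z => J z - β * K z) x) ^ 2 := by
  have e1 : phi Ω J K ε β =ᶠ[𝓝 x] fun z => gg ε (J z - β * K z) := by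
    filter_upwards [c.op.mem_nhds hx] with z hz
    exact indicator_of_mem hz _
  rw [lap_congr_nhds e1, lap_comp (w := fun z => J z - β * K z)
    ((c.gr.sm x hx).sub (contDiffAt_const.mul (c.ksm hx).1)) (gg_deriv hε) gp_deriv,
    lap_lin (c.gr.sm x hx) (c.ksm hx).1, (c.ksm hx).2, c.gr.lp x hx]
  ring

/-- the sweeping measure -/
def nu (Ω : Set (ES N)) (m J K : ES N → ℝ) (ε β : ℝ) (x : ES N) : ℝ :=
  lap (phi Ω J K ε β) x + m x

lemma Ctx.nu_nonneg (c : Ctx Ω x₀ y e d M R t A m J K) {ε β : ℝ} (hε : 0 < ε) (hβ : 0 ≤ β)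
    (x : ES N) : 0 ≤ nu Ω m J K ε β x := by
  unfold nu
  by_cases hx : x ∈ Ω
  · rw [c.phi_lap hε hx]
    have h1 := gp_le ε (J x - β * K x)
    have h2 := c.gr.m0 x
    have h3 := gp_deriv_nonneg hε (J x - β * K x)
    have h4 : 0 ≤ ∑ i, (dd i (fun z => J z - β * K z) x) ^ 2 :=
      Finset.sum_nonneg fun i _ => sq_nonneg _
    nlinarith [mul_nonneg h3 h4]
  · rw [(c.phi_test hε hβ).lap_off hx]
    have := c.gr.m0 x; linarith

lemma Ctx.nu_ne (c : Ctx Ω x₀ y e d M R t A m J K) {ε β : ℝ} (hε : 0 < ε) (hβ : 0 ≤ β)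
    (hm : ∀ x ∈ closedBall x₀ t, 2 * ε ≤ J x - β * K x)
    {x : ES N} (hx : nu Ω m J K ε β x ≠ 0) : x ∈ Ω ∧ ε ≤ J x - β * K x ∧
      J x - β * K x ≤ 2 * ε := by
  have hxΩ : x ∈ Ω := by
    by_contra h
    refine hx ?_
    unfold nu
    rw [(c.phi_test hε hβ).lap_off h, c.gr.mz x fun h' => h (c.gr.ball h'), zero_add]
  refine ⟨hxΩ, ?_⟩
  by_contra hc
  refine hx ?_
  unfold nu
  have hd : deriv (gp ε) (J x - β * K x) = 0 := by
    refine gp_deriv_zero hε ?_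
    by_contra h'
    push Not at h'
    exact hc h'
  rw [c.phi_lap hε hxΩ, hd]
  by_cases hxb : x ∈ closedBall x₀ t
  · rw [gp_one hε (hm x hxb)]; ring
  · rw [c.gr.mz x hxb]; ring

end Part13

/-! ### Part 14 : bump functions and annulus estimate -/

section Part14
variable {N : ℕ}

lemma tsupport_radial {κ : ℝ → ℝ} (h : ∀ s, 1 ≤ s → κ s = 0) {ρ : ℝ} (hρ : 0 < ρ) (p : ES N) :
    tsupport (fun z : ES N => κ ((ρ ^ 2)⁻¹ * ‖z - p‖ ^ 2)) ⊆ closedBall p ρ := by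
  refine closure_minimal (fun z hz => ?_) isClosed_closedBall
  by_contra hn
  rw [mem_closedBall, dist_eq_norm] at hn
  push Not at hn
  refine hz (h _ ?_)
  rw [inv_mul_eq_div, le_div_iff₀ (by positivity)]
  nlinarith

lemma radial_test {κ : ℝ → ℝ} (hs : ContDiff ℝ (⊤ : ℕ∞) κ) (h : ∀ s, 1 ≤ s → κ s = 0) {ρ : ℝ}
    (hρ : 0 < ρ) (p : ES N) {U : Set (ES N)} (hU : closedBall p ρ ⊆ U) :
    IsTestFun U (fun z : ES N => κ ((ρ ^ 2)⁻¹ * ‖z - p‖ ^ 2)) :=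
  ⟨contDiff_radial hs _ p, (isCompact_closedBall p ρ).of_isClosed_subset (isClosed_tsupport _)
    (tsupport_radial h hρ p), (tsupport_radial h hρ p).trans hU⟩

/-- cut-off profile -/
def kc (s : ℝ) : ℝ := Real.smoothTransition (4 / 3 * (1 - s))

lemma kc_smooth : ContDiff ℝ (⊤ : ℕ∞) kc :=
  Real.smoothTransition.contDiff.comp (contDiff_const.mul (contDiff_const.sub contDiff_id))

lemma kc_zero {s : ℝ} (hs : 1 ≤ s) : kc s = 0 :=
  Real.smoothTransition.zero_of_nonpos (by linarith)

lemma kc_one {s : ℝ} (hs : s ≤ 1 / 4) : kc s = 1 :=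
  Real.smoothTransition.one_of_one_le (by linarith)

lemma bdd_of_zero {f : ℝ → ℝ} (hf : Continuous f) (h : ∀ s, 1 < s → f s = 0) :
    ∃ B > 0, ∀ s, 0 ≤ s → |f s| ≤ B := by
  obtain ⟨B, hB⟩ := (isCompact_Icc (a := (0:ℝ)) (b := 1)).exists_bound_of_continuousOn
    hf.continuousOn
  refine ⟨|B| + 1, by positivity, fun s hs => ?_⟩
  by_cases h1 : s ≤ 1
  · have := hB s ⟨hs, h1⟩
    rw [Real.norm_eq_abs] at this
    have := le_abs_self B; linarith
  · rw [h s (by linarith)]; simp; positivity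

lemma deriv_zero_of {f : ℝ → ℝ} (h : ∀ s, 1 < s → f s = 0) : ∀ s, 1 < s → deriv f s = 0 := by
  intro s hs
  have : f =ᶠ[𝓝 s] fun _ => 0 := by
    filter_upwards [Ioi_mem_nhds hs] with z hz
    exact h z hz
  rw [this.deriv_eq]; simp

def cut (p : ES N) (ρ : ℝ) (z : ES N) : ℝ := kc ((ρ ^ 2)⁻¹ * ‖z - p‖ ^ 2)

lemma cut_test {p : ES N} {ρ : ℝ} (hρ : 0 < ρ) {U : Set (ES N)} (hU : closedBall p ρ ⊆ U) :
    IsTestFun U (cut p ρ) := radial_test kc_smooth (fun _ => kc_zero) hρ p hU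

lemma cut_smooth (p : ES N) (ρ : ℝ) : ContDiff ℝ (⊤ : ℕ∞) (cut p ρ) :=
  contDiff_radial kc_smooth _ p

lemma cut_nonneg (p : ES N) (ρ : ℝ) (z : ES N) : 0 ≤ cut p ρ z := Real.smoothTransition.nonneg _
lemma cut_le (p : ES N) (ρ : ℝ) (z : ES N) : cut p ρ z ≤ 1 := Real.smoothTransition.le_one _

lemma cut_one {p : ES N} {ρ : ℝ} (hρ : 0 < ρ) {z : ES N} (hz : dist z p ≤ ρ / 2) :
    cut p ρ z = 1 := by
  refine kc_one ?_
  rw [dist_eq_norm] at hz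
  rw [inv_mul_eq_div, div_le_iff₀ (by positivity)]
  nlinarith [norm_nonneg (z - p)]

lemma cut_zero {p : ES N} {ρ : ℝ} (hρ : 0 < ρ) {z : ES N} (hz : ρ ≤ dist z p) :
    cut p ρ z = 0 := by
  refine kc_zero ?_
  rw [dist_eq_norm] at hz
  rw [inv_mul_eq_div, le_div_iff₀ (by positivity)]
  nlinarith [norm_nonneg (z - p)]

lemma sum_inner_sq (v : ES N) : ∑ i, (inner ℝ v (EuclideanSpace.single i (1:ℝ))) ^ 2 = ‖v‖ ^ 2 := by
  rw [EuclideanSpace.norm_sq_eq]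
  refine Finset.sum_congr rfl fun i _ => ?_
  rw [EuclideanSpace.inner_single_right]
  simp

lemma cut_bounds (N : ℕ) : ∃ B > 0, ∀ (p : ES N) (ρ : ℝ), 0 < ρ → ∀ z,
    |lap (cut p ρ) z| ≤ B / ρ ^ 2 ∧ ∑ i, (dd i (cut p ρ) z) ^ 2 ≤ B / ρ ^ 2 := by
  have hk : ∀ s, HasDerivAt kc (deriv kc s) s := fun s =>
    (kc_smooth.differentiable (by simp) s).hasDerivAt
  have hks : ContDiff ℝ (⊤ : ℕ∞) (deriv kc) := (contDiff_infty_iff_deriv.1 kc_smooth).2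
  have hk' : ∀ s, HasDerivAt (deriv kc) (deriv (deriv kc) s) s := fun s =>
    (hks.differentiable (by simp) s).hasDerivAt
  have z1 := deriv_zero_of (fun s (hs : (1:ℝ) < s) => kc_zero hs.le)
  have z2 := deriv_zero_of z1
  obtain ⟨B1, hB1, h1⟩ := bdd_of_zero hks.continuous z1
  obtain ⟨B2, hB2, h2⟩ := bdd_of_zero (contDiff_infty_iff_deriv.1 hks).2.continuous z2
  refine ⟨4 * B2 + 2 * N * B1 + 4 * B1 ^ 2, by positivity, fun p ρ hρ z => ?_⟩
  set s := (ρ ^ 2)⁻¹ * ‖z - p‖ ^ 2 with hs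
  have hs0 : 0 ≤ s := by positivity
  have hρ2 : 0 < (ρ ^ 2)⁻¹ := by positivity
  have e2 : |s * deriv (deriv kc) s| ≤ B2 := by
    by_cases hs1 : s ≤ 1
    · rw [abs_mul, abs_of_nonneg hs0]
      have := h2 s hs0
      nlinarith [abs_nonneg (deriv (deriv kc) s)]
    · rw [z2 s (by linarith)]; simp; positivity
  have e1 : s * (deriv kc s) ^ 2 ≤ B1 ^ 2 := by
    by_cases hs1 : s ≤ 1
    · have h3 := h1 s hs0
      have : (deriv kc s) ^ 2 ≤ B1 ^ 2 := by
        rw [← sq_abs]; gcongr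
      nlinarith [sq_nonneg (deriv kc s)]
    · rw [z1 s (by linarith)]; simp; positivity
  constructor
  · have : lap (cut p ρ) z = (ρ ^ 2)⁻¹ * (4 * (s * deriv (deriv kc) s) + 2 * N * deriv kc s) := by
      unfold cut
      rw [lap_radial hk hk']; rw [← hs]; rw [hs]; ring
    rw [this, abs_mul, abs_of_pos hρ2, div_eq_mul_inv, mul_comm]
    gcongr
    refine (abs_add_le _ _).trans ?_
    rw [abs_mul, abs_mul (2 * (N:ℝ)), abs_of_pos (by norm_num : (0:ℝ) < 4),
      abs_of_nonneg (by positivity : (0:ℝ) ≤ 2 * N)]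
    have := h1 s hs0
    have h5 : 2 * (N:ℝ) * |deriv kc s| ≤ 2 * N * B1 := by gcongr
    nlinarith [sq_nonneg B1]
  · have : ∀ i, dd i (cut p ρ) z = (deriv kc s * ((ρ ^ 2)⁻¹ * 2)) *
        inner ℝ (z - p) (EuclideanSpace.single i (1:ℝ)) := fun i => by
      unfold dd cut
      rw [fderiv_radial hk]; ring
    simp_rw [this, mul_pow, ← Finset.mul_sum]
    rw [sum_inner_sq]
    have e3 : (deriv kc s ^ 2 * (((ρ ^ 2)⁻¹) ^ 2 * 2 ^ 2)) * ‖z - p‖ ^ 2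
      = (ρ ^ 2)⁻¹ * (4 * (s * deriv kc s ^ 2)) := by rw [hs]; ring
    rw [e3, div_eq_mul_inv, mul_comm]
    gcongr
    have : 0 ≤ 2 * (N:ℝ) * B1 := by positivity
    linarith

/-! annulus -/

def ha (α s : ℝ) : ℝ := expNegInvGlue ((1 - s) / α)

lemma ha_prof {α : ℝ} (hα : 0 < α) : Prof (ha α) where
  smooth := expNegInvGlue.contDiff.comp ((contDiff_const.sub contDiff_id).div_const α)
  nonneg s := expNegInvGlue.nonneg _
  zero s hs := expNegInvGlue.zero_of_nonpos (div_nonpos_of_nonpos_of_nonneg (by linarith) hα.le)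
  anti a b hab := expNegInvGlue.monotone (by gcongr)

lemma ha_deriv {α : ℝ} (s : ℝ) :
    HasDerivAt (ha α) ((((1 - s) / α)⁻¹) ^ 2 * ha α s * (-(1 / α))) s := by
  have h0 : HasDerivAt expNegInvGlue ((((1 - s) / α)⁻¹) ^ 2 * expNegInvGlue ((1 - s) / α))
      ((1 - s) / α) := by
    simpa using expNegInvGlue.hasDerivAt_polynomial_eval_inv_mul 1 ((1 - s) / α)
  have h1 : HasDerivAt (fun s : ℝ => (1 - s) / α) (-(1 / α)) s := by
    refine (((hasDerivAt_id s).const_sub 1).div_const α).congr_deriv ?_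
    ring
  exact h0.comp s h1

lemma ha_le_one {α : ℝ} (s : ℝ) : ha α s ≤ 1 := by
  unfold ha expNegInvGlue
  split_ifs with h
  · norm_num
  · push Not at h
    rw [Real.exp_le_one_iff]
    have : 0 < ((1 - s) / α)⁻¹ := by positivity
    linarith

lemma exists_ann (hN : 2 ≤ N) : ∃ c0 > 0, ∃ C0 > 0, ∀ (p : ES N) (ρ : ℝ), 0 < ρ →
    ∃ η : ES N → ℝ, ContDiff ℝ (⊤ : ℕ∞) η ∧ tsupport η ⊆ closedBall p ρ ∧ (∀ z, 0 ≤ η z) ∧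
      (∀ z, η z ≤ 1) ∧ ∀ z, (ball p (3 / 4 * ρ)).indicator (fun _ => c0 / ρ ^ 2) z -
        (ball p (ρ / 4)).indicator (fun _ => C0 / ρ ^ 2) z ≤ lap η z := by
  have hNp : (0:ℝ) < N := by exact_mod_cast (by omega : 0 < N)
  set α : ℝ := 16 * N with hα
  have hα0 : 0 < α := by positivity
  have hP := ha_prof hα0
  have hh : 0 < ha α (9 / 16) := expNegInvGlue.pos_of_pos (by norm_num; positivity)
  refine ⟨N * ha α (9 / 16), by positivity, N + N * ha α (9 / 16), by positivity, fun p ρ hρ => ?_⟩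
  refine ⟨fun z => mpr (ha α) ((ρ ^ 2)⁻¹ * ‖z - p‖ ^ 2), contDiff_radial (mpr_smooth hP) _ p,
    tsupport_radial (fun s hs => mpr_zero hP hs) hρ p,
    fun z => (mpr_bounds hP (by positivity)).1, fun z => ?_, fun z => ?_⟩
  · have h1 := (mpr_bounds hP (s := (ρ ^ 2)⁻¹ * ‖z - p‖ ^ 2) (by positivity)).2
    have h2 := ha_le_one (α := α) ((ρ ^ 2)⁻¹ * ‖z - p‖ ^ 2)
    linarith
  · set s := (ρ ^ 2)⁻¹ * ‖z - p‖ ^ 2 with hs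
    have hs0 : 0 ≤ s := by positivity
    have hρ2 : 0 < (ρ ^ 2)⁻¹ := by positivity
    set Q := (((1 - s) / α)⁻¹) ^ 2 * (1 / α) with hQ
    have hQ0 : 0 ≤ Q := by positivity
    have hl : lap (fun z => mpr (ha α) ((ρ ^ 2)⁻¹ * ‖z - p‖ ^ 2)) z
        = (ρ ^ 2)⁻¹ * (ha α s * (2 * s * Q - N)) := by
      rw [lap_radial (mpr_hasDeriv hP)
        (fun s => ((ha_deriv (α := α) s).neg.div_const 2))]
      rw [← hs, hQ]
      have e1 : 4 * ((ρ ^ 2)⁻¹) ^ 2 * ‖z - p‖ ^ 2 = 4 * (ρ ^ 2)⁻¹ * s := by rw [hs]; ring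
      rw [e1]; ring
    rw [hl, div_eq_mul_inv (_ * _) (ρ ^ 2), div_eq_mul_inv (_ + _) (ρ ^ 2)]
    have hhs := hP.nonneg s
    by_cases h4 : z ∈ ball p (ρ / 4)
    · have h34 : z ∈ ball p (3 / 4 * ρ) := ball_subset_ball (by linarith) h4
      rw [indicator_of_mem h4, indicator_of_mem h34]
      have : -(N:ℝ) ≤ ha α s * (2 * s * Q - N) := by
        have := ha_le_one (α := α) s
        nlinarith [mul_nonneg hhs (mul_nonneg hs0 hQ0)]
      nlinarith
    · rw [indicator_of_notMem h4, sub_zero]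
      have hs1 : 1 / 16 ≤ s := by
        rw [mem_ball, dist_eq_norm] at h4
        push Not at h4
        rw [hs, inv_mul_eq_div, le_div_iff₀ (by positivity)]
        nlinarith
      have key : N * ha α s ≤ ha α s * (2 * s * Q - N) := by
        by_cases hs2 : s < 1
        · have : α ≤ Q := by
            have e : Q = α / (1 - s) ^ 2 := by
              have : 1 - s ≠ 0 := by linarith
              rw [hQ]; field_simp
            rw [e, le_div_iff₀ (by nlinarith)]
            have : (1 - s) ^ 2 ≤ 1 := by nlinarith
            nlinarith
          have : (N:ℝ) ≤ 2 * s * Q - N := by nlinarith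
          nlinarith
        · rw [hP.zero s (by linarith)]; simp
      by_cases h34 : z ∈ ball p (3 / 4 * ρ)
      · rw [indicator_of_mem h34]
        have h9 : ha α (9 / 16) ≤ ha α s := by
          apply hP.anti
          rw [mem_ball, dist_eq_norm] at h34
          rw [hs, inv_mul_eq_div, div_le_iff₀ (by positivity)]
          nlinarith [norm_nonneg (z - p)]
        have : N * ha α (9 / 16) ≤ ha α s * (2 * s * Q - N) := by nlinarith
        nlinarith
      · rw [indicator_of_notMem h34]
        have : 0 ≤ N * ha α s := by positivity
        have : 0 ≤ ha α s * (2 * s * Q - N) := by linarith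
        positivity

end Part14

/-! ### Part 15 : the key estimate -/

section Part15
variable {N : ℕ}

lemma ind_int (s : Set (ES N)) (hs : MeasurableSet s) (φ : ES N → ℝ) (b : ℝ) :
    ∫ z, φ z * s.indicator (fun _ => b) z = b * ∫ z in s, φ z := by
  have : (fun z => φ z * s.indicator (fun _ => b) z) = s.indicator fun z => φ z * b := by
    funext z
    by_cases h : z ∈ s
    · rw [indicator_of_mem h, indicator_of_mem h]
    · rw [indicator_of_notMem h, indicator_of_notMem h, mul_zero]
  rw [this, integral_indicator hs, integral_mul_const, mul_comm]

lemma ind_integrable {s : Set (ES N)} (hs : MeasurableSet s) {φ : ES N → ℝ} (hφ : Integrable φ)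
    (b : ℝ) : Integrable fun z => φ z * s.indicator (fun _ => b) z := by
  have : (fun z => φ z * s.indicator (fun _ => b) z) = s.indicator fun z => φ z * b := by
    funext z
    by_cases h : z ∈ s
    · rw [indicator_of_mem h, indicator_of_mem h]
    · rw [indicator_of_notMem h, indicator_of_notMem h, mul_zero]
  rw [this]
  exact (hφ.mul_const b).indicator hs

lemma ann_step (hN : 2 ≤ N) : ∃ C1 ≥ (1:ℝ), ∀ (φ : ES N → ℝ) (p : ES N) (ρ : ℝ), 0 < ρ →
    ContDiff ℝ (⊤ : ℕ∞) φ → HasCompactSupport φ → (∀ z, 0 ≤ φ z) →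
    (∀ z ∈ closedBall p ρ, 0 ≤ lap φ z) →
    ∫ z in ball p (3 / 4 * ρ), φ z ≤ C1 * ((∫ z in ball p (ρ / 4), φ z) +
      ρ ^ 2 * ∫ z in closedBall p ρ, lap φ z) := by
  obtain ⟨c0, hc0, C0, hC0, H⟩ := exists_ann hN
  refine ⟨max 1 (max (C0 / c0) (1 / c0)), le_max_left _ _, fun φ p ρ hρ hs hcs h0 hl => ?_⟩
  set C1 := max 1 (max (C0 / c0) (1 / c0))
  have hC1 : C0 / c0 ≤ C1 := (le_max_left _ _).trans (le_max_right _ _)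
  have hC2 : 1 / c0 ≤ C1 := (le_max_right _ _).trans (le_max_right _ _)
  obtain ⟨η, e1, e2, e3, e4, e5⟩ := H p ρ hρ
  have hφi : Integrable φ := hs.continuous.integrable_of_hasCompactSupport hcs
  have hli : Integrable (lap φ) :=
    (lap_contDiff hs).continuous.integrable_of_hasCompactSupport (lap_supp hcs)
  have hη : HasCompactSupport η := (isCompact_closedBall p ρ).of_isClosed_subset
    (isClosed_tsupport _) e2
  have id := lap_symm hs e1 hη
  have up : ∫ z, lap φ z * η z ≤ ∫ z in closedBall p ρ, lap φ z := by
    rw [← integral_indicator measurableSet_closedBall]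
    refine integral_mono ?_ (hli.indicator measurableSet_closedBall) fun z => ?_
    · exact ((lap_contDiff hs).continuous.mul e1.continuous).integrable_of_hasCompactSupport
        (hη.mul_left)
    · by_cases hz : z ∈ closedBall p ρ
      · simp only [indicator_of_mem hz]
        have := hl z hz; have := e4 z; nlinarith
      · simp only [indicator_of_notMem hz]
        rw [image_eq_zero_of_notMem_tsupport fun h => hz (e2 h), mul_zero]
  have lo : c0 / ρ ^ 2 * (∫ z in ball p (3 / 4 * ρ), φ z) - C0 / ρ ^ 2 * (∫ z in ball p (ρ / 4), φ z)
      ≤ ∫ z, φ z * lap η z := by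
    rw [← ind_int _ measurableSet_ball, ← ind_int _ measurableSet_ball, ← integral_sub
      (ind_integrable measurableSet_ball hφi _) (ind_integrable measurableSet_ball hφi _)]
    refine integral_mono ((ind_integrable measurableSet_ball hφi _).sub
      (ind_integrable measurableSet_ball hφi _)) ?_ fun z => ?_
    · exact (hs.continuous.mul (lap_contDiff e1).continuous).integrable_of_hasCompactSupport
        (hcs.mul_right)
    · simp only
      rw [← mul_sub]
      exact mul_le_mul_of_nonneg_left (e5 z) (h0 z)
  rw [id] at lo
  have h5 := lo.trans up
  have hI0 : 0 ≤ ∫ z in ball p (ρ / 4), φ z := integral_nonneg h0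
  have hL0 : 0 ≤ ∫ z in closedBall p ρ, lap φ z :=
    setIntegral_nonneg measurableSet_closedBall hl
  set I3 := ∫ z in ball p (3 / 4 * ρ), φ z
  set I1 := ∫ z in ball p (ρ / 4), φ z
  set L := ∫ z in closedBall p ρ, lap φ z
  have h6 : c0 * I3 ≤ C0 * I1 + ρ ^ 2 * L := by
    have : ρ ^ 2 * (c0 / ρ ^ 2 * I3 - C0 / ρ ^ 2 * I1) ≤ ρ ^ 2 * L := by gcongr
    have e : ρ ^ 2 * (c0 / ρ ^ 2 * I3 - C0 / ρ ^ 2 * I1) = c0 * I3 - C0 * I1 := by field_simp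
    linarith
  calc I3 = (c0 * I3) / c0 := by field_simp
    _ ≤ (C0 * I1 + ρ ^ 2 * L) / c0 := by gcongr
    _ = C0 / c0 * I1 + 1 / c0 * (ρ ^ 2 * L) := by ring
    _ ≤ C1 * I1 + C1 * (ρ ^ 2 * L) := by gcongr
    _ = _ := by ring

lemma ann_chain (hN : 2 ≤ N) (n : ℕ) : ∃ D > 0, ∀ (φ : ES N → ℝ) (p e : ES N) (ρ T : ℝ), 0 < ρ →
    ‖e‖ = 1 → 0 ≤ T →
    ContDiff ℝ (⊤ : ℕ∞) φ → HasCompactSupport φ → (∀ z, 0 ≤ φ z) →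
    (∀ z ∈ ball p (ρ / 4), φ z = 0) →
    (∀ j < n, (∀ z ∈ closedBall (p + (j * (ρ / 2)) • e) ρ, 0 ≤ lap φ z) ∧
      ∫ z in closedBall (p + (j * (ρ / 2)) • e) ρ, lap φ z ≤ T) →
    ∫ z in ball (p + (n * (ρ / 2)) • e) (ρ / 4), φ z ≤ D * ρ ^ 2 * T := by
  obtain ⟨C1, hC1, H⟩ := ann_step hN
  induction n with
  | zero =>
    refine ⟨1, one_pos, fun φ p e ρ T hρ he hT hs hcs h0 hz _ => ?_⟩
    simp only [Nat.cast_zero, zero_mul, zero_smul, add_zero]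
    rw [setIntegral_congr_fun measurableSet_ball (g := fun _ => 0) fun z hz' => hz z hz']
    simp; positivity
  | succ n ih =>
    obtain ⟨D, hD, ih⟩ := ih
    refine ⟨C1 * (D + 1), by positivity, fun φ p e ρ T hρ he hT hs hcs h0 hz hj => ?_⟩
    have h1 := ih φ p e ρ T hρ he hT hs hcs h0 hz fun j hj' => hj j (by omega)
    obtain ⟨h2, h3⟩ := hj n (by omega)
    have h4 := H φ (p + (n * (ρ / 2)) • e) ρ hρ hs hcs h0 h2
    have hφi : Integrable φ := hs.continuous.integrable_of_hasCompactSupport hcs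
    have h5 : ∫ z in ball (p + (((n + 1 : ℕ) : ℝ) * (ρ / 2)) • e) (ρ / 4), φ z
        ≤ ∫ z in ball (p + (n * (ρ / 2)) • e) (3 / 4 * ρ), φ z := by
      refine setIntegral_mono_set hφi.integrableOn (Eventually.of_forall h0)
        (Eventually.of_forall (ball_subset_ball' ?_))
      have : dist (p + (((n + 1 : ℕ) : ℝ) * (ρ / 2)) • e) (p + (n * (ρ / 2)) • e) = ρ / 2 := by
        rw [dist_eq_norm, add_sub_add_left_eq_sub, ← sub_smul, norm_smul, he, mul_one]
        push_cast
        rw [Real.norm_eq_abs, show ((n:ℝ) + 1) * (ρ / 2) - n * (ρ / 2) = ρ / 2 by ring,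
          abs_of_pos (by positivity)]
      rw [this]; linarith
    calc _ ≤ _ := h5.trans h4
      _ ≤ C1 * (D * ρ ^ 2 * T + ρ ^ 2 * T) := by gcongr
      _ = _ := by ring

variable {Ω : Set (ES N)} {x₀ y e : ES N} {d : ES N → ℝ} {M R t A : ℝ} {m J K : ES N → ℝ}

lemma Sol.id {U : Set (ES N)} {V u φ : ES N → ℝ} (h : Sol U V u) (hφ : IsTestFun U φ)
    (h0 : ∀ z, 0 ≤ φ z) : ∫ z, u z * lap φ z = ∫ z, V z * u z * φ z := by
  refine le_antisymm (h.sup.2 φ hφ h0) ?_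
  have := h.sub.2 φ hφ h0
  have e1 : ∫ z, (fun z => - u z) z * lap φ z = - ∫ z, u z * lap φ z := by
    rw [← integral_neg]; congr 1; funext z; ring
  have e2 : ∫ z, V z * (fun z => - u z) z * φ z = - ∫ z, V z * u z * φ z := by
    rw [← integral_neg]; congr 1; funext z; ring
  rw [e1, e2] at this
  linarith

lemma GR.m_int (h : GR Ω x₀ t m J) {u : ES N → ℝ} (hu : ContinuousOn u Ω) :
    Integrable fun z => u z * m z :=
  int_of_supp (isCompact_closedBall x₀ t)
    ((hu.mono h.ball).integrableOn_compact (isCompact_closedBall _ _)) h.mc h.mz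

lemma GR.m_pos (h : GR Ω x₀ t m J) {u : ES N → ℝ} (hu : ContinuousOn u Ω)
    (hp : ∀ x ∈ Ω, 0 < u x) : 0 < ∫ z, u z * m z := by
  have h0 : ∀ z, 0 ≤ u z * m z := fun z => by
    by_cases hz : z ∈ closedBall x₀ t
    · exact mul_nonneg (hp z (h.ball hz)).le (h.m0 z)
    · rw [h.mz z hz, mul_zero]
  rw [integral_pos_iff_support_of_nonneg h0 (h.m_int hu)]
  have hc : ContinuousAt m x₀ := h.mc.continuousAt
  have h1 : ∀ᶠ z in 𝓝 x₀, 0 < m z := hc.eventually (lt_mem_nhds h.mi)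
  have : Function.support (fun z => u z * m z) ∈ 𝓝 x₀ := by
    filter_upwards [h1, closedBall_mem_nhds x₀ h.tpos] with z h2 h3
    exact (mul_pos (hp z (h.ball h3)) h2).ne'
  exact Measure.measure_pos_of_mem_nhds volume this

lemma Ctx.nu_int (c : Ctx Ω x₀ y e d M R t A m J K) {φ u : ES N → ℝ} (hφ : IsTestFun Ω φ)
    (hu : ContinuousOn u Ω) : Integrable fun z => u z * (lap φ z + m z) := by
  have h1 := test_int_lap hφ (contLI c.op hu)
  have h2 := c.gr.m_int hu
  refine (h1.add h2).congr (Eventually.of_forall fun z => ?_)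
  simp only [Pi.add_apply]; ring

lemma Ctx.nu_id (c : Ctx Ω x₀ y e d M R t A m J K) {φ u V : ES N → ℝ} (hφ : IsTestFun Ω φ)
    (h0 : ∀ z, 0 ≤ φ z) (hu : Sol Ω V u) :
    ∫ z, u z * (lap φ z + m z) = (∫ z, u z * m z) + ∫ z, V z * u z * φ z := by
  have h1 := test_int_lap hφ (contLI c.op hu.sup.1)
  have h2 := c.gr.m_int hu.sup.1
  rw [← hu.id hφ h0, ← integral_add h2 h1]
  congr 1; funext z; ring

lemma Ctx.beta (c : Ctx Ω x₀ y e d M R t A m J K) : ∃ Λ ≥ (16:ℝ), ∃ Ci > 0, ∀ r, 0 < r →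
    16 * M * (2 * Λ * r) ≤ R →
    (∀ x ∈ Ω, dist x y ≤ r → J x ≤ Ci * J (y + r • e) / K (y + r • e) * K x) ∧
    (∀ x ∈ Ω, Λ * r ≤ dist x y → Ci * J (y + r • e) / K (y + r • e) * K x ≤ J x / 4) := by
  obtain ⟨Ci, hCi, hin⟩ := c.jin
  obtain ⟨Co, hCo, hout⟩ := c.jout
  obtain ⟨Cc, hCc, hcar⟩ := c.car
  obtain ⟨k, hk⟩ := c.jdec (ε := 1 / (4 * Ci * Co * Cc)) (by positivity)
  have hM := c.lg.M1
  have hΛ : (16:ℝ) ≤ 16 ^ (k + 1) := by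
    rw [pow_succ]; have : (1:ℝ) ≤ 16 ^ k := one_le_pow₀ (by norm_num); linarith
  refine ⟨16 ^ (k + 1), hΛ, Ci, by positivity, fun r hr hR => ?_⟩
  set Λ : ℝ := 16 ^ (k + 1) with hΛd
  have hΛr : 0 < Λ * r := by positivity
  have hRΛ : 16 * M * (Λ * r) ≤ R := by nlinarith
  have hrΛ : r ≤ Λ * r := by nlinarith
  have hRr : 16 * M * r ≤ R := by nlinarith
  have hKr := c.kg.sol.pos _ (c.Ar hr hRr)
  have hJr := c.gr.pos _ (c.Ar hr hRr)
  have hKs := c.kg.sol.pos _ (c.Ar hΛr hRΛ)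
  have hJs := c.gr.pos _ (c.Ar hΛr hRΛ)
  constructor
  · intro x hx hxr
    have := hin r hr hRr x hx hxr
    rw [div_mul_eq_mul_div, le_div_iff₀ hKr]; exact this
  · intro x hx hxr
    have h1 := hout (Λ * r) hΛr hRΛ x hx hxr
    have h2 := hcar _ K c.kg r hr hRr _ (c.Ar hΛr hRΛ) (by rw [c.Ad hΛr]; exact hrΛ)
    have h3 := hk (Λ * r) hΛr hRΛ
    rw [mul_div_cancel_left₀ r (by positivity : Λ ≠ 0)] at h3
    have hJx := c.gr.pos x hx
    have hKx := c.kg.sol.pos x hx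
    rw [div_mul_eq_mul_div, div_le_iff₀ hKr]
    have h4 : K x * J (y + (Λ * r) • e) ≤ Co * (Cc * K (y + r • e)) * J x := by
      refine h1.trans ?_; gcongr
    have h5 : J (y + r • e) * (4 * Ci * Co * Cc) ≤ J (y + (Λ * r) • e) := by
      rw [one_div_mul_eq_div, le_div_iff₀ (by positivity)] at h3; exact h3
    have h6 : K x * (J (y + r • e) * (4 * Ci * Co * Cc)) ≤ Co * (Cc * K (y + r • e)) * J x :=
      (mul_le_mul_of_nonneg_left h5 hKx.le).trans h4
    have h7 : (Co * Cc) * (4 * (Ci * J (y + r • e) * K x)) ≤ (Co * Cc) * (K (y + r • e) * J x) := by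
      nlinarith
    have h8 := le_of_mul_le_mul_left h7 (by positivity)
    linarith

end Part15

section Part16
variable {N : ℕ}
variable {Ω : Set (ES N)} {x₀ y e : ES N} {d : ES N → ℝ} {M R t A : ℝ} {m J K : ES N → ℝ}

lemma Ctx.unu_nonneg (c : Ctx Ω x₀ y e d M R t A m J K) {ε β : ℝ} (hε : 0 < ε) (hβ : 0 ≤ β)
    {u : ES N → ℝ} (hu : ∀ x ∈ Ω, 0 < u x) (z : ES N) :
    0 ≤ u z * (lap (phi Ω J K ε β) z + m z) := by
  by_cases hz : z ∈ Ω
  · exact mul_nonneg (hu z hz).le (c.nu_nonneg hε hβ z)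
  · rw [(c.phi_test hε hβ).lap_off hz, c.gr.mz z fun h => hz (c.gr.ball h)]; simp

theorem Ctx.lower (c : Ctx Ω x₀ y e d M R t A m J K) {Λ : ℝ} (hΛ : 16 ≤ Λ) :
    ∃ CA > 0, ∃ h > 0, ∀ r, 0 < r → 16 * M * (2 * Λ * r) ≤ R → ∀ β, 0 ≤ β →
    (∀ x ∈ Ω, dist x y ≤ r → J x ≤ β * K x) →
    (∀ x ∈ Ω, Λ * r ≤ dist x y → β * K x ≤ J x / 4) → ∀ ε, 0 < ε → ε ≤ h * J (y + r • e) →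
    ∀ V u, Glo Ω y d A R V u →
    J (y + r • e) * u (y + r • e) * r ^ N ≤
      CA * r ^ 2 * ∫ z, u z * (lap (phi Ω J K ε β) z + m z) := by
  have hM := c.lg.M1
  set n : ℕ := ⌈8 * M * Λ⌉₊ with hn
  obtain ⟨D, hD, hann⟩ := ann_chain c.hN n
  set H := cNT N A M (1 / (8 * Λ)) with hH
  have hH1 : 1 ≤ H := one_le_cNT c.hA
  have hvb := vb_pos (N := N)
  refine ⟨2 * H ^ 2 * D * (16 * M) ^ N / vb N, by positivity, 1 / (8 * H), by positivity, ?_⟩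
  intro r hr hR β hβ hnear hfar ε hε hεJ V u hu
  set φ := phi Ω J K ε β with hφ
  set ρ := r / (4 * M) with hρ
  have hρ0 : 0 < ρ := by positivity
  have hρr : ρ * M = r / 4 := by rw [hρ]; field_simp
  have hρ4 : ρ ≤ r / 4 := by rw [← hρr]; nlinarith
  have hs : 0 < 2 * Λ * r := by positivity
  have hMr : 2 * Λ * r ≤ M * (2 * Λ * r) := by nlinarith
  have hRr : 4 * (2 * Λ * r) ≤ R := by nlinarith
  have hRr' : 16 * M * r ≤ R := by
    have : r ≤ 2 * Λ * r := by nlinarith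
    have : M * r ≤ M * (2 * Λ * r) := by gcongr
    nlinarith
  have hAr := c.Ar hr hRr'
  have hcs : 1 / (8 * Λ) * (2 * Λ * r) = r / 4 := by field_simp; norm_num
  have hdA : d (y + r • e) = r := by rw [c.lg.shift, c.lg.dz]; ring
  have hAb : y + r • e ∈ ball y (4 * (2 * Λ * r)) := by
    rw [mem_ball, c.Ad hr]; nlinarith
  have hnt : ∀ (W w : ES N → ℝ), VB W d A y R → Sol (Ω ∩ ball y R) W w →
      ∀ p ∈ ball y (4 * (2 * Λ * r)), r / 4 ≤ d p → w (y + r • e) ≤ H * w p := by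
    intro W w hW hw p hp hdp
    exact c.lg.nt c.hA hW hw hs (c := 1 / (8 * Λ)) (by positivity) hR hp hAb
      (by rw [hcs]; exact hdp) (by rw [hcs, hdA]; linarith)
  set p := y + (r / 2) • e with hp
  have hnle : (n : ℝ) * (ρ / 2) ≤ Λ * r + r / 8 := by
    have h1 : (n : ℝ) ≤ 8 * M * Λ + 1 := (Nat.ceil_lt_add_one (by positivity)).le
    calc (n : ℝ) * (ρ / 2) ≤ (8 * M * Λ + 1) * (ρ / 2) := by gcongr
      _ = 4 * Λ * (ρ * M) + ρ / 2 := by ring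
      _ ≤ _ := by rw [hρr]; linarith
  have hnge : Λ * r ≤ (n : ℝ) * (ρ / 2) := by
    have h1 : 8 * M * Λ ≤ (n : ℝ) := Nat.le_ceil _
    calc Λ * r = 4 * Λ * (ρ * M) := by rw [hρr]; ring
      _ = (8 * M * Λ) * (ρ / 2) := by ring
      _ ≤ _ := by gcongr
  have hpj : ∀ s : ℝ, p + s • e = y + (r / 2 + s) • e := fun s => by rw [hp, add_smul, add_assoc]
  have hdp : ∀ s : ℝ, 0 ≤ s → dist (p + s • e) y = r / 2 + s := fun s h => by
    rw [hpj]; exact c.Ad (by linarith)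
  have htube : ∀ s : ℝ, 0 ≤ s → s ≤ n * (ρ / 2) → ∀ z ∈ closedBall (p + s • e) ρ,
      z ∈ ball y (4 * (2 * Λ * r)) ∧ r / 4 ≤ d z ∧ z ∈ Ω := by
    intro s h0 h1 z hz
    rw [mem_closedBall] at hz
    have h2 : z ∈ ball y (4 * (2 * Λ * r)) := by
      rw [mem_ball]
      have := dist_triangle z (p + s • e) y
      rw [hdp s h0] at this
      nlinarith
    have h3 : r / 4 ≤ d z := by
      have h4 := c.lg.le (p + s • e) z
      rw [hpj, c.lg.shift, c.lg.dz, ← hpj, dist_comm] at h4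
      have : M * dist z (p + s • e) ≤ M * ρ := by gcongr
      nlinarith
    exact ⟨h2, h3, (c.lg.mem z (ball_subset_ball hRr h2)).2 (by linarith)⟩
  set I := ∫ z, u z * (lap φ z + m z) with hI
  have hInn : 0 ≤ I := integral_nonneg (c.unu_nonneg hε hβ hu.sol.pos)
  have huA : 0 < u (y + r • e) := hu.sol.pos _ hAr
  have hJA : 0 < J (y + r • e) := c.gr.pos _ hAr
  have hTest := c.phi_test hε hβ
  have key := hann φ p e ρ (H / u (y + r • e) * I) hρ0 c.lg.e1 (by positivity) hTest.1 hTest.hcs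
    (phi_nonneg hε β) (by
      intro z hz
      refine Ctx.phi_zero hε fun hz' => hnear z hz' ?_
      have h1 := dist_triangle z p y
      have h2 := hdp 0 le_rfl
      simp only [zero_smul, add_zero] at h2
      rw [mem_ball] at hz
      linarith) (by
      intro j hj
      have hj' : (j : ℝ) * (ρ / 2) ≤ n * (ρ / 2) := by gcongr
      have ht := htube (j * (ρ / 2)) (by positivity) hj'
      have hm0 : ∀ z ∈ closedBall (p + ((j : ℝ) * (ρ / 2)) • e) ρ, m z = 0 := fun z hz =>
        c.gr.mz z (c.far z (ball_subset_ball hRr (ht z hz).1))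
      constructor
      · intro z hz
        have := c.nu_nonneg hε hβ z
        rw [nu, hm0 z hz] at this
        simpa using this
      · have h1 : ∀ z ∈ closedBall (p + ((j : ℝ) * (ρ / 2)) • e) ρ,
            lap φ z ≤ H / u (y + r • e) * (u z * (lap φ z + m z)) := by
          intro z hz
          have h2 := hnt V u hu.vb (hu.sol.mono inter_subset_left) z (ht z hz).1 (ht z hz).2.1
          have h3 := c.nu_nonneg hε hβ z
          rw [nu, ← hφ] at h3
          have h4 : 1 ≤ H / u (y + r • e) * u z := by
            rw [div_mul_eq_mul_div, le_div_iff₀ huA]; linarith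
          calc lap φ z = 1 * (lap φ z + m z) := by rw [hm0 z hz]; ring
            _ ≤ H / u (y + r • e) * u z * (lap φ z + m z) := by gcongr
            _ = _ := by ring
        have hIntg := (c.nu_int hTest hu.sol.sup.1).const_mul (H / u (y + r • e))
        calc ∫ z in closedBall (p + ((j : ℝ) * (ρ / 2)) • e) ρ, lap φ z
            ≤ ∫ z in closedBall (p + ((j : ℝ) * (ρ / 2)) • e) ρ,
              H / u (y + r • e) * (u z * (lap φ z + m z)) :=
              setIntegral_mono_on ((lap_contDiff hTest.1).continuous.continuousOn.integrableOn_compact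
                (isCompact_closedBall _ _)) hIntg.integrableOn measurableSet_closedBall h1
          _ ≤ ∫ z, H / u (y + r • e) * (u z * (lap φ z + m z)) :=
              setIntegral_le_integral hIntg (Eventually.of_forall fun z =>
                mul_nonneg (by positivity) (c.unu_nonneg hε hβ hu.sol.pos z))
          _ = _ := integral_const_mul _ _)
  -- lower bound on the last ball
  have ht := htube (n * (ρ / 2)) (by positivity) le_rfl
  have hlow : ∀ z ∈ ball (p + ((n : ℝ) * (ρ / 2)) • e) (ρ / 4), J (y + r • e) / (2 * H) ≤ φ z := by
    intro z hz
    have hz' : z ∈ closedBall (p + ((n : ℝ) * (ρ / 2)) • e) ρ :=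
      ball_subset_closedBall (ball_subset_ball (by linarith) hz)
    obtain ⟨h1, h2, h3⟩ := ht z hz'
    have h4 := hnt _ J c.vb0 c.jpm.sol z h1 h2
    have h5 := hfar z h3 (by
      have := dist_triangle_left (p + ((n : ℝ) * (ρ / 2)) • e) y z
      rw [hdp _ (by positivity)] at this
      rw [mem_ball] at hz
      linarith)
    have h6 := Ctx.phi_ge (K := K) (J := J) (β := β) hε h3
    have h7 : J (y + r • e) / H ≤ J z := by rw [div_le_iff₀ (by positivity)]; linarith
    have h8 : ε ≤ J (y + r • e) / H / 8 := by
      refine hεJ.trans (le_of_eq ?_); field_simp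
    have h9 : J (y + r • e) / (2 * H) = J (y + r • e) / H / 2 := by field_simp
    rw [h9]; linarith
  have hvol : (ρ / 4) ^ N * vb N * (J (y + r • e) / (2 * H)) ≤
      ∫ z in ball (p + ((n : ℝ) * (ρ / 2)) • e) (ρ / 4), φ z := by
    rw [← vol_ball (p + ((n : ℝ) * (ρ / 2)) • e) (by positivity), ← smul_eq_mul,
      ← setIntegral_const]
    refine setIntegral_mono_on (integrableOn_const measure_ball_lt_top.ne)
      (hTest.1.continuous.integrable_of_hasCompactSupport hTest.hcs).integrableOn
      measurableSet_ball hlow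
  have h1 := hvol.trans key
  have e1 : (ρ / 4) ^ N = r ^ N / (16 * M) ^ N := by
    rw [hρ, ← div_pow]; congr 1; field_simp; norm_num
  have e2 : ρ ^ 2 ≤ r ^ 2 := by
    have : ρ ≤ r := by linarith
    gcongr
  have h2 : r ^ N / (16 * M) ^ N * vb N * (J (y + r • e) / (2 * H)) ≤
      D * r ^ 2 * (H / u (y + r • e) * I) := by
    rw [← e1]; refine h1.trans ?_; gcongr
  have h3 := mul_le_mul_of_nonneg_right h2
    (show 0 ≤ (16 * M) ^ N / vb N * (2 * H) * u (y + r • e) by positivity)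
  have h4 : r ^ N / (16 * M) ^ N * vb N * (J (y + r • e) / (2 * H)) *
      ((16 * M) ^ N / vb N * (2 * H) * u (y + r • e)) =
      J (y + r • e) * u (y + r • e) * r ^ N := by field_simp
  rw [h4] at h3
  refine h3.trans (le_of_eq ?_)
  field_simp

end Part16

section Part17
variable {N : ℕ}
variable {Ω : Set (ES N)} {x₀ y e : ES N} {d : ES N → ℝ} {M R t A : ℝ} {m J K : ES N → ℝ}

lemma GR.m_int' (h : GR Ω x₀ t m J) : Integrable m := by
  have := h.m_int (u := fun _ => 1) continuousOn_const
  simpa using this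

lemma GR.m_pos' (h : GR Ω x₀ t m J) : 0 < ∫ z, m z := by
  have := h.m_pos (u := fun _ => 1) continuousOn_const (fun _ _ => one_pos)
  simpa using this

/-- `J` has a positive lower bound on the small ball about `x₀`. -/
lemma GR.lowb (h : GR Ω x₀ t m J) : ∃ b > 0, ∀ x ∈ closedBall x₀ t, b ≤ J x := by
  obtain ⟨p, hp, hmin⟩ := (isCompact_closedBall x₀ t).exists_isMinOn
    ⟨x₀, mem_closedBall_self h.tpos.le⟩ (h.cont.mono h.ball)
  exact ⟨J p, h.pos p (h.ball hp), fun x hx => hmin hx⟩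

set_option maxHeartbeats 800000 in
theorem Ctx.upper (c : Ctx Ω x₀ y e d M R t A m J K) {Λ Ci : ℝ} (hΛ : 16 ≤ Λ) (hCi : 0 < Ci)
    (hb : ∀ r, 0 < r → 16 * M * (2 * Λ * r) ≤ R →
    (∀ x ∈ Ω, dist x y ≤ r → J x ≤ Ci * J (y + r • e) / K (y + r • e) * K x) ∧
    (∀ x ∈ Ω, Λ * r ≤ dist x y → Ci * J (y + r • e) / K (y + r • e) * K x ≤ J x / 4)) :
    ∃ CB > 0, ∀ r, 0 < r → 16 * M * (2 * Λ * r) ≤ R →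
      r ^ 2 ≤ CB * (K (y + r • e) * J (y + r • e) * r ^ N) := by
  have hM := c.lg.M1
  obtain ⟨B, hB, hcut⟩ := cut_bounds N
  obtain ⟨Cc, hCc, hcar⟩ := c.car
  obtain ⟨Cl, hCl, hcarl⟩ := carleson N c.hA hM
  obtain ⟨b, hb0, hbJ⟩ := c.gr.lowb
  set H := cNT N A M (1 / (8 * Λ)) with hH
  have hH1 : 1 ≤ H := one_le_cNT c.hA
  have hvb := vb_pos (N := N)
  have hmp := c.gr.m_pos'
  have hKm := c.gr.m_pos c.kg.sol.sup.1 c.kg.sol.pos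
  set S := ∫ z, K z * m z with hS
  refine ⟨2 * Cc * (B * ((2 * Λ) ^ N * vb N * (Cl * H))) / S, by positivity, ?_⟩
  intro r hr hR
  obtain ⟨hnear, hfar⟩ := hb r hr hR
  have hs : 0 < 2 * Λ * r := by positivity
  have hMr : 2 * Λ * r ≤ M * (2 * Λ * r) := by nlinarith
  have hRr : 4 * (2 * Λ * r) ≤ R := by nlinarith
  have hRr' : 16 * M * r ≤ R := by
    have : r ≤ 2 * Λ * r := by nlinarith
    have : M * r ≤ M * (2 * Λ * r) := by gcongr
    nlinarith
  have hAr := c.Ar hr hRr'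
  have hcs : 1 / (8 * Λ) * (2 * Λ * r) = r / 4 := by field_simp; norm_num
  have hdA : d (y + r • e) = r := by rw [c.lg.shift, c.lg.dz]; ring
  have hAb : y + r • e ∈ ball y (4 * (2 * Λ * r)) := by
    rw [mem_ball, c.Ad hr]; nlinarith
  have hKA := c.kg.sol.pos _ hAr
  have hJA := c.gr.pos _ hAr
  set β := Ci * J (y + r • e) / K (y + r • e) with hβd
  have hβ : 0 < β := by positivity
  set ε := min (b / 4) (β * S / (2 * ∫ z, m z)) with hεd
  have hε : 0 < ε := by rw [hεd]; positivity
  have hε1 : ε ≤ b / 4 := min_le_left _ _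
  have hε2 : ε * (2 * ∫ z, m z) ≤ β * S := by
    rw [← le_div_iff₀ (by positivity)]; exact min_le_right _ _
  have hcb : ∀ x ∈ closedBall x₀ t, 2 * ε ≤ J x - β * K x := by
    intro x hx
    have h1 : x ∉ ball y R := fun h => c.far x h hx
    rw [mem_ball, not_lt] at h1
    have h2 := hfar x (c.gr.ball hx) (by nlinarith)
    have h3 := hbJ x hx
    linarith
  set φ := phi Ω J K ε β with hφ
  have hTest : IsTestFun Ω φ := c.phi_test hε hβ.le
  have hid := c.nu_id hTest (phi_nonneg hε β) c.kg.sol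
  simp only [zero_mul, integral_zero, add_zero] at hid
  have hIntg := c.nu_int hTest c.kg.sol.sup.1
  have hnn : ∀ z, 0 ≤ lap φ z + m z := fun z => c.nu_nonneg hε hβ.le z
  have hlapi : Integrable (lap φ) :=
    (lap_contDiff hTest.1).continuous.integrable_of_hasCompactSupport (HasCompactSupport.of_support_subset_isCompact hTest.2.1 fun z hz => by
      by_contra h
      exact hz (lap_off h))
  have hnui : Integrable fun z => lap φ z + m z := hlapi.add c.gr.m_int'
  have hnuI : ∫ z, (lap φ z + m z) = ∫ z, m z := by
    rw [integral_add hlapi c.gr.m_int', test_lap_integral hTest, zero_add]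
  set P := ball y (Λ * r) with hP
  have hsplit := integral_add_compl (measurableSet_ball : MeasurableSet P) hIntg
  -- far part
  have hfar' : ∫ z in Pᶜ, K z * (lap φ z + m z) ≤ S / 2 := by
    have h1 : ∀ z ∈ Pᶜ, K z * (lap φ z + m z) ≤ ε / β * (lap φ z + m z) := by
      intro z hz
      by_cases h0 : lap φ z + m z = 0
      · rw [h0]; simp
      · obtain ⟨h1, h2, h3⟩ := c.nu_ne hε hβ.le hcb h0
        rw [hP, mem_compl_iff, mem_ball, not_lt] at hz
        have h4 := hfar z h1 hz
        have h5 : K z ≤ ε / β := by rw [le_div_iff₀ hβ]; nlinarith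
        exact mul_le_mul_of_nonneg_right h5 (hnn z)
    calc _ ≤ ∫ z in Pᶜ, ε / β * (lap φ z + m z) :=
          setIntegral_mono_on hIntg.integrableOn (hnui.const_mul _).integrableOn
            measurableSet_ball.compl h1
      _ ≤ ∫ z, ε / β * (lap φ z + m z) := setIntegral_le_integral (hnui.const_mul _)
            (Eventually.of_forall fun z => mul_nonneg (by positivity) (hnn z))
      _ = ε / β * ∫ z, m z := by rw [integral_const_mul, hnuI]
      _ ≤ S / 2 := by
          rw [div_mul_eq_mul_div, div_le_iff₀ hβ]; linarith
  -- near part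
  have hnear1 : ∫ z in P, K z * (lap φ z + m z) ≤
      Cc * K (y + r • e) * ∫ z in P, (lap φ z + m z) := by
    rw [← integral_const_mul]
    refine setIntegral_mono_on hIntg.integrableOn (hnui.const_mul _).integrableOn
      measurableSet_ball fun z hz => ?_
    by_cases h0 : lap φ z + m z = 0
    · rw [h0]; simp
    · obtain ⟨h1, h2, h3⟩ := c.nu_ne hε hβ.le hcb h0
      refine mul_le_mul_of_nonneg_right (hcar _ K c.kg r hr hRr' z h1 ?_) (hnn z)
      by_contra h
      have := hnear z h1 (by linarith)
      linarith
  set χ := cut y (2 * Λ * r) with hχ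
  have hχc : HasCompactSupport χ := (cut_test hs (subset_univ _)).hcs
  have hmB : ∀ z ∈ ball y (2 * Λ * r), m z = 0 := fun z hz =>
    c.gr.mz z (c.far z (ball_subset_ball (by linarith) hz))
  have hχn : ∀ z, 0 ≤ χ z * lap φ z := by
    intro z
    by_cases hz : z ∈ ball y (2 * Λ * r)
    · have := hnn z
      rw [hmB z hz, add_zero] at this
      exact mul_nonneg (cut_nonneg _ _ _) this
    · rw [mem_ball, not_lt] at hz
      rw [hχ, cut_zero hs hz, zero_mul]
  have hχi : Integrable fun z => χ z * lap φ z :=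
    ((cut_smooth y _).continuous.mul (lap_contDiff hTest.1).continuous).integrable_of_hasCompactSupport
      hχc.mul_right
  have hnear2 : ∫ z in P, (lap φ z + m z) ≤ ∫ z, χ z * lap φ z := by
    calc _ ≤ ∫ z in P, χ z * lap φ z := by
          refine setIntegral_mono_on hnui.integrableOn hχi.integrableOn measurableSet_ball
            fun z hz => ?_
          rw [hP, mem_ball] at hz
          rw [hχ, cut_one hs (by linarith), hmB z (by rw [mem_ball]; nlinarith)]
          simp
      _ ≤ _ := setIntegral_le_integral hχi (Eventually.of_forall hχn)
  have hnear3 : ∫ z, χ z * lap φ z ≤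
      B / (2 * Λ * r) ^ 2 * (Cl * H * J (y + r • e)) * ((2 * Λ * r) ^ N * vb N) := by
    rw [lap_symm (cut_smooth y _) hTest.1 hTest.hcs]
    have h1 : ∀ z, lap χ z * φ z ≤ (ball y (2 * Λ * r)).indicator
        (fun _ => B / (2 * Λ * r) ^ 2 * (Cl * H * J (y + r • e))) z := by
      intro z
      by_cases hz : z ∈ ball y (2 * Λ * r)
      · rw [indicator_of_mem hz]
        by_cases hzΩ : z ∈ Ω
        · have h2 := (abs_le.1 (hcut y _ hs z).1).2
          have h3 : φ z ≤ J z := c.phi_le hε hβ.le hzΩ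
          have h4 := hcarl Ω e d y R _ J (2 * Λ * r) c.op c.lg c.vb0
            ⟨c.jpm.sol, fun p hp => c.gr.van p hp.1⟩ hs hR z ⟨hzΩ, hz⟩
          have h5 := c.lg.nt c.hA c.vb0 c.jpm.sol hs (c := 1 / (8 * Λ)) (by positivity) hR hAb
            (p' := y + (2 * Λ * r) • e)
            (by rw [mem_ball, c.Ad hs]; linarith) (by rw [hcs, hdA]; linarith)
            (by rw [hcs, c.lg.shift, c.lg.dz]; nlinarith)
          have h6 : φ z ≤ Cl * H * J (y + r • e) := by
            rw [mul_assoc]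
            exact h3.trans (h4.trans (mul_le_mul_of_nonneg_left h5 (by linarith)))
          have h7 : 0 ≤ φ z := phi_nonneg hε β z
          calc lap χ z * φ z ≤ B / (2 * Λ * r) ^ 2 * φ z := by gcongr
            _ ≤ _ := by gcongr
        · rw [hTest.off hzΩ, mul_zero]; positivity
      · rw [indicator_of_notMem hz]
        rw [mem_ball, not_lt] at hz
        by_cases hzc : z ∈ tsupport χ
        · have h8 : dist z y ≤ 2 * Λ * r := (cut_test hs subset_rfl).2.2 hzc
          by_cases hzΩ : z ∈ Ω
          · -- on the sphere the Laplacian of the cutoff vanishes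
            have h9 : lap χ z = 0 := by
              have hcl : IsClosed {w : ES N | lap χ w = 0} :=
                isClosed_eq (lap_contDiff (cut_smooth y _)).continuous continuous_const
              have h10 : (closedBall y (2 * Λ * r))ᶜ ⊆ {w : ES N | lap χ w = 0} := fun w hw =>
                lap_off fun h => hw ((cut_test hs subset_rfl).2.2 h)
              have h11 : z ∈ closure (closedBall y (2 * Λ * r))ᶜ := by
                rw [closure_compl, interior_closedBall _ hs.ne', mem_compl_iff, mem_ball, not_lt]
                exact hz
              exact (hcl.closure_subset_iff.2 h10) h11
            rw [h9, zero_mul]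
          · rw [hTest.off hzΩ, mul_zero]
        · rw [lap_off hzc, zero_mul]
    have hi1 : Integrable fun z => lap χ z * φ z :=
      ((lap_contDiff (cut_smooth y _)).continuous.mul hTest.1.continuous).integrable_of_hasCompactSupport
        hTest.hcs.mul_left
    calc _ ≤ ∫ z, (ball y (2 * Λ * r)).indicator
            (fun _ => B / (2 * Λ * r) ^ 2 * (Cl * H * J (y + r • e))) z :=
          integral_mono hi1 ((integrable_indicator_iff measurableSet_ball).2
            (integrableOn_const measure_ball_lt_top.ne)) h1
      _ = _ := by
          rw [integral_indicator measurableSet_ball, setIntegral_const, vol_ball y hs, smul_eq_mul]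
          ring
  have hfin : S / 2 ≤ Cc * K (y + r • e) * (B / (2 * Λ * r) ^ 2 * (Cl * H * J (y + r • e)) *
      ((2 * Λ * r) ^ N * vb N)) := by
    have h1 := hnear1.trans (mul_le_mul_of_nonneg_left (hnear2.trans hnear3)
      (by positivity : 0 ≤ Cc * K (y + r • e)))
    linarith
  have h1 : S / 2 ≤ Cc * K (y + r • e) * (B / r ^ 2 * (Cl * H * J (y + r • e)) *
      ((2 * Λ * r) ^ N * vb N)) := by
    refine hfin.trans ?_
    have : r ≤ 2 * Λ * r := by nlinarith
    gcongr
  have h2 := mul_le_mul_of_nonneg_right h1 (show 0 ≤ 2 * r ^ 2 / S by positivity)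
  have e1 : S / 2 * (2 * r ^ 2 / S) = r ^ 2 := by field_simp
  rw [e1, mul_pow] at h2
  refine h2.trans (le_of_eq ?_)
  field_simp

/-- the basic estimate -/
theorem Ctx.E (c : Ctx Ω x₀ y e d M R t A m J K) : ∃ r1 > 0, ∃ C ≥ (1:ℝ), 16 * M * r1 ≤ R ∧
    ∀ r, 0 < r → r ≤ r1 → K (y + r • e) * J (y + r • e) * r ^ N ≤ C * r ^ 2 ∧
    ∃ φ : ES N → ℝ, IsTestFun Ω φ ∧ (∀ x, 0 ≤ φ x) ∧ (∀ x ∈ Ω, φ x ≤ J x) ∧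
      (∀ x, dist x y ≤ r → φ x = 0) ∧ ∀ V u, Glo Ω y d A R V u →
      u (y + r • e) ≤ C * K (y + r • e) * ((∫ z, u z * m z) + ∫ z, V z * u z * φ z) := by
  obtain ⟨Λ, hΛ, Ci, hCi, hb⟩ := c.beta
  obtain ⟨CA, hCA, h, hh, hlow⟩ := c.lower hΛ
  obtain ⟨CB, hCB, hup⟩ := c.upper hΛ hCi hb
  have hM := c.lg.M1
  have hRp := c.lg.Rpos
  have hKm := c.gr.m_pos c.kg.sol.sup.1 c.kg.sol.pos
  refine ⟨R / (32 * M * Λ), by positivity, 1 + CA * CB + CA * ∫ z, K z * m z, ?_, ?_, ?_⟩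
  · have : 0 < CA * CB := by positivity
    have : 0 < CA * ∫ z, K z * m z := by positivity
    linarith
  · rw [mul_div_assoc', div_le_iff₀ (by positivity)]
    have : 16 * M * R * 1 ≤ 16 * M * R * (2 * Λ) := by gcongr; linarith
    linarith
  intro r hr hr1
  have hR : 16 * M * (2 * Λ * r) ≤ R := by
    rw [le_div_iff₀ (by positivity)] at hr1; linarith
  have hRr' : 16 * M * r ≤ R := by
    have : r ≤ 2 * Λ * r := by nlinarith
    have : M * r ≤ M * (2 * Λ * r) := by gcongr
    nlinarith
  have hAr := c.Ar hr hRr'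
  have hKA := c.kg.sol.pos _ hAr
  have hJA := c.gr.pos _ hAr
  set β := Ci * J (y + r • e) / K (y + r • e) with hβd
  have hβ : 0 < β := by positivity
  have hε : 0 < h * J (y + r • e) := by positivity
  set φ := phi Ω J K (h * J (y + r • e)) β with hφ
  have hTest : IsTestFun Ω φ := c.phi_test hε hβ.le
  have key := hlow r hr hR β hβ.le (hb r hr hR).1 (hb r hr hR).2 _ hε le_rfl
  constructor
  · have h1 := key _ K c.kg
    rw [c.nu_id hTest (phi_nonneg hε β) c.kg.sol] at h1
    simp only [zero_mul, integral_zero, add_zero] at h1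
    have : 0 ≤ (1 + CA * CB) * r ^ 2 := by positivity
    nlinarith
  refine ⟨φ, hTest, phi_nonneg hε β, fun x hx => c.phi_le hε hβ.le hx, fun x hx =>
    Ctx.phi_zero hε fun hx' => (hb r hr hR).1 x hx' hx, fun V u hu => ?_⟩
  have h1 := key V u hu
  rw [c.nu_id hTest (phi_nonneg hε β) hu.sol] at h1
  set I := (∫ z, u z * m z) + ∫ z, V z * u z * φ z with hI
  have hI0 : 0 ≤ I := by
    rw [hI, ← c.nu_id hTest (phi_nonneg hε β) hu.sol]
    exact integral_nonneg (c.unu_nonneg hε hβ.le hu.sol.pos)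
  have h2 : J (y + r • e) * u (y + r • e) * r ^ N ≤
      CA * (CB * (K (y + r • e) * J (y + r • e) * r ^ N)) * I := by
    refine h1.trans ?_
    have := hup r hr hR
    gcongr
  have h3 : (J (y + r • e) * r ^ N) * u (y + r • e) ≤
      (J (y + r • e) * r ^ N) * ((CA * CB) * K (y + r • e) * I) := by
    linarith
  have h4 := le_of_mul_le_mul_left h3 (by positivity)
  refine h4.trans ?_
  have : 0 < CA * ∫ z, K z * m z := by positivity
  gcongr
  linarith

end Part17

section Part18
variable {N : ℕ}

/-- kernel averages of a function whose ball integrals are nonpositive -/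
lemma ker_int_nonpos {κ : ℝ → ℝ} (h : Prof κ) {w : ES N → ℝ} {x : ES N} {ρ : ℝ} (hρ : 0 < ρ)
    (hw : IntegrableOn w (closedBall x ρ))
    (hb : ∀ τ, 0 < τ → τ ≤ ρ → ∫ z in ball x τ, w z ≤ 0) :
    ∫ z, w z * κ ((ρ ^ 2)⁻¹ * ‖z - x‖ ^ 2) ≤ 0 := by
  set q : ES N → ℝ := fun z => (ρ ^ 2)⁻¹ * ‖z - x‖ ^ 2 with hq
  have hqc : Continuous q := by fun_prop
  have hq0 : ∀ z, 0 ≤ q z := fun z => by positivity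
  set W : ES N → ℝ := (closedBall x ρ).indicator w with hW
  have hWi : Integrable W := (integrable_indicator_iff measurableSet_closedBall).2 hw
  set T : Set (ES N × ℝ) := {p | q p.1 < p.2} with hT
  have hTm : MeasurableSet T :=
    measurableSet_lt (hqc.measurable.comp measurable_fst) measurable_snd
  set μ : Measure ℝ := volume.restrict (Ioc 0 1) with hμ
  have hdi : Integrable (fun τ => - deriv κ τ) μ :=
    ((h.deriv_cont.neg.continuousOn (s := Icc 0 1)).integrableOn_compact isCompact_Icc).mono_set
      Ioc_subset_Icc_self
  have hF : Integrable (T.indicator fun p : ES N × ℝ => W p.1 * (- deriv κ p.2))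
      ((volume : Measure (ES N)).prod μ) := (hWi.mul_prod hdi).indicator hTm
  have hcake : ∀ z, κ (q z) = ∫ τ, (Ioi (q z)).indicator (fun τ => - deriv κ τ) τ ∂μ := by
    intro z
    rw [integral_indicator measurableSet_Ioi, hμ, Measure.restrict_restrict measurableSet_Ioi]
    by_cases hz : q z < 1
    · have : Ioi (q z) ∩ Ioc 0 1 = Ioc (q z) 1 := by
        ext τ; simp only [mem_inter_iff, mem_Ioi, mem_Ioc]
        constructor
        · rintro ⟨h1, h2, h3⟩; exact ⟨h1, h3⟩
        · rintro ⟨h1, h2⟩; exact ⟨h1, (hq0 z).trans_lt h1, h2⟩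
      rw [this, ← intervalIntegral.integral_of_le hz.le, intervalIntegral.integral_neg,
        intervalIntegral.integral_eq_sub_of_hasDerivAt (fun s _ => h.hasDeriv s)
          (h.deriv_cont.intervalIntegrable _ _), h.zero 1 le_rfl]
      ring
    · have : Ioi (q z) ∩ Ioc 0 1 = ∅ := by
        ext τ; simp only [mem_inter_iff, mem_Ioi, mem_Ioc, mem_empty_iff_false, iff_false]
        rintro ⟨h1, h2, h3⟩; linarith
      rw [this, h.zero _ (not_lt.1 hz)]; simp
  have e1 : ∫ z, w z * κ (q z) = ∫ z, ∫ τ, T.indicator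
      (fun p : ES N × ℝ => W p.1 * (- deriv κ p.2)) (z, τ) ∂μ := by
    congr 1; ext z
    have h1 : ∀ τ, T.indicator (fun p : ES N × ℝ => W p.1 * (- deriv κ p.2)) (z, τ) =
        W z * (Ioi (q z)).indicator (fun τ => - deriv κ τ) τ := by
      intro τ
      by_cases hτ : q z < τ
      · rw [indicator_of_mem (show (z, τ) ∈ T from hτ), indicator_of_mem (show τ ∈ Ioi (q z) from hτ)]
      · rw [indicator_of_notMem (show (z, τ) ∉ T from hτ),
          indicator_of_notMem (show τ ∉ Ioi (q z) from hτ), mul_zero]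
    simp only [h1]
    rw [integral_const_mul, ← hcake z]
    by_cases hz : z ∈ closedBall x ρ
    · rw [hW, indicator_of_mem hz]
    · rw [mem_closedBall, dist_eq_norm, not_le] at hz
      have : κ (q z) = 0 := ker_zero h hρ hz.le
      rw [this]; simp
  have e2 := integral_integral_swap (f := fun z τ => T.indicator
      (fun p : ES N × ℝ => W p.1 * (- deriv κ p.2)) (z, τ)) (μ := (volume : Measure (ES N)))
      (ν := μ) hF
  change ∫ z, w z * κ (q z) ≤ 0
  rw [e1, e2]
  refine integral_nonpos_of_ae ?_
  rw [hμ]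
  filter_upwards [ae_restrict_mem measurableSet_Ioc] with τ hτ
  have hs : 0 < Real.sqrt τ := Real.sqrt_pos.2 hτ.1
  have hs1 : Real.sqrt τ ≤ 1 := Real.sqrt_le_one.2 hτ.2
  have h1 : ∀ z, T.indicator (fun p : ES N × ℝ => W p.1 * (- deriv κ p.2)) (z, τ) =
      (ball x (ρ * Real.sqrt τ)).indicator w z * (- deriv κ τ) := by
    intro z
    have hiff : q z < τ ↔ z ∈ ball x (ρ * Real.sqrt τ) := by
      rw [hq, mem_ball, dist_eq_norm]
      simp only
      rw [inv_mul_lt_iff₀ (by positivity)]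
      rw [← abs_of_nonneg (norm_nonneg (z - x)), ← abs_of_nonneg (by positivity :
        0 ≤ ρ * Real.sqrt τ), ← sq_lt_sq, mul_pow, Real.sq_sqrt hτ.1.le, sq_abs]
    by_cases hz : q z < τ
    · rw [indicator_of_mem (show (z, τ) ∈ T from hz), indicator_of_mem (hiff.1 hz)]
      simp only
      rw [hW, indicator_of_mem]
      exact ball_subset_closedBall (ball_subset_ball (by nlinarith) (hiff.1 hz))
    · rw [indicator_of_notMem (show (z, τ) ∉ T from hz), indicator_of_notMem fun h => hz (hiff.2 h),
        zero_mul]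
  simp only [h1, Pi.zero_apply]
  rw [integral_mul_const, integral_indicator measurableSet_ball]
  refine mul_nonpos_of_nonpos_of_nonneg (hb _ (by positivity) (by nlinarith)) ?_
  have : deriv κ τ ≤ 0 := h.anti.deriv_nonpos
  linarith

lemma ball_real_pos (x : ES N) {t : ℝ} (ht : 0 < t) : 0 < (volume : Measure (ES N)).real (ball x t) := by
  rw [vol_ball x ht]; have := vb_pos (N := N); positivity

/-- superharmonic functions are weakly superharmonic -/
lemma superh_weak {Ω : Set (ES N)} (hΩ : IsOpen Ω) {s φ : ES N → ℝ} (hs : IsSuperharmonicOn Ω s)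
    (hφ : IsTestFun Ω φ) (h0 : ∀ z, 0 ≤ φ z) : ∫ z, s z * lap φ z ≤ 0 := by
  have := subharm_of_submean (f := fun z => - s z) hΩ hs.2.1.neg (fun C hC hCc => by
    obtain ⟨δ, hδ, hsub⟩ := hCc.exists_cthickening_subset_open hΩ hC
    refine ⟨δ, hδ, fun ρ hρ hρδ x hx => ?_⟩
    have hcb : closedBall x ρ ⊆ Ω := fun z hz => hsub (by
      exact mem_cthickening_of_dist_le z x δ C hx (le_trans hz hρδ.le))
    have hIntg : IntegrableOn s (closedBall x ρ) :=
      hs.2.1.integrableOn_compact_subset hcb (isCompact_closedBall _ _)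
    have key := ker_int_nonpos kap_prof (w := fun z => s z - s x) hρ
      (hIntg.sub (integrableOn_const (measure_closedBall_lt_top.ne))) (fun τ hτ hτρ => by
        have h1 := hs.2.2 x (hC hx) τ hτ ((closedBall_subset_closedBall hτρ).trans hcb)
        rw [setAverage_eq, smul_eq_mul, inv_mul_le_iff₀ (ball_real_pos x hτ)] at h1
        rw [integral_sub (hIntg.mono_set (ball_subset_closedBall.trans
          (closedBall_subset_closedBall hτρ))) (integrableOn_const measure_ball_lt_top.ne),
          setIntegral_const, smul_eq_mul]
        linarith)
    have e1 : ∫ z, (s z - s x) * kap ((ρ ^ 2)⁻¹ * ‖z - x‖ ^ 2) =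
        (∫ z, s z * kap ((ρ ^ 2)⁻¹ * ‖z - x‖ ^ 2)) - s x * (ρ ^ N * Zk N) := by
      simp only [sub_mul]
      rw [integral_sub (ker_mul_integrable kap_prof hρ hIntg)
        ((ker_integrable kap_prof hρ x).const_mul _), integral_const_mul, ker_integral hρ]
      rfl
    rw [e1] at key
    unfold av
    simp only [neg_mul, integral_neg]
    rw [mul_neg, mul_neg, neg_le_neg_iff, inv_mul_le_iff₀ (by positivity)]
    linarith) hφ h0
  simp only [neg_mul, integral_neg] at this
  linarith

/-- mean value property over balls for harmonic functions -/
lemma ball_mean {U : Set (ES N)} {u : ES N → ℝ} (h1 : Sup U (fun _ => 0) u)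
    (h2 : Sup U (fun _ => 0) (fun z => - u z)) {x : ES N} {t : ℝ} (ht : 0 < t)
    (hU : closedBall x t ⊆ U) : ⨍ z in ball x t, u z = u x := by
  set κ : ℕ → ℝ → ℝ := fun n s => Real.smoothTransition (n * (1 - s)) with hκ
  have hprof : ∀ n, Prof (κ n) := fun n =>
    { smooth := Real.smoothTransition.contDiff.comp (contDiff_const.mul (contDiff_const.sub contDiff_id))
      nonneg := fun s => Real.smoothTransition.nonneg _
      zero := fun s hs => Real.smoothTransition.zero_of_nonpos
        (mul_nonpos_of_nonneg_of_nonpos (Nat.cast_nonneg n) (by linarith))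
      anti := fun a b hab => Real.smoothTransition.monotone (by gcongr) }
  have hlim : ∀ w : ES N → ℝ, IntegrableOn w (closedBall x t) →
      Tendsto (fun n => ∫ z, w z * κ n ((t ^ 2)⁻¹ * ‖z - x‖ ^ 2)) atTop (𝓝 (∫ z in ball x t, w z)) := by
    intro w hw
    rw [← integral_indicator measurableSet_ball]
    refine tendsto_integral_of_dominated_convergence (fun z => ‖(closedBall x t).indicator w z‖)
      (fun n => (ker_mul_integrable (hprof n) ht hw).aestronglyMeasurable)
      ((integrable_indicator_iff measurableSet_closedBall).2 hw).norm
      (fun n => Eventually.of_forall fun z => ?_) (Eventually.of_forall fun z => ?_)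
    · by_cases hz : z ∈ closedBall x t
      · rw [indicator_of_mem hz, norm_mul]
        refine mul_le_of_le_one_right (norm_nonneg _) ?_
        rw [Real.norm_of_nonneg ((hprof n).nonneg _)]
        exact Real.smoothTransition.le_one _
      · rw [mem_closedBall, dist_eq_norm, not_le] at hz
        rw [ker_zero (hprof n) ht hz.le]; simp
    · by_cases hz : z ∈ ball x t
      · rw [indicator_of_mem hz]
        rw [mem_ball, dist_eq_norm] at hz
        have hq : (t ^ 2)⁻¹ * ‖z - x‖ ^ 2 < 1 := by
          rw [inv_mul_lt_iff₀ (by positivity), mul_one]; gcongr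
        set q := (t ^ 2)⁻¹ * ‖z - x‖ ^ 2
        obtain ⟨n0, hn0⟩ := exists_nat_ge (1 / (1 - q))
        refine tendsto_const_nhds.congr' ?_
        filter_upwards [eventually_ge_atTop n0] with n hn
        have : (1:ℝ) ≤ n * (1 - q) := by
          rw [div_le_iff₀ (by linarith)] at hn0
          refine hn0.trans ?_
          have : (n0:ℝ) ≤ n := by exact_mod_cast hn
          have : 0 ≤ 1 - q := by linarith
          gcongr
        rw [hκ]; simp only
        rw [Real.smoothTransition.one_of_one_le this, mul_one]
      · rw [indicator_of_notMem hz]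
        rw [mem_ball, dist_eq_norm, not_lt] at hz
        simp only [ker_zero (hprof _) ht hz, mul_zero]
        exact tendsto_const_nhds
  have hui : IntegrableOn u (closedBall x t) := (h1.1.mono hU).integrableOn_compact (isCompact_closedBall _ _)
  have l1 := hlim u hui
  have l2 := (hlim (fun _ => 1) (integrableOn_const measure_closedBall_lt_top.ne)).const_mul (u x)
  have heq : ∀ n, ∫ z, u z * κ n ((t ^ 2)⁻¹ * ‖z - x‖ ^ 2) =
      u x * ∫ z, (1:ℝ) * κ n ((t ^ 2)⁻¹ * ‖z - x‖ ^ 2) := by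
    intro n
    have := mean_eq h1 h2 ht hU (hprof n)
    unfold av at this
    rw [inv_mul_eq_iff_eq_mul₀ (by positivity)] at this
    simp only [one_mul]
    rw [this, ker_integral ht]; ring
  simp only [heq] at l1
  have := tendsto_nhds_unique l1 l2
  rw [setAverage_eq, this, setIntegral_const, smul_eq_mul, smul_eq_mul, mul_one]
  have := ball_real_pos x ht
  field_simp

end Part18

section Part19
variable {N : ℕ}
variable {Ω : Set (ES N)} {x₀ y e : ES N} {d : ES N → ℝ} {M R t A : ℝ} {m J K : ES N → ℝ}

lemma fin_iff (hΩ : IsOpen Ω) {f g V : ES N → ℝ} (hf : ContinuousOn f Ω) (hg : ContinuousOn g Ω)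
    (hV : Vok Ω V) (hf0 : ∀ x ∈ Ω, 0 ≤ f x) (hg0 : ∀ x ∈ Ω, 0 ≤ g x) :
    ∫⁻ z in Ω, ENNReal.ofReal (f z * V z * g z) < ⊤ ↔
      IntegrableOn (fun z => f z * V z * g z) Ω := by
  have hm : AEStronglyMeasurable (fun z => f z * V z * g z) (volume.restrict Ω) :=
    ((hf.aestronglyMeasurable hΩ.measurableSet).mul hV.meas.aestronglyMeasurable).mul
      (hg.aestronglyMeasurable hΩ.measurableSet)
  have h0 : 0 ≤ᵐ[volume.restrict Ω] fun z => f z * V z * g z := by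
    filter_upwards [ae_restrict_mem hΩ.measurableSet] with z hz
    exact mul_nonneg (mul_nonneg (hf0 z hz) (hV.nn z hz)) (hg0 z hz)
  rw [← hasFiniteIntegral_iff_ofReal h0]
  exact ⟨fun h => ⟨hm, h⟩, fun h => h.2⟩

lemma Ctx.yn (c : Ctx Ω x₀ y e d M R t A m J K) : y ∉ Ω := by
  have := c.hy
  rw [c.op.frontier_eq] at this
  exact this.2

/-- boundedness of the ratio at `A_r` gives the comparison -/
lemma Ctx.fin (c : Ctx Ω x₀ y e d M R t A m J K) {V KV : ES N → ℝ} (hV : Glo Ω y d A R V KV)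
    {r2 B : ℝ} (hr2 : 0 < r2) (hR : 16 * M * r2 ≤ R)
    (h : ∀ r, 0 < r → r ≤ r2 → KV (y + r • e) ≤ B * K (y + r • e)) :
    ∃ C > 0, ∀ x ∈ Ω, KV x ≤ C * K x := by
  obtain ⟨C, hC, hcmp⟩ := c.cmp
  have hM := c.lg.M1
  refine ⟨C * |B| + 1, by positivity, fun x hx => ?_⟩
  have hxy : 0 < dist x y := dist_pos.2 fun h => c.yn (h ▸ hx)
  set r := min r2 (dist x y) with hr
  have hr0 : 0 < r := lt_min hr2 hxy
  have hrR : 16 * M * r ≤ R := (mul_le_mul_of_nonneg_left (min_le_left _ _) (by positivity)).trans hR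
  have h1 := hcmp V _ KV K hV c.kg (fun z hz => hV.vok.nn z hz) r hr0 hrR x hx (min_le_right _ _)
  have h2 := h r hr0 (min_le_left _ _)
  have hKA := c.kg.sol.pos _ (c.Ar hr0 hrR)
  have hKx := c.kg.sol.pos _ hx
  have h3 : K (y + r • e) * KV x ≤ K (y + r • e) * (C * |B| * K x) := by
    have : C * KV (y + r • e) * K x ≤ C * (|B| * K (y + r • e)) * K x := by
      gcongr; exact h2.trans (by gcongr; exact le_abs_self B)
    linarith
  have := le_of_mul_le_mul_left h3 hKA
  linarith

lemma test_le_int (hΩ : IsOpen Ω) {V u φ : ES N → ℝ} (hV : Vok Ω V) (hu : ContinuousOn u Ω)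
    (hu0 : ∀ x ∈ Ω, 0 ≤ u x) (hφ : IsTestFun Ω φ) {g : ES N → ℝ} (hg : IntegrableOn g Ω)
    (h : ∀ x ∈ Ω, V x * u x * φ x ≤ g x) : ∫ z, V z * u z * φ z ≤ ∫ z in Ω, g z := by
  have h1 : ∫ z, V z * u z * φ z = ∫ z in Ω, V z * u z * φ z := by
    rw [setIntegral_eq_integral_of_forall_compl_eq_zero]
    intro z hz; rw [hφ.off hz, mul_zero]
  rw [h1]
  exact setIntegral_mono_on (test_intV hV hφ (contLI hΩ hu)).integrableOn hg hΩ.measurableSet h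

theorem Ctx.iv_imp (c : Ctx Ω x₀ y e d M R t A m J K) {V KV : ES N → ℝ} (hV : Glo Ω y d A R V KV)
    (h : IntegrableOn (fun z => J z * V z * K z) Ω) : ∃ C > 0, ∀ x ∈ Ω, KV x ≤ C * K x := by
  obtain ⟨r1, hr1, C, hC, hR, hE⟩ := c.E
  obtain ⟨C', hC', hcmp⟩ := c.cmp
  have hM := c.lg.M1
  set g : ES N → ℝ := fun z => J z * V z * K z with hg
  have hg0 : ∀ x ∈ Ω, 0 ≤ g x := fun x hx =>
    mul_nonneg (mul_nonneg (c.gr.pos x hx).le (hV.vok.nn x hx)) (c.kg.sol.pos x hx).le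
  have hlim : Tendsto (fun n : ℕ => ∫ z in Ω ∩ ball y (1 / ((n:ℝ) + 1)), g z) atTop
      (𝓝 (∫ z in ⋂ n : ℕ, Ω ∩ ball y (1 / ((n:ℝ) + 1)), g z)) := by
    refine tendsto_setIntegral_of_antitone (fun n => c.op.measurableSet.inter measurableSet_ball)
      (fun a b hab => inter_subset_inter_right _ (ball_subset_ball ?_))
      ⟨0, h.mono_set inter_subset_left⟩
    have : (a:ℝ) ≤ b := by exact_mod_cast hab
    gcongr
  have hemp : (⋂ n : ℕ, Ω ∩ ball y (1 / ((n:ℝ) + 1))) = ∅ := by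
    ext x
    simp only [mem_iInter, mem_inter_iff, mem_ball, mem_empty_iff_false, iff_false]
    intro hx
    have hxy : 0 < dist x y := dist_pos.2 fun h => c.yn (h ▸ (hx 0).1)
    obtain ⟨n, hn⟩ := exists_nat_one_div_lt hxy
    exact absurd (hx n).2 (by linarith)
  rw [hemp, setIntegral_empty] at hlim
  have hev := (hlim.eventually_lt_const (show (0:ℝ) < 1 / (2 * C * C') by positivity)).and
    ((tendsto_one_div_add_atTop_nhds_zero_nat (𝕜 := ℝ)).eventually_lt_const hr1)
  obtain ⟨n, hn1, hn2⟩ := hev.exists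
  set R' : ℝ := 1 / ((n:ℝ) + 1) with hR'
  have hR'0 : 0 < R' := by positivity
  have hR'R : 16 * M * R' ≤ R := (mul_le_mul_of_nonneg_left hn2.le (by positivity)).trans hR
  set I := ∫ z in Ω, g z with hI
  have hI0 : 0 ≤ I := setIntegral_nonneg c.op.measurableSet hg0
  have hKR := c.kg.sol.pos _ (c.Ar hR'0 hR'R)
  have hVR := hV.sol.pos _ (c.Ar hR'0 hR'R)
  have hS := c.gr.m_pos hV.sol.sup.1 hV.sol.pos
  refine c.fin hV hR'0 hR'R (B := 2 * C * ((∫ z, KV z * m z) +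
    C' * (KV (y + R' • e) / K (y + R' • e)) * I)) fun r hr hrr => ?_
  have hrR : 16 * M * r ≤ R := (mul_le_mul_of_nonneg_left hrr (by positivity)).trans hR'R
  obtain ⟨-, φ, hφ, h0, hle, hz, hu⟩ := hE r hr (hrr.trans hn2.le)
  have h1 := hu V KV hV
  have hKA := c.kg.sol.pos _ (c.Ar hr hrR)
  have hVA := hV.sol.pos _ (c.Ar hr hrR)
  set lR := KV (y + R' • e) / K (y + R' • e) with hlR
  set lr := KV (y + r • e) / K (y + r • e) with hlr
  have hcmp' : ∀ s, 0 < s → 16 * M * s ≤ R → ∀ x ∈ Ω, s ≤ dist x y →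
      KV x ≤ C' * (KV (y + s • e) / K (y + s • e)) * K x := by
    intro s hs hsR x hx hsx
    have := hcmp V _ KV K hV c.kg (fun z hz => hV.vok.nn z hz) s hs hsR x hx hsx
    have hK := c.kg.sol.pos _ (c.Ar hs hsR)
    rw [mul_div_assoc', div_mul_eq_mul_div, le_div_iff₀ hK]; exact this
  have hgi : IntegrableOn ((Ω ∩ ball y R').indicator g) Ω :=
    h.indicator (c.op.measurableSet.inter measurableSet_ball)
  have h2 := test_le_int c.op hV.vok hV.sol.sup.1 (fun x hx => (hV.sol.pos x hx).le) hφ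
    (g := fun z => C' * lR * g z + C' * lr * (Ω ∩ ball y R').indicator g z)
    ((h.const_mul _).add (hgi.const_mul _)) (fun x hx => by
      have hVx := hV.vok.nn x hx
      have hJx := c.gr.pos x hx
      have hKx := c.kg.sol.pos x hx
      have hKVx := hV.sol.pos x hx
      have hgx := hg0 x hx
      have hb : ∀ l, KV x ≤ C' * l * K x → V x * KV x * φ x ≤ C' * l * g x := by
        intro l hl
        calc V x * KV x * φ x ≤ V x * (C' * l * K x) * J x := by
              have := h0 x
              have h5 : 0 ≤ C' * l * K x := hKVx.le.trans hl
              gcongr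
              exact hle x hx
          _ = _ := by rw [hg]; ring
      by_cases hd : R' ≤ dist x y
      · have h3 := hb lR (hcmp' R' hR'0 hR'R x hx hd)
        have h4 : 0 ≤ (Ω ∩ ball y R').indicator g x := by
          by_cases hxx : x ∈ Ω ∩ ball y R'
          · rw [indicator_of_mem hxx]; exact hgx
          · rw [indicator_of_notMem hxx]
        have : 0 ≤ C' * lr * (Ω ∩ ball y R').indicator g x := by positivity
        linarith
      · rw [indicator_of_mem (show x ∈ Ω ∩ ball y R' from ⟨hx, not_le.1 hd⟩)]
        have h5 : 0 ≤ C' * lR * g x := by positivity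
        by_cases hdr : dist x y ≤ r
        · rw [hz x hdr, mul_zero]
          have : 0 ≤ C' * lr * g x := by positivity
          linarith
        · have h3 := hb lr (hcmp' r hr hrR x hx (not_le.1 hdr).le)
          linarith)
  have h3 : ∫ z in Ω, (C' * lR * g z + C' * lr * (Ω ∩ ball y R').indicator g z) =
      C' * lR * I + C' * lr * ∫ z in Ω ∩ ball y R', g z := by
    rw [integral_add (h.const_mul _) (hgi.const_mul _), integral_const_mul, integral_const_mul,
      setIntegral_indicator (c.op.measurableSet.inter measurableSet_ball)]
    congr 4
    ext z; simp only [mem_inter_iff]; tauto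
  rw [h3] at h2
  have h4 : lr ≤ C * ((∫ z, KV z * m z) + (C' * lR * I + C' * lr * (1 / (2 * C * C')))) := by
    rw [hlr, div_le_iff₀ hKA]
    refine h1.trans ?_
    have : C * K (y + r • e) * ((∫ z, KV z * m z) + ∫ z, V z * KV z * φ z) ≤
        C * K (y + r • e) * ((∫ z, KV z * m z) + (C' * lR * I + C' * lr * (1 / (2 * C * C')))) := by
      gcongr
      refine h2.trans ?_
      gcongr
    linarith
  have h5 : C * (C' * lr * (1 / (2 * C * C'))) = lr / 2 := by field_simp
  have h6 : lr ≤ 2 * C * ((∫ z, KV z * m z) + C' * lR * I) := by nlinarith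
  rw [← div_le_iff₀ hKA]
  exact h6

theorem Ctx.iii_imp (c : Ctx Ω x₀ y e d M R t A m J K) {V KV : ES N → ℝ} (hV : Glo Ω y d A R V KV)
    {s : ES N → ℝ} (hs : IsSuperharmonicOn Ω s) (hle : ∀ x ∈ Ω, KV x ≤ s x) :
    IntegrableOn (fun z => J z * V z * KV z) Ω := by
  have hsm : Integrable fun z => s z * m z :=
    int_of_supp (isCompact_closedBall x₀ t)
      (hs.2.1.integrableOn_compact_subset c.gr.ball (isCompact_closedBall _ _)) c.gr.mc c.gr.mz
  -- bound for the test functions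
  have hbd : ∀ ε, 0 < ε → ∫ z, V z * KV z * phi Ω J K ε 0 z ≤ ∫ z, s z * m z := by
    intro ε hε
    have hT : IsTestFun Ω (phi Ω J K ε 0) := c.phi_test hε le_rfl
    have h1 := c.nu_id hT (phi_nonneg hε 0) hV.sol
    have h2 := c.gr.m_pos hV.sol.sup.1 hV.sol.pos
    have h3 := superh_weak c.op hs hT (phi_nonneg hε 0)
    have hsl := test_int_lap hT hs.2.1
    have h4 : ∫ z, KV z * (lap (phi Ω J K ε 0) z + m z) ≤
        ∫ z, (s z * lap (phi Ω J K ε 0) z + s z * m z) := by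
      refine integral_mono (c.nu_int hT hV.sol.sup.1) (hsl.add hsm) fun z => ?_
      simp only
      rw [← mul_add]
      by_cases hz : z ∈ Ω
      · exact mul_le_mul_of_nonneg_right (hle z hz) (c.nu_nonneg hε le_rfl z)
      · rw [hT.lap_off hz, c.gr.mz z fun h => hz (c.gr.ball h)]; simp
    rw [integral_add hsl hsm] at h4
    linarith
  rw [← fin_iff c.op c.gr.cont hV.sol.sup.1 hV.vok (fun x hx => (c.gr.pos x hx).le)
    (fun x hx => (hV.sol.pos x hx).le)]
  set F : ℕ → ES N → ℝ≥0∞ := fun n z =>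
    ENNReal.ofReal (V z * KV z * phi Ω J K (1 / ((n:ℝ) + 1)) 0 z) with hF
  have hεn : ∀ n : ℕ, (0:ℝ) < 1 / ((n:ℝ) + 1) := fun n => by positivity
  have hFm : ∀ n, AEMeasurable (F n) (volume.restrict Ω) := fun n =>
    ENNReal.measurable_ofReal.comp_aemeasurable ((hV.vok.meas.aemeasurable.mul
      (hV.sol.sup.1.aemeasurable c.op.measurableSet)).mul
        (c.phi_test (hεn n) le_rfl).1.continuous.measurable.aemeasurable)
  have hFb : ∀ n, ∫⁻ z in Ω, F n z ≤ ENNReal.ofReal (∫ z, s z * m z) := by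
    intro n
    have hT : IsTestFun Ω (phi Ω J K (1 / ((n:ℝ) + 1)) 0) := c.phi_test (hεn n) le_rfl
    rw [← ofReal_integral_eq_lintegral_ofReal
      (test_intV hV.vok hT (contLI c.op hV.sol.sup.1)).integrableOn]
    · refine ENNReal.ofReal_le_ofReal ((setIntegral_eq_integral_of_forall_compl_eq_zero ?_).trans_le
        (hbd _ (hεn n)))
      intro z hz; rw [hT.off hz, mul_zero]
    · filter_upwards [ae_restrict_mem c.op.measurableSet] with z hz
      exact mul_nonneg (mul_nonneg (hV.vok.nn z hz) (hV.sol.pos z hz).le) (phi_nonneg (hεn n) 0 z)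
  have hfatou := lintegral_liminf_le' (μ := volume.restrict Ω) (u := atTop) hFm
  refine lt_of_le_of_lt ?_ (lt_of_le_of_lt hfatou (lt_of_le_of_lt
    (liminf_le_of_le (a := ENNReal.ofReal (∫ z, s z * m z)) (by isBoundedDefault)
      fun b hb => ?_) ENNReal.ofReal_lt_top))
  · refine setLIntegral_mono_ae' c.op.measurableSet (Eventually.of_forall fun z hz => ?_)
    have : Tendsto (fun n => F n z) atTop (𝓝 (ENNReal.ofReal (J z * V z * KV z))) := by
      refine ENNReal.tendsto_ofReal ?_
      have h1 : Tendsto (fun n : ℕ => phi Ω J K (1 / ((n:ℝ) + 1)) 0 z) atTop (𝓝 (J z)) := by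
        have h2 : Tendsto (fun n : ℕ => J z - 2 * (1 / ((n:ℝ) + 1))) atTop (𝓝 (J z)) := by
          have := ((tendsto_one_div_add_atTop_nhds_zero_nat (𝕜 := ℝ)).const_mul 2).const_sub (J z)
          simpa using this
        refine tendsto_of_tendsto_of_tendsto_of_le_of_le h2 tendsto_const_nhds (fun n => ?_)
          fun n => c.phi_le (hεn n) le_rfl hz
        have := Ctx.phi_ge (K := K) (J := J) (β := 0) (hεn n) hz
        simpa using this
      have := h1.const_mul (V z * KV z)
      rwa [show J z * V z * KV z = V z * KV z * J z by ring]
    exact this.liminf_eq.ge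
  · obtain ⟨n, hn⟩ := hb.exists
    exact hn.trans (hFb n)

end Part19

section Part20
variable {N : ℕ}

lemma cdiv {f d : ES N → ℝ} (hf : Continuous f) (hd : Continuous d)
    (hs : ∀ x ∈ tsupport f, 0 < d x) : Continuous fun z => f z / d z := by
  rw [continuous_iff_continuousAt]
  intro x
  by_cases hx : x ∈ tsupport f
  · exact hf.continuousAt.div hd.continuousAt (hs x hx).ne'
  · have h1 : ∀ᶠ z in 𝓝 x, f z / d z = 0 := by
      filter_upwards [(isClosed_tsupport f).isOpen_compl.mem_nhds hx] with z hz
      rw [image_eq_zero_of_notMem_tsupport hz, zero_div]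
    exact (continuousAt_const (y := (0:ℝ))).congr (h1.mono fun z hz => hz.symm)

lemma dir_le {f : ES N → ℝ} {e : ES N} (he : ‖e‖ = 1) (x : ES N) :
    (fderiv ℝ f x e) ^ 2 ≤ ∑ i, (dd i f x) ^ 2 := by
  set v := (InnerProductSpace.toDual ℝ (ES N)).symm (fderiv ℝ f x) with hv
  have h1 : ∀ w, fderiv ℝ f x w = inner ℝ v w := fun w => by
    rw [hv, InnerProductSpace.toDual_symm_apply]
  have h2 : ∑ i, (dd i f x) ^ 2 = ‖v‖ ^ 2 := by
    rw [← sum_inner_sq v]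
    exact Finset.sum_congr rfl fun i _ => by rw [dd, h1]
  rw [h2, h1, ← sq_abs]
  have := abs_real_inner_le_norm v e
  rw [he, mul_one] at this
  gcongr

lemma hardy {f d : ES N → ℝ} {e : ES N} (hf : ContDiff ℝ (⊤ : ℕ∞) f) (hc : HasCompactSupport f)
    (hd : Continuous d) (he : ‖e‖ = 1) (hsh : ∀ x t, d (x + t • e) = d x + t)
    (hs : ∀ x ∈ tsupport f, 0 < d x) :
    ∫ z, (f z / d z) ^ 2 ≤ 4 * ∫ z, ∑ i, (dd i f z) ^ 2 := by
  set D : ES N → ℝ := fun z => fderiv ℝ f z e with hD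
  have hDc : Continuous D := (hf.continuous_fderiv (by simp)).clm_apply continuous_const
  have hq : Continuous fun z => f z / d z := cdiv hf.continuous hd hs
  have hqs : HasCompactSupport fun z => f z / d z :=
    hc.mono' (fun z hz => subset_tsupport f fun h => hz (by simp [h]))
  have hline : ∀ x ∈ tsupport f, HasLineDerivAt ℝ (fun z => f z / d z)
      (D x / d x - f x / d x / d x) x e := by
    intro x hx
    have h1 : HasLineDerivAt ℝ f (D x) x e :=
      ((smooth_diff hf x).hasFDerivAt).hasLineDerivAt e
    unfold HasLineDerivAt at h1 ⊢
    have h2 : HasDerivAt (fun t : ℝ => d x + t) 1 0 := (hasDerivAt_id (0:ℝ)).const_add _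
    have h3 := h1.div h2 (by simpa using (hs x hx).ne')
    have h4 : (fun t : ℝ => f (x + t • e) / d (x + t • e)) =
        (fun t : ℝ => f (x + t • e)) / fun t : ℝ => d x + t := by
      funext t; simp [hsh]
    rw [h4]
    refine h3.congr_deriv ?_
    have := (hs x hx).ne'
    simp only [zero_smul, add_zero, mul_one]
    field_simp
  have i1 : Integrable fun z => D z * (f z / d z) :=
    (hDc.mul hq).integrable_of_hasCompactSupport hqs.mul_left
  have i2 : Integrable fun z => (f z / d z) ^ 2 :=
    (hq.pow 2).integrable_of_hasCompactSupport (by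
      have := hqs.mul_left (f := fun z => f z / d z)
      simpa [pow_two] using this)
  have hDs : HasCompactSupport D := hc.fderiv_apply ℝ e
  have i3 : Integrable fun z => (D z) ^ 2 :=
    (hDc.pow 2).integrable_of_hasCompactSupport (by
      have := hDs.mul_left (f := D)
      simpa [pow_two] using this)
  have hpt : ∀ z, f z * (D z / d z - f z / d z / d z) = D z * (f z / d z) - (f z / d z) ^ 2 := by
    intro z; ring
  have key := integral_bilinear_hasLineDerivAt_right_eq_neg_left_of_integrable
    (μ := (volume : Measure (ES N))) (f := f) (f' := D) (g := fun z => f z / d z)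
    (g' := fun x => D x / d x - f x / d x / d x) (v := e) (B := ContinuousLinearMap.mul ℝ ℝ)
    (by simpa using i1) (by simp only [ContinuousLinearMap.mul_apply', hpt]; exact i1.sub i2)
    (by
      simp only [ContinuousLinearMap.mul_apply']
      exact (hf.continuous.mul hq).integrable_of_hasCompactSupport hqs.mul_left)
    (fun x _ => ((smooth_diff hf x).hasFDerivAt).hasLineDerivAt e) hline
  simp only [ContinuousLinearMap.mul_apply', hpt] at key
  rw [integral_sub i1 i2] at key
  have h5 : ∫ z, (f z / d z) ^ 2 = 2 * ∫ z, D z * (f z / d z) := by linarith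
  have h6 : 2 * ∫ z, D z * (f z / d z) ≤ ∫ z, ((1 / 2) * (f z / d z) ^ 2 + 2 * (D z) ^ 2) := by
    rw [← integral_const_mul]
    refine integral_mono (i1.const_mul 2) ((i2.const_mul _).add (i3.const_mul _)) fun z => ?_
    simp only
    nlinarith [sq_nonneg (f z / d z - 2 * D z)]
  rw [integral_add (i2.const_mul _) (i3.const_mul _), integral_const_mul, integral_const_mul] at h6
  have h7 : ∫ z, (D z) ^ 2 ≤ ∫ z, ∑ i, (dd i f z) ^ 2 := by
    refine integral_mono i3 ?_ fun z => dir_le he z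
    refine integrable_finset_sum _ fun i _ => ?_
    refine ((dd_contDiff hf i).continuous.pow 2).integrable_of_hasCompactSupport ?_
    have := (dd_supp hc i).mul_left (f := dd i f)
    simpa [pow_two] using this
  linarith

/-- energy identity -/
lemma energy {ψ u : ES N → ℝ} (hψ : ContDiff ℝ (⊤ : ℕ∞) ψ) (hu : ContDiff ℝ (⊤ : ℕ∞) u)
    (hc : HasCompactSupport ψ) :
    ∫ z, ∑ i, (dd i (fun z => ψ z * u z) z) ^ 2 =
      (∫ z, u z ^ 2 * ∑ i, (dd i ψ z) ^ 2) - ∫ z, ψ z ^ 2 * u z * lap u z := by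
  have hh : ContDiff ℝ (⊤ : ℕ∞) (fun z => ψ z ^ 2 * u z) := (hψ.pow 2).mul hu
  have hhc : HasCompactSupport (fun z => ψ z ^ 2 * u z) :=
    hc.mono' (fun z hz => subset_tsupport ψ fun h => hz (by simp [h]))
  have hpt : ∀ z, ∑ i, (dd i (fun z => ψ z * u z) z) ^ 2 = u z ^ 2 * ∑ i, (dd i ψ z) ^ 2 +
      ∑ i, dd i u z * dd i (fun z => ψ z ^ 2 * u z) z := by
    intro z
    rw [Finset.mul_sum, ← Finset.sum_add_distrib]
    refine Finset.sum_congr rfl fun i _ => ?_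
    have e1 := dd_mul (smooth_diff hψ z) (smooth_diff hu z) i
    have e2 := dd_mul (f := fun z => ψ z ^ 2) (smooth_diff (hψ.pow 2) z) (smooth_diff hu z) i
    have e3 : dd i (fun z => ψ z ^ 2) z = 2 * ψ z * dd i ψ z := by
      have := dd_mul (smooth_diff hψ z) (smooth_diff hψ z) i
      simp only [pow_two]
      rw [this]; ring
    rw [e1, e2, e3]; ring
  have i1 : Integrable fun z => u z ^ 2 * ∑ i, (dd i ψ z) ^ 2 := by
    refine Continuous.integrable_of_hasCompactSupport ?_ ?_
    · exact (hu.continuous.pow 2).mul (continuous_finset_sum _ fun i _ =>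
        (dd_contDiff hψ i).continuous.pow 2)
    · refine HasCompactSupport.intro hc fun z hz => ?_
      have : ∀ i, dd i ψ z = 0 := fun i => by
        by_contra h
        exact hz (by
          have := (tsupport_fderiv_apply_subset ℝ (f := ψ) (EuclideanSpace.single i 1))
          exact this (subset_tsupport _ h))
      simp [this]
  have i2 : ∀ i, Integrable fun z => dd i u z * dd i (fun z => ψ z ^ 2 * u z) z := fun i =>
    ((dd_contDiff hu i).continuous.mul (dd_contDiff hh i).continuous).integrable_of_hasCompactSupport
      (dd_supp hhc i).mul_left
  simp_rw [hpt]
  rw [integral_add i1 (integrable_finset_sum _ fun i _ => i2 i), integral_finset_sum _ fun i _ => i2 i]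
  have : ∑ i, ∫ z, dd i u z * dd i (fun z => ψ z ^ 2 * u z) z =
      - ∫ z, ψ z ^ 2 * u z * lap u z := by
    simp_rw [dd_parts (dd_contDiff hu _) hh hhc, lap_eq, Finset.mul_sum]
    rw [integral_finset_sum, Finset.sum_neg_distrib]
    · congr 1
      refine Finset.sum_congr rfl fun i _ => ?_
      congr 1; funext z; ring
    · intro i _
      exact (hh.continuous.mul (dd_contDiff (dd_contDiff hu i) i).continuous).integrable_of_hasCompactSupport
        hhc.mul_right
  rw [this]; ring

end Part20

section Part21
variable {N : ℕ}

lemma unif_near {P : Set (ES N)} (hP : IsCompact P) {W : ES N → ℝ} (hW : Continuous W) {ε : ℝ}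
    (hε : 0 < ε) : ∃ ρ > 0, ∀ x ∈ P, ∀ z, dist z x < ρ → |W z - W x| ≤ ε := by
  have h := hP.uniformContinuousAt_of_continuousAt W (fun a _ => hW.continuousAt)
    (Metric.dist_mem_uniformity hε)
  obtain ⟨ρ, hρ, h2⟩ := Metric.mem_uniformity_dist.1 h
  refine ⟨ρ, hρ, fun x hx z hz => ?_⟩
  have := h2 (a := x) (b := z) (by rwa [dist_comm]) hx
  have h3 : dist (W x) (W z) < ε := this
  rw [Real.dist_eq, abs_sub_comm] at h3
  exact h3.le

lemma cont_int {w : ES N → ℝ} (hw : Continuous w) (x : ES N) (ρ : ℝ) :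
    IntegrableOn w (closedBall x ρ) :=
  hw.continuousOn.integrableOn_compact (isCompact_closedBall x ρ)

lemma lap_av' {h : ES N → ℝ} (hh : ContDiff ℝ (⊤ : ℕ∞) h) {t : ℝ} (ht : 0 < t) (x : ES N) :
    lap (av kap t h) x = av kap t (lap h) x := by
  rw [lap_av hh.continuous.locallyIntegrable ht, av]
  congr 1
  exact lap_symm hh (contDiff_radial kap_prof.smooth _ x) (ker_supp kap_prof ht x)

lemma dd_off {ψ : ES N → ℝ} {z : ES N} (hz : z ∉ tsupport ψ) (i : Fin N) : dd i ψ z = 0 := by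
  by_contra h
  exact hz (by
    have := (tsupport_fderiv_apply_subset ℝ (f := ψ) (EuclideanSpace.single i 1))
    exact this (subset_tsupport _ h))

set_option maxHeartbeats 1600000 in
lemma CH_eps {Ω U : Set (ES N)} {W ψ V u d : ES N → ℝ} {e : ES N} (hΩ : IsOpen Ω) (hU : IsOpen U)
    (hW : Continuous W) (hWs : HasCompactSupport W) (hW0 : ∀ x ∈ U, x ∉ Ω → W x ≤ 0)
    (hψ : IsTestFun U ψ) (hψ0 : ∀ x, 0 ≤ ψ x) (hV : Vok Ω V) (hu : ContinuousOn u Ω)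
    (hu0 : ∀ x ∈ Ω, 0 ≤ u x)
    (heq : ∀ φ, IsTestFun (Ω ∩ U) φ → (∀ x, 0 ≤ φ x) →
      -(∫ z, V z * u z * φ z) ≤ ∫ z, W z * lap φ z)
    (hd : Continuous d) (he : ‖e‖ = 1) (hsh : ∀ x t, d (x + t • e) = d x + t)
    (hdp : ∀ x ∈ Ω ∩ U, 0 < d x)
    (hIntg : IntegrableOn (fun z => V z * u z * (ψ z ^ 2 * max (W z) 0)) Ω) {ε τ : ℝ}
    (hε : 0 < ε) (hτ : 0 < τ) :
    ∃ f : ES N → ℝ, (∀ z, 0 ≤ f z) ∧ (∀ z, ψ z * (W z - 5 * ε) ≤ f z) ∧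
      Integrable (fun z => (f z / d z) ^ 2) ∧
      ∫ z, (f z / d z) ^ 2 ≤ 4 * (∫ z, max (W z) 0 ^ 2 * ∑ i, (dd i ψ z) ^ 2) +
        4 * (∫ z in Ω, V z * u z * (ψ z ^ 2 * max (W z) 0)) + τ := by
  set P := tsupport ψ with hP
  have hPc : IsCompact P := hψ.2.1
  set Q := P ∩ {x | ε ≤ W x} with hQ
  have hQc : IsCompact Q := hPc.inter_right (isClosed_le continuous_const hW)
  have hQs : Q ⊆ Ω ∩ U := by
    rintro x ⟨h1, h2⟩
    have h2' : ε ≤ W x := h2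
    refine ⟨?_, hψ.2.2 h1⟩
    by_contra h
    linarith [hW0 x (hψ.2.2 h1) h]
  obtain ⟨ρ1, hρ1, hQ1⟩ := hQc.exists_cthickening_subset_open (hΩ.inter hU) hQs
  set Q1 := cthickening ρ1 Q with hQ1d
  have hQ1c : IsCompact Q1 := hQc.cthickening
  have hQ1Ω : Q1 ⊆ Ω := hQ1.trans inter_subset_left
  obtain ⟨ρ2, hρ2, hWu⟩ := unif_near hPc hW hε
  set H : ES N → ℝ := fun z => ψ z ^ 2 * max (W z) 0 with hH
  have hHc : Continuous H := (hψ.1.continuous.pow 2).mul (hW.max continuous_const)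
  have hH0 : ∀ z, 0 ≤ H z := fun z => by simp only [hH]; positivity
  have hVuQ : IntegrableOn (fun z => V z * u z) Q1 :=
    hV.intOn hQ1c hQ1Ω ((hu.mono hQ1Ω).integrableOn_compact hQ1c)
  have hVu0 : ∀ z ∈ Ω, 0 ≤ V z * u z := fun z hz => mul_nonneg (hV.nn z hz) (hu0 z hz)
  set I1 := ∫ z in Q1, V z * u z with hI1
  have hI10 : 0 ≤ I1 := setIntegral_nonneg hQ1c.measurableSet fun z hz => hVu0 z (hQ1Ω hz)
  set τ' := τ / (4 * (1 + I1)) with hτ'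
  have hτ'0 : 0 < τ' := by positivity
  obtain ⟨ρ3, hρ3, hHu⟩ := unif_near hQ1c hHc hτ'0
  set t := min ρ1 (min ρ2 ρ3) with htd
  have ht : 0 < t := lt_min hρ1 (lt_min hρ2 hρ3)
  have ht1 : t ≤ ρ1 := min_le_left _ _
  have ht2 : t ≤ ρ2 := (min_le_right _ _).trans (min_le_left _ _)
  have ht3 : t ≤ ρ3 := (min_le_right _ _).trans (min_le_right _ _)
  have hZ : 0 < Zk N := Zk_pos
  set Wt : ES N → ℝ := fun x => (Zk N)⁻¹ * av kap t W x with hWt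
  have hWts : ContDiff ℝ (⊤ : ℕ∞) Wt :=
    contDiff_const.mul (av_contDiff hW.locallyIntegrable ht)
  have hnear : ∀ x ∈ P, W x - ε ≤ Wt x ∧ Wt x ≤ W x + ε := by
    intro x hx
    have h1 := const_le_av kap_prof ht (cont_int hW x t) (c := W x - ε) (fun z hz => by
      have := abs_le.1 (hWu x hx z (lt_of_lt_of_le hz ht2)); linarith)
    have h2 := av_le_const kap_prof ht (cont_int hW x t) (c := W x + ε) (fun z hz => by
      have := abs_le.1 (hWu x hx z (lt_of_lt_of_le hz ht2)); linarith)
    simp only [hWt]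
    rw [inv_mul_eq_div, le_div_iff₀ hZ, div_le_iff₀ hZ]
    exact ⟨h1, h2⟩
  have h2ε : 0 < 2 * ε := by positivity
  set uu : ES N → ℝ := fun z => gg (2 * ε) (Wt z) with huu
  have huus : ContDiff ℝ (⊤ : ℕ∞) uu := (gg_smooth _).comp hWts
  have huu0 : ∀ z, 0 ≤ uu z := fun z => gg_nonneg h2ε _
  have huule : ∀ z ∈ P, uu z ≤ max (W z) 0 := by
    intro z hz
    have h1 := (hnear z hz).2
    by_cases h : Wt z ≤ 2 * ε
    · simp only [huu]; rw [gg_zero h2ε h]; exact le_max_right _ _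
    · push Not at h
      have h3 := gg_lip h2ε h.le
      rw [gg_zero h2ε le_rfl] at h3
      exact le_max_of_le_left (by simp only [huu]; linarith)
  have huuge : ∀ z ∈ P, W z - 5 * ε ≤ uu z := by
    intro z hz
    have h1 := (hnear z hz).1
    have := gg_ge h2ε (Wt z)
    simp only [huu]; linarith
  have hQne : ∀ z, ψ z * uu z ≠ 0 → z ∈ Q := by
    intro z hz
    have h1 : z ∈ P := subset_tsupport ψ (left_ne_zero_of_mul hz)
    refine ⟨h1, ?_⟩
    by_contra h
    have h' : ¬ ε ≤ W z := h
    push Not at h'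
    exact right_ne_zero_of_mul hz (gg_zero h2ε (by linarith [(hnear z h1).2]))
  have hfs : tsupport (fun z => ψ z * uu z) ⊆ Q :=
    closure_minimal (fun z hz => hQne z hz) hQc.isClosed
  have hfc : HasCompactSupport (fun z => ψ z * uu z) :=
    hQc.of_isClosed_subset (isClosed_tsupport _) hfs
  have hfsm : ContDiff ℝ (⊤ : ℕ∞) (fun z => ψ z * uu z) := hψ.1.mul huus
  have hfd : ∀ x ∈ tsupport (fun z => ψ z * uu z), 0 < d x := fun x hx => hdp x (hQs (hfs hx))
  have hhardy := hardy hfsm hfc hd he hsh hfd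
  rw [energy hψ.1 huus hψ.2.1] at hhardy
  -- the test function h
  set h : ES N → ℝ := fun z => ψ z ^ 2 * uu z * gp (2 * ε) (Wt z) with hh
  have hhs : ContDiff ℝ (⊤ : ℕ∞) h := ((hψ.1.pow 2).mul huus).mul ((gp_smooth _).comp hWts)
  have hh0 : ∀ z, 0 ≤ h z := fun z =>
    mul_nonneg (mul_nonneg (sq_nonneg _) (huu0 z)) (gp_nonneg _ _)
  have hhQ : ∀ z, h z ≠ 0 → z ∈ Q := by
    intro z hz
    apply hQne
    intro h0
    apply hz
    simp only [hh]
    rw [show ψ z ^ 2 * uu z * gp (2 * ε) (Wt z) = ψ z * uu z * (ψ z * gp (2 * ε) (Wt z)) by ring, h0,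
      zero_mul]
  have hhc : HasCompactSupport h :=
    HasCompactSupport.intro hQc fun z hz => by by_contra h0; exact hz (hhQ z h0)
  have hhH : ∀ z, h z ≤ H z := by
    intro z
    by_cases hz : z ∈ P
    · have h1 := huule z hz
      have h2 := gp_le (2 * ε) (Wt z)
      calc h z ≤ ψ z ^ 2 * uu z * 1 :=
            mul_le_mul_of_nonneg_left h2 (mul_nonneg (sq_nonneg _) (huu0 z))
        _ = ψ z ^ 2 * uu z := mul_one _
        _ ≤ _ := mul_le_mul_of_nonneg_left h1 (sq_nonneg _)
    · have : h z = 0 := by by_contra h0; exact hz (hhQ z h0).1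
      rw [this]; exact hH0 z
  have hlapuu : ∀ z, h z * lap Wt z ≤ ψ z ^ 2 * uu z * lap uu z := by
    intro z
    have := lap_comp (w := Wt) (x := z) hWts.contDiffAt (fun s => gg_deriv h2ε s)
      (fun s => gp_deriv (ε := 2 * ε) s)
    have h3 : lap uu z = gp (2 * ε) (Wt z) * lap Wt z +
        deriv (gp (2 * ε)) (Wt z) * ∑ i, (dd i Wt z) ^ 2 := this
    rw [h3]
    have h4 : 0 ≤ deriv (gp (2 * ε)) (Wt z) * ∑ i, (dd i Wt z) ^ 2 :=
      mul_nonneg (gp_deriv_nonneg h2ε _) (Finset.sum_nonneg fun i _ => sq_nonneg _)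
    have h5 := mul_nonneg (mul_nonneg (sq_nonneg (ψ z)) (huu0 z)) h4
    simp only [hh]
    nlinarith
  have hI : ∫ z, h z * lap Wt z ≤ ∫ z, ψ z ^ 2 * uu z * lap uu z := by
    refine integral_mono ?_ ?_ hlapuu
    · exact (hhs.continuous.mul (lap_contDiff hWts).continuous).integrable_of_hasCompactSupport
        hhc.mul_right
    · refine Continuous.integrable_of_hasCompactSupport
        (((hψ.1.continuous.pow 2).mul huus.continuous).mul (lap_contDiff huus).continuous) ?_
      exact HasCompactSupport.intro hψ.2.1 fun z hz => by
        simp [image_eq_zero_of_notMem_tsupport hz]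
  -- the mollified test function
  set φ : ES N → ℝ := fun x => (Zk N)⁻¹ * av kap t h x with hφ
  have hav : ContDiff ℝ (⊤ : ℕ∞) (av kap t h) := av_contDiff hhs.continuous.locallyIntegrable ht
  have hφ0 : ∀ x, 0 ≤ φ x := fun x =>
    mul_nonneg (inv_nonneg.2 hZ.le) (av_nonneg kap_prof ht fun z _ => hh0 z)
  have hφQ : ∀ x, x ∉ Q1 → φ x = 0 := by
    intro x hx
    have h1 : av kap t h x = av kap t (fun _ => 0) x := av_congr kap_prof ht fun z hz => by
      by_contra h0
      exact hx (mem_cthickening_of_dist_le x z ρ1 Q (hhQ z h0)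
        (by rw [dist_comm]; exact (le_of_lt hz).trans ht1))
    simp only [hφ]
    rw [h1, av_const ht]; simp
  have hφs : tsupport φ ⊆ Q1 :=
    closure_minimal (fun z hz => by by_contra h0; exact hz (hφQ z h0)) hQ1c.isClosed
  have hφt : IsTestFun (Ω ∩ U) φ :=
    ⟨contDiff_const.mul hav, hQ1c.of_isClosed_subset (isClosed_tsupport _) hφs, hφs.trans hQ1⟩
  have hE := heq φ hφt hφ0
  have hswap : ∫ z, W z * lap φ z = ∫ z, h z * lap Wt z := by
    have e1 : ∀ z, lap φ z = (Zk N)⁻¹ * av kap t (lap h) z := fun z => by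
      rw [hφ, lap_smul hav, lap_av' hhs ht]
    have e2 : ∀ z, lap Wt z = lap Wt z := fun z => rfl
    have iW : Integrable W := hW.integrable_of_hasCompactSupport hWs
    have iL : Integrable (lap h) :=
      (lap_contDiff hhs).continuous.integrable_of_hasCompactSupport (lap_supp hhc)
    have e3 := av_swap iW iL t
    have e4 := lap_symm hWts hhs hhc
    calc ∫ z, W z * lap φ z = (Zk N)⁻¹ * ∫ z, W z * av kap t (lap h) z := by
          rw [← integral_const_mul]; congr 1; funext z; rw [e1]; ring
      _ = (Zk N)⁻¹ * ∫ z, lap h z * av kap t W z := by rw [e3]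
      _ = ∫ z, Wt z * lap h z := by
          rw [← integral_const_mul]; congr 1; funext z; simp only [hWt]; ring
      _ = ∫ z, lap Wt z * h z := e4
      _ = _ := by congr 1; funext z; ring
  have hφle : ∀ x ∈ Q1, φ x ≤ H x + τ' := by
    intro x hx
    have h1 := av_le_const kap_prof ht (cont_int hhs.continuous x t) (c := H x + τ') (fun z hz => by
      have := abs_le.1 (hHu x hx z (lt_of_lt_of_le hz ht3)); linarith [hhH z])
    simp only [hφ]
    rw [inv_mul_eq_div, div_le_iff₀ hZ]
    exact h1
  have hVφ : ∫ z, V z * u z * φ z ≤ (∫ z in Ω, V z * u z * H z) + τ' * I1 := by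
    have e1 : ∫ z, V z * u z * φ z = ∫ z in Q1, V z * u z * φ z := by
      rw [setIntegral_eq_integral_of_forall_compl_eq_zero]
      intro z hz; rw [hφQ z hz, mul_zero]
    have iH : IntegrableOn (fun z => V z * u z * H z) Q1 := hIntg.mono_set hQ1Ω
    have e2 : ∫ z in Q1, V z * u z * φ z ≤ ∫ z in Q1, (V z * u z * H z + τ' * (V z * u z)) := by
      refine setIntegral_mono_on ?_ (iH.add (hVuQ.const_mul τ')) hQ1c.measurableSet fun z hz => ?_
      · exact (test_intV (hV.mono inter_subset_left) hφt
          (contLI (hΩ.inter hU) (hu.mono inter_subset_left))).integrableOn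
      · have := mul_le_mul_of_nonneg_left (hφle z hz) (hVu0 z (hQ1Ω hz))
        linarith
    rw [integral_add iH (hVuQ.const_mul τ'), integral_const_mul] at e2
    have e3 : ∫ z in Q1, V z * u z * H z ≤ ∫ z in Ω, V z * u z * H z := by
      refine setIntegral_mono_set hIntg ?_ (Eventually.of_forall hQ1Ω)
      filter_upwards [ae_restrict_mem hΩ.measurableSet] with z hz
      exact mul_nonneg (hVu0 z hz) (hH0 z)
    linarith
  have hτI : τ' * I1 ≤ τ / 4 := by
    rw [hτ', div_mul_eq_mul_div, div_le_div_iff₀ (by positivity) (by norm_num)]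
    nlinarith
  have hfirst : ∫ z, uu z ^ 2 * ∑ i, (dd i ψ z) ^ 2 ≤
      ∫ z, max (W z) 0 ^ 2 * ∑ i, (dd i ψ z) ^ 2 := by
    have hcs : Continuous fun z => ∑ i, (dd i ψ z) ^ 2 := continuous_finset_sum _ fun i _ =>
        (dd_contDiff hψ.1 i).continuous.pow 2
    have hsz : ∀ z, z ∉ P → ∑ i, (dd i ψ z) ^ 2 = 0 := fun z hz => by
      simp [dd_off hz]
    refine integral_mono ?_ ?_ fun z => ?_
    · exact ((huus.continuous.pow 2).mul hcs).integrable_of_hasCompactSupport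
        (HasCompactSupport.intro hPc fun z hz => by rw [Pi.mul_apply, hsz z hz, mul_zero])
    · exact (((hW.max continuous_const).pow 2).mul hcs).integrable_of_hasCompactSupport
        (HasCompactSupport.intro hPc fun z hz => by rw [Pi.mul_apply, hsz z hz, mul_zero])
    · by_cases hz : z ∈ P
      · have := huule z hz
        have h0 := huu0 z
        have h1 : 0 ≤ ∑ i, (dd i ψ z) ^ 2 := Finset.sum_nonneg fun i _ => sq_nonneg _
        simp only
        gcongr
      · simp only [hsz z hz, mul_zero, le_refl]
  refine ⟨fun z => ψ z * uu z, fun z => mul_nonneg (hψ0 z) (huu0 z), fun z => ?_, ?_, ?_⟩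
  · by_cases hz : z ∈ P
    · exact mul_le_mul_of_nonneg_left (huuge z hz) (hψ0 z)
    · simp [image_eq_zero_of_notMem_tsupport hz]
  · have hq := cdiv hfsm.continuous hd hfd
    refine (hq.pow 2).integrable_of_hasCompactSupport (HasCompactSupport.intro hfc fun z hz => ?_)
    simp only [Pi.pow_apply]
    rw [image_eq_zero_of_notMem_tsupport hz]; simp
  · have h9 : ∫ z in Ω, V z * u z * (ψ z ^ 2 * max (W z) 0) = ∫ z in Ω, V z * u z * H z := rfl
    rw [h9]
    rw [hswap] at hE
    linarith

/-- Caccioppoli--Hardy inequality -/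
theorem CH {Ω U : Set (ES N)} {W ψ V u d : ES N → ℝ} {e : ES N} (hΩ : IsOpen Ω) (hU : IsOpen U)
    (hW : Continuous W) (hWs : HasCompactSupport W) (hW0 : ∀ x ∈ U, x ∉ Ω → W x ≤ 0)
    (hψ : IsTestFun U ψ) (hψ0 : ∀ x, 0 ≤ ψ x) (hV : Vok Ω V) (hu : ContinuousOn u Ω)
    (hu0 : ∀ x ∈ Ω, 0 ≤ u x)
    (heq : ∀ φ, IsTestFun (Ω ∩ U) φ → (∀ x, 0 ≤ φ x) →
      -(∫ z, V z * u z * φ z) ≤ ∫ z, W z * lap φ z)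
    (hd : Continuous d) (he : ‖e‖ = 1) (hsh : ∀ x t, d (x + t • e) = d x + t)
    (hdp : ∀ x ∈ Ω ∩ U, 0 < d x)
    (hIntg : IntegrableOn (fun z => V z * u z * (ψ z ^ 2 * max (W z) 0)) Ω) :
    Integrable (fun z => (ψ z * max (W z) 0 / d z) ^ 2) ∧
    ∫ z, (ψ z * max (W z) 0 / d z) ^ 2 ≤
      4 * (∫ z, max (W z) 0 ^ 2 * ∑ i, (dd i ψ z) ^ 2) +
        4 * (∫ z in Ω, V z * u z * (ψ z ^ 2 * max (W z) 0)) := by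
  set B := 4 * (∫ z, max (W z) 0 ^ 2 * ∑ i, (dd i ψ z) ^ 2) +
        4 * (∫ z in Ω, V z * u z * (ψ z ^ 2 * max (W z) 0)) with hB
  have hB0 : 0 ≤ B := by
    have h1 : 0 ≤ ∫ z, max (W z) 0 ^ 2 * ∑ i, (dd i ψ z) ^ 2 := integral_nonneg fun z =>
      mul_nonneg (sq_nonneg _) (Finset.sum_nonneg fun i _ => sq_nonneg _)
    have h2 : 0 ≤ ∫ z in Ω, V z * u z * (ψ z ^ 2 * max (W z) 0) :=
      setIntegral_nonneg hΩ.measurableSet fun z hz =>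
        mul_nonneg (mul_nonneg (hV.nn z hz) (hu0 z hz)) (by positivity)
    positivity
  set F : ℕ → ES N → ℝ≥0∞ := fun n z =>
    ENNReal.ofReal ((ψ z * max (W z - 5 * (1 / ((n:ℝ) + 1))) 0 / d z) ^ 2) with hF
  have hεn : ∀ n : ℕ, 0 < 1 / ((n:ℝ) + 1) := fun n => by positivity
  have hFm : ∀ n, AEMeasurable (F n) volume := fun n =>
    (ENNReal.measurable_ofReal.comp ((((hψ.1.continuous.mul ((hW.sub continuous_const).max
      continuous_const)).measurable.div hd.measurable).pow_const 2))).aemeasurable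
  have hFb : ∀ n, ∫⁻ z, F n z ≤ ENNReal.ofReal (B + 1 / ((n:ℝ) + 1)) := by
    intro n
    obtain ⟨f, hf0, hf1, hf2, hf3⟩ := CH_eps hΩ hU hW hWs hW0 hψ hψ0 hV hu hu0 heq hd he hsh hdp
      hIntg (hεn n) (hεn n)
    calc ∫⁻ z, F n z ≤ ∫⁻ z, ENNReal.ofReal ((f z / d z) ^ 2) := by
          refine lintegral_mono fun z => ENNReal.ofReal_le_ofReal ?_
          have h1 : ψ z * max (W z - 5 * (1 / ((n:ℝ) + 1))) 0 ≤ f z := by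
            rw [mul_max_of_nonneg _ _ (hψ0 z), mul_zero]
            exact max_le (hf1 z) (hf0 z)
          have h2 : 0 ≤ ψ z * max (W z - 5 * (1 / ((n:ℝ) + 1))) 0 :=
            mul_nonneg (hψ0 z) (le_max_right _ _)
          rw [div_pow, div_pow]
          gcongr
      _ = ENNReal.ofReal (∫ z, (f z / d z) ^ 2) :=
          (ofReal_integral_eq_lintegral_ofReal hf2 (Eventually.of_forall fun z => sq_nonneg _)).symm
      _ ≤ _ := ENNReal.ofReal_le_ofReal hf3
  have hfatou := lintegral_liminf_le' (μ := (volume : Measure (ES N))) (u := atTop) hFm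
  have hlim : Tendsto (fun n : ℕ => 1 / ((n:ℝ) + 1)) atTop (𝓝 0) :=
    tendsto_one_div_add_atTop_nhds_zero_nat
  have hmain : ∫⁻ z, ENNReal.ofReal ((ψ z * max (W z) 0 / d z) ^ 2) ≤ ENNReal.ofReal B := by
    calc _ = ∫⁻ z, liminf (fun n => F n z) atTop := by
          refine lintegral_congr fun z => ?_
          have : Tendsto (fun n => F n z) atTop
              (𝓝 (ENNReal.ofReal ((ψ z * max (W z) 0 / d z) ^ 2))) := by
            refine ENNReal.tendsto_ofReal ?_
            have h1 := ((hlim.const_mul 5).const_sub (W z)).max (tendsto_const_nhds (x := (0:ℝ)))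
            rw [mul_zero, sub_zero] at h1
            exact ((h1.const_mul (ψ z)).div_const (d z)).pow 2
          exact this.liminf_eq.symm
      _ ≤ _ := hfatou
      _ ≤ liminf (fun n : ℕ => ENNReal.ofReal (B + 1 / ((n:ℝ) + 1))) atTop :=
          liminf_le_liminf (Eventually.of_forall hFb)
      _ = _ := by
          have h2 := ENNReal.tendsto_ofReal (hlim.const_add B)
          rw [add_zero] at h2
          exact h2.liminf_eq
  have hm : Measurable fun z => (ψ z * max (W z) 0 / d z) ^ 2 :=
    ((hψ.1.continuous.mul (hW.max continuous_const)).measurable.div hd.measurable).pow_const 2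
  have hi : Integrable (fun z => (ψ z * max (W z) 0 / d z) ^ 2) := by
    refine ⟨hm.aestronglyMeasurable, ?_⟩
    rw [hasFiniteIntegral_iff_ofReal (Eventually.of_forall fun z => sq_nonneg _)]
    exact lt_of_le_of_lt hmain ENNReal.ofReal_lt_top
  refine ⟨hi, ?_⟩
  rw [← ofReal_integral_eq_lintegral_ofReal hi (Eventually.of_forall fun z => sq_nonneg _)] at hmain
  exact (ENNReal.ofReal_le_ofReal_iff hB0).1 hmain

end Part21

section Part22
variable {N : ℕ}

lemma glob_cont {Ω : Set (ES N)} (hΩ : IsOpen Ω) {p χ : ES N → ℝ} (hp : ContinuousOn p Ω)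
    (hχ : Continuous χ)
    (hv : ∀ q ∈ frontier Ω, q ∈ tsupport χ → Tendsto p (𝓝[Ω] q) (𝓝 0)) :
    Continuous fun x => χ x * Ω.indicator p x := by
  rw [continuous_iff_continuousAt]
  intro x
  by_cases hx : x ∈ Ω
  · have h1 : ContinuousAt (fun z => χ z * p z) x :=
      hχ.continuousAt.mul (hp.continuousAt (hΩ.mem_nhds hx))
    refine h1.congr ?_
    filter_upwards [hΩ.mem_nhds hx] with z hz
    rw [indicator_of_mem hz]
  by_cases hs : x ∈ tsupport χ
  · have h1 : Tendsto p (𝓝[Ω] x) (𝓝 0) := by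
      by_cases hc : x ∈ closure Ω
      · refine hv x ?_ hs
        rw [hΩ.frontier_eq]; exact ⟨hc, hx⟩
      · rw [mem_closure_iff_nhdsWithin_neBot, not_neBot] at hc
        rw [hc]; exact tendsto_bot
    have h2 : Tendsto (Ω.indicator p) (𝓝 x) (𝓝 0) := by
      rw [Metric.tendsto_nhds]
      intro ε hε
      have h3 := (Metric.tendsto_nhds.1 h1) ε hε
      rw [eventually_nhdsWithin_iff] at h3
      filter_upwards [h3] with z hz
      by_cases hzΩ : z ∈ Ω
      · rw [indicator_of_mem hzΩ]; exact hz hzΩ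
      · rw [indicator_of_notMem hzΩ]; simpa using hε
    have h3 : ContinuousAt (Ω.indicator p) x := by
      rw [ContinuousAt, indicator_of_notMem hx]; exact h2
    exact hχ.continuousAt.mul h3
  · have h1 : ∀ᶠ z in 𝓝 x, χ z * Ω.indicator p z = 0 := by
      filter_upwards [(isClosed_tsupport χ).isOpen_compl.mem_nhds hs] with z hz
      rw [image_eq_zero_of_notMem_tsupport hz, zero_mul]
    exact (continuousAt_const (y := (0:ℝ))).congr (h1.mono fun z hz => hz.symm)

lemma loc_CH {Ω U : Set (ES N)} {p χ ψ V u d : ES N → ℝ} {e : ES N} (hΩ : IsOpen Ω)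
    (hbd : Bornology.IsBounded Ω) (hU : IsOpen U) (hp : ContinuousOn p Ω) (hχ : Continuous χ)
    (hv : ∀ q ∈ frontier Ω, q ∈ tsupport χ → Tendsto p (𝓝[Ω] q) (𝓝 0))
    (hχ1 : ∀ x ∈ U, χ x = 1)
    (hψ : IsTestFun U ψ) (hψ0 : ∀ x, 0 ≤ ψ x) (hV : Vok Ω V) (hu : ContinuousOn u Ω)
    (hu0 : ∀ x ∈ Ω, 0 ≤ u x)
    (heq : ∀ φ, IsTestFun (Ω ∩ U) φ → (∀ x, 0 ≤ φ x) →
      -(∫ z, V z * u z * φ z) ≤ ∫ z, p z * lap φ z)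
    (hd : Continuous d) (he : ‖e‖ = 1) (hsh : ∀ x t, d (x + t • e) = d x + t)
    (hdp : ∀ x ∈ Ω ∩ U, 0 < d x)
    (hIntg : IntegrableOn (fun z => V z * u z * (ψ z ^ 2 * max (p z) 0)) Ω) :
    IntegrableOn (fun z => (ψ z * max (p z) 0 / d z) ^ 2) Ω ∧
    ∫ z in Ω, (ψ z * max (p z) 0 / d z) ^ 2 ≤
      4 * (∫ z in Ω, max (p z) 0 ^ 2 * ∑ i, (dd i ψ z) ^ 2) +
        4 * (∫ z in Ω, V z * u z * (ψ z ^ 2 * max (p z) 0)) := by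
  set W : ES N → ℝ := fun x => χ x * Ω.indicator p x with hW
  have hWc : Continuous W := glob_cont hΩ hp hχ hv
  have hWs : HasCompactSupport W := by
    refine HasCompactSupport.intro hbd.isCompact_closure fun x hx => ?_
    simp only [hW]
    rw [indicator_of_notMem fun h => hx (subset_closure h), mul_zero]
  have hWU : ∀ x ∈ Ω, x ∈ U → W x = p x := fun x h1 h2 => by
    simp only [hW]; rw [indicator_of_mem h1, hχ1 x h2, one_mul]
  have hWo : ∀ x, x ∉ Ω → W x = 0 := fun x h1 => by
    simp only [hW]; rw [indicator_of_notMem h1, mul_zero]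
  have hψo : ∀ x, x ∉ U → ψ x = 0 := fun x hx => hψ.off hx
  have e1 : ∀ z ∈ Ω, ψ z ^ 2 * max (W z) 0 = ψ z ^ 2 * max (p z) 0 := fun z hz => by
    by_cases h : z ∈ U
    · rw [hWU z hz h]
    · rw [hψo z h]; ring
  have e2 : ∀ z ∈ Ω, (ψ z * max (W z) 0 / d z) ^ 2 = (ψ z * max (p z) 0 / d z) ^ 2 := fun z hz => by
    by_cases h : z ∈ U
    · rw [hWU z hz h]
    · rw [hψo z h]; simp
  have e3 : ∀ z ∈ Ω, max (W z) 0 ^ 2 * ∑ i, (dd i ψ z) ^ 2 =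
      max (p z) 0 ^ 2 * ∑ i, (dd i ψ z) ^ 2 := fun z hz => by
    by_cases h : z ∈ U
    · rw [hWU z hz h]
    · have : ∀ i, dd i ψ z = 0 := fun i => dd_off (fun hh => h (hψ.2.2 hh)) i
      simp [this]
  have hE : ∀ φ, IsTestFun (Ω ∩ U) φ → (∀ x, 0 ≤ φ x) →
      -(∫ z, V z * u z * φ z) ≤ ∫ z, W z * lap φ z := by
    intro φ hφ h0
    refine (heq φ hφ h0).trans_eq ?_
    congr 1; funext z
    by_cases h : z ∈ tsupport φ
    · rw [hWU z (hφ.2.2 h).1 (hφ.2.2 h).2]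
    · rw [lap_off h]; simp
  obtain ⟨h1, h2⟩ := CH hΩ hU hWc hWs (fun x _ hx => (hWo x hx).le) hψ hψ0 hV hu hu0 hE hd he hsh hdp
    (hIntg.congr_fun (fun z hz => by simp only; rw [e1 z hz]) hΩ.measurableSet)
  refine ⟨h1.integrableOn.congr_fun (fun z hz => e2 z hz) hΩ.measurableSet, ?_⟩
  rw [← setIntegral_congr_fun hΩ.measurableSet (fun z hz => e2 z hz),
    ← setIntegral_congr_fun hΩ.measurableSet (fun z hz => e3 z hz),
    ← setIntegral_congr_fun hΩ.measurableSet (f := fun z => V z * u z * (ψ z ^ 2 * max (W z) 0))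
      (g := fun z => V z * u z * (ψ z ^ 2 * max (p z) 0))
      (fun z hz => by simp only; rw [e1 z hz]),
    setIntegral_eq_integral_of_forall_compl_eq_zero (s := Ω)
      (f := fun z => (ψ z * max (W z) 0 / d z) ^ 2) (fun z hz => by simp [hWo z hz]),
    setIntegral_eq_integral_of_forall_compl_eq_zero (s := Ω)
      (f := fun z => max (W z) 0 ^ 2 * ∑ i, (dd i ψ z) ^ 2) (fun z hz => by simp [hWo z hz])]
  exact h2

end Part22

section Part23
variable {N : ℕ}
variable {Ω : Set (ES N)} {x₀ y e : ES N} {d : ES N → ℝ} {M R t A : ℝ} {m J K : ES N → ℝ}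

/-- Shell cutoff. -/
def shc (y : ES N) (r : ℝ) (z : ES N) : ℝ := cut y (4 * r) z * (1 - cut y r z)

lemma shc_nonneg (y : ES N) (r : ℝ) (z : ES N) : 0 ≤ shc y r z :=
  mul_nonneg (cut_nonneg _ _ _) (sub_nonneg.2 (cut_le _ _ _))

lemma shc_le (y : ES N) (r : ℝ) (z : ES N) : shc y r z ≤ 1 :=
  mul_le_one₀ (cut_le _ _ _) (sub_nonneg.2 (cut_le _ _ _))
    (by linarith [cut_nonneg y r z])

lemma shc_one {y : ES N} {r : ℝ} (hr : 0 < r) {z : ES N} (h1 : r ≤ dist z y)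
    (h2 : dist z y ≤ 2 * r) : shc y r z = 1 := by
  rw [shc, cut_one (by linarith) (by linarith), cut_zero hr h1]; norm_num

lemma shc_zero {y : ES N} {r : ℝ} (hr : 0 < r) {z : ES N}
    (h : ¬ (r / 2 ≤ dist z y ∧ dist z y ≤ 4 * r)) : shc y r z = 0 := by
  rw [not_and_or] at h
  rcases h with h | h
  · rw [shc, cut_one hr (not_le.1 h).le]; simp
  · rw [shc, cut_zero (by linarith) (not_le.1 h).le]; simp

lemma shc_smooth (y : ES N) (r : ℝ) : ContDiff ℝ (⊤ : ℕ∞) (shc y r) :=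
  (cut_smooth _ _).mul (contDiff_const.sub (cut_smooth _ _))

lemma shc_tsupp {y : ES N} {r : ℝ} (hr : 0 < r) :
    tsupport (shc y r) ⊆ {z | r / 2 ≤ dist z y ∧ dist z y ≤ 4 * r} := by
  refine closure_minimal (fun z hz => ?_) ?_
  · by_contra h
    exact hz (shc_zero hr h)
  · have hc : Continuous fun z : ES N => dist z y := by fun_prop
    exact (isClosed_le continuous_const hc).inter (isClosed_le hc continuous_const)

lemma shc_test {y : ES N} {r : ℝ} (hr : 0 < r) :
    IsTestFun {z | r / 4 < dist z y ∧ dist z y < 8 * r} (shc y r) := by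
  refine ⟨shc_smooth y r, ?_, (shc_tsupp hr).trans ?_⟩
  · refine (isCompact_closedBall y (4 * r)).of_isClosed_subset (isClosed_tsupport _) ?_
    exact (shc_tsupp hr).trans fun z hz => hz.2
  · rintro z ⟨h1, h2⟩
    exact ⟨by linarith, by linarith⟩

lemma shc_grad (N : ℕ) : ∃ B > 0, ∀ (y : ES N) (r : ℝ), 0 < r → ∀ z,
    ∑ i, (dd i (shc y r) z) ^ 2 ≤ B / r ^ 2 := by
  obtain ⟨B, hB, h⟩ := cut_bounds N
  refine ⟨4 * B, by positivity, fun y r hr z => ?_⟩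
  have h1 := (h y (4 * r) (by linarith) z).2
  have h2 := (h y r hr z).2
  have hd : ∀ i, dd i (shc y r) z =
      cut y (4 * r) z * (- dd i (cut y r) z) + dd i (cut y (4 * r)) z * (1 - cut y r z) := by
    intro i
    have := dd_mul (f := cut y (4 * r)) (g := fun z => 1 - cut y r z) (x := z)
      (smooth_diff (cut_smooth _ _) z)
      (((smooth_diff (cut_smooth y r)) z).const_sub 1) i
    have e2 : dd i (fun z => 1 - cut y r z) z = - dd i (cut y r) z := by
      unfold dd
      rw [fderiv_const_sub]; rfl
    rw [e2] at this
    exact this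
  have hle : ∀ i, (dd i (shc y r) z) ^ 2 ≤
      2 * (dd i (cut y r) z) ^ 2 + 2 * (dd i (cut y (4 * r)) z) ^ 2 := by
    intro i
    rw [hd]
    have a0 := cut_nonneg y (4 * r) z
    have a1 := cut_le y (4 * r) z
    have b0 := cut_nonneg y r z
    have b1 := cut_le y r z
    generalize cut y (4 * r) z = a at *
    generalize cut y r z = b at *
    generalize dd i (cut y r) z = p
    generalize dd i (cut y (4 * r)) z = q
    have k1 : (a * (-p) + q * (1 - b)) ^ 2 ≤ 2 * (a ^ 2 * p ^ 2) + 2 * ((1 - b) ^ 2 * q ^ 2) := by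
      nlinarith [sq_nonneg (a * (-p) - q * (1 - b))]
    have k2 : a ^ 2 * p ^ 2 ≤ 1 * p ^ 2 := by
      gcongr; nlinarith
    have k3 : (1 - b) ^ 2 * q ^ 2 ≤ 1 * q ^ 2 := by
      gcongr; nlinarith
    linarith
  calc ∑ i, (dd i (shc y r) z) ^ 2 ≤ ∑ i, (2 * (dd i (cut y r) z) ^ 2 + 2 * (dd i (cut y (4 * r)) z) ^ 2) :=
        Finset.sum_le_sum fun i _ => hle i
    _ = 2 * ∑ i, (dd i (cut y r) z) ^ 2 + 2 * ∑ i, (dd i (cut y (4 * r)) z) ^ 2 := by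
        rw [Finset.sum_add_distrib, Finset.mul_sum, Finset.mul_sum]
    _ ≤ 2 * (B / r ^ 2) + 2 * (B / (4 * r) ^ 2) := by gcongr
    _ ≤ 4 * B / r ^ 2 := by
        have : B / (4 * r) ^ 2 ≤ B / r ^ 2 := by
          gcongr; linarith
        have e : 4 * B / r ^ 2 = 4 * (B / r ^ 2) := by ring
        linarith

/-- Shell in `Ω`. -/
def shT (Ω : Set (ES N)) (y : ES N) (r : ℝ) : Set (ES N) :=
  {z | z ∈ Ω ∧ r / 2 ≤ dist z y ∧ dist z y ≤ 4 * r}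

def shS (Ω : Set (ES N)) (y : ES N) (r : ℝ) : Set (ES N) :=
  {z | z ∈ Ω ∧ r < dist z y ∧ dist z y ≤ 2 * r}

lemma shS_meas (hΩ : IsOpen Ω) (r : ℝ) : MeasurableSet (shS Ω y r) :=
  have hc : Measurable fun z : ES N => dist z y := by fun_prop
  hΩ.measurableSet.inter ((measurableSet_lt measurable_const hc).inter
    (measurableSet_le hc measurable_const))

lemma shT_meas (hΩ : IsOpen Ω) (r : ℝ) : MeasurableSet (shT Ω y r) :=
  have hc : Measurable fun z : ES N => dist z y := by fun_prop
  hΩ.measurableSet.inter ((measurableSet_le measurable_const hc).inter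
    (measurableSet_le hc measurable_const))

lemma Ctx.shell_CH (c : Ctx Ω x₀ y e d M R t A m J K) {B : ℝ} {V u p : ES N → ℝ} {r : ℝ}
    (hB : ∀ (y : ES N) (r : ℝ), 0 < r → ∀ z, ∑ i, (dd i (shc y r) z) ^ 2 ≤ B / r ^ 2)
    (hr : 0 < r) (hR : 16 * M * r ≤ R) (hp : ContinuousOn p Ω)
    (hv : ∀ q ∈ frontier Ω, q ≠ y → Tendsto p (𝓝[Ω] q) (𝓝 0))
    (hV : Vok Ω V) (hu : ContinuousOn u Ω) (hu0 : ∀ x ∈ Ω, 0 ≤ u x)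
    (heq : ∀ φ, IsTestFun Ω φ → (∀ x, 0 ≤ φ x) →
      -(∫ z, V z * u z * φ z) ≤ ∫ z, p z * lap φ z)
    (hIntg : IntegrableOn (fun z => V z * u z * (shc y r z ^ 2 * max (p z) 0)) Ω)
    {q : ES N → ℝ} (hq : IntegrableOn q (shT Ω y r))
    (hqp : ∀ z ∈ shT Ω y r, max (p z) 0 ^ 2 ≤ q z) :
    IntegrableOn (fun z => (shc y r z * max (p z) 0 / d z) ^ 2) Ω ∧
    ∫ z in Ω, (shc y r z * max (p z) 0 / d z) ^ 2 ≤
      4 * (B / r ^ 2 * ∫ z in shT Ω y r, q z) +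
        4 * (∫ z in Ω, V z * u z * (shc y r z ^ 2 * max (p z) 0)) := by
  have hM := c.lg.M1
  have h8 : 8 * r < R := by nlinarith
  set U := {z : ES N | r / 4 < dist z y ∧ dist z y < 8 * r} with hU
  have hc : Continuous fun z : ES N => dist z y := by fun_prop
  have hUo : IsOpen U := (isOpen_lt continuous_const hc).inter (isOpen_lt hc continuous_const)
  have hχ : Continuous fun z => 1 - cut y (r / 4) z :=
    continuous_const.sub (cut_smooth y (r / 4)).continuous
  obtain ⟨h1, h2⟩ := loc_CH (Ω := Ω) (U := U) (p := p) (χ := fun z => 1 - cut y (r / 4) z)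
    (ψ := shc y r) (V := V) (u := u) (d := d) (e := e) c.op c.bd hUo hp hχ
    (fun q hqf hqs => hv q hqf (by
      rintro rfl
      have : ∀ᶠ z in 𝓝 q, (1 - cut q (r / 4) z) = 0 := by
        filter_upwards [closedBall_mem_nhds q (show 0 < r / 8 by linarith)] with z hz
        rw [cut_one (by linarith) (by rw [mem_closedBall] at hz; linarith)]; simp
      exact (notMem_tsupport_iff_eventuallyEq.2 this) hqs))
    (fun x hx => by rw [cut_zero (by linarith) hx.1.le]; simp)
    (shc_test hr) (shc_nonneg y r) hV hu hu0
    (fun φ hφ h0 => heq φ ⟨hφ.1, hφ.2.1, hφ.2.2.trans inter_subset_left⟩ h0)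
    c.lg.cont c.lg.e1 c.lg.shift
    (fun x hx => (c.lg.mem x (by rw [mem_ball]; linarith [hx.2.2])).1 hx.1) hIntg
  refine ⟨h1, h2.trans ?_⟩
  have hz : ∀ z, z ∉ {z | r / 2 ≤ dist z y ∧ dist z y ≤ 4 * r} → ∀ i, dd i (shc y r) z = 0 :=
    fun z hz i => dd_off (fun h => hz (shc_tsupp hr h)) i
  have key : ∫ z in Ω, max (p z) 0 ^ 2 * ∑ i, (dd i (shc y r) z) ^ 2 ≤
      B / r ^ 2 * ∫ z in shT Ω y r, q z := by
    rw [← integral_const_mul, ← integral_indicator c.op.measurableSet,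
      ← integral_indicator (shT_meas c.op r)]
    refine integral_mono_of_nonneg (ae_of_all _ fun z => ?_) ((integrable_indicator_iff (shT_meas c.op r)).2
      (Integrable.const_mul hq _)) (ae_of_all _ fun z => ?_)
    · refine indicator_nonneg (fun z _ => ?_) z
      exact mul_nonneg (sq_nonneg _) (Finset.sum_nonneg fun i _ => sq_nonneg _)
    · by_cases h : z ∈ shT Ω y r
      · rw [indicator_of_mem h, indicator_of_mem h.1]
        have h3 := hB y r hr z
        have h4 := hqp z h
        have h5 : 0 ≤ ∑ i, (dd i (shc y r) z) ^ 2 := Finset.sum_nonneg fun i _ => sq_nonneg _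
        calc _ ≤ q z * (B / r ^ 2) := mul_le_mul h4 h3 h5 ((sq_nonneg _).trans h4)
          _ = _ := mul_comm _ _
      · rw [indicator_of_notMem h]
        by_cases h' : z ∈ Ω
        · rw [indicator_of_mem h']
          have : ∀ i, dd i (shc y r) z = 0 := hz z fun hh => h ⟨h', hh⟩
          simp [this]
        · rw [indicator_of_notMem h']
  linarith

/-- comparability of `J/K` on shells, and size of `K`. -/
lemma Ctx.ratio (c : Ctx Ω x₀ y e d M R t A m J K) : ∃ C ≥ (1:ℝ), ∀ r, 0 < r → 64 * M * r ≤ R →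
    ∀ z ∈ shT Ω y r, J z * K (y + r • e) ≤ C * J (y + r • e) * K z ∧
      K z * J (y + r • e) ≤ C * K (y + r • e) * J z ∧ K z ≤ C * K (y + r • e) := by
  obtain ⟨C1, hC1, h1⟩ := c.jout
  obtain ⟨C2, hC2, h2⟩ := c.jin
  obtain ⟨C3, hC3, h3⟩ := c.car
  have hM := c.lg.M1
  set D := cNT N A M (1 / 4) with hD
  have hD1 : 1 ≤ D := one_le_cNT c.hA
  have g : ∀ u, Sol (Ω ∩ ball y R) (fun _ => 0) u → ∀ r, 0 < r → 64 * M * r ≤ R → ∀ p q,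
      r / 2 ≤ p → p ≤ 4 * r → r / 2 ≤ q → q ≤ 4 * r → u (y + p • e) ≤ D * u (y + q • e) := by
    intro u hu r hr hR p q hp1 hp2 hq1 hq2
    have dp : ∀ s, 0 < s → d (y + s • e) = s := fun s _ => by rw [c.lg.shift, c.lg.dz, zero_add]
    refine c.lg.nt c.hA c.vb0 hu (s := 2 * r) (c := 1 / 4) (by linarith) (by norm_num)
      (by nlinarith) ?_ ?_ ?_ ?_
    · rw [mem_ball, c.Ad (by linarith)]; linarith
    · rw [mem_ball, c.Ad (by linarith)]; linarith
    · rw [dp _ (by linarith)]; linarith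
    · rw [dp _ (by linarith)]; linarith
  have hKs := c.kg.pm.sol
  have hJs := c.jpm.sol
  refine ⟨C1 * C2 * C3 * D * D, ?_, fun r hr hR z hz => ?_⟩
  · have : 1 ≤ C1 * C2 := one_le_mul_of_one_le_of_one_le hC1 hC2
    have := one_le_mul_of_one_le_of_one_le this hC3
    have := one_le_mul_of_one_le_of_one_le this hD1
    exact one_le_mul_of_one_le_of_one_le this hD1
  have hAo : ∀ s, 0 < s → s ≤ 4 * r → 0 < K (y + s • e) ∧ 0 < J (y + s • e) := by
    intro s hs hs4
    have : y + s • e ∈ Ω := c.Ar hs (by nlinarith)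
    exact ⟨c.kg.sol.pos _ this, c.gr.pos _ this⟩
  obtain ⟨hz0, hz1, hz2⟩ := hz
  have Kz := c.kg.sol.pos z hz0
  have Jz := c.gr.pos z hz0
  have a1 := h1 (r / 2) (by linarith) (by nlinarith) z hz0 hz1
  have a2 := h2 (4 * r) (by linarith) (by nlinarith) z hz0 hz2
  have a3 := h3 _ _ c.kg (r / 2) (by linarith) (by nlinarith) z hz0 hz1
  have Kr := (hAo r hr (by linarith)).1
  have Jr := (hAo r hr (by linarith)).2
  have K4 := (hAo (4 * r) (by linarith) le_rfl).1
  have J4 := (hAo (4 * r) (by linarith) le_rfl).2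
  have K2 := (hAo (r / 2) (by linarith) (by linarith)).1
  have J2 := (hAo (r / 2) (by linarith) (by linarith)).2
  have k1 := g K hKs r hr hR r (4 * r) (by linarith) (by linarith) (by linarith) (by linarith)
  have k2 := g K hKs r hr hR (r / 2) r (by linarith) (by linarith) (by linarith) (by linarith)
  have j1 := g J hJs r hr hR (4 * r) r (by linarith) (by linarith) (by linarith) (by linarith)
  have j2 := g J hJs r hr hR r (r / 2) (by linarith) (by linarith) (by linarith) (by linarith)
  have hC2' : C2 * (D * D) ≤ C1 * C2 * C3 * D * D := by
    have : 1 ≤ C1 * C3 := one_le_mul_of_one_le_of_one_le hC1 hC3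
    have h0 : 0 ≤ C2 * (D * D) := by positivity
    nlinarith
  have hC1' : C1 * (D * D) ≤ C1 * C2 * C3 * D * D := by
    have : 1 ≤ C2 * C3 := one_le_mul_of_one_le_of_one_le hC2 hC3
    have h0 : 0 ≤ C1 * (D * D) := by positivity
    nlinarith
  have hC3' : C3 * D ≤ C1 * C2 * C3 * D * D := by
    have : 1 ≤ C1 * C2 * D := one_le_mul_of_one_le_of_one_le
      (one_le_mul_of_one_le_of_one_le hC1 hC2) hD1
    have h0 : 0 ≤ C3 * D := by positivity
    nlinarith
  refine ⟨?_, ?_, ?_⟩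
  · calc J z * K (y + r • e) ≤ J z * (D * K (y + (4 * r) • e)) := by gcongr
      _ = D * (J z * K (y + (4 * r) • e)) := by ring
      _ ≤ D * (C2 * J (y + (4 * r) • e) * K z) := by gcongr
      _ ≤ D * (C2 * (D * J (y + r • e)) * K z) := by gcongr
      _ = C2 * (D * D) * (J (y + r • e) * K z) := by ring
      _ ≤ (C1 * C2 * C3 * D * D) * (J (y + r • e) * K z) := by gcongr
      _ = _ := by ring
  · calc K z * J (y + r • e) ≤ K z * (D * J (y + (r / 2) • e)) := by gcongr
      _ = D * (K z * J (y + (r / 2) • e)) := by ring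
      _ ≤ D * (C1 * K (y + (r / 2) • e) * J z) := by gcongr
      _ ≤ D * (C1 * (D * K (y + r • e)) * J z) := by gcongr
      _ = C1 * (D * D) * (K (y + r • e) * J z) := by ring
      _ ≤ (C1 * C2 * C3 * D * D) * (K (y + r • e) * J z) := by gcongr
      _ = _ := by ring
  · calc K z ≤ C3 * K (y + (r / 2) • e) := a3
      _ ≤ C3 * (D * K (y + r • e)) := by gcongr
      _ = C3 * D * K (y + r • e) := by ring
      _ ≤ _ := by gcongr

lemma Ctx.lowerV (c : Ctx Ω x₀ y e d M R t A m J K) {V KV : ES N → ℝ} (hV : Glo Ω y d A R V KV)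
    {δ : ℝ} (hδ : 0 < δ) : ∃ η > 0, ∀ z ∈ Ω, 16 * M * dist z y ≤ R → δ * dist z y ≤ d z →
      η * K z ≤ KV z := by
  obtain ⟨C, hC, h⟩ := c.cmp
  have hM := c.lg.M1
  have hx0 : x₀ ∈ Ω := c.gr.ball (mem_closedBall_self c.gr.tpos.le)
  have Kx := c.kg.sol.pos _ hx0
  have Vx := hV.sol.pos _ hx0
  set D := cNT N A M (min δ 1) with hD
  have hD1 : 1 ≤ D := one_le_cNT c.hA
  have hxR : R ≤ dist x₀ y := by
    by_contra hh
    exact c.far x₀ (by rw [mem_ball]; linarith) (mem_closedBall_self c.gr.tpos.le)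
  refine ⟨KV x₀ / (C * K x₀ * D * D), by positivity, fun z hz hzR hzd => ?_⟩
  have hyz : 0 < dist z y := dist_pos.2 (by rintro rfl; exact c.yn hz)
  set r := dist z y with hr
  have hAo := c.Ar hyz hzR
  have h1 := h V (fun _ => 0) KV K hV c.kg (fun x hx => hV.sol.Vnn x hx) r hyz hzR x₀ hx0
    (by nlinarith)
  have dp : d (y + r • e) = r := by rw [c.lg.shift, c.lg.dz, zero_add]
  have hδ1 : min δ 1 * r ≤ d z := (mul_le_mul_of_nonneg_right (min_le_left _ _) hyz.le).trans hzd
  have hδ2 : min δ 1 * r ≤ d (y + r • e) := by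
    rw [dp]; nlinarith [min_le_right δ 1]
  have zb : z ∈ ball y (4 * r) := by rw [mem_ball]; linarith
  have ab : y + r • e ∈ ball y (4 * r) := by rw [mem_ball, c.Ad hyz]; linarith
  have h2 := c.lg.nt c.hA hV.vb hV.pm.sol hyz (lt_min hδ one_pos) hzR zb ab hδ1 hδ2
  have h3 := c.lg.nt c.hA c.vb0 c.kg.pm.sol hyz (lt_min hδ one_pos) hzR ab zb hδ2 hδ1
  have Kz := c.kg.sol.pos z hz
  have Vz := hV.sol.pos z hz
  rw [div_mul_eq_mul_div, div_le_iff₀ (by positivity)]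
  calc KV x₀ * K z ≤ KV x₀ * (D * K (y + r • e)) := by gcongr
    _ = D * (KV x₀ * K (y + r • e)) := by ring
    _ ≤ D * (C * KV (y + r • e) * K x₀) := by gcongr
    _ ≤ D * (C * (D * KV z) * K x₀) := by gcongr
    _ = _ := by ring

end Part23

section Part24
variable {N : ℕ}
variable {Ω : Set (ES N)} {x₀ y e : ES N} {d : ES N → ℝ} {M R t A : ℝ} {m J K : ES N → ℝ}

lemma sum_lemma {a b : ℕ → ℝ} {B θ C : ℝ} (ha : ∀ k, 0 ≤ a k) (haB : ∀ k, a k ≤ B)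
    (hb : ∀ k, 0 ≤ b k) (hbs : Summable b) (hθ0 : 0 ≤ θ) (hθ : θ ≤ 1 / 8) (hC : 0 ≤ C)
    (h : ∀ k, a (k + 1) ≤ θ * (a k + a (k + 1) + a (k + 2) + a (k + 3)) +
      C * (b k + b (k + 1) + b (k + 2) + b (k + 3))) : Summable a := by
  have hs : ∀ j n, ∑ k ∈ Finset.range n, a (k + j) ≤ ∑ k ∈ Finset.range n, a k + j * B := by
    intro j
    induction j with
    | zero => intro n; simp
    | succ j ih =>
      intro n
      have e : ∑ k ∈ Finset.range n, a (k + (j + 1)) + a j = ∑ k ∈ Finset.range n, a (k + j) + a (n + j) := by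
        have := Finset.sum_range_succ' (fun k => a (k + j)) n
        rw [Finset.sum_range_succ] at this
        simp only [zero_add] at this
        rw [this]
        congr 1
        exact Finset.sum_congr rfl fun k _ => by ring_nf
      have := ih n
      have := haB (n + j)
      have := ha j
      push_cast
      linarith
  have hbj : ∀ j n, ∑ k ∈ Finset.range n, b (k + j) ≤ ∑' k, b k := by
    intro j n
    have h1 : ∑ k ∈ Finset.range n, b (k + j) ≤ ∑' k, b (k + j) :=
      ((summable_nat_add_iff j).2 hbs).sum_le_tsum _ fun k _ => hb _
    have h2 := hbs.sum_add_tsum_nat_add j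
    have h3 : 0 ≤ ∑ k ∈ Finset.range j, b k := Finset.sum_nonneg fun k _ => hb k
    linarith
  set S := ∑' k, b k
  refine summable_of_sum_range_le (c := 4 * B + 8 * C * S) ha fun n => ?_
  set P := ∑ k ∈ Finset.range n, a k with hP
  have hP0 : 0 ≤ P := Finset.sum_nonneg fun k _ => ha k
  have e1 : P ≤ ∑ k ∈ Finset.range n, a (k + 1) + a 0 := by
    rw [← Finset.sum_range_succ' a n, Finset.sum_range_succ]
    linarith [ha n]
  have e2 : ∑ k ∈ Finset.range n, a (k + 1) ≤ θ * (∑ k ∈ Finset.range n, a k +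
      ∑ k ∈ Finset.range n, a (k + 1) + ∑ k ∈ Finset.range n, a (k + 2) + ∑ k ∈ Finset.range n, a (k + 3)) +
      C * (∑ k ∈ Finset.range n, b k +
      ∑ k ∈ Finset.range n, b (k + 1) + ∑ k ∈ Finset.range n, b (k + 2) + ∑ k ∈ Finset.range n, b (k + 3)) := by
    simp only [← Finset.sum_add_distrib, Finset.mul_sum]
    exact Finset.sum_le_sum fun k _ => by simpa only [Finset.mul_sum] using h k
  have s1 := hs 1 n
  have s2 := hs 2 n
  have s3 := hs 3 n
  push_cast at s1 s2 s3
  have b0 := hbj 0 n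
  have b1 := hbj 1 n
  have b2 := hbj 2 n
  have b3 := hbj 3 n
  simp only [add_zero] at b0
  have hB0 : 0 ≤ B := (ha 0).trans (haB 0)
  have e3 : θ * (∑ k ∈ Finset.range n, a k +
      ∑ k ∈ Finset.range n, a (k + 1) + ∑ k ∈ Finset.range n, a (k + 2) + ∑ k ∈ Finset.range n, a (k + 3)) ≤
      1 / 8 * (4 * P + 6 * B) := by
    refine mul_le_mul hθ (by linarith) ?_ (by norm_num)
    have : ∀ j, 0 ≤ ∑ k ∈ Finset.range n, a (k + j) := fun j => Finset.sum_nonneg fun k _ => ha _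
    linarith [this 1, this 2, this 3]
  have e4 : C * (∑ k ∈ Finset.range n, b k +
      ∑ k ∈ Finset.range n, b (k + 1) + ∑ k ∈ Finset.range n, b (k + 2) + ∑ k ∈ Finset.range n, b (k + 3)) ≤
      C * (4 * S) := by
    gcongr; linarith
  have := haB 0
  linarith

lemma shS_sub (r : ℝ) (hr : 0 < r) : shS Ω y r ⊆ shT Ω y r := by
  rintro z ⟨h0, h1, h2⟩
  exact ⟨h0, by linarith, by linarith⟩

lemma shT_cover {r : ℝ} (hr : 0 < r) : shT Ω y r ⊆
    shS Ω y (2 * r) ∪ (shS Ω y r ∪ (shS Ω y (r / 2) ∪ shS Ω y (r / 4))) := by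
  rintro z ⟨h0, h1, h2⟩
  by_cases k1 : 2 * r < dist z y
  · exact Or.inl ⟨h0, k1, by linarith⟩
  by_cases k2 : r < dist z y
  · exact Or.inr (Or.inl ⟨h0, k2, by linarith⟩)
  by_cases k3 : r / 2 < dist z y
  · exact Or.inr (Or.inr (Or.inl ⟨h0, k3, by linarith⟩))
  · exact Or.inr (Or.inr (Or.inr ⟨h0, by linarith, by linarith⟩))

lemma cover_int {f : ES N → ℝ} {s s1 s2 s3 s4 : Set (ES N)} (hs : s ⊆ s1 ∪ (s2 ∪ (s3 ∪ s4)))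
    (hf : ∀ z ∈ s1 ∪ (s2 ∪ (s3 ∪ s4)), 0 ≤ f z) (m1 : MeasurableSet s1) (m2 : MeasurableSet s2)
    (m3 : MeasurableSet s3) (m4 : MeasurableSet s4)
    (h1 : IntegrableOn f s1) (h2 : IntegrableOn f s2) (h3 : IntegrableOn f s3)
    (h4 : IntegrableOn f s4) : IntegrableOn f s ∧
    ∫ z in s, f z ≤ (∫ z in s1, f z) + (∫ z in s2, f z) + (∫ z in s3, f z) + ∫ z in s4, f z := by
  have two : ∀ {a b : Set (ES N)}, MeasurableSet b → (∀ z ∈ a ∪ b, 0 ≤ f z) → MeasurableSet a →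
      IntegrableOn f a → IntegrableOn f b →
      ∫ z in a ∪ b, f z ≤ (∫ z in a, f z) + ∫ z in b, f z := by
    intro a b mb h0 ma ha hb
    rw [← union_diff_self, setIntegral_union disjoint_sdiff_right (mb.diff ma) ha
      (hb.mono_set diff_subset)]
    refine add_le_add le_rfl ?_
    refine setIntegral_mono_set hb ?_ (HasSubset.Subset.eventuallyLE diff_subset)
    exact (ae_restrict_iff' mb).2 (ae_of_all _ fun z hz => h0 z (Or.inr hz))
  have hu : IntegrableOn f (s1 ∪ (s2 ∪ (s3 ∪ s4))) := h1.union (h2.union (h3.union h4))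
  refine ⟨hu.mono_set hs, ?_⟩
  have m34 := m3.union m4
  have m234 := m2.union m34
  have k1 := two m234 hf m1 h1 (h2.union (h3.union h4))
  have k2 := two m34 (fun z hz => hf z (Or.inr hz)) m2 h2 (h3.union h4)
  have k3 := two m4 (fun z hz => hf z (Or.inr (Or.inr hz))) m3 h3 h4
  have k0 : ∫ z in s, f z ≤ ∫ z in s1 ∪ (s2 ∪ (s3 ∪ s4)), f z := by
    refine setIntegral_mono_set hu ?_ (HasSubset.Subset.eventuallyLE hs)
    exact (ae_restrict_iff' (m1.union m234)).2 (ae_of_all _ fun z hz => hf z hz)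
  linarith

end Part24

section Part25
variable {N : ℕ}
variable {Ω : Set (ES N)} {x₀ y e : ES N} {d : ES N → ℝ} {M R t A : ℝ} {m J K : ES N → ℝ}

lemma Ctx.dpos (c : Ctx Ω x₀ y e d M R t A m J K) {r : ℝ} (hr : 0 < r) (hR : 16 * M * r ≤ R)
    {z : ES N} (hz : z ∈ shT Ω y r) : 0 < d z := by
  have hM := c.lg.M1
  refine (c.lg.mem z ?_).1 hz.1
  rw [mem_ball]; nlinarith [hz.2.2]

lemma shT_vol {r : ℝ} (hr : 0 < r) : volume.real (shT Ω y r) ≤ (8 * r) ^ N * vb N := by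
  rw [← vol_ball y (by linarith : 0 < 8 * r)]
  refine measureReal_mono (fun z hz => ?_) measure_ball_lt_top.ne
  rw [mem_ball]; linarith [hz.2.2]

lemma shT_fin (r : ℝ) : volume (shT Ω y r) < ⊤ :=
  (measure_mono (fun z hz => mem_closedBall.2 hz.2.2)).trans_lt
    (isCompact_closedBall y (4 * r)).measure_lt_top

lemma Ctx.kmeas (c : Ctx Ω x₀ y e d M R t A m J K) {r : ℝ} (hr : 0 < r) (hR : 16 * M * r ≤ R)
    {w : ES N → ℝ} (hw : ContinuousOn w Ω) {s : Set (ES N)} (hs : s ⊆ shT Ω y r)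
    (hm : MeasurableSet s) :
    AEStronglyMeasurable (fun z => J z / K z * (w z / d z) ^ 2) (volume.restrict s) := by
  refine ContinuousOn.aestronglyMeasurable ?_ hm
  have hsΩ : s ⊆ Ω := fun z hz => (hs hz).1
  refine ((c.gr.cont.mono hsΩ).div (c.kg.sol.sup.1.mono hsΩ)
    fun z hz => (c.kg.sol.pos z (hsΩ hz)).ne').mul (((hw.mono hsΩ).div c.lg.cont.continuousOn
      fun z hz => (c.dpos hr hR (hs hz)).ne').pow 2)

set_option maxHeartbeats 800000 in
lemma Ctx.kd (c : Ctx Ω x₀ y e d M R t A m J K) : ∃ ρ > 0, 64 * M * ρ ≤ R ∧ ∃ C ≥ (0:ℝ),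
    ∀ r, 0 < r → r ≤ ρ → IntegrableOn (fun z => J z / K z * (K z / d z) ^ 2) (shS Ω y r) ∧
      ∫ z in shS Ω y r, J z / K z * (K z / d z) ^ 2 ≤ C := by
  obtain ⟨C2, hC2, h2⟩ := c.ratio
  obtain ⟨r1, hr1, CE, hCE, hr1R, hE⟩ := c.E
  obtain ⟨B, hB, hgr⟩ := shc_grad N
  have hM := c.lg.M1
  have vbp := vb_pos (N := N)
  refine ⟨r1 / 4, by linarith, by linarith, C2 * (4 * (B * (C2 ^ 2 * (8 ^ N * vb N)))) * CE,
    by positivity, fun r hr hrr => ?_⟩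
  have hR64 : 64 * M * r ≤ R := by nlinarith
  have hR16 : 16 * M * r ≤ R := by nlinarith
  have hAΩ := c.Ar hr hR16
  have Kr := c.kg.sol.pos _ hAΩ
  have Jr := c.gr.pos _ hAΩ
  set k := K (y + r • e) with hk
  set j := J (y + r • e) with hj
  have hE1 := (hE r hr (by linarith)).1
  have hmax : ∀ z ∈ Ω, max (K z) 0 = K z := fun z hz => max_eq_left (c.kg.sol.pos z hz).le
  obtain ⟨i1, i2⟩ := c.shell_CH (V := fun _ => 0) (u := K) (p := K) (q := fun _ => (C2 * k) ^ 2)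
    hgr hr hR16 c.kg.sol.sup.1 c.kg.van
    (Vok_zero Ω) c.kg.sol.sup.1 (fun x hx => (c.kg.sol.pos x hx).le)
    (fun φ hφ h0 => by
      have := c.kg.sol.sub.2 φ hφ h0
      simp only [neg_mul, integral_neg, zero_mul, mul_neg, neg_zero, integral_zero] at this ⊢
      linarith)
    (by simp) (by
      exact integrableOn_const (shT_fin r).ne)
    (fun z hz => by
      rw [hmax z hz.1]
      exact pow_le_pow_left₀ (c.kg.sol.pos z hz.1).le (h2 r hr hR64 z hz).2.2 2)
  simp only [zero_mul, integral_zero, mul_zero, add_zero, setIntegral_const, smul_eq_mul] at i2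
  have hpt : ∀ z ∈ shS Ω y r, J z / K z * (K z / d z) ^ 2 ≤
      C2 * (j / k) * (shc y r z * max (K z) 0 / d z) ^ 2 := by
    intro z hz
    have hzT := shS_sub r hr hz
    rw [shc_one hr hz.2.1.le hz.2.2, hmax z hz.1, one_mul]
    have Kz := c.kg.sol.pos z hz.1
    refine mul_le_mul_of_nonneg_right ?_ (sq_nonneg _)
    have := (h2 r hr hR64 z hzT).1
    rw [div_le_iff₀ Kz, ← mul_div_assoc, div_mul_eq_mul_div, le_div_iff₀ Kr]
    exact this
  have hsub : shS Ω y r ⊆ Ω := fun z hz => hz.1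
  have hI : IntegrableOn (fun z => C2 * (j / k) * (shc y r z * max (K z) 0 / d z) ^ 2) (shS Ω y r) :=
    (Integrable.const_mul i1 _ : Integrable _ _).mono_measure (Measure.restrict_mono hsub le_rfl)
  have hnn : ∀ z ∈ shS Ω y r, 0 ≤ J z / K z * (K z / d z) ^ 2 := fun z hz => by
    have Kz := c.kg.sol.pos z hz.1
    have Jz := c.gr.pos z hz.1
    positivity
  have hI2 : IntegrableOn (fun z => J z / K z * (K z / d z) ^ 2) (shS Ω y r) := by
    refine Integrable.mono' hI (c.kmeas hr hR16 c.kg.sol.sup.1 (shS_sub r hr) (shS_meas c.op r)) ?_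
    refine (ae_restrict_iff' (shS_meas c.op r)).2 (ae_of_all _ fun z hz => ?_)
    rw [Real.norm_of_nonneg (hnn z hz)]
    exact hpt z hz
  refine ⟨hI2, ?_⟩
  have f1 : ∫ z in shS Ω y r, (shc y r z * max (K z) 0 / d z) ^ 2 ≤
      ∫ z in Ω, (shc y r z * max (K z) 0 / d z) ^ 2 :=
    setIntegral_mono_set i1 (ae_of_all _ fun z => sq_nonneg _)
      (HasSubset.Subset.eventuallyLE hsub)
  have f2 := shT_vol (Ω := Ω) (y := y) hr
  calc ∫ z in shS Ω y r, J z / K z * (K z / d z) ^ 2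
      ≤ ∫ z in shS Ω y r, C2 * (j / k) * (shc y r z * max (K z) 0 / d z) ^ 2 :=
        setIntegral_mono_on hI2 hI (shS_meas c.op r) hpt
    _ = C2 * (j / k) * ∫ z in shS Ω y r, (shc y r z * max (K z) 0 / d z) ^ 2 :=
        integral_const_mul _ _
    _ ≤ C2 * (j / k) * (4 * (B / r ^ 2 * (((8 * r) ^ N * vb N) * (C2 * k) ^ 2))) := by
        gcongr
        refine f1.trans (i2.trans ?_)
        gcongr
    _ = C2 * (4 * (B * (C2 ^ 2 * (8 ^ N * vb N)))) * (k * j * r ^ N / r ^ 2) := by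
        rw [mul_pow 8 r N]; field_simp
    _ ≤ C2 * (4 * (B * (C2 ^ 2 * (8 ^ N * vb N)))) * CE := by
        gcongr
        rw [div_le_iff₀ (by positivity)]
        exact hE1

end Part25

section Part26
variable {N : ℕ}
variable {Ω : Set (ES N)} {x₀ y e : ES N} {d : ES N → ℝ} {M R t A : ℝ} {m J K : ES N → ℝ}

set_option maxHeartbeats 1600000 in
lemma Ctx.stepW (c : Ctx Ω x₀ y e d M R t A m J K) {V KV : ES N → ℝ} (hV : Glo Ω y d A R V KV)
    (hD : IntegrableOn (fun z => J z * V z * KV z) Ω) {B C2 η δ r : ℝ} (hB : 0 < B)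
    (hgr : ∀ (y : ES N) (r : ℝ), 0 < r → ∀ z, ∑ i, (dd i (shc y r) z) ^ 2 ≤ B / r ^ 2)
    (hC2 : 1 ≤ C2) (hη : 0 < η) (hδ : 0 < δ) (hr : 0 < r) (hR : 64 * M * r ≤ R)
    (h2 : ∀ z ∈ shT Ω y r, J z * K (y + r • e) ≤ C2 * J (y + r • e) * K z ∧
      K z * J (y + r • e) ≤ C2 * K (y + r • e) * J z ∧ K z ≤ C2 * K (y + r • e))
    (hlow : ∀ z ∈ Ω, 16 * M * dist z y ≤ R → δ * dist z y ≤ d z → η * K z ≤ KV z)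
    (hI : IntegrableOn (fun z => J z / K z * (max (η * K z - KV z) 0 / d z) ^ 2) (shT Ω y r)) :
    ∫ z in shS Ω y r, J z / K z * (max (η * K z - KV z) 0 / d z) ^ 2 ≤
      C2 ^ 2 * 64 * B * δ ^ 2 *
        (∫ z in shT Ω y r, J z / K z * (max (η * K z - KV z) 0 / d z) ^ 2) +
      4 * C2 ^ 2 * η * ∫ z in shT Ω y r, J z * V z * KV z := by
  have hM := c.lg.M1
  have hR16 : 16 * M * r ≤ R := by nlinarith
  have hAΩ := c.Ar hr hR16
  have Kr := c.kg.sol.pos _ hAΩ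
  have Jr := c.gr.pos _ hAΩ
  set k := K (y + r • e) with hk
  set j := J (y + r • e) with hj
  set W : ES N → ℝ := fun z => η * K z - KV z with hW
  have hWc : ContinuousOn W Ω := (continuousOn_const.mul c.kg.sol.sup.1).sub hV.sol.sup.1
  have hWc' : ContinuousOn (fun z => max (W z) 0) Ω := ContinuousOn.sup hWc continuousOn_const
  have mT := shT_meas (y := y) c.op r
  have mS := shS_meas (y := y) c.op r
  -- the ratio in both directions
  have q1 : ∀ z ∈ shT Ω y r, J z / K z ≤ C2 * (j / k) := fun z hz => by
    have Kz := c.kg.sol.pos z hz.1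
    rw [div_le_iff₀ Kz, ← mul_div_assoc, div_mul_eq_mul_div, le_div_iff₀ Kr]
    exact (h2 z hz).1
  have q2 : ∀ z ∈ shT Ω y r, 1 ≤ C2 * (k / j) * (J z / K z) := fun z hz => by
    have Kz := c.kg.sol.pos z hz.1
    have := (h2 z hz).2.1
    have e0 : C2 * (k / j) * (J z / K z) = C2 * k * J z / (j * K z) := by field_simp
    rw [e0, le_div_iff₀ (by positivity), one_mul]
    linarith
  have WK : ∀ z ∈ Ω, max (W z) 0 ≤ η * K z := fun z hz => by
    have Kz := c.kg.sol.pos z hz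
    have Vz := hV.sol.pos z hz
    refine max_le ?_ (by positivity)
    simp only [hW]; linarith
  -- integrability of the zero order term
  have hDT : IntegrableOn (fun z => J z * V z * KV z) (shT Ω y r) :=
    hD.mono_set fun z hz => hz.1
  have hDnn : ∀ z ∈ Ω, 0 ≤ J z * V z * KV z := fun z hz =>
    mul_nonneg (mul_nonneg (c.gr.pos z hz).le (hV.vok.nn z hz)) (hV.sol.pos z hz).le
  have hpt : ∀ z ∈ Ω, V z * KV z * (shc y r z ^ 2 * max (W z) 0) ≤
      (shT Ω y r).indicator (fun z => η * (C2 * (k / j)) * (J z * V z * KV z)) z := by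
    intro z hz
    have Kz := c.kg.sol.pos z hz
    have Vz := hV.sol.pos z hz
    have Jz := c.gr.pos z hz
    have Vn := hV.vok.nn z hz
    by_cases h : z ∈ shT Ω y r
    · rw [indicator_of_mem h]
      have s1 : shc y r z ^ 2 ≤ 1 := pow_le_one₀ (shc_nonneg _ _ _) (shc_le _ _ _)
      have hq := q2 z h
      calc V z * KV z * (shc y r z ^ 2 * max (W z) 0) ≤ V z * KV z * (1 * (η * K z)) := by
            gcongr
            exact WK z hz
        _ = (V z * KV z * η * K z) * 1 := by ring
        _ ≤ (V z * KV z * η * K z) * (C2 * (k / j) * (J z / K z)) := by gcongr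
        _ = η * (C2 * (k / j)) * (J z * V z * KV z) := by field_simp
    · rw [indicator_of_notMem h, shc_zero hr fun hh => h ⟨hz, hh⟩]
      simp
  have hnn0 : ∀ z ∈ Ω, 0 ≤ V z * KV z * (shc y r z ^ 2 * max (W z) 0) := fun z hz =>
    mul_nonneg (mul_nonneg (hV.vok.nn z hz) (hV.sol.pos z hz).le)
      (mul_nonneg (sq_nonneg _) (le_max_right _ _))
  have hIT : IntegrableOn ((shT Ω y r).indicator
      (fun z => η * (C2 * (k / j)) * (J z * V z * KV z))) Ω := by
    refine Integrable.integrableOn ?_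
    exact (integrable_indicator_iff mT).2 (Integrable.const_mul hDT _)
  have hIntg : IntegrableOn (fun z => V z * KV z * (shc y r z ^ 2 * max (W z) 0)) Ω := by
    refine Integrable.mono' hIT ?_ ?_
    · refine (hV.vok.meas.aestronglyMeasurable.mul
        (hV.sol.sup.1.aestronglyMeasurable c.op.measurableSet)).mul ?_
      exact (((shc_smooth y r).continuous.continuousOn.pow 2).mul hWc').aestronglyMeasurable
        c.op.measurableSet
    · refine (ae_restrict_iff' c.op.measurableSet).2 (ae_of_all _ fun z hz => ?_)
      rw [Real.norm_of_nonneg (hnn0 z hz)]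
      exact hpt z hz
  have hint2 : ∫ z in Ω, V z * KV z * (shc y r z ^ 2 * max (W z) 0) ≤
      η * (C2 * (k / j)) * ∫ z in shT Ω y r, J z * V z * KV z := by
    refine (setIntegral_mono_on hIntg hIT c.op.measurableSet hpt).trans_eq ?_
    rw [setIntegral_indicator mT, inter_eq_right.2 (fun z hz => hz.1 : shT Ω y r ⊆ Ω),
      integral_const_mul]
  -- integrability of `(W₊/d)²` on the shell
  have hH : IntegrableOn (fun z => (max (W z) 0 / d z) ^ 2) (shT Ω y r) := by
    refine Integrable.mono' (Integrable.const_mul hI (C2 * (k / j))) ?_ ?_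
    · refine ContinuousOn.aestronglyMeasurable ?_ mT
      exact ((hWc'.mono fun z hz => hz.1).div c.lg.cont.continuousOn
        fun z hz => (c.dpos hr hR16 hz).ne').pow 2
    · refine (ae_restrict_iff' mT).2 (ae_of_all _ fun z hz => ?_)
      rw [Real.norm_of_nonneg (sq_nonneg _), ← mul_assoc]
      exact le_mul_of_one_le_left (sq_nonneg _) (q2 z hz)
  have hH2 : ∫ z in shT Ω y r, (max (W z) 0 / d z) ^ 2 ≤ C2 * (k / j) *
      ∫ z in shT Ω y r, J z / K z * (max (W z) 0 / d z) ^ 2 := by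
    rw [← integral_const_mul]
    refine setIntegral_mono_on hH (Integrable.const_mul hI _) mT fun z hz => ?_
    rw [← mul_assoc]
    exact le_mul_of_one_le_left (sq_nonneg _) (q2 z hz)
  have lK : LocallyIntegrableOn K Ω := c.kg.sol.sup.1.locallyIntegrableOn c.op.measurableSet
  have lV : LocallyIntegrableOn KV Ω := hV.sol.sup.1.locallyIntegrableOn c.op.measurableSet
  obtain ⟨i1, i2⟩ := c.shell_CH (V := V) (u := KV) (p := W)
    (q := fun z => (4 * r * δ) ^ 2 * (max (W z) 0 / d z) ^ 2)
    hgr hr hR16 hWc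
    (fun q hq hqy => by
      have := ((c.kg.van q hq hqy).const_mul η).sub (hV.van q hq hqy)
      simpa using this)
    hV.vok hV.sol.sup.1 (fun x hx => (hV.sol.pos x hx).le)
    (fun φ hφ h0 => by
      have a1 := c.kg.sol.sub.2 φ hφ h0
      have a2 := hV.sol.sup.2 φ hφ h0
      simp only [neg_mul, integral_neg, zero_mul, integral_zero, mul_neg, neg_zero] at a1
      have e1 : ∫ z, W z * lap φ z = η * (∫ z, K z * lap φ z) - ∫ z, KV z * lap φ z := by
        rw [← integral_const_mul, ← integral_sub ((test_int_lap hφ lK).const_mul _)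
          (test_int_lap hφ lV)]
        congr 1; funext z; simp only [hW]; ring
      rw [e1]
      nlinarith)
    hIntg (Integrable.const_mul hH _)
    (fun z hz => by
      have dz := c.dpos hr hR16 hz
      rw [← mul_pow]
      refine pow_le_pow_left₀ (le_max_right _ _) ?_ 2
      by_cases hw : W z ≤ 0
      · rw [max_eq_right hw]; simp
      · have hlt : d z ≤ δ * dist z y := by
          by_contra hh
          have := hlow z hz.1 (by nlinarith [hz.2.2]) (not_le.1 hh).le
          exact hw (by simp only [hW]; linarith)
        have hm : 0 ≤ max (W z) 0 := le_max_right _ _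
        rw [← mul_div_assoc, le_div_iff₀ dz, mul_comm]
        refine mul_le_mul_of_nonneg_right (hlt.trans ?_) hm
        nlinarith [hz.2.2])
  have hnnT : ∀ z ∈ shT Ω y r, 0 ≤ J z / K z := fun z hz =>
    (div_pos (c.gr.pos z hz.1) (c.kg.sol.pos z hz.1)).le
  have hsub : shS Ω y r ⊆ Ω := fun z hz => hz.1
  have f1 : ∫ z in shS Ω y r, (shc y r z * max (W z) 0 / d z) ^ 2 ≤
      ∫ z in Ω, (shc y r z * max (W z) 0 / d z) ^ 2 :=
    setIntegral_mono_set i1 (ae_of_all _ fun z => sq_nonneg _)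
      (HasSubset.Subset.eventuallyLE hsub)
  rw [integral_const_mul] at i2
  calc ∫ z in shS Ω y r, J z / K z * (max (W z) 0 / d z) ^ 2
      ≤ ∫ z in shS Ω y r, C2 * (j / k) * (shc y r z * max (W z) 0 / d z) ^ 2 := by
        refine setIntegral_mono_on (hI.mono_set (shS_sub r hr))
          (Integrable.const_mul (i1.mono_set hsub) _) mS fun z hz => ?_
        rw [shc_one hr hz.2.1.le hz.2.2, one_mul]
        exact mul_le_mul_of_nonneg_right (q1 z (shS_sub r hr hz)) (sq_nonneg _)
    _ = C2 * (j / k) * ∫ z in shS Ω y r, (shc y r z * max (W z) 0 / d z) ^ 2 :=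
        integral_const_mul _ _
    _ ≤ C2 * (j / k) * (4 * (B / r ^ 2 * ((4 * r * δ) ^ 2 * (C2 * (k / j) *
          ∫ z in shT Ω y r, J z / K z * (max (W z) 0 / d z) ^ 2))) +
          4 * (η * (C2 * (k / j)) * ∫ z in shT Ω y r, J z * V z * KV z)) := by
        gcongr
        refine f1.trans (i2.trans ?_)
        gcongr
    _ = C2 ^ 2 * 64 * B * δ ^ 2 *
        (∫ z in shT Ω y r, J z / K z * (max (W z) 0 / d z) ^ 2) +
      4 * C2 ^ 2 * η * ∫ z in shT Ω y r, J z * V z * KV z := by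
        field_simp; ring

end Part26

section Part27
variable {N : ℕ}
variable {Ω : Set (ES N)} {x₀ y e : ES N} {d : ES N → ℝ} {M R t A : ℝ} {m J K : ES N → ℝ}

set_option maxHeartbeats 1600000 in
theorem Ctx.near (c : Ctx Ω x₀ y e d M R t A m J K) {V KV : ES N → ℝ} (hV : Glo Ω y d A R V KV)
    (hD : IntegrableOn (fun z => J z * V z * KV z) Ω) :
    ∃ ρ > 0, IntegrableOn (fun z => J z * V z * K z) (Ω ∩ ball y ρ) := by
  obtain ⟨C2, hC2, h2⟩ := c.ratio
  obtain ⟨ρ, hρ, hρR, Ck, hCk, hkd⟩ := c.kd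
  obtain ⟨B, hB, hgr⟩ := shc_grad N
  have hM := c.lg.M1
  set X := C2 ^ 2 * 64 * B with hX
  have hX0 : 0 < X := by positivity
  set δ := 1 / (8 * X + 1) with hδ
  have hδ0 : 0 < δ := by positivity
  have hδ1 : δ ≤ 1 := by
    rw [hδ, div_le_one (by positivity)]; linarith
  have hXδ : X * δ ^ 2 ≤ 1 / 8 := by
    have h1 : X * δ ≤ 1 / 8 := by
      rw [hδ, mul_one_div, div_le_iff₀ (by positivity)]; linarith
    nlinarith
  obtain ⟨η, hη, hlow⟩ := c.lowerV hV hδ0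
  set h : ES N → ℝ := fun z => J z / K z * (max (η * K z - KV z) 0 / d z) ^ 2 with hh
  have hWc : ContinuousOn (fun z => max (η * K z - KV z) 0) Ω := ContinuousOn.sup
    ((continuousOn_const.mul c.kg.sol.sup.1).sub hV.sol.sup.1) continuousOn_const
  have hnn : ∀ z ∈ Ω, 0 ≤ h z := fun z hz =>
    mul_nonneg (div_pos (c.gr.pos z hz) (c.kg.sol.pos z hz)).le (sq_nonneg _)
  have hDnn : ∀ z ∈ Ω, 0 ≤ J z * V z * KV z := fun z hz =>
    mul_nonneg (mul_nonneg (c.gr.pos z hz).le (hV.vok.nn z hz)) (hV.sol.pos z hz).le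
  have hS : ∀ r, 0 < r → r ≤ ρ → IntegrableOn h (shS Ω y r) ∧
      ∫ z in shS Ω y r, h z ≤ η ^ 2 * Ck := by
    intro r hr hrρ
    obtain ⟨k1, k2⟩ := hkd r hr hrρ
    have hR16 : 16 * M * r ≤ R := by nlinarith
    have hpt : ∀ z ∈ shS Ω y r, h z ≤ η ^ 2 * (J z / K z * (K z / d z) ^ 2) := by
      intro z hz
      have dz := c.dpos hr hR16 (shS_sub r hr hz)
      have Kz := c.kg.sol.pos z hz.1
      have Vz := hV.sol.pos z hz.1
      have Jz := c.gr.pos z hz.1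
      have e1 : η ^ 2 * (J z / K z * (K z / d z) ^ 2) = J z / K z * (η * K z / d z) ^ 2 := by
        ring
      rw [e1]
      simp only [hh]
      gcongr
      exact max_le (by linarith) (by positivity)
    have i1 : IntegrableOn h (shS Ω y r) := by
      refine Integrable.mono' (Integrable.const_mul k1 (η ^ 2))
        (c.kmeas hr hR16 hWc (shS_sub r hr) (shS_meas c.op r)) ?_
      refine (ae_restrict_iff' (shS_meas c.op r)).2 (ae_of_all _ fun z hz => ?_)
      rw [Real.norm_of_nonneg (hnn z hz.1)]
      exact hpt z hz
    refine ⟨i1, ?_⟩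
    calc ∫ z in shS Ω y r, h z ≤ ∫ z in shS Ω y r, η ^ 2 * (J z / K z * (K z / d z) ^ 2) :=
          setIntegral_mono_on i1 (Integrable.const_mul k1 _) (shS_meas c.op r) hpt
      _ = η ^ 2 * ∫ z in shS Ω y r, J z / K z * (K z / d z) ^ 2 := integral_const_mul _ _
      _ ≤ η ^ 2 * Ck := by gcongr
  set rr : ℕ → ℝ := fun k => ρ * (1 / 2) ^ k with hrr
  have rpos : ∀ k, 0 < rr k := fun k => by simp only [hrr]; positivity
  have rle : ∀ k, rr k ≤ ρ := fun k => by
    simp only [hrr]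
    exact mul_le_of_le_one_right hρ.le (pow_le_one₀ (by norm_num) (by norm_num))
  have rs : ∀ k, rr (k + 1) = rr k / 2 := fun k => by simp only [hrr]; rw [pow_succ]; ring
  set S : ℕ → Set (ES N) := fun k => shS Ω y (rr k) with hSd
  have mS : ∀ k, MeasurableSet (S k) := fun k => shS_meas c.op _
  have SΩ : ∀ k, S k ⊆ Ω := fun k z hz => hz.1
  have hDS : ∀ k, IntegrableOn (fun z => J z * V z * KV z) (S k) := fun k => hD.mono_set (SΩ k)
  have anti : ∀ i j, i < j → 2 * rr j ≤ rr i := by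
    intro i j hij
    have h1 : rr j ≤ rr (i + 1) := by
      simp only [hrr]
      gcongr ρ * ?_
      exact pow_le_pow_of_le_one (by norm_num) (by norm_num) hij
    rw [rs] at h1; linarith
  have hdisj : Pairwise (Function.onFun Disjoint S) := by
    intro i j hij
    rw [Function.onFun, Set.disjoint_left]
    rintro z ⟨_, h1, h2⟩ ⟨_, h3, h4⟩
    rcases lt_or_gt_of_ne hij with hlt | hlt
    · have := anti i j hlt; linarith
    · have := anti j i hlt; linarith
  have hbs : Summable fun k => ∫ z in S k, J z * V z * KV z :=
    (hasSum_integral_iUnion mS hdisj (hD.mono_set (iUnion_subset SΩ))).summable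
  have hstep : ∀ k, ∫ z in S (k + 1), h z ≤ X * δ ^ 2 * ((∫ z in S k, h z) + (∫ z in S (k + 1), h z) +
      (∫ z in S (k + 2), h z) + ∫ z in S (k + 3), h z) + 4 * C2 ^ 2 * η *
      ((∫ z in S k, J z * V z * KV z) + (∫ z in S (k + 1), J z * V z * KV z) +
      (∫ z in S (k + 2), J z * V z * KV z) + ∫ z in S (k + 3), J z * V z * KV z) := by
    intro k
    have cov : shT Ω y (rr (k + 1)) ⊆ S k ∪ (S (k + 1) ∪ (S (k + 2) ∪ S (k + 3))) := by
      have := shT_cover (Ω := Ω) (y := y) (rpos (k + 1))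
      have e0 : 2 * rr (k + 1) = rr k := by rw [rs]; ring
      have e2 : rr (k + 1) / 2 = rr (k + 2) := (rs (k + 1)).symm
      have e3 : rr (k + 1) / 4 = rr (k + 3) := by rw [rs (k + 2), rs (k + 1)]; ring
      rw [e0, e2, e3] at this
      exact this
    have sub4 : ∀ z ∈ S k ∪ (S (k + 1) ∪ (S (k + 2) ∪ S (k + 3))), z ∈ Ω := by
      rintro z (hz | hz | hz | hz) <;> exact hz.1
    obtain ⟨a1, a2⟩ := cover_int cov (fun z hz => hnn z (sub4 z hz)) (mS _) (mS _) (mS _) (mS _)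
      (hS _ (rpos _) (rle _)).1 (hS _ (rpos _) (rle _)).1 (hS _ (rpos _) (rle _)).1
      (hS _ (rpos _) (rle _)).1
    obtain ⟨b1, b2⟩ := cover_int cov (fun z hz => hDnn z (sub4 z hz)) (mS _) (mS _) (mS _) (mS _)
      (hDS _) (hDS _) (hDS _) (hDS _)
    have hR64 : 64 * M * rr (k + 1) ≤ R := by nlinarith [rle (k + 1)]
    refine (c.stepW hV hD hB hgr hC2 hη hδ0 (rpos (k + 1)) hR64 (h2 _ (rpos _) hR64) hlow a1).trans ?_
    gcongr
  have hsum : Summable fun k => ∫ z in S k, h z := by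
    refine sum_lemma (B := η ^ 2 * Ck) (θ := X * δ ^ 2) (C := 4 * C2 ^ 2 * η)
      (fun k => setIntegral_nonneg (mS k) fun z hz => hnn z hz.1)
      (fun k => (hS _ (rpos k) (rle k)).2)
      (fun k => setIntegral_nonneg (mS k) fun z hz => hDnn z hz.1) hbs (by positivity) hXδ
      (by positivity) hstep
  have hU : IntegrableOn h (⋃ k, S k) := by
    refine integrableOn_iUnion_of_summable_integral_norm
      (fun k => (hS _ (rpos k) (rle k)).1) ?_
    refine hsum.congr fun k => ?_
    exact (setIntegral_congr_fun (mS k) fun z hz => (Real.norm_of_nonneg (hnn z hz.1)).symm)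
  have hρR' : ρ ≤ R := by nlinarith
  refine ⟨ρ, hρ, ?_⟩
  have hcov : Ω ∩ ball y ρ ⊆ ⋃ k, S k := by
    rintro z ⟨hz, hzb⟩
    rw [mem_ball] at hzb
    have hzy : 0 < dist z y := dist_pos.2 (by rintro rfl; exact c.yn hz)
    obtain ⟨n, hn1, hn2⟩ := exists_nat_pow_near_of_lt_one (x := dist z y / ρ) (y := 1 / 2)
      (by positivity) (by rw [div_le_one hρ]; exact hzb.le) (by norm_num) (by norm_num)
    rw [lt_div_iff₀ hρ] at hn1
    rw [div_le_iff₀ hρ] at hn2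
    refine mem_iUnion.2 ⟨n + 1, hz, ?_, ?_⟩
    · simp only [hrr]; linarith
    · rw [rs]; simp only [hrr]; linarith
  have mO : MeasurableSet (Ω ∩ ball y ρ) := c.op.measurableSet.inter measurableSet_ball
  have hG : IntegrableOn (fun z => 4 * A / η ^ 2 * h z + 2 / η * (J z * V z * KV z)) (Ω ∩ ball y ρ) :=
    (Integrable.const_mul (hU.mono_set hcov) _).add
      (Integrable.const_mul (hD.mono_set inter_subset_left) _)
  refine Integrable.mono' hG ?_ ?_
  · refine ((c.gr.cont.mono inter_subset_left).aestronglyMeasurable mO).mul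
      hV.vok.meas.aestronglyMeasurable |>.mul ?_
    exact (c.kg.sol.sup.1.mono inter_subset_left).aestronglyMeasurable mO
  · refine (ae_restrict_iff' mO).2 (ae_of_all _ fun z hz => ?_)
    have Kz := c.kg.sol.pos z hz.1
    have Vz := hV.sol.pos z hz.1
    have Jz := c.gr.pos z hz.1
    have Vn := hV.vok.nn z hz.1
    have zR : z ∈ ball y R := ball_subset_ball hρR' hz.2
    have dz := (c.lg.mem z zR).1 hz.1
    have hVd := (hV.vb z zR dz).2
    have hA := c.hA
    have hn := hnn z hz.1
    have hDz := hDnn z hz.1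
    rw [Real.norm_of_nonneg (by positivity)]
    by_cases hc : KV z ≤ η * K z / 2
    · have hV2 : V z ≤ A / d z ^ 2 := by rwa [le_div_iff₀ (by positivity)]
      have hw : η * K z / 2 ≤ max (η * K z - KV z) 0 := le_max_of_le_left (by linarith)
      have : J z * V z * K z ≤ 4 * A / η ^ 2 * h z := by
        calc J z * V z * K z ≤ J z * (A / d z ^ 2) * K z := by gcongr
          _ = 4 * A / η ^ 2 * (J z / K z * ((η * K z / 2) / d z) ^ 2) := by field_simp; ring
          _ ≤ 4 * A / η ^ 2 * h z := by
            simp only [hh]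
            gcongr
      have : 0 ≤ 2 / η * (J z * V z * KV z) := by positivity
      linarith
    · push Not at hc
      have : J z * V z * K z ≤ 2 / η * (J z * V z * KV z) := by
        have : K z ≤ 2 / η * KV z := by
          rw [div_mul_eq_mul_div, le_div_iff₀ hη]; linarith
        calc J z * V z * K z ≤ J z * V z * (2 / η * KV z) := by gcongr
          _ = _ := by ring
      have : 0 ≤ 4 * A / η ^ 2 * h z := by positivity
      linarith

end Part27

section Part28
variable {N : ℕ}
variable {Ω : Set (ES N)} {x₀ y e : ES N} {d : ES N → ℝ} {M R t A : ℝ} {m J K : ES N → ℝ}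

lemma bdry_int (hΩ : IsOpen Ω) (hbd : Bornology.IsBounded Ω) {z : ES N} {ρ : ℝ}
    (lg : LG Ω e d M z R) (hρ : 0 < ρ) (hR : 4 * ρ ≤ R) {p : ES N → ℝ} (hp : ContinuousOn p Ω)
    (hp0 : ∀ x ∈ Ω, 0 ≤ p x)
    (hv : ∀ q ∈ frontier Ω, dist q z ≤ 8 * ρ → Tendsto p (𝓝[Ω] q) (𝓝 0))
    (heq : ∀ φ, IsTestFun (Ω ∩ ball z (4 * ρ)) φ → (∀ x, 0 ≤ φ x) → 0 ≤ ∫ z, p z * lap φ z) :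
    IntegrableOn (fun x => (p x / d x) ^ 2) (Ω ∩ ball z ρ) := by
  have h8 : 0 < 8 * ρ := by linarith
  have h2 : 0 < 2 * ρ := by linarith
  obtain ⟨h1, -⟩ := loc_CH (Ω := Ω) (U := ball z (4 * ρ)) (p := p) (χ := cut z (8 * ρ))
    (ψ := cut z (2 * ρ)) (V := fun _ => 0) (u := fun _ => 0) (d := d) (e := e) hΩ hbd isOpen_ball
    hp (cut_smooth _ _).continuous
    (fun q hq hqs => hv q hq ((cut_test h8 (subset_refl (closedBall z (8 * ρ)))).2.2 hqs))
    (fun x hx => cut_one h8 (by rw [mem_ball] at hx; linarith))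
    (cut_test h2 (closedBall_subset_ball (by linarith))) (cut_nonneg _ _) (Vok_zero Ω)
    continuousOn_const (fun _ _ => le_rfl) (fun φ hφ h0 => by simpa using heq φ hφ h0)
    lg.cont lg.e1 lg.shift (fun x hx => (lg.mem x (ball_subset_ball hR hx.2)).1 hx.1) (by simp)
  refine (h1.mono_set inter_subset_left).congr_fun (fun x hx => ?_)
    (hΩ.measurableSet.inter measurableSet_ball)
  have := mem_ball.1 hx.2
  simp only
  rw [cut_one h2 (by linarith), max_eq_left (hp0 x hx.1), one_mul]

lemma Ctx.away (c : Ctx Ω x₀ y e d M R t A m J K) {a : ℝ} (hL : IsLipschitzDomain Ω)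
    {V : ES N → ℝ} (hV : VClass Ω a V) (hVo : Vok Ω V) {z : ES N} (hz : z ∈ frontier Ω) (hzy : z ≠ y) :
    ∃ ρ > 0, IntegrableOn (fun z => J z * V z * K z) (Ω ∩ ball z ρ) := by
  obtain ⟨e', d', M', R', lg⟩ := exists_LG hL hz
  have vb := lg.vb c.op hz hV
  have hzΩ : z ∉ Ω := by
    rw [c.op.frontier_eq] at hz; exact hz.2
  have hzc : (closedBall x₀ t)ᶜ ∈ 𝓝 z :=
    isClosed_closedBall.isOpen_compl.mem_nhds fun h => hzΩ (c.gr.ball h)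
  obtain ⟨ε, hε, hεs⟩ := Metric.mem_nhds_iff.1 hzc
  have hd : 0 < dist y z := dist_pos.2 hzy.symm
  have hR' := lg.Rpos
  set ρ := min (min (dist y z / 16) (ε / 8)) (R' / 8) with hρd
  have hρ : 0 < ρ := by
    simp only [hρd, lt_min_iff]; exact ⟨⟨by linarith, by linarith⟩, by linarith⟩
  have r1 : ρ ≤ dist y z / 16 := (min_le_left _ _).trans (min_le_left _ _)
  have r2 : ρ ≤ ε / 8 := (min_le_left _ _).trans (min_le_right _ _)
  have r3 : ρ ≤ R' / 8 := min_le_right _ _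
  have iK := bdry_int c.op c.bd lg hρ (by linarith) c.kg.sol.sup.1 (fun x hx => (c.kg.sol.pos x hx).le)
    (fun q hq hqz => c.kg.van q hq (by rintro rfl; linarith))
    (fun φ hφ h0 => by
      have := (c.kg.sol.mono (U := Ω ∩ ball z (4 * ρ)) inter_subset_left).sub.2 φ hφ h0
      simp only [neg_mul, integral_neg, zero_mul, integral_zero, mul_neg, neg_zero] at this
      linarith)
  have iJ := bdry_int c.op c.bd lg hρ (by linarith) c.gr.cont (fun x hx => (c.gr.pos x hx).le)
    (fun q hq hqz => c.gr.van q hq)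
    (fun φ hφ h0 => by
      have := (c.gr.sol (U := Ω ∩ ball z (4 * ρ)) c.op inter_subset_left (fun x hx =>
        hεs (ball_subset_ball (by linarith) hx.2))).sub.2 φ hφ h0
      simp only [neg_mul, integral_neg, zero_mul, integral_zero, mul_neg, neg_zero] at this
      linarith)
  refine ⟨ρ, hρ, ?_⟩
  have mO : MeasurableSet (Ω ∩ ball z ρ) := c.op.measurableSet.inter measurableSet_ball
  refine Integrable.mono' (Integrable.const_mul (Integrable.add iJ iK) (a * M' ^ 2)) ?_ ?_
  · refine ((c.gr.cont.mono inter_subset_left).aestronglyMeasurable mO).mul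
      hVo.meas.aestronglyMeasurable |>.mul ?_
    exact (c.kg.sol.sup.1.mono inter_subset_left).aestronglyMeasurable mO
  · refine (ae_restrict_iff' mO).2 (ae_of_all _ fun x hx => ?_)
    have Kz := c.kg.sol.pos x hx.1
    have Jz := c.gr.pos x hx.1
    have Vn := hVo.nn x hx.1
    have zR : x ∈ ball z (R' / 2) := ball_subset_ball (by linarith) hx.2
    have dz := (lg.mem x (ball_subset_ball (by linarith) hx.2)).1 hx.1
    have hVd := (vb x zR dz).2
    rw [Real.norm_of_nonneg (by positivity)]
    simp only [Pi.add_apply]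
    have e0 : a * M' ^ 2 * ((J x / d' x) ^ 2 + (K x / d' x) ^ 2) =
        (a * M' ^ 2) / d' x ^ 2 * (J x ^ 2 + K x ^ 2) := by field_simp
    rw [e0]
    have hV2 : V x ≤ a * M' ^ 2 / d' x ^ 2 := by rwa [le_div_iff₀ (by positivity)]
    calc J x * V x * K x = V x * (J x * K x) := by ring
      _ ≤ V x * (J x ^ 2 + K x ^ 2) := by
        gcongr; nlinarith [sq_nonneg (J x - K x), mul_pos Jz Kz]
      _ ≤ _ := by gcongr

lemma Vok.int2 {V f g : ES N → ℝ} (hV : Vok Ω V) (hf : ContinuousOn f Ω) (hg : ContinuousOn g Ω)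
    {C : Set (ES N)} (hC : IsCompact C) (hCΩ : C ⊆ Ω) :
    IntegrableOn (fun z => f z * V z * g z) C := by
  have := hV.intOn hC hCΩ (((hf.mul hg).mono hCΩ).integrableOn_compact hC)
  refine this.congr_fun (fun z _ => ?_) hC.measurableSet
  simp only [Pi.mul_apply]; ring

theorem Ctx.ii_iv (c : Ctx Ω x₀ y e d M R t A m J K) {a : ℝ} (hL : IsLipschitzDomain Ω)
    {V KV : ES N → ℝ} (hV : VClass Ω a V) (hg : Glo Ω y d A R V KV)
    (hD : IntegrableOn (fun z => J z * V z * KV z) Ω) :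
    IntegrableOn (fun z => J z * V z * K z) Ω := by
  have hc : IsCompact (closure Ω) := c.bd.isCompact_closure
  have key : IntegrableOn (fun z => J z * V z * K z) (Ω ∩ closure Ω) := by
    refine hc.induction_on (p := fun s => IntegrableOn (fun z => J z * V z * K z) (Ω ∩ s) volume) (by simp)
      (fun s s' hs h => h.mono_set (inter_subset_inter_right _ hs))
      (fun s s' h h' => by
        show IntegrableOn _ (Ω ∩ (s ∪ s'))
        rw [inter_union_distrib_left]; exact h.union h') ?_
    intro z hz
    have main : ∃ ρ > 0, IntegrableOn (fun z => J z * V z * K z) (Ω ∩ ball z ρ) := by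
      by_cases hzΩ : z ∈ Ω
      · obtain ⟨ρ, hρ, h⟩ := Metric.nhds_basis_closedBall.mem_iff.1 (c.op.mem_nhds hzΩ)
        exact ⟨ρ, hρ, (hg.vok.int2 c.gr.cont c.kg.sol.sup.1 (isCompact_closedBall z ρ) h).mono_set
          (inter_subset_right.trans ball_subset_closedBall)⟩
      · have hzf : z ∈ frontier Ω := by
          rw [c.op.frontier_eq]; exact ⟨hz, hzΩ⟩
        by_cases hzy : z = y
        · subst hzy; exact c.near hg hD
        · exact c.away hL hV hg.vok hzf hzy
    obtain ⟨ρ, hρ, h⟩ := main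
    exact ⟨ball z ρ, mem_nhdsWithin_of_mem_nhds (ball_mem_nhds z hρ), h⟩
  rwa [inter_eq_left.2 subset_closure] at key

end Part28

section Part29
variable {N : ℕ}
variable {Ω : Set (ES N)} {x₀ y e : ES N} {d : ES N → ℝ} {M R t A : ℝ} {m J K : ES N → ℝ}

lemma exists_Ctx (hN : 2 ≤ N) (hΩ : IsLipschitzDomain Ω) (hbd : Bornology.IsBounded Ω)
    (hx₀ : x₀ ∈ Ω) {a : ℝ} (ha : 0 < a) {V : ES N → ℝ} (hV : VClass Ω a V)
    (hy : y ∈ frontier Ω) {G : ES N → ℝ} (hK : IsMartinKernel Ω (fun _ => 0) x₀ y K)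
    (hG : IsGreenFunction Ω (fun _ => 0) x₀ G) : ∃ e d M R t A m J,
      Ctx Ω x₀ y e d M R t A m J K ∧ Vok Ω V ∧ VB V d A y R ∧
      ∀ x ∈ Ω, x ∉ closedBall x₀ t → J x = G x := by
  have hop := hΩ.1
  have hyΩ : y ∉ Ω := by
    rw [hop.frontier_eq] at hy; exact hy.2
  obtain ⟨e, d, M, R0, lg⟩ := exists_LG hΩ hy
  have vb := lg.vb hop hy hV
  have vok : Vok Ω V := hV.vok hop ⟨y, hyΩ⟩
  have hd : 0 < dist x₀ y := dist_pos.2 (by rintro rfl; exact hyΩ hx₀)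
  obtain ⟨ε, hε, hεs⟩ := Metric.nhds_basis_closedBall.mem_iff.1 (hop.mem_nhds hx₀)
  have hR0 := lg.Rpos
  set t := min (ε / 4) (dist x₀ y / 4) with ht
  have ht0 : 0 < t := lt_min (by linarith) (by linarith)
  have t1 : t ≤ ε / 4 := min_le_left _ _
  have t2 : t ≤ dist x₀ y / 4 := min_le_right _ _
  set R := min (R0 / 2) (dist x₀ y / 4) with hR
  have hRp : 0 < R := lt_min (by linarith) (by linarith)
  have R1 : R ≤ R0 / 2 := min_le_left _ _
  have R2 : R ≤ dist x₀ y / 4 := min_le_right _ _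
  obtain ⟨m, J, gr, hJ⟩ := exists_GR hN hop hG ht0
    ((closedBall_subset_closedBall (by linarith)).trans hεs)
  refine ⟨e, d, M, R, t, a * M ^ 2, m, J, ?_, vok, fun x hx => vb x (ball_subset_ball R1 hx), hJ⟩
  refine ⟨hN, hop, hbd, lg.recenter lg.dz hRp (ball_subset_ball (by linarith)), by positivity, hy, gr,
    fun x hx hx' => ?_, ?_⟩
  · rw [mem_ball] at hx
    rw [mem_closedBall, dist_comm] at hx'
    have := dist_triangle x₀ x y
    linarith
  · exact ⟨hK.1.sol (fun _ _ => le_rfl) hK.2.1, hK.2.2.2, Vok_zero Ω, VB_zero (by positivity)⟩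

lemma Ctx.green_iff (c : Ctx Ω x₀ y e d M R t A m J K) {G V f : ES N → ℝ}
    (hG : IsGreenFunction Ω (fun _ => 0) x₀ G) (hJ : ∀ x ∈ Ω, x ∉ closedBall x₀ t → J x = G x)
    (hV : Vok Ω V) (hf : ContinuousOn f Ω) (hf0 : ∀ x ∈ Ω, 0 ≤ f x) :
    ∫⁻ z in Ω, ENNReal.ofReal (G z * V z * f z) < ⊤ ↔
      IntegrableOn (fun z => J z * V z * f z) Ω := by
  rw [← fin_iff c.op c.gr.cont hf hV (fun x hx => (c.gr.pos x hx).le) hf0]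
  have mB : MeasurableSet (closedBall x₀ t) := measurableSet_closedBall
  have hB := isCompact_closedBall x₀ t
  rw [← lintegral_inter_add_diff (fun z => ENNReal.ofReal (G z * V z * f z)) Ω mB,
    ← lintegral_inter_add_diff (fun z => ENNReal.ofReal (J z * V z * f z)) Ω mB,
    inter_eq_right.2 c.gr.ball, ENNReal.add_lt_top, ENNReal.add_lt_top]
  have f1 : ∫⁻ z in closedBall x₀ t, ENNReal.ofReal (J z * V z * f z) < ⊤ :=
    (hV.int2 c.gr.cont hf hB c.gr.ball).lintegral_lt_top
  have f2 : ∫⁻ z in closedBall x₀ t, ENNReal.ofReal (G z * V z * f z) < ⊤ := by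
    have g1 : IntegrableOn G (closedBall x₀ t) := hG.2.2.1.integrableOn_compact_subset c.gr.ball hB
    have g2 := hV.intOn hB c.gr.ball (g1.mul_continuousOn (hf.mono c.gr.ball) hB)
    have g3 : IntegrableOn (fun z => G z * V z * f z) (closedBall x₀ t) :=
      g2.congr_fun (fun z _ => by simp only; ring) mB
    exact g3.lintegral_lt_top
  have f3 : ∫⁻ z in Ω \ closedBall x₀ t, ENNReal.ofReal (G z * V z * f z) =
      ∫⁻ z in Ω \ closedBall x₀ t, ENNReal.ofReal (J z * V z * f z) :=
    setLIntegral_congr_fun (c.op.measurableSet.diff mB) fun z hz => by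
      rw [hJ z hz.1 hz.2]
  rw [f3]
  exact ⟨fun h => ⟨f1, h.2⟩, fun h => ⟨f2, h.2⟩⟩

lemma LVHarmonic.const_mul' {V u : ES N → ℝ} (h : LVHarmonic Ω V u) (C : ℝ) :
    LVHarmonic Ω V (fun x => C * u x) := by
  refine ⟨continuousOn_const.mul h.1, fun x hx => (h.2.1 x hx).imp fun s => ?_, fun x hx => (h.2.2.1 x hx).imp fun s => ?_, fun φ hφ => ?_⟩
  · exact fun hs => ⟨hs.1, Integrable.const_mul hs.2 C⟩
  · refine fun hs => ⟨hs.1, (Integrable.const_mul hs.2 C).congr (ae_of_all _ fun z => ?_)⟩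
    simp only; ring
  · have := h.2.2.2 φ hφ
    have e1 : ∀ x, C * u x * lap φ x = C * (u x * lap φ x) := fun x => by ring
    have e2 : ∀ x, V x * (C * u x) * φ x = C * (V x * u x * φ x) := fun x => by ring
    simp only [e1, e2, integral_const_mul, this]

lemma Ctx.reg_imp (c : Ctx Ω x₀ y e d M R t A m J K) {V KV : ES N → ℝ} (hg : Glo Ω y d A R V KV)
    (h : FinelyRegular Ω V K) : ∃ C > 0, ∀ x ∈ Ω, KV x ≤ C * K x := by
  obtain ⟨h, hh, hpos, hle⟩ := h
  have gh : Glo Ω y d A R V h := by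
    refine ⟨hh.sol hg.vok.nn hpos, fun p hp hpy => ?_, hg.vok, hg.vb⟩
    refine tendsto_of_tendsto_of_tendsto_of_le_of_le' tendsto_const_nhds (c.kg.van p hp hpy) ?_ ?_
    · filter_upwards [self_mem_nhdsWithin] with x hx using (hpos x hx).le
    · filter_upwards [self_mem_nhdsWithin] with x hx using hle x hx
  obtain ⟨C, hC, hcmp⟩ := c.cmp
  have hx0 : x₀ ∈ Ω := c.gr.ball (mem_closedBall_self c.gr.tpos.le)
  have hM := c.lg.M1
  have hh0 := hpos _ hx0
  have hk0 := hg.sol.pos _ hx0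
  refine ⟨C * C * KV x₀ / h x₀, by positivity, fun x hx => ?_⟩
  have d1 : 0 < dist x y := dist_pos.2 (by rintro rfl; exact c.yn hx)
  have d2 : 0 < dist x₀ y := dist_pos.2 (by rintro rfl; exact c.yn hx0)
  have hR := c.lg.Rpos
  set r := min (min (dist x y) (dist x₀ y)) (R / (16 * M)) with hr
  have hr0 : 0 < r := lt_min (lt_min d1 d2) (by positivity)
  have r1 : r ≤ dist x y := (min_le_left _ _).trans (min_le_left _ _)
  have r2 : r ≤ dist x₀ y := (min_le_left _ _).trans (min_le_right _ _)
  have r3 : 16 * M * r ≤ R := by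
    have : r ≤ R / (16 * M) := min_le_right _ _
    rw [le_div_iff₀ (by positivity)] at this
    linarith
  have hA := c.Ar hr0 r3
  have a1 := hcmp V V KV h hg gh (fun _ _ => le_rfl) r hr0 r3 x hx r1
  have a2 := hcmp V V h KV gh hg (fun _ _ => le_rfl) r hr0 r3 x₀ hx0 r2
  have hAp := hpos _ hA
  have hx' := hpos _ hx
  have hKx := c.kg.sol.pos _ hx
  rw [div_mul_eq_mul_div, le_div_iff₀ hh0]
  refine le_of_mul_le_mul_right ?_ hAp
  calc KV x * h x₀ * h (y + r • e) = h x₀ * (KV x * h (y + r • e)) := by ring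
    _ ≤ h x₀ * (C * KV (y + r • e) * h x) := by gcongr
    _ = C * h x * (h x₀ * KV (y + r • e)) := by ring
    _ ≤ C * h x * (C * h (y + r • e) * KV x₀) := by gcongr
    _ ≤ C * K x * (C * h (y + r • e) * KV x₀) := by
        gcongr; exact hle x hx
    _ = _ := by ring

end Part29

/-- Theorem `charac`. For a bounded Lipschitz domain `Ω ⊆ ℝ^N`,
`V ∈ 𝒱(Ω,a)` and `y ∈ ∂Ω`, the following are equivalent: (i) `y` is finely regular
for `L_V = Δ - V`; (ii) `∫_Ω G(x₀,z) V(z) K_y^V(z) dz < ∞`; (iii) `K_y^V` admits a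
superharmonic majorant in `Ω`; (iv) `∫_Ω G(x₀,z) V(z) K_y(z) dz < ∞`. -/
theorem statement0 {N : ℕ} (hN : 2 ≤ N) (Ω : Set (ES N))
    (hΩ : IsLipschitzDomain Ω) (hbd : Bornology.IsBounded Ω)
    (x₀ : ES N) (hx₀ : x₀ ∈ Ω) (a : ℝ) (ha : 0 < a)
    (V : ES N → ℝ) (hV : VClass Ω a V)
    (y : ES N) (hy : y ∈ frontier Ω)
    (K KV G : ES N → ℝ)
    (hK : IsMartinKernel Ω (fun _ => 0) x₀ y K)
    (hKV : IsMartinKernel Ω V x₀ y KV)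
    (hG : IsGreenFunction Ω (fun _ => 0) x₀ G) :
    List.TFAE
      [FinelyRegular Ω V K,
       ∫⁻ z in Ω, ENNReal.ofReal (G z * V z * KV z) < ⊤,
       ∃ s, IsSuperharmonicOn Ω s ∧ ∀ x ∈ Ω, KV x ≤ s x,
       ∫⁻ z in Ω, ENNReal.ofReal (G z * V z * K z) < ⊤] := by
  obtain ⟨e, d, M, R, t, A, m, J, c, vok, vb, hJ⟩ := exists_Ctx hN hΩ hbd hx₀ ha hV hy hK hG
  have hg : Glo Ω y d A R V KV := ⟨hKV.1.sol vok.nn hKV.2.1, hKV.2.2.2, vok, vb⟩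
  have e2 := c.green_iff hG hJ vok hKV.1.1 fun x hx => (hKV.2.1 x hx).le
  have e4 := c.green_iff hG hJ vok hK.1.1 fun x hx => (hK.2.1 x hx).le
  tfae_have 1 → 3 := fun h => by
    obtain ⟨C, hC, hle⟩ := c.reg_imp hg h
    have hs : Sol Ω (fun _ => 0) (fun x => C * K x) :=
      (hK.1.const_mul' C).sol (fun _ _ => le_rfl) fun x hx => mul_pos hC (hK.2.1 x hx)
    have hc : ContinuousOn (fun x => C * K x) Ω := continuousOn_const.mul hK.1.1
    exact ⟨fun x => C * K x, ⟨hc.lowerSemicontinuousOn,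
      hc.locallyIntegrableOn c.op.measurableSet,
      fun x _ t ht hU => (ball_mean hs.sup hs.sub ht hU).le⟩, hle⟩
  tfae_have 3 → 2 := fun ⟨s, hs, hle⟩ => e2.2 (c.iii_imp hg hs hle)
  tfae_have 2 → 4 := fun h => e4.2 (c.ii_iv hΩ hV hg (e2.1 h))
  tfae_have 4 → 1 := fun h => by
    obtain ⟨C, hC, hle⟩ := c.iv_imp hg (e4.1 h)
    exact ⟨fun x => C⁻¹ * KV x, hKV.1.const_mul' C⁻¹,
      fun x hx => mul_pos (inv_pos.2 hC) (hKV.2.1 x hx),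
      fun x hx => (inv_mul_le_iff₀ hC).2 (hle x hx)⟩
  tfae_finish
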